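/- Let K be a totally real number field with [K:ℚ] ≤ 5. Then every pair x, y ∈ K with x⁵ + y⁵ + 1 = 0 satisfies xy = 0. In other words, there is no totally real number field of degree at most 5 over ℚ on which the Fermat quintic x⁵+y⁵+z⁵=0 has a non-trivial point. -/

import Mathlib

namespace FQ

/-- The ring of rationals with odd denominator. -/
def Z2 : Subring ℚ where
  carrier := {x | padicNorm 2 x ≤ 1}
  mul_mem' := by
    intro a b ha hb
    simp only [Set.mem_ofPred_eq, padicNorm.mul] at *
    exact mul_le_one₀ ha (padicNorm.nonneg _) hb
  one_mem' := by simp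
  add_mem' := by
    intro a b ha hb
    exact le_trans padicNorm.nonarchimedean (max_le ha hb)
  zero_mem' := by simp
  neg_mem' := by
    intro a ha
    simpa using ha

@[simp, norm_cast] theorem Z2.coe_ofNat (n : ℕ) [n.AtLeastTwo] :
    ((OfNat.ofNat n : Z2) : ℚ) = OfNat.ofNat n := rfl

@[simp, norm_cast] theorem Z2.coe_two : ((2 : Z2) : ℚ) = 2 := rfl

/-- Inclusion in the 2-adic integers. -/
noncomputable def Z2.toPadicInt : Z2 →+* ℤ_[2] where
  toFun x := ⟨((x : ℚ) : ℚ_[2]), by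
    rw [Padic.eq_padicNorm]; exact_mod_cast x.2⟩
  map_one' := by apply Subtype.ext; simp
  map_zero' := by apply Subtype.ext; simp
  map_mul' := by intro x y; apply Subtype.ext; change ((((x:ℚ)*(y:ℚ) : ℚ)) : ℚ_[2]) = ((x:ℚ):ℚ_[2]) * ((y:ℚ):ℚ_[2]); push_cast; rfl
  map_add' := by intro x y; apply Subtype.ext; change ((((x:ℚ)+(y:ℚ) : ℚ)) : ℚ_[2]) = ((x:ℚ):ℚ_[2]) + ((y:ℚ):ℚ_[2]); push_cast; rfl

/-- Reduction mod 2. -/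
noncomputable def res : Z2 →+* ZMod 2 := (PadicInt.toZMod (p := 2)).comp Z2.toPadicInt

theorem res_eq_zero_iff (x : Z2) : res x = 0 ↔ ∃ y : Z2, x = 2 * y := by
  constructor
  · intro h
    have h1 : Z2.toPadicInt x ∈ RingHom.ker (PadicInt.toZMod (p := 2)) := h
    rw [PadicInt.ker_toZMod, PadicInt.maximalIdeal_eq_span_p, Ideal.mem_span_singleton] at h1
    obtain ⟨z, hz⟩ := h1
    have h2 : padicNorm 2 (x : ℚ) ≤ 1/2 := by
      have : ‖Z2.toPadicInt x‖ ≤ 1/2 := by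
        rw [hz, norm_mul, PadicInt.norm_p]
        have := PadicInt.norm_le_one z
        have := norm_nonneg z
        norm_num
        linarith
      have h3 : ‖Z2.toPadicInt x‖ = ((padicNorm 2 (x : ℚ) : ℚ) : ℝ) := by
        rw [← Padic.eq_padicNorm]; rfl
      rw [h3] at this
      have h4 : ((padicNorm 2 (x : ℚ) : ℚ) : ℝ) ≤ ((1/2 : ℚ) : ℝ) := by push_cast; exact this
      exact_mod_cast h4
    refine ⟨⟨(x : ℚ) / 2, ?_⟩, ?_⟩
    · change padicNorm 2 _ ≤ 1
      rw [padicNorm.div]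
      have : padicNorm 2 (2 : ℚ) = 1/2 := by
        have := padicNorm.padicNorm_p (p := 2) (by norm_num)
        simpa using this
      rw [this]
      rw [div_le_iff₀ (by norm_num)]; linarith
    · ext; push_cast; ring
  · rintro ⟨y, rfl⟩
    rw [map_mul]
    have : res 2 = 0 := by
      have := map_ofNat res 2
      rw [this]; rfl
    rw [this, zero_mul]

theorem res_cases (x : Z2) : res x = 0 ∨ res x = 1 := by
  have : ∀ z : ZMod 2, z = 0 ∨ z = 1 := by decide
  exact this _

theorem isUnit_of_res (x : Z2) (h : res x = 1) : ∃ y : Z2, x * y = 1 := by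
  have hx : ¬ padicNorm 2 (x : ℚ) < 1 := by
    intro hlt
    have h3 : ‖Z2.toPadicInt x‖ = ((padicNorm 2 (x : ℚ) : ℚ) : ℝ) := by
      rw [← Padic.eq_padicNorm]; rfl
    have h4 : ‖Z2.toPadicInt x‖ < 1 := by rw [h3]; exact_mod_cast hlt
    have h5 : Z2.toPadicInt x ∈ IsLocalRing.maximalIdeal ℤ_[2] := by
      rw [IsLocalRing.mem_maximalIdeal, PadicInt.mem_nonunits]; exact h4
    rw [← PadicInt.ker_toZMod] at h5
    have h6 : res x = 0 := h5
    rw [h6] at h; exact absurd h (by decide)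
  have hx1 : padicNorm 2 (x : ℚ) = 1 := le_antisymm x.2 (not_lt.mp hx)
  have hx0 : (x : ℚ) ≠ 0 := by
    intro h0; rw [h0] at hx1; simp at hx1
  refine ⟨⟨(x : ℚ)⁻¹, ?_⟩, ?_⟩
  · change padicNorm 2 _ ≤ 1
    rw [← one_div, padicNorm.div, hx1]; simp
  · ext; push_cast; exact mul_inv_cancel₀ hx0

theorem res_two : res 2 = 0 := (res_eq_zero_iff 2).2 ⟨1, by ring⟩

/-- Scaling a nonzero vector to a 2-primitive one. -/
theorem exists_primitive {ι : Type*} [Fintype ι] (f : ι → ℚ) (hf : ∃ i, f i ≠ 0) :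
    ∃ s : ℚ, s ≠ 0 ∧ ∃ g : ι → Z2, (∀ i, (g i : ℚ) = s * f i) ∧ ∃ i, res (g i) = 1 := by
  obtain ⟨i0, hi0⟩ := hf
  have : Nonempty ι := ⟨i0⟩
  obtain ⟨i, -, hi⟩ := Finset.exists_max_image Finset.univ (fun i => padicNorm 2 (f i)) ⟨i0, Finset.mem_univ _⟩
  have hfi : f i ≠ 0 := by
    intro h
    have h1 := hi i0 (Finset.mem_univ _)
    rw [h, padicNorm.zero] at h1
    have := padicNorm.nonneg (p := 2) (f i0)
    exact hi0 (padicNorm.zero_of_padicNorm_eq_zero (le_antisymm h1 this))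
  have hpos : 0 < padicNorm 2 (f i) :=
    lt_of_le_of_ne (padicNorm.nonneg _) (Ne.symm (padicNorm.nonzero hfi))
  have hmem : ∀ j, (f i)⁻¹ * f j ∈ Z2 := by
    intro j
    change padicNorm 2 _ ≤ 1
    rw [mul_comm, ← div_eq_mul_inv, padicNorm.div, div_le_one hpos]
    exact hi j (Finset.mem_univ _)
  refine ⟨(f i)⁻¹, inv_ne_zero hfi, fun j => ⟨(f i)⁻¹ * f j, hmem j⟩, fun j => rfl, i, ?_⟩
  have : (⟨(f i)⁻¹ * f i, hmem i⟩ : Z2) = 1 := by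
    ext; simp [hfi]
  change res (⟨(f i)⁻¹ * f i, hmem i⟩ : Z2) = 1
  rw [this, map_one]

/-- An element divisible by all powers of two is zero. -/
theorem eq_zero_of_pow_dvd (x : Z2) (h : ∀ k : ℕ, (2 : Z2) ^ (k + 1) ∣ x) : x = 0 := by
  by_contra hx
  have hx0 : (x : ℚ) ≠ 0 := by
    intro h0; exact hx (by ext; simpa using h0)
  have hpos : 0 < padicNorm 2 (x : ℚ) :=
    lt_of_le_of_ne (padicNorm.nonneg _) (Ne.symm (padicNorm.nonzero hx0))
  obtain ⟨n, hn⟩ := exists_pow_lt_of_lt_one hpos (show (1/2 : ℚ) < 1 by norm_num)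
  obtain ⟨y, hy⟩ := h n
  have h2 : padicNorm 2 (2 : ℚ) = 1/2 := by
    have := padicNorm.padicNorm_p (p := 2) (by norm_num)
    simpa using this
  have h3 : padicNorm 2 (x : ℚ) ≤ (1/2)^(n+1) := by
    rw [hy]; push_cast
    rw [padicNorm.mul]
    have h4 : padicNorm 2 ((2:ℚ)^(n+1)) = (1/2)^(n+1) := by
      induction n+1 with
      | zero => simp
      | succ k ih => rw [pow_succ, padicNorm.mul, ih, h2, pow_succ]
    rw [h4]
    have := y.2
    change padicNorm 2 _ ≤ 1 at this
    have h5 : (0:ℚ) ≤ (1/2)^(n+1) := by positivity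
    nlinarith
  have h6 : (1/2 : ℚ)^(n+1) ≤ (1/2)^n := by
    apply pow_le_pow_of_le_one <;> norm_num
  linarith

end FQ

namespace FQ

theorem even_of_res {x : Z2} (h : res x = 0) : ∃ y : Z2, x = 2 * y := (res_eq_zero_iff x).1 h

/-- Parameters of the curves. -/
structure Par where
  Q0 : Z2
  Q1 : Z2
  Q2 : Z2
  c : Z2
  hQ0 : res Q0 = 1
  hQ1 : res Q1 = 0
  hQ2 : res Q2 = 0
  hc : res c = 1

/-- Mumford pair over a commutative ring: `T^2+uT+w` divides `b^2+Qb+cT^5`. -/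
def MP {R : Type*} [CommRing R] (Q0 Q1 Q2 c u w b0 b1 : R) : Prop :=
  ∃ q0 q1 q2 : R, b0^2+Q0*b0 = w*q0 ∧ 2*b0*b1+Q0*b1+Q1*b0 = w*q1+u*q0 ∧
    b1^2+Q1*b1+Q2*b0 = w*q2+u*q1+q0 ∧ Q2*b1 = w*c+u*q2+q1 ∧ 0 = u*c+q2

/-- Halving relation. -/
structure Halv (P : Par) (u w A0 A1 A2 A3 α u' w' : Z2) : Prop where
  h0 : A0 = α * P.Q0
  h1 : 2*A0*A1-(P.Q0*(α*A1+A0)+P.Q1*(α*A0)) = P.c*(w*w'^2)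
  h2 : 2*A0*A2+A1^2-(P.Q0*(α*A2+A1)+P.Q1*(α*A1+A0)+P.Q2*(α*A0)) = P.c*(w*(2*u'*w')+u*w'^2)
  h3 : 2*A0*A3+2*A1*A2-(P.Q0*(α*A3+A2)+P.Q1*(α*A2+A1)+P.Q2*(α*A1+A0))
        = P.c*(w*(u'^2+2*w')+u*(2*u'*w')+w'^2)
  h4 : 2*A1*A3+A2^2-(P.Q0*A3+P.Q1*(α*A3+A2)+P.Q2*(α*A2+A1)) = P.c*(w*(2*u')+u*(u'^2+2*w')+2*u'*w')
  h5 : 2*A2*A3-(P.Q1*A3+P.Q2*(α*A3+A2))+P.c*α^2 = P.c*(w+u*(2*u')+(u'^2+2*w'))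
  h6 : A3^2-P.Q2*A3+2*P.c*α = P.c*(u+2*u')

theorem Halv.step {P : Par} {u w A0 A1 A2 A3 α u' w' : Z2} (H : Halv P u w A0 A1 A2 A3 α u' w')
    (p p' : Z2) (hp : p = 2 * p') (hp0 : p ≠ 0)
    (hu : p ∣ u) (hw : p ∣ w) (hA0 : p ∣ A0) (hA1 : p ∣ A1) (hA2 : p ∣ A2) (hA3 : p ∣ A3)
    (hα : p ∣ α) (hu' : p ∣ u') (hw' : p ∣ w') :
    2 * p ∣ u ∧ 2 * p ∣ w ∧ 2 * p ∣ A0 ∧ 2 * p ∣ A1 ∧ 2 * p ∣ A2 ∧ 2 * p ∣ A3 ∧ 2 * p ∣ α := by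
  obtain ⟨u, rfl⟩ := hu
  obtain ⟨w, rfl⟩ := hw
  obtain ⟨A0, rfl⟩ := hA0
  obtain ⟨A1, rfl⟩ := hA1
  obtain ⟨A2, rfl⟩ := hA2
  obtain ⟨A3, rfl⟩ := hA3
  obtain ⟨α, rfl⟩ := hα
  obtain ⟨u', rfl⟩ := hu'
  obtain ⟨w', rfl⟩ := hw'
  obtain ⟨h0, h1, h2, h3, h4, h5, h6⟩ := H
  have rp : res p = 0 := by rw [hp, map_mul, res_two, zero_mul]
  have key : ∀ {x y : Z2}, p * x = p * y → res x = res y := fun h => by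
    rw [mul_left_cancel₀ hp0 h]
  have r0 : res A0 = res α := by
    have := key (x := A0) (y := α * P.Q0) (by linear_combination h0)
    simpa [map_mul, P.hQ0] using this
  have r6 : res u = 0 := by
    have := key (x := p*A3^2-P.Q2*A3+2*P.c*α) (y := P.c*(u+2*u')) (by linear_combination h6)
    simp [map_mul, rp, P.hQ2, P.hc, res_two] at this
    simpa using this.symm
  have r5 : res w = 0 := by
    have := key (x := 2*p*A2*A3-(P.Q1*A3+P.Q2*(p*α*A3+A2))+P.c*p*α^2)
      (y := P.c*(w+p*u*(2*u')+(p*u'^2+2*w'))) (by linear_combination h5)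
    simp [map_mul, rp, P.hQ2, P.hQ1, P.hc, res_two] at this
    simpa using this.symm
  have r4 : res A3 = 0 := by
    have := key (x := 2*p*A1*A3+p*A2^2-(P.Q0*A3+P.Q1*(p*α*A3+A2)+P.Q2*(p*α*A2+A1)))
      (y := P.c*p*(w*(2*u')+u*(p*u'^2+2*w')+2*u'*w')) (by linear_combination h4)
    simp [map_mul, rp, P.hQ2, P.hQ1, P.hQ0, P.hc, res_two] at this
    simpa using this
  have r3 : res A2 = 0 := by
    have := key (x := 2*p*A0*A3+2*p*A1*A2-(P.Q0*(p*α*A3+A2)+P.Q1*(p*α*A2+A1)+P.Q2*(p*α*A1+A0)))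
      (y := P.c*p*(w*(p*u'^2+2*w')+u*(p*2*u'*w')+w'^2)) (by linear_combination h3)
    simp [map_mul, rp, P.hQ2, P.hQ1, P.hQ0, P.hc, res_two] at this
    simpa using this
  have r2 : res A1 = 0 := by
    have := key (x := 2*p*A0*A2+p*A1^2-(P.Q0*(p*α*A2+A1)+P.Q1*(p*α*A1+A0)+P.Q2*(p*α*A0)))
      (y := P.c*p^2*(w*(2*u'*w')+u*w'^2)) (by linear_combination h2)
    simp [map_mul, rp, P.hQ2, P.hQ1, P.hQ0, P.hc, res_two] at this
    simpa using this
  have r1 : res A0 = 0 := by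
    have := key (x := 2*p*A0*A1-(P.Q0*(p*α*A1+A0)+P.Q1*(p*α*A0)))
      (y := P.c*p^2*(w*w'^2)) (by linear_combination h1)
    simp [map_mul, rp, P.hQ2, P.hQ1, P.hQ0, P.hc, res_two] at this
    simpa using this
  have fin : ∀ x : Z2, res x = 0 → 2 * p ∣ p * x := by
    intro x hx
    obtain ⟨y, rfl⟩ := even_of_res hx
    exact ⟨y, by ring⟩
  exact ⟨fin _ r6, fin _ r5, fin _ r1, fin _ r2, fin _ r3, fin _ r4, fin _ (r0 ▸ r1)⟩

theorem Halv.contr {P : Par} {u w A0 A1 A2 A3 α u' w' : Z2} (H : Halv P u w A0 A1 A2 A3 α u' w')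
    (hu : 2 ∣ u) (hw : 2 ∣ w) (hA0 : 2 ∣ A0) (hA1 : 2 ∣ A1) (hA2 : 2 ∣ A2) (hA3 : 2 ∣ A3)
    (hα : 2 ∣ α) (k : ℕ) (hu' : 2^(k+1) ∣ u') (hw' : 2^(k+1) ∣ w') :
    2^(k+2) ∣ u ∧ 2^(k+2) ∣ w := by
  have main : ∀ l, l ≤ k + 1 → (2^(l+1) ∣ u ∧ 2^(l+1) ∣ w ∧ 2^(l+1) ∣ A0 ∧ 2^(l+1) ∣ A1 ∧
      2^(l+1) ∣ A2 ∧ 2^(l+1) ∣ A3 ∧ 2^(l+1) ∣ α) := by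
    intro l
    induction l with
    | zero => intro _; simp only [zero_add, pow_one]; exact ⟨hu, hw, hA0, hA1, hA2, hA3, hα⟩
    | succ l ih =>
      intro hl
      obtain ⟨i1, i2, i3, i4, i5, i6, i7⟩ := ih (by omega)
      have hd : (2:Z2)^(l+1) ∣ 2^(k+1) := pow_dvd_pow _ (by omega)
      have h20 : (2:Z2) ≠ 0 := by
        intro h
        have := congrArg (fun x : Z2 => (x:ℚ)) h
        simp at this
      have := H.step (2^(l+1)) (2^l) (by ring) (pow_ne_zero _ h20) i1 i2 i3 i4 i5 i6 i7
        (hd.trans hu') (hd.trans hw')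
      have e : (2:Z2)^(l+1+1) = 2 * 2^(l+1) := by ring
      rw [e]; exact this
  have := main (k+1) le_rfl
  exact ⟨this.1, this.2.1⟩

end FQ

namespace FQ
open Polynomial

theorem Z2.two_ne : (2 : Z2) ≠ 0 := by
  intro h
  have := congrArg (fun x : Z2 => (x:ℚ)) h
  simp at this

theorem MP_iff {R : Type*} [CommRing R] (Q0 Q1 Q2 c u w b0 b1 : R) :
    MP Q0 Q1 Q2 c u w b0 b1 ↔
    b0^2+Q0*b0 = w*(b1^2+Q1*b1+Q2*b0+2*w*u*c-u*Q2*b1-u^3*c) ∧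
    2*b0*b1+Q0*b1+Q1*b0 = w*(Q2*b1-w*c+u^2*c)+u*(b1^2+Q1*b1+Q2*b0+2*w*u*c-u*Q2*b1-u^3*c) := by
  constructor
  · rintro ⟨q0, q1, q2, e0, e1, e2, e3, e4⟩
    have f2 : q2 = -(u*c) := by linear_combination -e4
    subst f2
    have f1 : q1 = Q2*b1-w*c+u^2*c := by linear_combination -e3
    subst f1
    have f0 : q0 = b1^2+Q1*b1+Q2*b0+2*w*u*c-u*Q2*b1-u^3*c := by linear_combination -e2
    subst f0
    exact ⟨e0, e1⟩
  · rintro ⟨e0, e1⟩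
    exact ⟨_, _, -(u*c), e0, e1, by ring, by ring, by ring⟩

theorem MP.map {R S : Type*} [CommRing R] [CommRing S] (f : R →+* S) {Q0 Q1 Q2 c u w b0 b1 : R}
    (h : MP Q0 Q1 Q2 c u w b0 b1) :
    MP (f Q0) (f Q1) (f Q2) (f c) (f u) (f w) (f b0) (f b1) := by
  rw [MP_iff] at *
  obtain ⟨h1, h2⟩ := h
  have h1' := congrArg f h1
  have h2' := congrArg f h2
  simp only [map_mul, map_add, map_sub, map_pow, map_ofNat] at h1' h2'
  exact ⟨h1', h2'⟩

theorem MP.comap {R S : Type*} [CommRing R] [CommRing S] (f : R →+* S)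
    (hf : Function.Injective f) {Q0 Q1 Q2 c u w b0 b1 : R}
    (h : MP (f Q0) (f Q1) (f Q2) (f c) (f u) (f w) (f b0) (f b1)) :
    MP Q0 Q1 Q2 c u w b0 b1 := by
  rw [MP_iff] at *
  obtain ⟨h1, h2⟩ := h
  constructor
  · apply hf
    simp only [map_mul, map_add, map_sub, map_pow, map_ofNat]
    exact h1
  · apply hf
    simp only [map_mul, map_add, map_sub, map_pow, map_ofNat]
    exact h2

theorem lin_of_quad_dvd {F : Type*} [Field F] {u w r0 r1 : F}
    (h : (X^2 + C u * X + C w : F[X]) ∣ C r1 * X + C r0) : r0 = 0 ∧ r1 = 0 := by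
  have hz : (C r1 * X + C r0 : F[X]) = 0 := by
    apply eq_zero_of_dvd_of_degree_lt h
    have h2 : (X^2 + C u * X + C w : F[X]).degree = 2 := by compute_degree!
    rw [h2]
    exact lt_of_le_of_lt degree_linear_le (by norm_num)
  constructor
  · have := congrArg (fun p => coeff p 0) hz
    simpa using this
  · have := congrArg (fun p => coeff p 1) hz
    simpa using this

theorem MP_of_dvd {F : Type*} [Field F] {Q0 Q1 Q2 c u w b0 b1 : F}
    (h : (X^2 + C u * X + C w : F[X]) ∣ (C b0 + C b1 * X)^2 +
      (C Q0 + C Q1 * X + C Q2 * X^2) * (C b0 + C b1 * X) + C c * X^5) :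
    MP Q0 Q1 Q2 c u w b0 b1 := by
  rw [MP_iff]
  set q0 := b1^2+Q1*b1+Q2*b0+2*w*u*c-u*Q2*b1-u^3*c with hq0
  set q1 := Q2*b1-w*c+u^2*c with hq1
  have e : (C b0 + C b1 * X)^2 +
      (C Q0 + C Q1 * X + C Q2 * X^2) * (C b0 + C b1 * X) + C c * X^5 =
      (X^2 + C u * X + C w : F[X]) * (C c * X^3 + C (-(u*c)) * X^2 + C q1 * X + C q0) +
      (C (2*b0*b1+Q0*b1+Q1*b0 - (w*q1+u*q0)) * X + C (b0^2+Q0*b0 - w*q0)) := by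
    rw [hq0, hq1]
    simp only [map_mul, map_add, map_sub, map_pow, map_neg, map_ofNat]
    ring
  rw [e] at h
  have h' := (dvd_add_right (dvd_mul_right _ _)).1 h
  obtain ⟨h1, h2⟩ := lin_of_quad_dvd h'
  exact ⟨by linear_combination h1, by linear_combination h2⟩

theorem MP.poly {R S : Type*} [CommRing R] [CommRing S] (f : R →+* S) (T : S)
    {Q0 Q1 Q2 c u w b0 b1 : R} (h : MP Q0 Q1 Q2 c u w b0 b1) :
    (T^2 + f u * T + f w) ∣ (f b0 + f b1 * T)^2 +
      (f Q0 + f Q1 * T + f Q2 * T^2) * (f b0 + f b1 * T) + f c * T^5 := by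
  obtain ⟨q0, q1, q2, e0, e1, e2, e3, e4⟩ := h.map f
  refine ⟨f c * T^3 + q2 * T^2 + q1 * T + q0, ?_⟩
  linear_combination e0 + T * e1 + T^2 * e2 + T^3 * e3 + T^4 * e4

theorem Halv.poly {P : Par} {u w A0 A1 A2 A3 α u' w' : Z2} (H : Halv P u w A0 A1 A2 A3 α u' w')
    {S : Type*} [CommRing S] (f : Z2 →+* S) (T : S) :
    (f A0 + f A1 * T + f A2 * T^2 + f A3 * T^3)^2
     - (f A0 + f A1 * T + f A2 * T^2 + f A3 * T^3) * (f α + T)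
        * (f P.Q0 + f P.Q1 * T + f P.Q2 * T^2) + f P.c * T^5 * (f α + T)^2
     = f P.c * T * (T^2 + f u * T + f w) * (T^2 + f u' * T + f w')^2 := by
  obtain ⟨h0, h1, h2, h3, h4, h5, h6⟩ := H
  replace h0 := congrArg f h0
  replace h1 := congrArg f h1
  replace h2 := congrArg f h2
  replace h3 := congrArg f h3
  replace h4 := congrArg f h4
  replace h5 := congrArg f h5
  replace h6 := congrArg f h6
  simp only [map_mul, map_add, map_sub, map_pow, map_ofNat] at h0 h1 h2 h3 h4 h5 h6
  linear_combination f A0 * h0 + T * h1 + T^2 * h2 + T^3 * h3 + T^4 * h4 + T^5 * h5 + T^6 * h6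

theorem quad_isCoprime {F : Type*} [Field F] {u w z : F} (h : z^2 - u*z + w ≠ 0) :
    IsCoprime (X^2 + C u * X + C w : F[X]) (C z + X) := by
  refine ⟨C (z^2-u*z+w)⁻¹, - C (z^2-u*z+w)⁻¹ * (X + C (u - z)), ?_⟩
  have e : (C (z^2-u*z+w)⁻¹ : F[X]) * (C z ^2 - C u * C z + C w) = 1 := by
    simp only [← map_mul, ← map_pow, ← map_sub, ← map_add]
    rw [inv_mul_cancel₀ h, map_one]
  simp only [map_sub] at *
  linear_combination e

/-- Integrality + MP for the halved pair. -/
theorem Halv.pair {P : Par} {u w A0 A1 A2 A3 α u' w' : Z2} (H : Halv P u w A0 A1 A2 A3 α u' w')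
    (hu : res u = 0) (hw : res w = 0) (hA1 : res A1 = 0) (hA2 : res A2 = 0)
    (hA3 : res A3 = 0) (hα : res α = 0) (hu' : res u' = 0) (hw' : res w' = 0) :
    ∃ b0 b1 : Z2, res b0 = 0 ∧ res b1 = 0 ∧ MP P.Q0 P.Q1 P.Q2 P.c u' w' b0 b1 := by
  have hinj : Function.Injective (Z2.subtype) := Subtype.coe_injective
  have inj0 : ∀ {x : Z2}, x ≠ 0 → Z2.subtype x ≠ 0 := fun hx h => hx (hinj (by simpa using h))
  set κ : Z2 →+* ℚ[X] := (C : ℚ →+* ℚ[X]).comp Z2.subtype with hκ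
  have poly := H.poly κ X
  by_cases hα0 : α = 0
  · -- α = 0
    have hA0 : A0 = 0 := by rw [H.h0, hα0, zero_mul]
    subst hα0 hA0
    refine ⟨-(A1 - A3*w'), -(A2-A3*u'), by simp [hA1, hA3], by simp [hA2, hA3], ?_⟩
    apply MP.comap Z2.subtype hinj
    apply MP_of_dvd
    change (X^2 + κ u' * X + κ w') ∣ (κ _ + κ _ * X)^2 +
      (κ P.Q0 + κ P.Q1 * X + κ P.Q2 * X^2) * (κ _ + κ _ * X) + κ P.c * X^5
    simp only [map_neg, map_sub, map_mul, map_zero] at *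
    have e : X * ((κ A1 + κ A2 * X + κ A3 * X^2)^2
     - (κ A1 + κ A2 * X + κ A3 * X^2) * (κ P.Q0 + κ P.Q1 * X + κ P.Q2 * X^2) + κ P.c * X^5)
        = κ P.c * (X^2 + κ u * X + κ w) * (X^2 + κ u' * X + κ w')^2 := by
      apply mul_left_cancel₀ (X_ne_zero (R := ℚ))
      linear_combination poly
    have e2 : (X^2 + κ u' * X + κ w') ∣ ((κ A1 + κ A2 * X + κ A3 * X^2)^2
     - (κ A1 + κ A2 * X + κ A3 * X^2) * (κ P.Q0 + κ P.Q1 * X + κ P.Q2 * X^2) + κ P.c * X^5) := by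
      by_cases hw0 : w' = 0
      · subst hw0
        refine ⟨κ P.c * (X^2 + κ u * X + κ w) * (X + κ u'), ?_⟩
        apply mul_left_cancel₀ (X_ne_zero (R := ℚ))
        rw [e]
        simp only [map_zero]
        ring
      · have hc : IsCoprime (X^2 + κ u' * X + κ w') (C 0 + X : ℚ[X]) :=
          quad_isCoprime (by simpa using inj0 hw0)
        rw [map_zero, zero_add] at hc
        apply hc.dvd_of_dvd_mul_left
        rw [e]
        exact Dvd.dvd.mul_left (dvd_pow_self _ two_ne_zero) _
    obtain ⟨r, hr⟩ := e2
    refine ⟨r + κ A3 * (-2 *(κ A1 + κ A2 * X + κ A3 * X^2) + κ A3 * (X^2 + κ u' * X + κ w') + (κ P.Q0 + κ P.Q1 * X + κ P.Q2 * X^2)), ?_⟩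
    linear_combination hr
  · -- α ≠ 0
    set o : Z2 := P.Q0 - A1 + A2*α - A3*α^2 with ho
    have hro : res o = 1 := by simp [ho, P.hQ0, hA1, hα, hA2, hA3]
    obtain ⟨o', hoo⟩ := isUnit_of_res o hro
    set s : Z2 := α^2-u'*α+w' with hs
    set r : Z2 := α^2-u*α+w with hr
    have key : α * o^2 = - P.c * r * s^2 := by
      apply mul_left_cancel₀ hα0
      have := H.poly (RingHom.id Z2) (-α)
      simp only [RingHom.id_apply] at this
      rw [ho, hs, hr]
      linear_combination this - H.h0 * (A0 + α * P.Q0 + 2 * (-A1*α+A2*α^2-A3*α^3))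
    have hs0 : s ≠ 0 := by
      intro h
      rw [h] at key
      have : α * o^2 = 0 := by rw [key]; ring
      rcases mul_eq_zero.1 this with h1 | h1
      · exact hα0 h1
      · have h2 := congrArg res h1
        rw [map_pow, hro, map_zero] at h2
        exact absurd h2 (by decide)
    set L1 : Z2 := - P.c * r * s * o' with hL1
    have hsL : s * L1 = α * o := by
      rw [hL1]
      linear_combination (-o')*key + α*o*hoo
    have hrL1 : res L1 = 0 := by simp [hL1, hr, hu, hw, hα]
    set L0 : Z2 := L1 + A3*α with hL0
    have hrL0 : res L0 = 0 := by simp [hL0, hrL1, hα]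
    set b1 : Z2 := A3*u'+L0-A2 with hb1
    set b0 : Z2 := A3*w'+L0*u'-A1 - α*b1 with hb0
    have hb0' : α * b0 = L0*w' - A0 := by
      rw [hb0, hb1, hL0]
      have h0 := H.h0
      rw [hs, ho] at hsL
      linear_combination (-1)*hsL+h0
    refine ⟨b0, b1, ?_, ?_, ?_⟩
    · simp [hb0, hb1, hrL0, hu', hA1, hA2, hA3, hα]
    · simp [hb1, hrL0, hA2, hA3]
    · apply MP.comap Z2.subtype hinj
      apply MP_of_dvd
      change (X^2 + κ u' * X + κ w') ∣ (κ _ + κ _ * X)^2 +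
        (κ P.Q0 + κ P.Q1 * X + κ P.Q2 * X^2) * (κ _ + κ _ * X) + κ P.c * X^5
      have hcop : IsCoprime (X^2 + κ u' * X + κ w') (κ α + X) := by
        apply quad_isCoprime
        have := inj0 hs0
        rw [hs] at this
        simpa using this
      apply (hcop.pow_right (n := 2)).dvd_of_dvd_mul_left
      have f1 : (κ α + X) * (κ b0 + κ b1 * X) = (X^2 + κ u' * X + κ w') * (κ A3 * X + κ L0)
          - (κ A0 + κ A1 * X + κ A2 * X^2 + κ A3 * X^3) := by
        have g0 := congrArg κ hb0'
        have g1 := congrArg κ hb0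
        have g2 := congrArg κ hb1
        simp only [map_mul, map_add, map_sub] at g0 g1 g2
        linear_combination g0 + X * g1 + X^2 * g2
      refine ⟨(X^2 + κ u' * X + κ w') * (κ A3 * X + κ L0)^2 - 2 * (κ A3 * X + κ L0) * (κ A0 + κ A1 * X + κ A2 * X^2 + κ A3 * X^3) + (κ P.Q0 + κ P.Q1 * X + κ P.Q2 * X^2) * (κ α + X) * (κ A3 * X + κ L0) + κ P.c * X * (X^2 + κ u * X + κ w) * (X^2 + κ u' * X + κ w'), ?_⟩
      linear_combination poly + ((κ α + X) * (κ b0 + κ b1 * X) + (X^2 + κ u' * X + κ w') * (κ A3 * X + κ L0)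
          - (κ A0 + κ A1 * X + κ A2 * X^2 + κ A3 * X^3) + (κ P.Q0 + κ P.Q1 * X + κ P.Q2 * X^2) * (κ α + X)) * f1

end FQ

namespace FQ
open Polynomial

def HalvHyp (P : Par) : Prop := ∀ u w b0 b1 : Z2, res u = 0 → res w = 0 → res b0 = 0 → res b1 = 0 →
  MP P.Q0 P.Q1 P.Q2 P.c u w b0 b1 → ¬ (u = 0 ∧ w = 0) →
  ∃ A0 A1 A2 A3 α u' w' : Z2, Halv P u w A0 A1 A2 A3 α u' w' ∧ res A0 = 0 ∧ res A1 = 0 ∧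
    res A2 = 0 ∧ res A3 = 0 ∧ res α = 0 ∧ res u' = 0 ∧ res w' = 0

theorem two_dvd {x : Z2} (h : res x = 0) : 2 ∣ x := even_of_res h

theorem lemmaS (P : Par) (H : HalvHyp P) (u w b0 b1 : Z2) (hu : res u = 0) (hw : res w = 0)
    (hb0 : res b0 = 0) (hb1 : res b1 = 0) (hM : MP P.Q0 P.Q1 P.Q2 P.c u w b0 b1) :
    u = 0 ∧ w = 0 := by
  have main : ∀ k : ℕ, ∀ u w b0 b1 : Z2, res u = 0 → res w = 0 → res b0 = 0 → res b1 = 0 →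
      MP P.Q0 P.Q1 P.Q2 P.c u w b0 b1 → 2^(k+1) ∣ u ∧ 2^(k+1) ∣ w := by
    intro k
    induction k with
    | zero =>
      intro u w b0 b1 hu hw _ _ _
      simp only [zero_add, pow_one]
      exact ⟨two_dvd hu, two_dvd hw⟩
    | succ k ih =>
      intro u w b0 b1 hu hw hb0 hb1 hM
      by_cases h0 : u = 0 ∧ w = 0
      · rw [h0.1, h0.2]; exact ⟨dvd_zero _, dvd_zero _⟩
      · obtain ⟨A0, A1, A2, A3, α, u', w', hH, rA0, rA1, rA2, rA3, rα, ru', rw'⟩ :=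
          H u w b0 b1 hu hw hb0 hb1 hM h0
        obtain ⟨b0', b1', h1, h2, h3⟩ := hH.pair hu hw rA1 rA2 rA3 rα ru' rw'
        obtain ⟨i1, i2⟩ := ih u' w' b0' b1' ru' rw' h1 h2 h3
        exact hH.contr (two_dvd hu) (two_dvd hw) (two_dvd rA0) (two_dvd rA1) (two_dvd rA2)
          (two_dvd rA3) (two_dvd rα) k i1 i2
  exact ⟨eq_zero_of_pow_dvd u fun k => (main k u w b0 b1 hu hw hb0 hb1 hM).1,
    eq_zero_of_pow_dvd w fun k => (main k u w b0 b1 hu hw hb0 hb1 hM).2⟩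

theorem dvd_deg_zero {p D : ℚ[X]} {n : ℕ} (hp : p ∣ D) (hpn : (n : WithBot ℕ) < p.degree)
    (hD : D.degree ≤ n) : D = 0 :=
  eq_zero_of_dvd_of_degree_lt hp (lt_of_le_of_lt hD hpn)

theorem poly7_coeff {d0 d1 d2 d3 d4 d5 d6 d7 : ℚ}
    (h : (C d0 + C d1 * X + C d2 * X^2 + C d3 * X^3 + C d4 * X^4 + C d5 * X^5 + C d6 * X^6 +
      C d7 * X^7 : ℚ[X]) = 0) :
    d0 = 0 ∧ d1 = 0 ∧ d2 = 0 ∧ d3 = 0 ∧ d4 = 0 ∧ d5 = 0 ∧ d6 = 0 ∧ d7 = 0 := by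
  have := fun n => congrArg (fun p => coeff p n) h
  simp only [coeff_add, coeff_C_mul, coeff_X_pow, coeff_X, coeff_C, coeff_zero] at this
  refine ⟨by simpa using this 0, by simpa using this 1, by simpa using this 2, by simpa using this 3,
    by simpa using this 4, by simpa using this 5, by simpa using this 6, by simpa using this 7⟩

/-- The halving relation before normalisation, over the rationals. -/
theorem halving_rational {L : Type*} [Field L] [Algebra ℚ L] (hfin : Module.finrank ℚ L = 5)
    (θ τ σ : L) (hmin : (minpoly ℚ θ).natDegree = 5) (Q0 Q1 Q2 c u w b0 b1 : ℚ) (hQ0 : Q0 ≠ 0)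
    (hM : MP Q0 Q1 Q2 c u w b0 b1)
    (hne : w = 0 → u ≠ 0 ∧ b0 = 0)
    (hτ : τ^2 = algebraMap ℚ L c * θ)
    (hf : (algebraMap ℚ L Q0 + algebraMap ℚ L Q1 * θ + algebraMap ℚ L Q2 * θ^2)^2
      = 4 * algebraMap ℚ L c * θ^5)
    (hσ : σ^2 = θ^2 + algebraMap ℚ L u * θ + algebraMap ℚ L w) :
    ∃ A0 A1 A2 A3 α β e0 e1 e2 : ℚ, ¬ (A0 = 0 ∧ A1 = 0 ∧ A2 = 0 ∧ A3 = 0 ∧ α = 0 ∧ β = 0 ∧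
      e0 = 0 ∧ e1 = 0 ∧ e2 = 0) ∧ A0 = α * Q0 ∧
      A0 - w * A2 + u * w * A3 + b0 * α - w * b1 * β = 0 ∧
      A1 - u * A2 + (u ^ 2 - w) * A3 + b1 * α + (b0 - u * b1) * β = 0 ∧
      (C A0 + C A1 * X + C A2 * X^2 + C A3 * X^3)^2
       - (C A0 + C A1 * X + C A2 * X^2 + C A3 * X^3) * (C α + C β * X)
          * (C Q0 + C Q1 * X + C Q2 * X^2) + C c * X^5 * (C α + C β * X)^2
       = C c * X * (X^2 + C u * X + C w) * (C e0 + C e1 * X + C e2 * X^2 : ℚ[X])^2 := by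
  have hint : IsIntegral ℚ θ := by
    by_contra h
    rw [minpoly.eq_zero h] at hmin; simp at hmin
  have : CharZero L := algebraRat.charZero L
  have hirr := minpoly.irreducible hint
  have : FiniteDimensional ℚ L := Module.finite_of_finrank_pos (by omega)
  -- linear map
  let am := Algebra.linearMap ℚ L
  let pr : Fin 9 → ((Fin 9 → ℚ) →ₗ[ℚ] ℚ) := fun i => LinearMap.proj i
  let M : (Fin 9 → ℚ) →ₗ[ℚ] (ℚ × ℚ × ℚ) × L :=
    ((pr 0 - Q0 • pr 4).prod
      ((pr 0 - w • pr 2 + (u*w) • pr 3 + b0 • pr 4 - (w*b1) • pr 5).prod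
       (pr 1 - u • pr 2 + (u^2-w) • pr 3 + b1 • pr 4 + (b0 - u*b1) • pr 5))).prod
    (((am.comp (pr 0)) + (LinearMap.mulLeft ℚ θ).comp (am.comp (pr 1)) +
      (LinearMap.mulLeft ℚ (θ^2)).comp (am.comp (pr 2)) +
      (LinearMap.mulLeft ℚ (θ^3)).comp (am.comp (pr 3))) -
      ((LinearMap.mulLeft ℚ ((am Q0 + am Q1 * θ + am Q2 * θ^2)/2)).comp (am.comp (pr 4)) +
       (LinearMap.mulLeft ℚ (θ * (am Q0 + am Q1 * θ + am Q2 * θ^2)/2)).comp (am.comp (pr 5))) -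
      ((LinearMap.mulLeft ℚ (τ*σ)).comp (am.comp (pr 6)) +
       (LinearMap.mulLeft ℚ (τ*σ*θ)).comp (am.comp (pr 7)) +
       (LinearMap.mulLeft ℚ (τ*σ*θ^2)).comp (am.comp (pr 8))))
  have hker : LinearMap.ker M ≠ ⊥ := by
    apply LinearMap.ker_ne_bot_of_finrank_lt
    simp [hfin]
  obtain ⟨v, hv, hv0⟩ := (Submodule.ne_bot_iff _).1 hker
  rw [LinearMap.mem_ker] at hv
  have hv1 := congrArg (fun z => z.1.1) hv
  have hv2 := congrArg (fun z => z.1.2.1) hv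
  have hv3 := congrArg (fun z => z.1.2.2) hv
  have hv4 := congrArg (fun z => z.2) hv
  simp [M, pr, am] at hv1 hv2 hv3 hv4
  have hnz : ¬ (v 0 = 0 ∧ v 1 = 0 ∧ v 2 = 0 ∧ v 3 = 0 ∧ v 4 = 0 ∧ v 5 = 0 ∧
      v 6 = 0 ∧ v 7 = 0 ∧ v 8 = 0) := by
    rintro ⟨h0, h1, h2, h3, h4, h5, h6, h7, h8⟩
    apply hv0
    ext i
    fin_cases i <;> simp [*]
  clear_value M pr am
  clear hv hv0 hker
  generalize v 0 = A0 at *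
  generalize v 1 = A1 at *
  generalize v 2 = A2 at *
  generalize v 3 = A3 at *
  generalize v 4 = α at *
  generalize v 5 = β at *
  generalize v 6 = e0 at *
  generalize v 7 = e1 at *
  generalize v 8 = e2 at *
  clear v M pr am
  have hA0 : A0 = α * Q0 := by linear_combination hv1
  have hdvd : (X^2 + C u * X + C w : ℚ[X]) ∣ (C A0 + C A1 * X + C A2 * X^2 + C A3 * X^3)
        + (C α + C β * X) * (C b0 + C b1 * X) := by
    refine ⟨C A3 * X + C (A2 - u * A3 + β * b1), ?_⟩
    have g2 := congrArg (C : ℚ →+* ℚ[X]) hv2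
    have g3 := congrArg (C : ℚ →+* ℚ[X]) hv3
    simp only [map_mul, map_add, map_sub, map_pow, map_zero] at g2 g3 ⊢
    linear_combination g2 + X * g3
  refine ⟨A0, A1, A2, A3, α, β, e0, e1, e2, hnz, hA0, hv2, hv3, ?_⟩
  rw [← sub_eq_zero]
  set D : ℚ[X] := (C A0 + C A1 * X + C A2 * X^2 + C A3 * X^3)^2
       - (C A0 + C A1 * X + C A2 * X^2 + C A3 * X^3) * (C α + C β * X)
          * (C Q0 + C Q1 * X + C Q2 * X^2) + C c * X^5 * (C α + C β * X)^2
       - C c * X * (X^2 + C u * X + C w) * (C e0 + C e1 * X + C e2 * X^2 : ℚ[X])^2 with hD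
  have hDdeg : D.degree ≤ (7 : ℕ) := by
    rw [hD]
    compute_degree
    exact le_rfl
  have hDθ : aeval θ D = 0 := by
    rw [hD]
    simp only [map_mul, map_add, map_sub, map_pow, aeval_X, aeval_C]
    simp only [eq_ratCast] at *
    linear_combination ((A0 + A1 * θ + A2 * θ^2 + A3 * θ^3)  - (α + β * θ) * (Q0 + Q1 * θ + Q2 * θ^2)/2
      + τ * σ * (e0 + e1 * θ + e2 * θ^2)) * hv4 - (α + β * θ : L)^2/4 * hf + (e0 + e1 * θ + e2 * θ^2 : L)^2 *
      (σ^2 * hτ + c * θ * hσ)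
  have hminD : minpoly ℚ θ ∣ D := minpoly.dvd ℚ θ hDθ
  have hmindeg : (minpoly ℚ θ).degree = 5 := by
    rw [degree_eq_natDegree hirr.ne_zero, hmin]; rfl
  have hcopr : ∀ p : ℚ[X], p ≠ 0 → p.degree ≤ (4 : ℕ) → IsCoprime (minpoly ℚ θ) p := by
    intro p hp hdeg
    rw [hirr.coprime_iff_not_dvd]
    intro h
    apply hp
    apply eq_zero_of_dvd_of_degree_lt h
    rw [hmindeg]
    exact lt_of_le_of_lt hdeg (by norm_num)
  have haD : (X^2 + C u * X + C w : ℚ[X]) ∣ D := by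
    obtain ⟨r, hr⟩ := hdvd
    obtain ⟨q, hq⟩ := hM.poly (C : ℚ →+* ℚ[X]) X
    refine ⟨r * ((C A0 + C A1 * X + C A2 * X^2 + C A3 * X^3)
        - (C α + C β * X) * (C b0 + C b1 * X) - (C α + C β * X) * (C Q0 + C Q1 * X + C Q2 * X^2)) +
        (C α + C β * X)^2 * q - C c * X * (C e0 + C e1 * X + C e2 * X^2 : ℚ[X])^2, ?_⟩
    rw [hD]
    linear_combination ((C A0 + C A1 * X + C A2 * X^2 + C A3 * X^3)
        - (C α + C β * X) * (C b0 + C b1 * X) - (C α + C β * X) * (C Q0 + C Q1 * X + C Q2 * X^2)) * hr +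
        (C α + C β * X)^2 * hq
  have hXD : X ∣ D := by
    rw [X_dvd_iff, hD]
    simp [coeff_zero_eq_eval_zero]
    rw [hA0]; ring
  by_cases hw : w = 0
  · obtain ⟨hu, hb⟩ := hne hw
    have hA00 : A0 = 0 := by rw [hw, hb] at hv2; simpa using hv2
    have hα0 : α = 0 := by
      rw [hA00] at hA0
      rcases mul_eq_zero.1 hA0.symm with h | h
      · exact h
      · exact absurd h hQ0
    have h2 : (X^2 : ℚ[X]) ∣ D := by
      rw [hD, hA00, hα0, hw]
      refine ⟨(C A1 + C A2 * X + C A3 * X^2)^2 - (C A1 + C A2 * X + C A3 * X^2) * C β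
          * (C Q0 + C Q1 * X + C Q2 * X^2) + C c * X^5 * (C β)^2
       - C c * (X + C u) * (C e0 + C e1 * X + C e2 * X^2 : ℚ[X])^2, ?_⟩
      simp only [map_zero]
      ring
    have h1 : (X + C u : ℚ[X]) ∣ D := by
      refine dvd_trans ⟨X, ?_⟩ haD
      rw [hw, map_zero]; ring
    have c1 : IsCoprime (X^2 : ℚ[X]) (X + C u) := by
      apply IsCoprime.pow_left
      refine ⟨-C u⁻¹, C u⁻¹, ?_⟩
      have : (C u⁻¹ * C u : ℚ[X]) = 1 := by rw [← map_mul, inv_mul_cancel₀ hu, map_one]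
      linear_combination this
    have h3 := c1.mul_dvd h2 h1
    have hdeg : (X^2 * (X + C u) : ℚ[X]).degree = 3 := by compute_degree!
    have hne0 : (X^2 * (X + C u) : ℚ[X]) ≠ 0 := by
      intro h; rw [h] at hdeg; simp at hdeg
    have h4 := (hcopr _ hne0 (by rw [hdeg]; norm_num)).mul_dvd hminD h3
    apply dvd_deg_zero h4 _ hDdeg
    rw [degree_mul, hdeg, hmindeg]; norm_num
  · have c1 : IsCoprime (X^2 + C u * X + C w : ℚ[X]) X := by
      have := quad_isCoprime (u := u) (w := w) (z := 0) (by simpa using hw)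
      simpa using this
    have h3 := c1.mul_dvd haD hXD
    have hdeg : ((X^2 + C u * X + C w) * X : ℚ[X]).degree = 3 := by compute_degree!
    have hne0 : ((X^2 + C u * X + C w) * X : ℚ[X]) ≠ 0 := by
      intro h; rw [h] at hdeg; simp at hdeg
    have h4 := (hcopr _ hne0 (by rw [hdeg]; norm_num)).mul_dvd hminD h3
    apply dvd_deg_zero h4 _ hDdeg
    rw [degree_mul, hdeg, hmindeg]; norm_num

end FQ

namespace FQ
open Polynomial

theorem Z2.ext_rat {x y : Z2} (h : (x : ℚ) = y) : x = y := Subtype.ext h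

theorem res_decide : ∀ a2 a3 be f0 f1 f2 : ZMod 2,
    -(be*a2) = f0^2 → a2^2 - be*a3 = 0 → 0 = f1^2 → a3^2 = 0 → be^2 = f2^2 →
    a2 = 0 ∧ a3 = 0 ∧ f0 = 0 ∧ f1 = 0 ∧ f2 = be := by decide

theorem exists_fin9 (p : Fin 9 → Prop) (h : ∃ i, p i) :
    p 0 ∨ p 1 ∨ p 2 ∨ p 3 ∨ p 4 ∨ p 5 ∨ p 6 ∨ p 7 ∨ p 8 := by
  obtain ⟨i, hi⟩ := h
  fin_cases i <;> simp at hi <;> tauto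

set_option maxHeartbeats 1000000 in
theorem halvHyp_of_square (P : Par) {L : Type*} [Field L] [Algebra ℚ L]
    (hfin : Module.finrank ℚ L = 5)
    (θ τ : L) (hmin : (minpoly ℚ θ).natDegree = 5)
    (hτ : τ^2 = algebraMap ℚ L P.c * θ)
    (hf : (algebraMap ℚ L P.Q0 + algebraMap ℚ L P.Q1 * θ + algebraMap ℚ L P.Q2 * θ^2)^2
      = 4 * algebraMap ℚ L P.c * θ^5)
    (hsq : ∀ u w b0 b1 : Z2, res u = 0 → res w = 0 → res b0 = 0 → res b1 = 0 →
      MP P.Q0 P.Q1 P.Q2 P.c u w b0 b1 →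
      ∃ σ : L, σ^2 = θ^2 + algebraMap ℚ L u * θ + algebraMap ℚ L w) : HalvHyp P := by
  intro u w b0 b1 hu hw hb0 hb1 hM hne
  obtain ⟨σ, hσ⟩ := hsq u w b0 b1 hu hw hb0 hb1 hM
  have one_ne : (1 : ZMod 2) ≠ 0 := by decide
  have hQ00 : P.Q0 ≠ 0 := by
    intro h; have := P.hQ0; rw [h, map_zero] at this; exact one_ne this.symm
  have hc0 : P.c ≠ 0 := by
    intro h; have := P.hc; rw [h, map_zero] at this; exact one_ne this.symm
  have hne' : (w : ℚ) = 0 → (u : ℚ) ≠ 0 ∧ (b0 : ℚ) = 0 := by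
    intro h
    have hw0 : w = 0 := Z2.ext_rat h
    refine ⟨fun h' => hne ⟨Z2.ext_rat h', hw0⟩, ?_⟩
    obtain ⟨q0, q1, q2, e0, -⟩ := hM
    have e : b0 * (b0 + P.Q0) = 0 := by rw [hw0] at e0; linear_combination e0
    rcases mul_eq_zero.1 e with h1 | h1
    · rw [h1]; rfl
    · have := congrArg res h1
      rw [map_add, hb0, P.hQ0, map_zero, zero_add] at this
      exact absurd this one_ne
  obtain ⟨A0, A1, A2, A3, α, β, e0, e1, e2, hnz, hA0, hv2, hv3, hpoly⟩ :=
    halving_rational hfin θ τ σ hmin P.Q0 P.Q1 P.Q2 P.c u w b0 b1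
      (fun h => hQ00 (Z2.ext_rat h)) (hM.map Z2.subtype) hne' hτ hf hσ
  obtain ⟨s, hs0, g, hg, hg1⟩ := exists_primitive ![A0, A1, A2, A3, α, β, e0, e1, e2] (by
    by_contra hcon
    push Not at hcon
    apply hnz
    exact ⟨hcon 0, hcon 1, hcon 2, hcon 3, hcon 4, hcon 5, hcon 6, hcon 7, hcon 8⟩)
  have G0 : (g 0 : ℚ) = s * A0 := hg 0
  have G1 : (g 1 : ℚ) = s * A1 := hg 1
  have G2 : (g 2 : ℚ) = s * A2 := hg 2
  have G3 : (g 3 : ℚ) = s * A3 := hg 3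
  have G4 : (g 4 : ℚ) = s * α := hg 4
  have G5 : (g 5 : ℚ) = s * β := hg 5
  have G6 : (g 6 : ℚ) = s * e0 := hg 6
  have G7 : (g 7 : ℚ) = s * e1 := hg 7
  have G8 : (g 8 : ℚ) = s * e2 := hg 8
  have hg1' := exists_fin9 (fun i => res (g i) = 1) hg1
  beta_reduce at hg1'
  clear hg hg1
  generalize g 0 = a0 at *
  generalize g 1 = a1 at *
  generalize g 2 = a2 at *
  generalize g 3 = a3 at *
  generalize g 4 = al at *
  generalize g 5 = be at *
  generalize g 6 = f0 at *
  generalize g 7 = f1 at *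
  generalize g 8 = f2 at *
  have k0 : a0 = al * P.Q0 := by
    apply Z2.ext_rat; push_cast; rw [G0, G4, hA0]; ring
  have k2 : a0 - w * a2 + u * w * a3 + b0 * al - w * b1 * be = 0 := by
    apply Z2.ext_rat; push_cast; rw [G0, G2, G3, G4, G5]; linear_combination s * hv2
  have k3 : a1 - u * a2 + (u ^ 2 - w) * a3 + b1 * al + (b0 - u * b1) * be = 0 := by
    apply Z2.ext_rat; push_cast; rw [G1, G2, G3, G4, G5]; linear_combination s * hv3
  have hpoly' : (C (a0:ℚ) + C (a1:ℚ) * X + C (a2:ℚ) * X^2 + C (a3:ℚ) * X^3)^2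
       - (C (a0:ℚ) + C (a1:ℚ) * X + C (a2:ℚ) * X^2 + C (a3:ℚ) * X^3) * (C (al:ℚ) + C (be:ℚ) * X)
          * (C (P.Q0:ℚ) + C (P.Q1:ℚ) * X + C (P.Q2:ℚ) * X^2)
          + C (P.c:ℚ) * X^5 * (C (al:ℚ) + C (be:ℚ) * X)^2
       = C (P.c:ℚ) * X * (X^2 + C (u:ℚ) * X + C (w:ℚ))
          * (C (f0:ℚ) + C (f1:ℚ) * X + C (f2:ℚ) * X^2 : ℚ[X])^2 := by
    rw [G0, G1, G2, G3, G4, G5, G6, G7, G8]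
    simp only [map_mul]
    linear_combination (C s)^2 * hpoly
  rw [← sub_eq_zero] at hpoly'
  clear hpoly hv2 hv3 hA0 hnz G0 G1 G2 G3 G4 G5 G6 G7 G8
  have hc := poly7_coeff (d0 := (a0:ℚ)^2 - P.Q0*(al*a0))
    (d1 := 2*(a0:ℚ)*a1-(P.Q0*(al*a1+be*a0)+P.Q1*(al*a0)) - P.c*(w*f0^2))
    (d2 := 2*(a0:ℚ)*a2+a1^2-(P.Q0*(al*a2+be*a1)+P.Q1*(al*a1+be*a0)+P.Q2*(al*a0))
      - P.c*(w*(2*f0*f1)+u*f0^2))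
    (d3 := 2*(a0:ℚ)*a3+2*a1*a2-(P.Q0*(al*a3+be*a2)+P.Q1*(al*a2+be*a1)+P.Q2*(al*a1+be*a0))
      - P.c*(w*(f1^2+2*f0*f2)+u*(2*f0*f1)+f0^2))
    (d4 := 2*(a1:ℚ)*a3+a2^2-(P.Q0*(be*a3)+P.Q1*(al*a3+be*a2)+P.Q2*(al*a2+be*a1))
      - P.c*(w*(2*f1*f2)+u*(f1^2+2*f0*f2)+2*f0*f1))
    (d5 := 2*(a2:ℚ)*a3-(P.Q1*(be*a3)+P.Q2*(al*a3+be*a2)) + P.c*al^2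
      - P.c*(w*f2^2+u*(2*f1*f2)+(f1^2+2*f0*f2)))
    (d6 := (a3:ℚ)^2-P.Q2*(be*a3) + 2*P.c*al*be - P.c*(u*f2^2+2*f1*f2))
    (d7 := (P.c:ℚ)*be^2-P.c*f2^2) (by
      rw [← hpoly']
      simp only [map_mul, map_add, map_sub, map_pow, map_ofNat]
      ring)
  clear hpoly'
  obtain ⟨-, c1, c2, c3, c4, c5, c6, c7⟩ := hc
  have m1 : 2*a0*a1-(P.Q0*(al*a1+be*a0)+P.Q1*(al*a0)) - P.c*(w*f0^2) = 0 := by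
    apply Z2.ext_rat; push_cast; exact c1
  have m2 : 2*a0*a2+a1^2-(P.Q0*(al*a2+be*a1)+P.Q1*(al*a1+be*a0)+P.Q2*(al*a0))
      - P.c*(w*(2*f0*f1)+u*f0^2) = 0 := by
    apply Z2.ext_rat; push_cast; exact c2
  have m3 : 2*a0*a3+2*a1*a2-(P.Q0*(al*a3+be*a2)+P.Q1*(al*a2+be*a1)+P.Q2*(al*a1+be*a0))
      - P.c*(w*(f1^2+2*f0*f2)+u*(2*f0*f1)+f0^2) = 0 := by
    apply Z2.ext_rat; push_cast; exact c3
  have m4 : 2*a1*a3+a2^2-(P.Q0*(be*a3)+P.Q1*(al*a3+be*a2)+P.Q2*(al*a2+be*a1))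
      - P.c*(w*(2*f1*f2)+u*(f1^2+2*f0*f2)+2*f0*f1) = 0 := by
    apply Z2.ext_rat; push_cast; exact c4
  have m5 : 2*a2*a3-(P.Q1*(be*a3)+P.Q2*(al*a3+be*a2)) + P.c*al^2
      - P.c*(w*f2^2+u*(2*f1*f2)+(f1^2+2*f0*f2)) = 0 := by
    apply Z2.ext_rat; push_cast; exact c5
  have m6 : a3^2-P.Q2*(be*a3) + 2*P.c*al*be - P.c*(u*f2^2+2*f1*f2) = 0 := by
    apply Z2.ext_rat; push_cast; exact c6
  have m7 : P.c*be^2-P.c*f2^2 = 0 := by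
    apply Z2.ext_rat; push_cast; exact c7
  clear c1 c2 c3 c4 c5 c6 c7
  have r0 : res a0 = 0 := by
    have := congrArg res k2
    simpa [hu, hw, hb0, hb1] using this
  have r1 : res a1 = 0 := by
    have := congrArg res k3
    simpa [hu, hw, hb0, hb1] using this
  have ral : res al = 0 := by
    have := congrArg res k0
    simpa [r0, P.hQ0] using this.symm
  have two0 : (2 : ZMod 2) = 0 := by decide
  have hd : res a2 = 0 ∧ res a3 = 0 ∧ res f0 = 0 ∧ res f1 = 0 ∧ res f2 = res be := by
    apply res_decide
    · have := congrArg res m3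
      simp only [map_sub, map_add, map_mul, map_pow, map_ofNat, map_zero, hu, hw, r0, r1, ral,
        P.hQ0, P.hQ1, P.hQ2, P.hc, two0] at this
      linear_combination this
    · have := congrArg res m4
      simp only [map_sub, map_add, map_mul, map_pow, map_ofNat, map_zero, hu, hw, r0, r1, ral,
        P.hQ0, P.hQ1, P.hQ2, P.hc, two0] at this
      linear_combination this
    · have := congrArg res m5
      simp only [map_sub, map_add, map_mul, map_pow, map_ofNat, map_zero, hu, hw, r0, r1, ral,
        P.hQ0, P.hQ1, P.hQ2, P.hc, two0] at this
      linear_combination this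
    · have := congrArg res m6
      simp only [map_sub, map_add, map_mul, map_pow, map_ofNat, map_zero, hu, hw, r0, r1, ral,
        P.hQ0, P.hQ1, P.hQ2, P.hc, two0] at this
      linear_combination this
    · have := congrArg res m7
      simp only [map_sub, map_add, map_mul, map_pow, map_ofNat, map_zero, hu, hw, r0, r1, ral,
        P.hQ0, P.hQ1, P.hQ2, P.hc, two0] at this
      linear_combination this
  obtain ⟨r2, r3, rf0, rf1, rf2⟩ := hd
  have rbe : res be = 1 := by
    rw [r0, r1, r2, r3, ral, rf0, rf1, rf2] at hg1'
    simpa using hg1'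
  obtain ⟨i, hi⟩ := isUnit_of_res be rbe
  have hf2 : f2 = be ∨ f2 = -be := by
    have : (f2 - be) * (f2 + be) = 0 := by
      apply mul_left_cancel₀ hc0
      linear_combination -m7
    rcases mul_eq_zero.1 this with h | h
    · left; linear_combination h
    · right; linear_combination h
  have hε : ∃ ε : Z2, ε^2 = 1 ∧ f2 = ε * be := by
    rcases hf2 with h | h
    · exact ⟨1, by ring, by rw [h]; ring⟩
    · exact ⟨-1, by ring, by rw [h]; ring⟩
  obtain ⟨ε, hε1, hε2⟩ := hε
  subst hε2
  refine ⟨a0*i, a1*i, a2*i, a3*i, al*i, ε*f1*i, ε*f0*i, ?_, by simp [r0], by simp [r1], by simp [r2],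
    by simp [r3], by simp [ral], by simp [rf1], by simp [rf0]⟩
  have E2 : be * be * (i * i) = 1 := by linear_combination (be*i+1)*hi
  constructor
  · rw [k0]; ring
  · linear_combination i^2*m1 + (i * P.Q0 * a0) * hi - P.c * w * f0^2*i^2 * hε1
  · linear_combination i^2*m2 + i*(P.Q0*a1+P.Q1*a0)*hi - P.c * (w*2*f0*f1+u*f0^2)*i^2 * hε1
  · linear_combination i^2*m3 + i*(P.Q0*a2+P.Q1*a1+P.Q2*a0)*hi - P.c * (w*f1^2+u*2*f0*f1+f0^2)*i^2 * hε1 + 2*P.c*w*f0*ε*i*hi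
  · linear_combination i^2*m4 + i*(P.Q0*a3+P.Q1*a2+P.Q2*a1)*hi - P.c * (u*f1^2+2*f0*f1)*i^2 * hε1 + 2*P.c*(w*f1+u*f0)*ε*i*hi
  · linear_combination i^2*m5 + i*(P.Q1*a3+P.Q2*a2)*hi - P.c * (f1^2)*i^2 * hε1 + 2*P.c*(u*f1+f0)*ε*i*hi + P.c*w*(i^2*be^2*hε1 + (be*i+1)*hi)
  · linear_combination i^2*m6 + i*(P.Q2*a3)*hi + 2*P.c*(f1)*ε*i*hi + P.c*u*(i^2*be^2*hε1 + (be*i+1)*hi) - 2*P.c*al*i*hi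

end FQ

namespace FQ
open Polynomial

/-- conclusion of lemma S -/
def SC (P : Par) : Prop := ∀ u w b0 b1 : Z2, res u = 0 → res w = 0 → res b0 = 0 → res b1 = 0 →
  MP P.Q0 P.Q1 P.Q2 P.c u w b0 b1 → u = 0 ∧ w = 0

noncomputable def kap : Z2 →+* ℚ[X] := (C : ℚ →+* ℚ[X]).comp Z2.subtype

theorem kap_apply (x : Z2) : kap x = C (x : ℚ) := rfl

theorem Z2.rat_ne {x : Z2} (h : x ≠ 0) : (x : ℚ) ≠ 0 := fun h' => h (Z2.ext_rat h')

theorem ne_zero_of_res {x : Z2} (h : res x = 1) : x ≠ 0 := by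
  intro h'; rw [h', map_zero] at h; exact absurd h (by decide)

/-- the polynomial of the curve at `b` -/
noncomputable def curveP (P : Par) (b : ℚ[X]) : ℚ[X] :=
  b^2 + (kap P.Q0 + kap P.Q1 * X + kap P.Q2 * X^2) * b + kap P.c * X^5

theorem MP_of_curve_dvd {P : Par} {u w b0 b1 : Z2}
    (h : (X^2 + kap u * X + kap w) ∣ curveP P (kap b0 + kap b1 * X)) :
    MP P.Q0 P.Q1 P.Q2 P.c u w b0 b1 := by
  apply MP.comap Z2.subtype Subtype.coe_injective
  exact MP_of_dvd h

theorem kap_unit {x y : Z2} (h : x * y = 1) : kap x * kap y = 1 := by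
  rw [← map_mul, h, map_one]

/-- S-pair conclusion in a convenient form. -/
theorem Sconc {P : Par} (hS : SC P) {k0 k1 k2 b0 b1 : Z2} (h2 : res k2 = 1) (h1 : res k1 = 0)
    (h0 : res k0 = 0) (hb0 : res b0 = 0) (hb1 : res b1 = 0)
    (h : (kap k2 * X^2 + kap k1 * X + kap k0) ∣ curveP P (kap b0 + kap b1 * X)) :
    k1 = 0 ∧ k0 = 0 := by
  obtain ⟨i, hi⟩ := isUnit_of_res k2 h2
  have hk := kap_unit hi
  have := hS (i*k1) (i*k0) b0 b1 (by simp [h1]) (by simp [h0]) hb0 hb1 (MP_of_curve_dvd (by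
    refine dvd_trans ⟨kap k2, ?_⟩ h
    simp only [map_mul]
    linear_combination (-kap k1 * X - kap k0) * hk))
  constructor
  · linear_combination k2 * this.1 - k1 * hi
  · linear_combination k2 * this.2 - k0 * hi

theorem lin32 (p q : Fin 3 → ℚ) : ∃ v : Fin 3 → ℚ, (∃ i, v i ≠ 0) ∧
    p 0 * v 0 + p 1 * v 1 + p 2 * v 2 = 0 ∧ q 0 * v 0 + q 1 * v 1 + q 2 * v 2 = 0 := by
  let pr : Fin 3 → ((Fin 3 → ℚ) →ₗ[ℚ] ℚ) := fun i => LinearMap.proj i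
  let M : (Fin 3 → ℚ) →ₗ[ℚ] ℚ × ℚ :=
    (p 0 • pr 0 + p 1 • pr 1 + p 2 • pr 2).prod (q 0 • pr 0 + q 1 • pr 1 + q 2 • pr 2)
  have hker : LinearMap.ker M ≠ ⊥ := by
    apply LinearMap.ker_ne_bot_of_finrank_lt
    simp
  obtain ⟨v, hv, hv0⟩ := (Submodule.ne_bot_iff _).1 hker
  rw [LinearMap.mem_ker] at hv
  have hv1 := congrArg (fun z => z.1) hv
  have hv2 := congrArg (fun z => z.2) hv
  simp [M, pr] at hv1 hv2
  refine ⟨v, ?_, hv1, hv2⟩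
  by_contra hcon
  push Not at hcon
  exact hv0 (funext hcon)

theorem exists_fin3 (p : Fin 3 → Prop) (h : ∃ i, p i) : p 0 ∨ p 1 ∨ p 2 := by
  obtain ⟨i, hi⟩ := h
  fin_cases i <;> simp at hi <;> tauto

theorem prim3 (x y z : ℚ) (h : ¬ (x = 0 ∧ y = 0 ∧ z = 0)) :
    ∃ s : ℚ, s ≠ 0 ∧ ∃ x' y' z' : Z2, (x' : ℚ) = s * x ∧ (y' : ℚ) = s * y ∧ (z' : ℚ) = s * z ∧
      (res x' = 1 ∨ res y' = 1 ∨ res z' = 1) := by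
  obtain ⟨s, hs0, g, hg, hg1⟩ := exists_primitive ![x, y, z] (by
    by_contra hcon
    push Not at hcon
    exact h ⟨hcon 0, hcon 1, hcon 2⟩)
  exact ⟨s, hs0, g 0, g 1, g 2, hg 0, hg 1, hg 2, exists_fin3 (fun i => res (g i) = 1) hg1⟩

theorem rat_trichotomy (s : ℚ) (hs : s ≠ 0) :
    (∃ y : Z2, (y : ℚ) = s⁻¹) ∨ ∃ y : Z2, (y : ℚ) = s ∧ res y = 0 := by
  rcases le_total (padicNorm 2 s) 1 with h | h
  · rcases res_cases ⟨s, h⟩ with h1 | h1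
    · right; exact ⟨⟨s, h⟩, rfl, h1⟩
    · left
      obtain ⟨y, hy⟩ := isUnit_of_res _ h1
      refine ⟨y, ?_⟩
      have := congrArg (fun z : Z2 => (z : ℚ)) hy
      simp only [Subring.coe_mul, Subring.coe_one] at this
      field_simp
      linear_combination this
  · left
    refine ⟨⟨s⁻¹, ?_⟩, rfl⟩
    change padicNorm 2 _ ≤ 1
    rw [← one_div, padicNorm.div, padicNorm.one]
    rw [div_le_one (by linarith)]; exact h

theorem gauss_dec : ∀ k0 k1 k2 m0 m1 m2 : ZMod 2, (k0 = 1 ∨ k1 = 1 ∨ k2 = 1) →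
    (m0 = 1 ∨ m1 = 1 ∨ m2 = 1) → k0*m0 = 0 → k0*m1+k1*m0 = 0 → k0*m2+k1*m1+k2*m0 = 0 →
    k1*m2+k2*m1 = 0 → k2*m2 = 0 → False := by
  have h2 : ∀ k : ZMod 2, k = 0 ∨ k = 1 := by decide
  intro k0 k1 k2 m0 m1 m2
  rcases h2 k0 with rfl | rfl <;> rcases h2 k1 with rfl | rfl <;> rcases h2 k2 with rfl | rfl <;>
  rcases h2 m0 with rfl | rfl <;> rcases h2 m1 with rfl | rfl <;> rcases h2 m2 with rfl | rfl <;>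
  simp

/-- Gauss lemma for quadratics. -/
theorem gauss_quad {k0 k1 k2 : Z2} (hk : res k0 = 1 ∨ res k1 = 1 ∨ res k2 = 1) (m0 m1 m2 : ℚ)
    {n0 n1 n2 n3 n4 : Z2} (e0 : (n0:ℚ) = k0*m0) (e1 : (n1:ℚ) = k0*m1+k1*m0)
    (e2 : (n2:ℚ) = k0*m2+k1*m1+k2*m0) (e3 : (n3:ℚ) = k1*m2+k2*m1) (e4 : (n4:ℚ) = k2*m2) :
    ∃ m0' m1' m2' : Z2, (m0' : ℚ) = m0 ∧ (m1' : ℚ) = m1 ∧ (m2' : ℚ) = m2 := by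
  by_cases h : m0 = 0 ∧ m1 = 0 ∧ m2 = 0
  · exact ⟨0, 0, 0, by simp [h.1], by simp [h.2.1], by simp [h.2.2]⟩
  · obtain ⟨s, hs, x, y, z, hx, hy, hz, hr⟩ := prim3 m0 m1 m2 h
    rcases rat_trichotomy s hs with ⟨t, ht⟩ | ⟨t, ht, ht0⟩
    · refine ⟨t*x, t*y, t*z, ?_, ?_, ?_⟩
      · push_cast; rw [ht, hx]; field_simp
      · push_cast; rw [ht, hy]; field_simp
      · push_cast; rw [ht, hz]; field_simp
    · exfalso
      have f0 : k0 * x = t * n0 := Z2.ext_rat (by push_cast; rw [hx, ht, e0]; ring)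
      have f1 : k0 * y + k1 * x = t * n1 := Z2.ext_rat (by push_cast; rw [hx, hy, ht, e1]; ring)
      have f2 : k0 * z + k1 * y + k2 * x = t * n2 :=
        Z2.ext_rat (by push_cast; rw [hx, hy, hz, ht, e2]; ring)
      have f3 : k1 * z + k2 * y = t * n3 := Z2.ext_rat (by push_cast; rw [hz, hy, ht, e3]; ring)
      have f4 : k2 * z = t * n4 := Z2.ext_rat (by push_cast; rw [hz, ht, e4]; ring)
      have g0 := congrArg res f0
      have g1 := congrArg res f1
      have g2 := congrArg res f2
      have g3 := congrArg res f3
      have g4 := congrArg res f4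
      simp only [map_mul, map_add, ht0, zero_mul] at g0 g1 g2 g3 g4
      exact gauss_dec _ _ _ _ _ _ hk hr g0 g1 g2 g3 g4

/-- quotient of a degree 4 polynomial by a quadratic dividing it. -/
theorem quot4 {u w n0 n1 n2 n3 n4 : ℚ}
    (h : (X^2 + C u * X + C w : ℚ[X]) ∣ C n0 + C n1 * X + C n2 * X^2 + C n3 * X^3 + C n4 * X^4) :
    ∃ m0 m1 m2 : ℚ, n0 = w*m0 ∧ n1 = w*m1+u*m0 ∧ n2 = w*m2+u*m1+m0 ∧ n3 = u*m2+m1 ∧ n4 = m2 := by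
  have e : (C n0 + C n1 * X + C n2 * X^2 + C n3 * X^3 + C n4 * X^4 : ℚ[X]) =
      (X^2 + C u * X + C w) * (C n4 * X^2 + C (n3-u*n4) * X + C (n2 - w*n4-u*(n3-u*n4))) +
      (C (n1 - (w*(n3-u*n4)+u*(n2 - w*n4-u*(n3-u*n4)))) * X +
        C (n0 - w*(n2 - w*n4-u*(n3-u*n4)))) := by
    simp only [map_mul, map_add, map_sub]
    ring
  rw [e] at h
  obtain ⟨h1, h2⟩ := lin_of_quad_dvd ((dvd_add_right (dvd_mul_right _ _)).1 h)
  exact ⟨n2 - w*n4-u*(n3-u*n4), n3-u*n4, n4, by linear_combination h1, by linear_combination h2, by ring, by ring, rfl⟩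

end FQ

namespace FQ
open Polynomial

theorem coprimeX (u w : ℚ) (hw : w ≠ 0) : IsCoprime (X^2 + C u * X + C w : ℚ[X]) X := by
  have h : C w * C w⁻¹ = (1 : ℚ[X]) := by rw [← C_mul, mul_inv_cancel₀ hw, C_1]
  exact ⟨C w⁻¹, -C w⁻¹ * (X + C u), by linear_combination h⟩

theorem C_ne {x : ℚ} (h : x ≠ 0) : (C x : ℚ[X]) ≠ 0 := by simpa using h

/-- `b = 0` impossible. -/
theorem no_zero {P : Par} {u w : ℚ} (hw : w ≠ 0)
    (h : (X^2 + C u * X + C w) ∣ curveP P 0) : False := by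
  have h1 : (X^2 + C u * X + C w : ℚ[X]) ∣ kap P.c * X^5 := by
    simpa [curveP] using h
  have h2 := ((coprimeX u w hw).pow_right (n := 5)).dvd_of_dvd_mul_right h1
  have h3 : (X^2 + C u * X + C w : ℚ[X]) ∣ C 0 * X + C (P.c : ℚ) := by
    simpa [kap_apply] using h2
  have := (lin_of_quad_dvd h3).1
  exact Z2.rat_ne (ne_zero_of_res P.hc) this

theorem lam0 {P : Par} {u w b0 b1 α β : ℚ} (hw : w ≠ 0) (hab : ¬ (α = 0 ∧ β = 0))
    (h : (X^2 + C u * X + C w) ∣ curveP P (C b0 + C b1 * X))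
    (e0 : α * b0 - β * b1 * w = 0) (e1 : α * b1 + β * b0 - β * b1 * u = 0) : False := by
  by_cases hμ : β * b1 = 0
  · have hb : b0 = 0 ∧ b1 = 0 := by
      rcases mul_eq_zero.1 hμ with hβ | hb
      · have ha : α ≠ 0 := fun h => hab ⟨h, hβ⟩
        subst hβ
        constructor
        · simpa [ha] using e0
        · simpa [ha] using e1
      · subst hb
        simp at e0 e1
        refine ⟨?_, rfl⟩
        by_contra hb0
        exact hab ⟨by tauto, by tauto⟩
    rw [hb.1, hb.2] at h
    exact no_zero hw (by simpa using h)
  · have hb1 : b1 ≠ 0 := fun h => hμ (by rw [h, mul_zero])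
    have hβ : β ≠ 0 := fun h => hμ (by rw [h, zero_mul])
    obtain ⟨q, hq⟩ := h
    have := congrArg (eval (-b0/b1)) hq
    simp only [curveP, kap_apply, eval_add, eval_mul, eval_pow, eval_C, eval_X] at this
    have hb : b0 + b1 * (-b0/b1) = 0 := by field_simp; ring
    have ha : (-b0/b1)^2 + u * (-b0/b1) + w = 0 := by
      have : β * b1 * ((-b0/b1)^2 + u * (-b0/b1) + w) = 0 := by
        field_simp
        linear_combination b0 * e1 - b1 * e0
      exact (mul_eq_zero.1 this).resolve_left hμ
    rw [hb, ha] at this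
    have hc := Z2.rat_ne (ne_zero_of_res P.hc)
    have h5 : (P.c : ℚ) * (-b0/b1)^5 = 0 := by linear_combination this
    have h6 : -b0/b1 = 0 := by
      rcases mul_eq_zero.1 h5 with h | h
      · exact absurd h hc
      · exact pow_eq_zero_iff (by norm_num) |>.1 h
    rw [h6] at ha
    exact hw (by linear_combination ha)

theorem red3 {u w b0 b1 l α β : ℚ} (e0 : l * (u*w) + α * b0 - β * b1 * w = 0)
    (e1 : l * (u^2-w) + α * b1 + β * b0 - β * b1 * u = 0) :
    (C l * X^3 + (C α + C β * X) * (C b0 + C b1 * X) : ℚ[X]) =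
      (X^2 + C u * X + C w) * (C l * X + C (β * b1 - l * u)) := by
  have e0' := congrArg (C : ℚ → ℚ[X]) e0
  have e1' := congrArg (C : ℚ → ℚ[X]) e1
  simp only [map_add, map_mul, map_sub, map_pow, map_zero] at e0' e1' ⊢
  linear_combination e0' + X * e1'

/-- the `3R` polynomial -/
noncomputable def N3 (P : Par) (l α β : Z2) : ℚ[X] :=
  kap l^2 * X^3 - kap l * (kap α + kap β * X) * (kap P.Q0 + kap P.Q1 * X + kap P.Q2 * X^2)
    + kap P.c * X^2 * (kap α + kap β * X)^2

theorem N3_id (P : Par) (l α β : Z2) (b : ℚ[X]) :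
    X^3 * N3 P l α β = (kap l * X^3 + (kap α + kap β * X) * b) *
      (kap l * X^3 - (kap α + kap β * X) * b -
        (kap α + kap β * X) * (kap P.Q0 + kap P.Q1 * X + kap P.Q2 * X^2)) +
      (kap α + kap β * X)^2 * curveP P b := by
  unfold N3 curveP; ring

/-- the `2R` polynomial -/
noncomputable def N2 (P : Par) (l0 l1 m : Z2) : ℚ[X] :=
  X^2 * (kap l0 + kap l1 * X)^2 - kap m * (kap l0 + kap l1 * X) *
    (kap P.Q0 + kap P.Q1 * X + kap P.Q2 * X^2) + kap P.c * kap m^2 * X^3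

theorem N2_id (P : Par) (l0 l1 m : Z2) (b : ℚ[X]) :
    X^2 * N2 P l0 l1 m = (X^2 * (kap l0 + kap l1 * X) + kap m * b) *
      (X^2 * (kap l0 + kap l1 * X) - kap m * b -
        kap m * (kap P.Q0 + kap P.Q1 * X + kap P.Q2 * X^2)) +
      kap m^2 * curveP P b := by
  unfold N2 curveP; ring

/-- factorisation -/
theorem factor_N {s u w : ℚ} {k0 k1 k2 n0 n1 n2 n3 n4 : Z2} (hs : s ≠ 0) (h2 : (k2:ℚ) = s)
    (h1 : (k1:ℚ) = s * u) (h0 : (k0:ℚ) = s * w)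
    (hk : res k0 = 1 ∨ res k1 = 1 ∨ res k2 = 1)
    (hd : (X^2 + C u * X + C w : ℚ[X]) ∣
      kap n0 + kap n1 * X + kap n2 * X^2 + kap n3 * X^3 + kap n4 * X^4) :
    ∃ m0 m1 m2 : Z2, k0*m0 = n0 ∧ k0*m1+k1*m0 = n1 ∧ k0*m2+k1*m1+k2*m0 = n2 ∧
      k1*m2+k2*m1 = n3 ∧ k2*m2 = n4 := by
  simp only [kap_apply] at hd
  obtain ⟨m0, m1, m2, g0, g1, g2, g3, g4⟩ := quot4 hd
  obtain ⟨m0', m1', m2', f0, f1, f2⟩ := gauss_quad (n0 := n0) (n1 := n1) (n2 := n2) (n3 := n3)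
    (n4 := n4) hk (m0/s) (m1/s) (m2/s)
    (by rw [h0, g0]; field_simp) (by rw [h0, h1, g1]; field_simp)
    (by rw [h0, h1, h2, g2]; field_simp) (by rw [h1, h2, g3]; field_simp)
    (by rw [h2, g4]; field_simp)
  refine ⟨m0', m1', m2', ?_, ?_, ?_, ?_, ?_⟩ <;> apply Z2.ext_rat <;> push_cast <;>
    simp only [f0, f1, f2, h0, h1, h2, g0, g1, g2, g3, g4] <;> field_simp

theorem N3_coef (P : Par) (l α β : Z2) : N3 P l α β =
    kap (-l*α*P.Q0) + kap (-l*(α*P.Q1+β*P.Q0)) * X + kap (-l*(α*P.Q2+β*P.Q1)+P.c*α^2) * X^2 +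
    kap (l^2-l*β*P.Q2+2*P.c*α*β) * X^3 + kap (P.c*β^2) * X^4 := by
  unfold N3
  simp only [map_add, map_mul, map_sub, map_neg, map_pow, map_ofNat]
  ring

theorem N2_coef (P : Par) (l0 l1 m : Z2) : N2 P l0 l1 m =
    kap (-m*l0*P.Q0) + kap (-m*(P.Q0*l1+P.Q1*l0)) * X + kap (l0^2-m*(P.Q1*l1+P.Q2*l0)) * X^2 +
    kap (2*l0*l1-m*P.Q2*l1+P.c*m^2) * X^3 + kap (l1^2) * X^4 := by
  unfold N2
  simp only [map_add, map_mul, map_sub, map_neg, map_pow, map_ofNat]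
  ring

/-- existence of 3R data -/
theorem exists_3R {P : Par} {u w b0 b1 : ℚ} (hw : w ≠ 0)
    (h : (X^2 + C u * X + C w) ∣ curveP P (C b0 + C b1 * X)) :
    ∃ l α β : Z2, (res l = 1 ∨ res α = 1 ∨ res β = 1) ∧
      (l:ℚ) * (u*w) + α * b0 - β * b1 * w = 0 ∧ (l:ℚ) * (u^2-w) + α * b1 + β * b0 - β * b1 * u = 0 ∧
      (X^2 + C u * X + C w) ∣ N3 P l α β := by
  obtain ⟨v, hv, h1, h2⟩ := lin32 ![u*w, b0, -b1*w] ![u^2-w, b1, b0-b1*u]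
  have hv' := exists_fin3 _ hv
  obtain ⟨s, hs, l, α, β, hl, ha, hb, hr⟩ := prim3 (v 0) (v 1) (v 2) (by tauto)
  simp at h1 h2
  have e0 : (l:ℚ) * (u*w) + α * b0 - β * b1 * w = 0 := by
    rw [hl, ha, hb]; linear_combination s * h1
  have e1 : (l:ℚ) * (u^2-w) + α * b1 + β * b0 - β * b1 * u = 0 := by
    rw [hl, ha, hb]; linear_combination s * h2
  refine ⟨l, α, β, hr, e0, e1, ?_⟩
  have hr3 := red3 e0 e1
  have : (X^2 + C u * X + C w) ∣ X^3 * N3 P l α β := by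
    rw [N3_id P l α β (C b0 + C b1 * X)]
    apply dvd_add
    · apply Dvd.dvd.mul_right
      exact ⟨_, hr3⟩
    · exact Dvd.dvd.mul_left h _
  exact ((coprimeX u w hw).pow_right (n := 3)).dvd_of_dvd_mul_left this

theorem red2 {u w b0 b1 l0 l1 m : ℚ} (e0 : -w*l0 + u*w*l1 + m*b0 = 0)
    (e1 : -u*l0 + (u^2-w)*l1 + m*b1 = 0) :
    (X^2 * (C l0 + C l1 * X) + C m * (C b0 + C b1 * X) : ℚ[X]) =
      (X^2 + C u * X + C w) * (C l1 * X + C (l0 - l1 * u)) := by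
  have e0' := congrArg (C : ℚ → ℚ[X]) e0
  have e1' := congrArg (C : ℚ → ℚ[X]) e1
  simp only [map_add, map_mul, map_sub, map_neg, map_pow, map_zero] at e0' e1' ⊢
  linear_combination e0' + X * e1'

theorem exists_2R {P : Par} {u w b0 b1 : ℚ} (hw : w ≠ 0)
    (h : (X^2 + C u * X + C w) ∣ curveP P (C b0 + C b1 * X)) :
    ∃ l0 l1 m : Z2, (res l0 = 1 ∨ res l1 = 1 ∨ res m = 1) ∧
      -w*(l0:ℚ) + u*w*l1 + m*b0 = 0 ∧ -u*(l0:ℚ) + (u^2-w)*l1 + m*b1 = 0 ∧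
      (X^2 + C u * X + C w) ∣ N2 P l0 l1 m := by
  obtain ⟨v, hv, h1, h2⟩ := lin32 ![-w, u*w, b0] ![-u, u^2-w, b1]
  have hv' := exists_fin3 _ hv
  obtain ⟨s, hs, l, α, β, hl, ha, hb, hr⟩ := prim3 (v 0) (v 1) (v 2) (by tauto)
  simp at h1 h2
  have e0 : -w*(l:ℚ) + u*w*α + β*b0 = 0 := by
    rw [hl, ha, hb]; linear_combination s * h1
  have e1 : -u*(l:ℚ) + (u^2-w)*α + β*b1 = 0 := by
    rw [hl, ha, hb]; linear_combination s * h2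
  refine ⟨l, α, β, hr, e0, e1, ?_⟩
  have hr3 := red2 e0 e1
  have : (X^2 + C u * X + C w) ∣ X^2 * N2 P l α β := by
    rw [N2_id P l α β (C b0 + C b1 * X)]
    apply dvd_add
    · apply Dvd.dvd.mul_right
      exact ⟨_, hr3⟩
    · exact Dvd.dvd.mul_left h _
  exact ((coprimeX u w hw).pow_right (n := 2)).dvd_of_dvd_mul_left this

set_option synthInstance.maxSize 100000 in
set_option synthInstance.maxHeartbeats 2000000 in
set_option maxRecDepth 100000 in
theorem decA : ∀ k0 k1 k2 l a b m0 m1 m2 : ZMod 2, (l = 1 ∨ a = 1 ∨ b = 1) → k0 = 1 →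
    k0*m0 = l*a → k0*m1+k1*m0 = l*b → k0*m2+k1*m1+k2*m0 = a → k1*m2+k2*m1 = l → k2*m2 = b →
    k1 = 0 ∧ l = 0 ∧ a = 1 ∧ m0 = 0 ∧ m1 = 0 ∧ m2 = 1 := by
  have h2 : ∀ k : ZMod 2, k = 0 ∨ k = 1 := by decide
  intro k0 k1 k2 l a b m0 m1 m2 h hk
  subst hk
  intro e0 e1 e2 e3 e4
  have e0' : m0 = l * a := by simpa using e0
  subst e0'
  rcases h2 k1 with rfl | rfl <;> rcases h2 k2 with rfl | rfl <;>
  rcases h2 l with rfl | rfl <;> rcases h2 a with rfl | rfl <;> rcases h2 b with rfl | rfl <;>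
  rcases h2 m1 with rfl | rfl <;> rcases h2 m2 with rfl | rfl <;>
  revert h e1 e2 e3 e4 <;> decide

set_option synthInstance.maxSize 100000 in
theorem decD : ∀ l0 l1 m m0 m1 m2 : ZMod 2, (l0 = 1 ∨ l1 = 1 ∨ m = 1) →
    0 = m*l0 → m0 = m*l1 → m1 = l0 → m2 = m → 0 = l1 →
    (m = 1 ∧ l0 = 0 ∧ l1 = 0 ∧ m0 = 0 ∧ m1 = 0 ∧ m2 = 1) ∨
    (m = 0 ∧ l0 = 1 ∧ l1 = 0 ∧ m1 = 1) := by
  have h2 : ∀ k : ZMod 2, k = 0 ∨ k = 1 := by decide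
  intro l0 l1 m m0 m1 m2 h e0 e1 e2 e3 e4
  subst e1 e2 e3 e4
  rcases h2 m1 with rfl | rfl <;> rcases h2 m2 with rfl | rfl <;> revert h e0 <;> decide

end FQ

namespace FQ
open Polynomial

theorem bcase (b0 b1 : ℚ) : (∃ x y : Z2, (x:ℚ) = b0 ∧ (y:ℚ) = b1) ∨
    ∃ t x y : Z2, res t = 0 ∧ t ≠ 0 ∧ (x:ℚ) = t * b0 ∧ (y:ℚ) = t * b1 ∧ (res x = 1 ∨ res y = 1) := by
  by_cases h : b0 = 0 ∧ b1 = 0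
  · left; exact ⟨0, 0, by simp [h.1], by simp [h.2]⟩
  · obtain ⟨s, hs, x, y, z, hx, hy, hz, hr⟩ := prim3 b0 b1 0 (by tauto)
    have hz0 : z = 0 := Z2.ext_rat (by rw [hz]; simp)
    rcases rat_trichotomy s hs with ⟨t, ht⟩ | ⟨t, ht, ht0⟩
    · left
      refine ⟨t*x, t*y, ?_, ?_⟩
      · push_cast; rw [ht, hx]; field_simp
      · push_cast; rw [ht, hy]; field_simp
    · right
      refine ⟨t, x, y, ht0, ?_, by rw [hx, ht], by rw [hy, ht], ?_⟩
      · rintro rfl; exact hs (by rw [← ht]; simp)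
      · subst hz0; simp at hr; exact hr

theorem scale_MP {P : Par} {u w b0 b1 : ℚ} {u' w' t x y : Z2} (hu : (u':ℚ) = u) (hw : (w':ℚ) = w)
    (hx : (x:ℚ) = t * b0) (hy : (y:ℚ) = t * b1)
    (h : (X^2 + C u * X + C w) ∣ curveP P (C b0 + C b1 * X)) :
    MP (t*P.Q0) (t*P.Q1) (t*P.Q2) (t^2*P.c) u' w' x y := by
  apply MP.comap Z2.subtype Subtype.coe_injective
  have := MP_of_dvd h
  rw [MP_iff] at this ⊢
  obtain ⟨h1, h2⟩ := this
  simp only [map_mul, map_pow, Subring.subtype_apply, hu, hw, hx, hy] at *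
  constructor
  · linear_combination (t:ℚ)^2 * h1
  · linear_combination (t:ℚ)^2 * h2

theorem dvd_of_L {P : Par} {l α β : Z2} {A b : ℚ[X]} (h1 : A ∣ N3 P l α β)
    (h2 : A ∣ kap l * X^3 + (kap α + kap β * X) * b) (h3 : IsCoprime A (kap α + kap β * X)) :
    A ∣ curveP P b := by
  have h : A ∣ (kap α + kap β * X)^2 * curveP P b := by
    have := N3_id P l α β b
    have h4 : (kap α + kap β * X)^2 * curveP P b = X^3 * N3 P l α β -
      (kap l * X^3 + (kap α + kap β * X) * b) *
      (kap l * X^3 - (kap α + kap β * X) * b -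
        (kap α + kap β * X) * (kap P.Q0 + kap P.Q1 * X + kap P.Q2 * X^2)) := by
      linear_combination -this
    rw [h4]
    exact dvd_sub (h1.mul_left _) (h2.mul_right _)
  exact (h3.pow_right (n := 2)).dvd_of_dvd_mul_left h

/-- case `A0 = 1` or `1+T^2` modulo 2 -/
theorem caseA {P : Par} (hS : SC P) {u w b0 b1 : ℚ} (hw : w ≠ 0)
    (h : (X^2 + C u * X + C w) ∣ curveP P (C b0 + C b1 * X))
    {l α β : Z2} (e0 : (l:ℚ) * (u*w) + α * b0 - β * b1 * w = 0)
    (e1 : (l:ℚ) * (u^2-w) + α * b1 + β * b0 - β * b1 * u = 0)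
    {m0 m1 m2 : Z2} (hdv : (kap m2 * X^2 + kap m1 * X + kap m0) ∣ N3 P l α β)
    (hm0 : m0 = 0 → l * α * P.Q0 = 0)
    (hl : res l = 0) (hα : res α = 1) (r0 : res m0 = 0) (r1 : res m1 = 0) (r2 : res m2 = 1) :
    False := by
  obtain ⟨i, hi⟩ := isUnit_of_res m2 r2
  obtain ⟨j, hj⟩ := isUnit_of_res (α^2-α*β*(i*m1)+β^2*(i*m0)) (by simp [r0, r1, hα])
  set u' := i*m1 with hu'
  set w' := i*m0 with hw'
  have hm1 : m1 = m2 * u' := by rw [hu']; linear_combination -m1 * hi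
  have hm0' : m0 = m2 * w' := by rw [hw']; linear_combination -m0 * hi
  have ru : res u' = 0 := by simp [hu', r1]
  have rw' : res w' = 0 := by simp [hw', r0]
  clear_value u' w'
  have hAA : (kap m2 * X^2 + kap m1 * X + kap m0) = kap m2 * (X^2 + kap u' * X + kap w') := by
    rw [hm1, hm0']; simp only [map_mul]; ring
  have hu2 := kap_unit hi
  have hassoc : ∀ f : ℚ[X], (kap m2 * X^2 + kap m1 * X + kap m0) ∣ f ↔
      (X^2 + kap u' * X + kap w') ∣ f := by
    intro f
    rw [hAA]
    constructor
    · intro h; exact dvd_trans (dvd_mul_left _ _) h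
    · rintro ⟨q, hq⟩
      exact ⟨kap i * q, by rw [hq]; linear_combination -(X^2 + kap u' * X + kap w') * q * hu2⟩
  set x := (α - β*u')*j with hx
  set y := -β*j with hy
  set t1 := u'^2-w' with ht1
  set t0 := u'*w' with ht0
  set c0 := -l*(x*t0-y*w'*t1) with hc0
  set c1 := -l*(x*t1+y*(t0-u'*t1)) with hc1
  have hcop : (kap α + kap β * X) * (kap x + kap y * X) =
      1 + (X^2 + kap u' * X + kap w') * kap (β * y) := by
    have := congrArg kap hj
    rw [hx, hy]
    simp only [map_mul, map_add, map_sub, map_neg, map_pow, map_one] at *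
    linear_combination this
  have hmain := Sconc hS (k0 := m0) (k1 := m1) (k2 := m2) (b0 := c0) (b1 := c1) r2 r1 r0
    (by rw [hc0]; simp [hl]) (by rw [hc1]; simp [hl]) (by
      refine dvd_of_L hdv ?_ ?_
      · rw [hassoc]
        have e : kap l * X^3 + (kap α + kap β * X) * (kap c0 + kap c1 * X) =
          (X^2 + kap u' * X + kap w') * (kap l * X + kap (β*c1-l*u')) := by
          have hj1 : α * c0 + l*t0 - β*c1*w' = 0 := by
            rw [hc0, hc1, hx, hy, ht0, ht1]
            linear_combination (-l*u'*w') * hj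
          have hj2 : α * c1 + β * c0 + l*t1 - β*c1*u' = 0 := by
            rw [hc0, hc1, hx, hy, ht0, ht1]
            linear_combination (-l*(u'^2-w')) * hj
          have k1 := congrArg kap hj1
          have k2 := congrArg kap hj2
          rw [ht0] at k1
          rw [ht1] at k2
          simp only [map_mul, map_add, map_sub, map_neg, map_pow, map_zero] at k1 k2 ⊢
          linear_combination k1 + X * k2
        exact ⟨_, e⟩
      · rw [hAA]
        refine ⟨-kap i * kap (β * y), kap x + kap y * X, ?_⟩
        linear_combination hcop - (X^2 + kap u' * X + kap w') * kap (β*y) * hu2)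
  have hl0 : l = 0 := by
    have := hm0 hmain.2
    rcases mul_eq_zero.1 this with h | h
    · rcases mul_eq_zero.1 h with h | h
      · exact h
      · exact absurd h (ne_zero_of_res hα)
    · exact absurd h (ne_zero_of_res P.hQ0)
  subst hl0
  refine lam0 (α := α) (β := β) hw ?_ h (by simpa using e0) (by simpa using e1)
  intro hh
  exact Z2.rat_ne (ne_zero_of_res hα) hh.1

theorem decB1 : ∀ x y : ZMod 2, MP 0 0 0 0 1 0 x y → x = 0 ∧ y = 0 := by
  intro x y h; rw [MP_iff] at h; revert x y; decide
theorem decB2 : ∀ x y : ZMod 2, MP 1 0 0 1 1 0 x y → False := by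
  intro x y h; rw [MP_iff] at h; revert x y; decide
theorem decC1 : ∀ x y : ZMod 2, MP 0 0 0 0 0 0 x y → x = 0 := by
  intro x y h; rw [MP_iff] at h; revert x y; decide
theorem decC2 : ∀ x y : ZMod 2, MP 1 0 0 1 0 0 x y → y = 0 := by
  intro x y h; rw [MP_iff] at h; revert x y; decide

theorem caseB {P : Par} {u w b0 b1 : ℚ} {u' w' : Z2} (hu : (u':ℚ) = u) (hw : (w':ℚ) = w)
    (h : (X^2 + C u * X + C w) ∣ curveP P (C b0 + C b1 * X)) (ru : res u' = 1) (rw' : res w' = 0) :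
    False := by
  rcases bcase b0 b1 with ⟨x, y, hx, hy⟩ | ⟨t, x, y, ht, ht0, hx, hy, hr⟩
  · have := (scale_MP (t := 1) hu hw (by simpa using hx) (by simpa using hy) h).map res
    simp only [map_mul, map_pow, map_one, P.hQ0, P.hQ1, P.hQ2, P.hc, ru, rw', one_mul, one_pow] at this
    exact decB2 _ _ this
  · have := (scale_MP (t := t) hu hw hx hy h).map res
    simp only [map_mul, map_pow, ht, ru, rw', zero_mul, ne_eq, OfNat.ofNat_ne_zero,
      not_false_eq_true, zero_pow] at this
    obtain ⟨h1, h2⟩ := decB1 _ _ this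
    rw [h1, h2] at hr
    revert hr; decide

/-- the involution -/
theorem iota_dvd {P : Par} {u w b0 b1 : ℚ}
    (h : (X^2 + C u * X + C w) ∣ curveP P (C b0 + C b1 * X)) :
    (X^2 + C u * X + C w) ∣
      curveP P (C (-b0-P.Q0+P.Q2*w) + C (-b1-P.Q1+P.Q2*u) * X) := by
  have e : (C (-b0-P.Q0+P.Q2*w) + C (-b1-P.Q1+P.Q2*u) * X : ℚ[X]) =
    (-(C b0 + C b1 * X) - (kap P.Q0 + kap P.Q1 * X + kap P.Q2 * X^2)) +
      (X^2 + C u * X + C w) * kap P.Q2 := by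
    simp only [kap_apply, map_add, map_sub, map_mul, map_neg]; ring
  have e2 : curveP P (C (-b0-P.Q0+P.Q2*w) + C (-b1-P.Q1+P.Q2*u) * X) =
     curveP P (C b0 + C b1 * X) + (X^2 + C u * X + C w) * (kap P.Q2 *
      (2 * (-(C b0 + C b1 * X) - (kap P.Q0 + kap P.Q1 * X + kap P.Q2 * X^2)) +
      (X^2 + C u * X + C w) * kap P.Q2 + (kap P.Q0 + kap P.Q1 * X + kap P.Q2 * X^2))) := by
    rw [e]; unfold curveP; ring
  rw [e2]
  exact dvd_add h (dvd_mul_right _ _)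

end FQ

namespace FQ
open Polynomial

theorem dual3 {P : Par} {u w b0 b1 : ℚ} (hw : w ≠ 0)
    (h : (X^2 + C u * X + C w) ∣ curveP P (C b0 + C b1 * X))
    {l α β : Z2} (e0 : (l:ℚ) * (u*w) + α * b0 - β * b1 * w = 0)
    (e1 : (l:ℚ) * (u^2-w) + α * b1 + β * b0 - β * b1 * u = 0) :
    (l:ℚ)*(P.Q1+b1) + (l*P.Q2-P.c*α)*(-u) - P.c*β*(u^2-w) = 0 := by
  have hr3 := red3 e0 e1
  have h1 : (X^2 + C u * X + C w) ∣ X^3 * (kap l * ((kap P.Q0 + kap P.Q1 * X + kap P.Q2 * X^2) +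
      (C b0 + C b1 * X)) - kap P.c * (kap α + kap β * X) * X^2) := by
    have e : X^3 * (kap l * ((kap P.Q0 + kap P.Q1 * X + kap P.Q2 * X^2) +
      (C b0 + C b1 * X)) - kap P.c * (kap α + kap β * X) * X^2) =
      (C (l:ℚ) * X^3 + (C (α:ℚ) + C (β:ℚ) * X) * (C b0 + C b1 * X)) *
        ((kap P.Q0 + kap P.Q1 * X + kap P.Q2 * X^2) + (C b0 + C b1 * X)) -
      (kap α + kap β * X) * curveP P (C b0 + C b1 * X) := by
      unfold curveP; simp only [kap_apply]; ring
    rw [e, hr3]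
    exact dvd_sub ((dvd_mul_right _ _).mul_right _) (h.mul_left _)
  have h2 := ((coprimeX u w hw).pow_right (n := 3)).dvd_of_dvd_mul_left h1
  have e : (kap l * ((kap P.Q0 + kap P.Q1 * X + kap P.Q2 * X^2) +
      (C b0 + C b1 * X)) - kap P.c * (kap α + kap β * X) * X^2) =
      (X^2 + C u * X + C w) * (C ((l*P.Q2-P.c*α) + P.c*β*u : ℚ) - kap P.c * kap β * X) +
      (C ((l:ℚ)*(P.Q1+b1) + (l*P.Q2-P.c*α)*(-u) - P.c*β*(u^2-w)) * X +
       C ((l:ℚ)*(P.Q0+b0) - ((l*P.Q2-P.c*α) + P.c*β*u)*w)) := by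
    simp only [kap_apply, map_add, map_sub, map_mul, map_neg, map_pow]; ring
  rw [e] at h2
  exact (lin_of_quad_dvd ((dvd_add_right (dvd_mul_right _ _)).1 h2)).2

theorem caseC_core {P : Par} (hS : SC P) {b0 b1 : ℚ} {u w : Z2} (hw : w ≠ 0)
    (h : (X^2 + kap u * X + kap w) ∣ curveP P (C b0 + C b1 * X))
    {l α : Z2} (e0 : (l:ℚ) * (u*w) + α * b0 - b1 * w = 0)
    (e1 : (l:ℚ) * (u^2-w) + α * b1 + b0 - b1 * u = 0)
    (hN : (X^2 + kap u * X + kap w) ∣ N3 P l α 1)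
    {t x y : Z2} (hx : (x:ℚ) = t * b0) (hy : (y:ℚ) = t * b1)
    (rt : res t = 0) (ry : res y = 1) (ru : res u = 0) (rw' : res w = 0) (rl : res l = 0)
    (rα : res α = 0) : False := by
  have hwq := Z2.rat_ne hw
  by_cases hl : l = 0
  · subst hl
    exact lam0 (α := α) (β := 1) hwq (by simp) h (by simpa using e0) (by simpa using e1)
  by_cases hα : α = 0
  · subst hα
    have : b1 = l * u := by
      have : (w:ℚ) * (l * u - b1) = 0 := by simp at e0; linear_combination e0
      have := (mul_eq_zero.1 this).resolve_left hwq
      linear_combination -this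
    have hy' : y = t * (l * u) := Z2.ext_rat (by rw [hy, this]; push_cast; ring)
    rw [hy'] at ry
    simp [rt] at ry
  have F0 : t*l*u*w + α*x - y*w = 0 := Z2.ext_rat (by
    push_cast; rw [hx, hy]; linear_combination (t:ℚ) * e0)
  have F1 : t*l*(u^2-w) + α*y + x - y*u = 0 := Z2.ext_rat (by
    push_cast; rw [hx, hy]; linear_combination (t:ℚ) * e1)
  rw [N3_coef] at hN
  obtain ⟨m0, m1, m2, g0, g1, g2, g3, g4⟩ := factor_N (s := 1) (u := u) (w := w) (k0 := w)
    (k1 := u) (k2 := 1) one_ne_zero (by simp) (by simp) (by simp) (by simp) hN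
  have hm2 : m2 = P.c := by linear_combination g4
  subst hm2
  have r1 : res m1 = 0 := by
    have : m1 = (l^2-l*1*P.Q2+2*P.c*α*1) - u*P.c := by linear_combination g3
    rw [this]; simp [rl, ru, rα]
  have r0 : res m0 = 0 := by
    have : m0 = (-l*(α*P.Q2+1*P.Q1)+P.c*α^2) - w * P.c - u * m1 := by linear_combination g2
    rw [this]; simp [rl, ru, rα, rw']
  set o := y - u*t*l - α*(t*l) with ho
  obtain ⟨oi, hoi⟩ := isUnit_of_res o (by rw [ho]; simp [rt, ry])
  obtain ⟨ci, hci⟩ := isUnit_of_res P.c P.hc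
  have G1 : -(t*l*α^3) = (α^2-u*α+w)*o := by
    rw [ho]; linear_combination F0 - α * F1
  have G2 : (α^2-u*α+w)*(P.c*α^2-m1*α+m0) = -(l^2*α^3) := by
    linear_combination g0 - α * g1 + α^2 * g2 - α^3*g3 + α^4*g4
  set Aα := P.c*α^2-m1*α+m0 with hAα
  have G3 : t * Aα = l * o := by
    have : l * α^3 * (t * Aα - l * o) = 0 := by
      linear_combination -Aα * G1 - o * G2
    have h1 : l * α^3 ≠ 0 := mul_ne_zero hl (pow_ne_zero _ hα)
    linear_combination (mul_eq_zero.1 this).resolve_left h1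
  have hA0 : Aα ≠ 0 := by
    intro h0
    rw [h0, mul_zero] at G3
    rcases mul_eq_zero.1 G3.symm with h | h
    · exact hl h
    · rw [h] at hoi; simp at hoi
  set M1 := l * ci with hM1
  set M0 := α * M1 - t*α^3*oi with hM0
  have rM1 : res M1 = 0 := by rw [hM1]; simp [rl]
  have rM0 : res M0 = 0 := by rw [hM0]; simp [rα, rt]
  set c1 := P.c * M0 + m1 * M1 with hc1
  set c0 := m1 * M0 + m0 * M1 - α * c1 with hc0
  have hcc : α * c0 = m0 * M0 := by
    have hM0' : M0 - α*M1 = - (t*α^3*oi) := by rw [hM0]; ring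
    have hcM : P.c * M1 = l := by rw [hM1]; linear_combination l * hci
    have : m0 * M0 - α * c0 = Aα * (M0 - α * M1) + P.c * M1 * α^3 := by
      rw [hc0, hc1, hAα]; ring
    rw [hM0', hcM] at this
    linear_combination -this + oi*α^3*G3 + l*α^3*hoi
  have hcM : P.c * M1 = l := by rw [hM1]; linear_combination l * hci
  clear_value M0 M1 c0 c1 Aα o
  have hdv : (kap P.c * X^2 + kap m1 * X + kap m0) ∣ N3 P l α 1 := by
    refine ⟨X^2 + kap u * X + kap w, ?_⟩
    rw [N3_coef, ← g0, ← g1, ← g2, ← g3, ← g4]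
    simp only [map_add, map_mul, map_one]; ring
  have hmain := Sconc hS (k0 := m0) (k1 := m1) (k2 := P.c) (b0 := c0) (b1 := c1) P.hc r1 r0
    (by rw [hc0, hc1]; simp [rM0, rM1]) (by rw [hc1]; simp [rM0, rM1]) (by
      refine dvd_of_L hdv ?_ ?_
      · refine ⟨kap M1 * X + kap M0, ?_⟩
        have k1 := congrArg kap hcc
        have k2 := congrArg kap hcM
        have k3 := congrArg kap hc0
        have k4 := congrArg kap hc1
        simp only [map_add, map_mul, map_sub, map_one] at k1 k2 k3 k4 ⊢
        linear_combination k1 - X^3 * k2 + X * k3 + X^2 * k4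
      · have hq := Z2.rat_ne hA0
        have hAA : C (Aα:ℚ) * C (Aα:ℚ)⁻¹ = (1 : ℚ[X]) := by
          rw [← C_mul, mul_inv_cancel₀ hq, C_1]
        have k1 := congrArg kap hAα
        refine ⟨C (Aα:ℚ)⁻¹, -C (Aα:ℚ)⁻¹ * (kap P.c * X + (kap m1 - kap α * kap P.c)), ?_⟩
        simp only [map_add, map_mul, map_sub, map_one, map_pow] at k1 ⊢
        rw [kap_apply Aα] at k1
        linear_combination hAA - C (Aα:ℚ)⁻¹ * k1)
  rw [hmain.2, mul_zero] at g0
  have : l * α * P.Q0 = 0 := by linear_combination g0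
  exact mul_ne_zero (mul_ne_zero hl hα) (ne_zero_of_res P.hQ0) this

theorem N3_scale (P : Par) (i l α β : Z2) :
    N3 P (i*l) (i*α) (i*β) = kap i^2 * N3 P l α β := by
  unfold N3; simp only [map_mul]; ring

theorem caseC {P : Par} (hS : SC P) {b0 b1 : ℚ} {u w : Z2} (hw : w ≠ 0)
    (h : (X^2 + kap u * X + kap w) ∣ curveP P (C b0 + C b1 * X))
    (ru : res u = 0) (rw' : res w = 0) : False := by
  have hwq := Z2.rat_ne hw
  rcases bcase b0 b1 with ⟨x, y, hx, hy⟩ | ⟨t, x, y, rt, ht0, hx, hy, hr⟩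
  · have := (scale_MP (t := 1) rfl rfl (by simpa using hx) (by simpa using hy) h).map res
    simp only [P.hQ0, P.hQ1, P.hQ2, P.hc, ru, rw', one_mul, one_pow] at this
    have ry := decC2 _ _ this
    rcases res_cases x with rx | rx
    · rw [← hx, ← hy] at h
      exact hw (hS u w x y ru rw' rx ry (MP_of_curve_dvd h)).2
    · have h2 := iota_dvd h
      rw [← hx, ← hy] at h2
      have h3 : (X^2 + kap u * X + kap w) ∣
        curveP P (kap (-x-P.Q0+P.Q2*w) + kap (-y-P.Q1+P.Q2*u) * X) := by
        simpa [kap_apply] using h2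
      refine hw (hS u w _ _ ru rw' ?_ ?_ (MP_of_curve_dvd h3)).2
      · simp only [map_add, map_sub, map_neg, map_mul, rx, P.hQ0, rw', mul_zero]; decide
      · simp only [map_add, map_sub, map_neg, map_mul, ry, P.hQ1, ru, mul_zero]; decide
  · have := (scale_MP (t := t) rfl rfl hx hy h).map res
    simp only [map_mul, map_pow, rt, ru, rw', zero_mul, ne_eq, OfNat.ofNat_ne_zero,
      not_false_eq_true, zero_pow] at this
    have rx := decC1 _ _ this
    have ry : res y = 1 := by
      rcases hr with h | h
      · rw [rx] at h; exact absurd h (by decide)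
      · exact h
    obtain ⟨l, α, β, hprim, e0, e1, hN⟩ := exists_3R (u := u) (w := w) hwq h
    have F1 : t*l*(u^2-w) + α*y + β*x - β*y*u = 0 := Z2.ext_rat (by
      push_cast; rw [hx, hy]; linear_combination (t:ℚ) * e1)
    have rα : res α = 0 := by
      have := congrArg res F1
      simpa [rt, ry, rx, ru] using this
    have hd := dual3 (u := u) (w := w) hwq h e0 e1
    have F2 : l*(t*P.Q1+y) + t*((l*P.Q2-P.c*α)*(-u) - P.c*β*(u^2-w)) = 0 := Z2.ext_rat (by
      push_cast; rw [hy]; linear_combination (t:ℚ) * hd)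
    have rl : res l = 0 := by
      have := congrArg res F2
      simpa [rt, ry] using this
    have rβ : res β = 1 := by
      rw [rl, rα] at hprim
      simpa using hprim
    obtain ⟨i, hi⟩ := isUnit_of_res β rβ
    have hiq : (i:ℚ) * β = 1 := by
      have := congrArg (fun z : Z2 => (z:ℚ)) hi
      push_cast at this
      linear_combination this
    refine caseC_core hS hw h (l := i*l) (α := i*α) ?_ ?_ ?_ hx hy rt ry ru rw' (by simp [rl])
      (by simp [rα])
    · push_cast; linear_combination (i:ℚ) * e0 + b1 * w * hiq
    · push_cast; linear_combination (i:ℚ) * e1 + (-b0 + b1 * u) * hiq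
    · have : N3 P (i*l) (i*α) 1 = kap i^2 * N3 P l α β := by
        rw [← N3_scale]; congr 1; linear_combination -hi
      rw [this]
      exact hN.mul_left _

end FQ

namespace FQ
open Polynomial

theorem caseD_step {P : Par} (hS : SC P) {s u w b0 b1 : ℚ} {k0 k1 k2 : Z2} (hs : s ≠ 0)
    (hk2 : (k2:ℚ) = s) (hk1 : (k1:ℚ) = s * u) (hk0 : (k0:ℚ) = s * w) (hw : w ≠ 0)
    (r0 : res k0 = 0) (r1 : res k1 = 1) (r2 : res k2 = 0)
    (h : (X^2 + C u * X + C w) ∣ curveP P (C b0 + C b1 * X)) :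
    ∃ l0 l1 υ : Z2, res l0 = 1 ∧ res υ = 1 ∧
      -w*(l0:ℚ) + u*w*l1 + (k0^2*υ : Z2)*b0 = 0 ∧ -u*(l0:ℚ) + (u^2-w)*l1 + (k0^2*υ : Z2)*b1 = 0 := by
  obtain ⟨l0, l1, m, hprim, e0, e1, hN⟩ := exists_2R hw h
  rw [N2_coef] at hN
  obtain ⟨m0, m1, m2, g0, g1, g2, g3, g4⟩ := factor_N hs hk2 hk1 hk0 (Or.inr (Or.inl r1)) hN
  have f0 := congrArg res g0
  have f1 := congrArg res g1
  have f2 := congrArg res g2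
  have f3 := congrArg res g3
  have f4 := congrArg res g4
  simp only [map_mul, map_add, map_sub, map_neg, map_pow, r0, r1, r2, P.hQ0, P.hQ1, P.hQ2, P.hc,
    res_two, zero_mul, mul_zero, zero_add, add_zero, one_mul, mul_one, sub_zero] at f0 f1 f2 f3 f4
  have hneg : ∀ x : ZMod 2, -x = x := by decide
  have hsq : ∀ x : ZMod 2, x^2 = x := by decide
  simp only [hneg, hsq] at f0 f1 f2 f3 f4
  rcases decD _ _ _ _ _ _ hprim f0 f1 f2 f3 f4 with ⟨rm, rl0, rl1, rm0, rm1, rm2⟩ | ⟨rm, rl0, rl1, rm1⟩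
  · exfalso
    obtain ⟨i, hi⟩ := isUnit_of_res m rm
    obtain ⟨j, hj⟩ := isUnit_of_res m2 rm2
    have hiK := kap_unit hi
    have hjK := kap_unit hj
    set u' := j*m1 with hu'
    set w' := j*m0 with hw'
    have hm1 : m1 = m2 * u' := by rw [hu']; linear_combination -m1 * hj
    have hm0' : m0 = m2 * w' := by rw [hw']; linear_combination -m0 * hj
    clear_value u' w'
    set c0 := -i*(-w'*l0+u'*w'*l1) with hc0
    set c1 := -i*(-u'*l0+(u'^2-w')*l1) with hc1
    have hdv : (kap m2 * X^2 + kap m1 * X + kap m0) ∣ N2 P l0 l1 m := by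
      refine ⟨kap k2 * X^2 + kap k1 * X + kap k0, ?_⟩
      rw [N2_coef, ← g0, ← g1, ← g2, ← g3, ← g4]
      simp only [map_add, map_mul]; ring
    have hmain := Sconc hS (k0 := m0) (k1 := m1) (k2 := m2) (b0 := c0) (b1 := c1) rm2 rm1 rm0
      (by rw [hc0]; simp [rl0, rl1]) (by rw [hc1]; simp [rl0, rl1]) (by
        have hd2 : (kap m2 * X^2 + kap m1 * X + kap m0) ∣
            (X^2 * (kap l0 + kap l1 * X) + kap m * (kap c0 + kap c1 * X)) := by
          refine ⟨kap j * (kap l1 * X + kap (l0 - l1 * u')), ?_⟩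
          have hA : m * c0 = -(-w'*l0+u'*w'*l1) := by
            rw [hc0]; linear_combination -(-w'*l0+u'*w'*l1) * hi
          have hB : m * c1 = -(-u'*l0+(u'^2-w')*l1) := by
            rw [hc1]; linear_combination -(-u'*l0+(u'^2-w')*l1) * hi
          have kA := congrArg kap hA
          have kB := congrArg kap hB
          rw [hm1, hm0']
          simp only [map_add, map_mul, map_sub, map_neg, map_pow] at kA kB ⊢
          linear_combination kA + X * kB - (X^2 + kap u' * X + kap w') *
            (kap l1 * X + (kap l0 - kap l1 * kap u')) * hjK
        have hd3 : (kap m2 * X^2 + kap m1 * X + kap m0) ∣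
            kap m^2 * curveP P (kap c0 + kap c1 * X) := by
          have := N2_id P l0 l1 m (kap c0 + kap c1 * X)
          have h4 : kap m^2 * curveP P (kap c0 + kap c1 * X) = X^2 * N2 P l0 l1 m -
            (X^2 * (kap l0 + kap l1 * X) + kap m * (kap c0 + kap c1 * X)) *
            (X^2 * (kap l0 + kap l1 * X) - kap m * (kap c0 + kap c1 * X) -
            kap m * (kap P.Q0 + kap P.Q1 * X + kap P.Q2 * X^2)) := by linear_combination -this
          rw [h4]
          exact dvd_sub (hdv.mul_left _) (hd2.mul_right _)
        have h5 : curveP P (kap c0 + kap c1 * X) =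
          kap i^2 * (kap m^2 * curveP P (kap c0 + kap c1 * X)) := by
          linear_combination -(kap m * kap i + 1) * curveP P (kap c0 + kap c1 * X) * hiK
        rw [h5]
        exact hd3.mul_left _)
    obtain ⟨z1, z0⟩ := hmain
    have hm : m ≠ 0 := ne_zero_of_res rm
    have hQ : P.Q0 ≠ 0 := ne_zero_of_res P.hQ0
    have hl0 : l0 = 0 := by
      rw [z0, mul_zero] at g0
      have : m * P.Q0 * l0 = 0 := by linear_combination g0
      exact (mul_eq_zero.1 this).resolve_left (mul_ne_zero hm hQ)
    have hl1 : l1 = 0 := by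
      rw [z0, z1, mul_zero, mul_zero, hl0] at g1
      have : m * P.Q0 * l1 = 0 := by linear_combination g1
      exact (mul_eq_zero.1 this).resolve_left (mul_ne_zero hm hQ)
    rw [hl0, hl1] at e0 e1
    have hmq := Z2.rat_ne hm
    simp [hmq] at e0 e1
    rw [e0, e1] at h
    exact no_zero hw (by simpa using h)
  · obtain ⟨g, hg⟩ := isUnit_of_res (P.Q0*l0) (by simp [P.hQ0, rl0])
    obtain ⟨d, hd⟩ := isUnit_of_res (k0*g*(P.Q0*l1+P.Q1*l0)-k1) (by
      simp only [map_mul, map_sub, r0, r1]; simp)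
    have rg : res g = 1 := by
      have := congrArg res hg; simpa [P.hQ0, rl0] using this
    have rd : res d = 1 := by
      have := congrArg res hd
      simp only [map_mul, map_sub, r0, r1, map_one, map_add] at this
      rcases res_cases d with h | h
      · rw [h] at this; simp at this
      · exact h
    have hm : m = k0^2 * (-m1*d*g) := by
      have h1 : m = -k0*m0*g := by linear_combination g * g0 - m * hg
      have h2 : k0*m1 = m0 * (k0*g*(P.Q0*l1+P.Q1*l0)-k1) := by
        linear_combination g1 - (P.Q0*l1+P.Q1*l0) * h1
      have h3 : m0 = k0*m1*d := by linear_combination -m0*hd - d * h2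
      linear_combination h1 - k0 * g * h3
    refine ⟨l0, l1, -m1*d*g, rl0, ?_, ?_, ?_⟩
    · simp only [map_mul, map_neg, rm1, rd, rg]; decide
    · rw [← hm]; exact e0
    · rw [← hm]; exact e1

theorem caseD {P : Par} (hS : SC P) {s u w b0 b1 : ℚ} {k0 k1 k2 : Z2} (hs : s ≠ 0)
    (hk2 : (k2:ℚ) = s) (hk1 : (k1:ℚ) = s * u) (hk0 : (k0:ℚ) = s * w) (hw : w ≠ 0)
    (r0 : res k0 = 0) (r1 : res k1 = 1) (r2 : res k2 = 0)
    (h : (X^2 + C u * X + C w) ∣ curveP P (C b0 + C b1 * X)) : False := by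
  obtain ⟨l0, l1, v, rl, rv, e0, e1⟩ := caseD_step hS hs hk2 hk1 hk0 hw r0 r1 r2 h
  obtain ⟨l0', l1', v', rl', rv', e0', e1'⟩ :=
    caseD_step hS hs hk2 hk1 hk0 hw r0 r1 r2 (iota_dvd h)
  have hp : v'*l0+v*l0' = k1*(k1*(v*v')*P.Q0-k0*(v*v')*P.Q1) - k0*k2*(v*v')*P.Q0 +
      k0^2*(v*v')*P.Q2 := by
    apply Z2.ext_rat
    push_cast at *
    have E0 : w * (-(v'*l0+v*l0') + u*(v'*l1+v*l1') + k0*s*(v*v')*(-P.Q0)+k0^2*(v*v')*P.Q2) = 0 := by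
      have hk : (k0:ℚ)^2 = w * (k0*s) := by rw [hk0]; ring
      linear_combination (v':ℚ) * e0 + v * e0' + v*v'*P.Q0 * hk
    have E0' := (mul_eq_zero.1 E0).resolve_left hw
    have E1 : w * (s * (k1*(v*v')*P.Q0 - k0*(v*v')*P.Q1) - (v'*l1+v*l1')) = 0 := by
      rw [hk0] at e1 e1' E0' ⊢
      rw [hk1]
      linear_combination (v':ℚ) * e1 + v * e1' - u * E0'
    have E1' := (mul_eq_zero.1 E1).resolve_left hw
    rw [hk2]
    linear_combination -E0' - u * E1' - (k1*(v*v')*P.Q0-k0*(v*v')*P.Q1) * hk1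
  have := congrArg res hp
  simp only [map_add, map_sub, map_mul, map_pow, rl, rv, rl', rv', r0, r1, P.hQ0] at this
  revert this
  simp

/-- no Mumford pair with `w ≠ 0`. -/
theorem J2p {P : Par} (hS : SC P) {u w b0 b1 : ℚ} (hw : w ≠ 0)
    (h : (X^2 + C u * X + C w) ∣ curveP P (C b0 + C b1 * X)) : False := by
  obtain ⟨s, hs, k0, k1, k2, hk0, hk1, hk2, hr⟩ := prim3 w u 1 (by simp)
  rw [mul_one] at hk2
  have key : res k2 = 1 → ∃ u' w' : Z2, (u':ℚ) = u ∧ (w':ℚ) = w ∧ k1 = k2 * u' ∧ k0 = k2 * w' := by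
    intro r2
    obtain ⟨i, hi⟩ := isUnit_of_res k2 r2
    have hiq := congrArg (fun z : Z2 => (z:ℚ)) hi
    push_cast at hiq
    rw [hk2] at hiq
    refine ⟨i*k1, i*k0, ?_, ?_, by linear_combination -k1*hi, by linear_combination -k0*hi⟩
    · push_cast; rw [hk1]; linear_combination u * hiq
    · push_cast; rw [hk0]; linear_combination w * hiq
  rcases res_cases k0 with r0 | r0
  · rcases res_cases k1 with r1 | r1
    · have r2 : res k2 = 1 := by simpa [r0, r1] using hr
      obtain ⟨u', w', hu, hw', f1, f0⟩ := key r2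
      have ru : res u' = 0 := by
        have := congrArg res f1; rw [map_mul, r1, r2, one_mul] at this; exact this.symm
      have rw' : res w' = 0 := by
        have := congrArg res f0; rw [map_mul, r0, r2, one_mul] at this; exact this.symm
      subst hu hw'
      exact caseC hS (fun h => hw (by rw [h]; simp)) h ru rw'
    · rcases res_cases k2 with r2 | r2
      · exact caseD hS hs hk2 hk1 hk0 hw r0 r1 r2 h
      · obtain ⟨u', w', hu, hw', f1, f0⟩ := key r2
        have ru : res u' = 1 := by
          have := congrArg res f1; rw [map_mul, r1, r2, one_mul] at this; exact this.symm
        have rw' : res w' = 0 := by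
          have := congrArg res f0; rw [map_mul, r0, r2, one_mul] at this; exact this.symm
        exact caseB hu hw' h ru rw'
  · obtain ⟨l, α, β, hprim, e0, e1, hN⟩ := exists_3R hw h
    have hN' := hN
    rw [N3_coef] at hN'
    obtain ⟨m0, m1, m2, g0, g1, g2, g3, g4⟩ := factor_N hs hk2 hk1 hk0 hr hN'
    have f0 := congrArg res g0
    have f1 := congrArg res g1
    have f2 := congrArg res g2
    have f3 := congrArg res g3
    have f4 := congrArg res g4
    simp only [map_mul, map_add, map_sub, map_neg, map_pow, P.hQ0, P.hQ1, P.hQ2, P.hc,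
      res_two, zero_mul, mul_zero, zero_add, add_zero, one_mul, mul_one, sub_zero] at f0 f1 f2 f3 f4
    have hneg : ∀ x : ZMod 2, -x = x := by decide
    have hsq : ∀ x : ZMod 2, x^2 = x := by decide
    simp only [hneg, hsq] at f0 f1 f2 f3 f4
    obtain ⟨q1, q2, q3, q4, q5, q6⟩ := decA _ _ _ _ _ _ _ _ _ hprim r0 f0 f1 f2 f3 f4
    refine caseA hS hw h e0 e1 (m0 := m0) (m1 := m1) (m2 := m2) ?_ ?_ q2 q3 q4 q5 q6
    · refine ⟨kap k2 * X^2 + kap k1 * X + kap k0, ?_⟩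
      rw [N3_coef, ← g0, ← g1, ← g2, ← g3, ← g4]
      simp only [map_add, map_mul]; ring
    · intro hm0
      rw [hm0, mul_zero] at g0
      linear_combination g0

/-- rational points have `T = 0` -/
theorem J1 {P : Par} (hS : SC P)
    (hroot : ∀ x : ℚ, (P.Q0 + P.Q1*x + P.Q2*x^2)^2 - 4*P.c*x^5 ≠ 0) {x e : ℚ} (hx : x ≠ 0)
    (h : e^2 + (P.Q0 + P.Q1*x + P.Q2*x^2)*e + P.c*x^5 = 0) : False := by
  have hD0 : 2*e + (P.Q0 + P.Q1*x + P.Q2*x^2) ≠ 0 := by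
    intro h0
    apply hroot x
    linear_combination (2*e + (P.Q0 + P.Q1*x + P.Q2*x^2)) * h0 - 4 * h
  set D := 2*e + (P.Q0 + P.Q1*x + P.Q2*x^2) with hD
  set e' := -((P.Q1+2*P.Q2*x)*e+5*P.c*x^4)/D with he'
  have ht : e' * D + (P.Q1+2*P.Q2*x)*e+5*P.c*x^4 = 0 := by rw [he']; field_simp; ring
  rw [hD] at ht
  clear_value e'
  refine J2p hS (u := -2*x) (w := x^2) (b0 := e - e'*x) (b1 := e') (by positivity) ?_
  have k1 := congrArg (C : ℚ → ℚ[X]) h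
  have k2 := congrArg (C : ℚ → ℚ[X]) ht
  refine ⟨C e'^2 + (C (P.Q1:ℚ)+2*C (P.Q2:ℚ)*C x)*C e' + C (P.Q2:ℚ)*C e + C (P.Q2:ℚ)*C e'*(X-C x) +
    C (P.c:ℚ)*(10*C x^3+10*C x^2*(X-C x)+5*C x*(X-C x)^2+(X-C x)^3), ?_⟩
  unfold curveP
  simp only [kap_apply, map_add, map_mul, map_sub, map_neg, map_pow, map_ofNat, map_zero] at k1 k2 ⊢
  linear_combination k1 + (X - C x) * k2

/-- quadratic version -/
theorem J2 {P : Par} (hS : SC P)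
    (hroot : ∀ x : ℚ, (P.Q0 + P.Q1*x + P.Q2*x^2)^2 - 4*P.c*x^5 ≠ 0) {u w b0 b1 : ℚ}
    (h : (X^2 + C u * X + C w) ∣ curveP P (C b0 + C b1 * X)) : u = 0 ∧ w = 0 := by
  have hw : w = 0 := by
    by_contra hw
    exact J2p hS hw h
  refine ⟨?_, hw⟩
  by_contra hu
  obtain ⟨q, hq⟩ := h
  have := congrArg (eval (-u)) hq
  simp only [curveP, kap_apply, eval_add, eval_mul, eval_pow, eval_C, eval_X, hw] at this
  exact J1 hS hroot (x := -u) (e := b0 + b1 * (-u)) (by simpa using hu) (by linear_combination this)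

end FQ

namespace FQ
open Polynomial

/-- A rational fifth root hypothesis: `c` is not a fifth power of a rational. -/
lemma minpoly_fifth {L : Type*} [Field L] [NumberField L] (hL : Module.finrank ℚ L = 5)
    {t : L} {c : ℚ} (ht : t ^ 5 = algebraMap ℚ L c) (hc : ∀ x : ℚ, x ^ 5 ≠ c) :
    minpoly ℚ t = X ^ 5 - C c := by
  have hint : IsIntegral ℚ t := Algebra.IsIntegral.isIntegral t
  have hd : (minpoly ℚ t).natDegree ∣ 5 := by
    have := minpoly.degree_dvd hint
    rwa [hL] at this
  have hdvd : minpoly ℚ t ∣ X ^ 5 - C c := by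
    apply minpoly.dvd
    simp [ht]
  have h1 : (minpoly ℚ t).natDegree ≠ 1 := by
    intro h
    rw [minpoly.natDegree_eq_one_iff] at h
    obtain ⟨x, hx⟩ := h
    apply hc x
    apply (algebraMap ℚ L).injective
    rw [map_pow, ← ht, ← hx]
  have h5 : (minpoly ℚ t).natDegree = 5 := by
    rcases (Nat.dvd_prime (by norm_num : Nat.Prime 5)).1 hd with h | h
    · exact absurd h h1
    · exact h
  have hm : (X ^ 5 - C c : ℚ[X]).Monic := monic_X_pow_sub_C c (by norm_num)
  refine eq_of_dvd_of_natDegree_le_of_leadingCoeff hdvd ?_ ?_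
  · rw [natDegree_X_pow_sub_C, h5]
  · rw [hm.leadingCoeff, (minpoly.monic hint).leadingCoeff]

lemma prod_fifth {L : Type*} [Field L] [NumberField L] (hL : Module.finrank ℚ L = 5)
    {t : L} {c : ℚ} (ht : t ^ 5 = algebraMap ℚ L c) (hc : ∀ x : ℚ, x ^ 5 ≠ c) (z : ℂ) :
    ∏ σ : L →ₐ[ℚ] ℂ, (σ t - z) = (c : ℂ) - z ^ 5 := by
  have hmin := minpoly_fifth hL ht hc
  have hprim : IntermediateField.adjoin ℚ {t} = ⊤ := by
    rw [Field.primitive_element_iff_minpoly_natDegree_eq, hmin, natDegree_X_pow_sub_C, hL]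
  have hinj := (Field.primitive_element_iff_algHom_eq_of_eval' ℚ ℂ
    (fun x => IsAlgClosed.splits _) t).1 hprim
  have hcard : Fintype.card (L →ₐ[ℚ] ℂ) = 5 := by
    rw [AlgHom.card, hL]
  have hdvd : ∏ σ : L →ₐ[ℚ] ℂ, (X - C (σ t)) ∣ (X ^ 5 - C (c : ℂ)) := by
    apply Finset.prod_dvd_of_coprime
    · intro i _ j _ hij
      exact pairwise_coprime_X_sub_C hinj hij
    · intro σ _
      rw [dvd_iff_isRoot]
      simp [← map_pow, ht]
  have heq : ∏ σ : L →ₐ[ℚ] ℂ, (X - C (σ t)) = (X ^ 5 - C (c : ℂ)) := by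
    refine eq_of_dvd_of_natDegree_le_of_leadingCoeff hdvd ?_ ?_
    · rw [natDegree_X_pow_sub_C, natDegree_prod_of_monic _ _ (fun σ _ => monic_X_sub_C _)]
      simp [hcard]
    · rw [(monic_X_pow_sub_C (c : ℂ) (by norm_num)).leadingCoeff,
        (monic_prod_of_monic _ _ (fun σ _ => monic_X_sub_C _)).leadingCoeff]
  have := congrArg (eval z) heq
  rw [eval_prod] at this
  simp only [eval_sub, eval_X, eval_C, eval_pow] at this
  have h2 : ∏ σ : L →ₐ[ℚ] ℂ, (σ t - z) = ∏ σ : L →ₐ[ℚ] ℂ, (-1) * (z - σ t) := by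
    apply Finset.prod_congr rfl
    intros; ring
  rw [h2, Finset.prod_mul_distrib, this]
  simp [hcard]
  ring

lemma norm_quad {L : Type*} [Field L] [NumberField L] (hL : Module.finrank ℚ L = 5)
    {t : L} {c : ℚ} (ht : t ^ 5 = algebraMap ℚ L c) (hc : ∀ x : ℚ, x ^ 5 ≠ c) (u w : ℚ) :
    Algebra.norm ℚ (t ^ 2 + algebraMap ℚ L u * t + algebraMap ℚ L w) =
      w ^ 5 + c * (u ^ 5 - 5 * u ^ 3 * w + 5 * u * w ^ 2) + c ^ 2 := by
  obtain ⟨s, hs⟩ : ∃ s : ℂ, s ^ 2 = (u : ℂ) ^ 2 - 4 * w := IsAlgClosed.exists_pow_nat_eq _ (by norm_num)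
  obtain ⟨r1, r2, h1, h2⟩ : ∃ r1 r2 : ℂ, r1 + r2 = -u ∧ r1 * r2 = w := by
    refine ⟨(-u + s) / 2, (-u - s) / 2, by ring, ?_⟩
    linear_combination (-1 / 4) * hs
  have hinj : Function.Injective (algebraMap ℚ ℂ) := (algebraMap ℚ ℂ).injective
  apply hinj
  rw [Algebra.norm_eq_prod_embeddings ℚ ℂ]
  have : ∀ σ : L →ₐ[ℚ] ℂ, σ (t ^ 2 + algebraMap ℚ L u * t + algebraMap ℚ L w) =
      (σ t - r1) * (σ t - r2) := by
    intro σ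
    simp only [map_add, map_mul, map_pow, eq_ratCast, map_ratCast]
    linear_combination (σ t) * h1 - h2
  rw [Finset.prod_congr rfl (fun σ _ => this σ), Finset.prod_mul_distrib,
    prod_fifth hL ht hc, prod_fifth hL ht hc]
  simp only [eq_ratCast]
  push_cast
  rw [← h2]
  have hu : (u : ℂ) = -(r1 + r2) := by rw [h1]; ring
  rw [hu]
  ring

/-- The field `L = ℚ(2^{1/5})`. -/
structure LD (L : Type*) [Field L] [NumberField L] (π : L) : Prop where
  fin : Module.finrank ℚ L = 5
  pow : π ^ 5 = 2

lemma not_fifth {x c : ℚ} (hx : x ^ 5 = c) (h : ¬ (5 : ℤ) ∣ padicValRat 2 c) : False := by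
  by_cases h0 : x = 0
  · subst h0; simp at hx; subst hx; simp at h
  · have : Fact (Nat.Prime 2) := ⟨by norm_num⟩
    have := padicValRat.pow (p := 2) x (k := 5)
    rw [hx] at this
    exact h ⟨_, this⟩

lemma nf2 (x : ℚ) : x ^ 5 ≠ 2 := fun h => not_fifth h (by
  have := padicValRat.self (p := 2) (by norm_num)
  norm_num at this
  rw [this]; norm_num)
lemma nf4 (x : ℚ) : x ^ 5 ≠ 4 := fun h => not_fifth h (by
  have : Fact (Nat.Prime 2) := ⟨by norm_num⟩
  have := padicValRat.pow (p := 2) 2 (k := 2)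
  have h2 := padicValRat.self (p := 2) (by norm_num)
  norm_num at this h2
  rw [this, h2]; norm_num)
lemma nf8 (x : ℚ) : x ^ 5 ≠ 8 := fun h => not_fifth h (by
  have : Fact (Nat.Prime 2) := ⟨by norm_num⟩
  have := padicValRat.pow (p := 2) 2 (k := 3)
  have h2 := padicValRat.self (p := 2) (by norm_num)
  norm_num at this h2
  rw [this, h2]; norm_num)
lemma nfq (x : ℚ) : x ^ 5 ≠ 1 / 4 := by
  intro h
  apply nf4 (1 / x)
  rw [div_pow, h]; norm_num

section
variable {L : Type*} [Field L] [NumberField L] {π : L} (D : LD L π)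
include D
lemma LD.ne_zero : π ≠ 0 := by
  intro h
  have := D.pow
  rw [h] at this
  norm_num at this
lemma LD.norm1 (u w : ℚ) : Algebra.norm ℚ (π ^ 2 + algebraMap ℚ L u * π + algebraMap ℚ L w) =
      w ^ 5 + 2 * (u ^ 5 - 5 * u ^ 3 * w + 5 * u * w ^ 2) + 4 := by
  rw [norm_quad D.fin (c := 2) (by simp [D.pow]) nf2]; norm_num
lemma LD.norm2 (u w : ℚ) : Algebra.norm ℚ (π ^ 4 + algebraMap ℚ L u * π ^ 2 + algebraMap ℚ L w) =
      w ^ 5 + 4 * (u ^ 5 - 5 * u ^ 3 * w + 5 * u * w ^ 2) + 16 := by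
  have := norm_quad D.fin (t := π ^ 2) (c := 4) (by
    rw [← pow_mul, mul_comm, pow_mul, D.pow]; norm_num) nf4 u w
  rw [← pow_mul] at this
  rw [this]; norm_num
lemma LD.norm3 (u w : ℚ) : Algebra.norm ℚ (π ^ 6 + algebraMap ℚ L u * π ^ 3 + algebraMap ℚ L w) =
      w ^ 5 + 8 * (u ^ 5 - 5 * u ^ 3 * w + 5 * u * w ^ 2) + 64 := by
  have := norm_quad D.fin (t := π ^ 3) (c := 8) (by
    rw [← pow_mul, mul_comm, pow_mul, D.pow]; norm_num) nf8 u w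
  rw [← pow_mul] at this
  rw [this]; norm_num
lemma LD.normm2 (u w : ℚ) :
    Algebra.norm ℚ ((π⁻¹ ^ 2) ^ 2 + algebraMap ℚ L u * π⁻¹ ^ 2 + algebraMap ℚ L w) =
      w ^ 5 + 1 / 4 * (u ^ 5 - 5 * u ^ 3 * w + 5 * u * w ^ 2) + 1 / 16 := by
  have := norm_quad D.fin (t := π⁻¹ ^ 2) (c := 1 / 4) (by
    rw [← pow_mul, mul_comm, pow_mul, inv_pow, D.pow]; norm_num) nfq u w
  rw [this]; norm_num
/-- odd degree: norm of `-1`. -/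
lemma LD.norm_neg (x : L) : Algebra.norm ℚ (-x) = - Algebra.norm ℚ x := by
  have : -x = algebraMap ℚ L (-1) * x := by simp
  rw [this, map_mul, Algebra.norm_algebraMap, D.fin]
  norm_num

open NumberField in
lemma LD.isInt : IsIntegral ℤ π := by
  refine ⟨X ^ 5 - C 2, monic_X_pow_sub_C _ (by norm_num), by simp [D.pow]⟩
end

open NumberField in
/-- `π` as an algebraic integer -/
noncomputable def LD.p {L : Type*} [Field L] [NumberField L] {π : L} (D : LD L π) : 𝓞 L :=
  ⟨π, D.isInt⟩

section
open NumberField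
variable {L : Type*} [Field L] [NumberField L] {π : L} (D : LD L π)
lemma LD.coe_p : algebraMap (𝓞 L) L D.p = π := rfl
lemma LD.p_pow : D.p ^ 5 = 2 := by
  apply RingOfIntegers.ext
  change algebraMap (𝓞 L) L _ = algebraMap (𝓞 L) L _
  rw [map_pow, D.coe_p, D.pow, map_ofNat]
lemma absNorm_of_sq {x : 𝓞 L} {n : ℕ} (h : Algebra.norm ℚ (algebraMap (𝓞 L) L x ^ 2) = (n : ℚ) ^ 2) :
    Ideal.absNorm (Ideal.span {x}) = n := by
  rw [Ideal.absNorm_span_singleton]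
  have h1 : ((Algebra.norm ℤ x : ℤ) : ℚ) = Algebra.norm ℚ (algebraMap (𝓞 L) L x) := Algebra.coe_norm_int x
  rw [map_pow, ← h1] at h
  have h2 : (Algebra.norm ℤ x) ^ 2 = (n : ℤ) ^ 2 := by exact_mod_cast h
  have := Int.natAbs_eq_iff_sq_eq.2 h2
  simpa using this
lemma LD.abs2 : Ideal.absNorm (Ideal.span {D.p}) = 2 := by
  apply absNorm_of_sq
  rw [D.coe_p]
  have := D.norm1 0 0
  simp at this; simp [this]; norm_num
lemma LD.abs3 : Ideal.absNorm (Ideal.span {D.p + 1}) = 3 := by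
  apply absNorm_of_sq
  have := D.norm1 2 1
  rw [map_add, D.coe_p, map_one, show (π + 1) ^ 2 = π ^ 2 + algebraMap ℚ L 2 * π + algebraMap ℚ L 1 by simp; ring, this]
  norm_num
lemma LD.abs5 : Ideal.absNorm (Ideal.span {D.p ^ 2 + 1}) = 5 := by
  apply absNorm_of_sq
  have := D.norm2 2 1
  simp only [map_add, map_sub, map_pow (algebraMap (𝓞 L) L), D.coe_p, map_one]
  rw [show (π ^ 2 + 1) ^ 2 = π ^ 4 + algebraMap ℚ L 2 * π ^ 2 + algebraMap ℚ L 1 by simp; ring, this]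
  norm_num
lemma LD.abs7 : Ideal.absNorm (Ideal.span {D.p ^ 3 - 1}) = 7 := by
  apply absNorm_of_sq
  have := D.norm3 (-2) 1
  simp only [map_add, map_sub, map_pow (algebraMap (𝓞 L) L), D.coe_p, map_one]
  rw [show (π ^ 3 - 1) ^ 2 = π ^ 6 + algebraMap ℚ L (-2) * π ^ 3 + algebraMap ℚ L 1 by simp; ring, this]
  norm_num
lemma LD.abs13 : Ideal.absNorm (Ideal.span {D.p ^ 4 - D.p ^ 2 + 1}) = 13 := by
  apply absNorm_of_sq
  have := D.norm2 (-1) 1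
  simp only [map_add, map_sub, map_pow (algebraMap (𝓞 L) L), D.coe_p, map_one]
  rw [show π ^ 4 - π ^ 2 + 1 = π ^ 4 + algebraMap ℚ L (-1) * π ^ 2 + algebraMap ℚ L 1 by simp; ring, map_pow, this]
  norm_num
end
end FQ

namespace FQ
open Polynomial NumberField

section
variable {L : Type*} [Field L] [NumberField L] {π : L} (D : LD L π)
include D
lemma LD.minpoly_eq : minpoly ℚ π = X ^ 5 - C 2 :=
  minpoly_fifth D.fin (c := 2) (by simp [D.pow]) nf2

lemma LD.minpoly_int : minpoly ℤ D.p = X ^ 5 - C 2 := by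
  have h := minpoly.isIntegrallyClosed_eq_field_fractions ℚ L (RingOfIntegers.isIntegral D.p)
  rw [D.coe_p, D.minpoly_eq] at h
  apply Polynomial.map_injective (algebraMap ℤ ℚ) (RingHom.injective_int _)
  rw [← h]; simp; rfl

lemma LD.adjoin_top : IntermediateField.adjoin ℚ {π} = ⊤ := by
  rw [Field.primitive_element_iff_minpoly_natDegree_eq, D.minpoly_eq, natDegree_X_pow_sub_C, D.fin]

lemma LD.embed_ext (φ ψ : L →+* ℂ) (h : φ π = ψ π) : φ = ψ := by
  have hinj := (Field.primitive_element_iff_algHom_eq_of_eval' ℚ ℂ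
    (fun x => IsAlgClosed.splits _) π).1 D.adjoin_top
  have : φ.toRatAlgHom = ψ.toRatAlgHom := hinj h
  ext x
  exact DFunLike.congr_fun this x

lemma LD.discr_le : |discr L| ≤ 50000 := by
  have hadj : Algebra.adjoin ℚ {algebraMap (𝓞 L) L D.p} = ⊤ := by
    rw [D.coe_p, ← IntermediateField.adjoin_simple_toSubalgebra_of_isAlgebraic
      (Algebra.IsAlgebraic.isAlgebraic _), D.adjoin_top]
    rfl
  have h1 := aeval_derivative_mem_differentIdeal ℤ ℚ L D.p hadj
  have h2 : Ideal.absNorm (differentIdeal ℤ (𝓞 L)) ∣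
      Ideal.absNorm (Ideal.span {aeval D.p (derivative (minpoly ℤ D.p))}) :=
    Ideal.absNorm_dvd_absNorm_of_le ((Ideal.span_singleton_le_iff_mem _).2 h1)
  rw [absNorm_differentIdeal (K := L), Ideal.absNorm_span_singleton, D.minpoly_int] at h2
  have h3 : aeval D.p (derivative (X ^ 5 - C 2 : ℤ[X])) = (5 : ℤ) • D.p ^ 4 := by
    simp
    left
    exact map_ofNat (aeval D.p) 5
  have h5 : Module.finrank ℤ (𝓞 L) = 5 := by rw [RingOfIntegers.rank, D.fin]
  have h4 : (Algebra.norm ℤ ((5 : ℤ) • D.p ^ 4)).natAbs = 50000 := by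
    have h2 := D.abs2
    rw [Ideal.absNorm_span_singleton] at h2
    rw [zsmul_eq_mul, map_mul, map_pow, Int.natAbs_mul, Int.natAbs_pow, h2]
    rw [show ((5 : ℤ) : 𝓞 L) = algebraMap ℤ (𝓞 L) 5 by simp, Algebra.norm_algebraMap_of_basis (RingOfIntegers.basis L)]
    rw [← Module.finrank_eq_card_basis (RingOfIntegers.basis L), h5]
    norm_num
  rw [h3, h4] at h2
  have h6 := Nat.le_of_dvd (by norm_num) h2
  rw [Int.abs_eq_natAbs]
  exact_mod_cast h6

lemma LD.real_le : InfinitePlace.nrRealPlaces L ≤ 1 := by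
  classical
  rw [← InfinitePlace.card_real_embeddings, Fintype.card_le_one_iff]
  rintro ⟨φ, hφ⟩ ⟨ψ, hψ⟩
  apply Subtype.ext
  apply D.embed_ext
  have e1 : ∀ φ : L →+* ℂ, (hφ : ComplexEmbedding.IsReal φ) → ((hφ.embedding π : ℝ)) ^ 5 = 2 := by
    intro φ hφ
    rw [← map_pow, D.pow, map_ofNat]
  have h1 := e1 φ hφ
  have h2 := e1 ψ hψ
  have : hφ.embedding π = hψ.embedding π :=
    (Odd.strictMono_pow (by decide : Odd 5)).injective (h1.trans h2.symm)
  change φ π = ψ π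
  rw [← ComplexEmbedding.IsReal.coe_embedding_apply hφ π, ← ComplexEmbedding.IsReal.coe_embedding_apply hψ π, this]

lemma LD.sig : InfinitePlace.nrRealPlaces L = 1 ∧ InfinitePlace.nrComplexPlaces L = 2 := by
  have h := InfinitePlace.card_add_two_mul_card_eq_rank L
  have h1 := D.real_le
  rw [D.fin] at h
  omega

lemma LD.minkowski {n : ℕ} (h : (n : ℝ) ≤ (4 / Real.pi) ^ InfinitePlace.nrComplexPlaces L *
    ((Module.finrank ℚ L).factorial / (Module.finrank ℚ L) ^ (Module.finrank ℚ L) * √|discr L|)) : n ≤ 13 := by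
  rw [D.sig.2, D.fin] at h
  by_contra hn
  have hn : (14 : ℝ) ≤ n := by exact_mod_cast (by omega : 14 ≤ n)
  have h1 : √|(discr L : ℝ)| ≤ 223.61 := by
    rw [Real.sqrt_le_left (by norm_num)]
    have := D.discr_le
    have h2 : |(discr L : ℝ)| ≤ 50000 := by exact_mod_cast this
    linarith
  have h2 : (4 / Real.pi) ≤ 1.2733 := by
    rw [div_le_iff₀ Real.pi_pos]
    linarith [Real.pi_gt_d4]
  have h3 : (4 / Real.pi) ^ 2 ≤ 1.2733 ^ 2 := by
    apply pow_le_pow_left₀ (by positivity) h2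
  have h4 : (4 / Real.pi) ^ 2 * ((Nat.factorial 5 : ℝ) / (5 : ℕ) ^ 5 * √|(discr L : ℝ)|) ≤
     1.2733 ^ 2 * ((Nat.factorial 5 : ℝ) / (5 : ℕ) ^ 5 * 223.61) := by
    gcongr
  have : (1.2733 : ℝ) ^ 2 * ((Nat.factorial 5 : ℝ) / (5 : ℕ) ^ 5 * 223.61) < 14 := by
    norm_num [Nat.factorial]
  linarith
end
end FQ

namespace FQ
open Polynomial NumberField

section
variable {L : Type*} [Field L] [NumberField L] {π : L} (D : LD L π)

lemma principal_of_mem {P : Ideal (𝓞 L)} (hP : P.IsPrime) {γ : 𝓞 L} {n : ℕ} (hn : n.Prime)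
    (hγ : Ideal.absNorm (Ideal.span {γ}) = n) (hm : γ ∈ P) : Submodule.IsPrincipal P := by
  have hpr : (Ideal.span {γ}).IsPrime := Ideal.isPrime_of_irreducible_absNorm (by rw [hγ]; exact hn)
  have hne : Ideal.span {γ} ≠ ⊥ := by
    intro h
    rw [h] at hγ
    simp at hγ
    rw [← hγ] at hn; norm_num at hn
  have hmax := hpr.isMaximal hne
  have := hmax.eq_of_le hP.ne_top ((Ideal.span_singleton_le_iff_mem _).2 hm)
  exact ⟨γ, this.symm⟩


lemma field_cases {F : Type*} [Field F] [Finite F] (x : F) (hx : x ^ 5 = 2) {q : ℕ} (hq : Nat.card F = q)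
    (hq2 : q ≤ 13) : x = 0 ∨ x + 1 = 0 ∨ x ^ 2 + 1 = 0 ∨ x ^ 3 - 1 = 0 ∨ x ^ 4 - x ^ 2 + 1 = 0 := by
  have := Fintype.ofFinite F
  rw [Nat.card_eq_fintype_card] at hq
  by_cases h0 : x = 0
  · exact Or.inl h0
  right
  have hpow : x ^ (q - 1) = 1 := by rw [← hq]; exact FiniteField.pow_card_sub_one_eq_one x h0
  have hchar : (q : F) = 0 := by rw [← hq]; simp
  have h1 := Finite.one_lt_card (α := F)
  rw [Nat.card_eq_fintype_card, hq] at h1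
  have h2 : (2 : F) ≠ 0 := by rw [← hx]; exact pow_ne_zero _ h0
  have hpp : IsPrimePow q := by rw [← hq]; exact FiniteField.isPrimePow_card F
  interval_cases q
  · exact absurd hchar (by exact_mod_cast h2)
  · left
    have h3 : (3 : F) = 0 := by exact_mod_cast hchar
    have hpow : x ^ 2 = 1 := hpow
    linear_combination (-1) * (x ^ 3 + x) * hpow + hx + h3
  · exfalso; apply h2; 
    have : (2 : F) ^ 2 = 0 := by linear_combination (by exact_mod_cast hchar : (4 : F) = 0)
    exact pow_eq_zero_iff (by norm_num) |>.1 this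
  · right; left
    have h3 : (5 : F) = 0 := by exact_mod_cast hchar
    norm_num at hpow
    have hx2 : x = 2 := by linear_combination hx - x * hpow
    rw [hx2]
    linear_combination h3
  · exfalso
    rw [isPrimePow_iff_unique_prime_dvd] at hpp
    obtain ⟨p, _, hp⟩ := hpp
    have a1 := hp 2 (by norm_num)
    have a2 := hp 3 (by norm_num)
    omega
  · right; right; left
    have h3 : (7 : F) = 0 := by exact_mod_cast hchar
    norm_num at hpow
    have hx2 : 2 * x = 1 := by linear_combination hpow - x * hx
    apply mul_left_cancel₀ (pow_ne_zero 3 h2)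
    linear_combination (4 * x ^ 2 + 2 * x + 1) * hx2 - h3
  · exfalso; apply h2; 
    have : (2 : F) ^ 3 = 0 := by linear_combination (by exact_mod_cast hchar : (8 : F) = 0)
    exact pow_eq_zero_iff (by norm_num) |>.1 this
  · left
    have h3 : (3 : F) = 0 := by
      have : (3 : F) ^ 2 = 0 := by linear_combination (by exact_mod_cast hchar : (9 : F) = 0)
      exact pow_eq_zero_iff (by norm_num) |>.1 this
    norm_num at hpow
    have h5 : x ^ 5 = -1 := by linear_combination hx + h3
    have : x ^ 2 = 1 := by
      have : x ^ 10 = 1 := by linear_combination (x ^ 5 - 1) * h5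
      linear_combination this - x ^ 2 * hpow
    linear_combination h5 - (x ^ 3 + x) * this
  · exfalso
    rw [isPrimePow_iff_unique_prime_dvd] at hpp
    obtain ⟨p, _, hp⟩ := hpp
    have a1 := hp 2 (by norm_num)
    have a2 := hp 5 (by norm_num)
    omega
  · exfalso
    have h3 : (11 : F) = 0 := by exact_mod_cast hchar
    norm_num at hpow
    have h4 : (3 : F) = 0 := by linear_combination hpow - (x ^ 5 + 2) * hx
    have : (1 : F) = 0 := by linear_combination 4 * h4 - h3
    exact one_ne_zero this
  · exfalso
    rw [isPrimePow_iff_unique_prime_dvd] at hpp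
    obtain ⟨p, _, hp⟩ := hpp
    have a1 := hp 2 (by norm_num)
    have a2 := hp 3 (by norm_num)
    omega
  · right; right; right
    have h3 : (13 : F) = 0 := by exact_mod_cast hchar
    norm_num at hpow
    have h4 : 4 * x ^ 2 = 1 := by linear_combination hpow - x ^ 2 * (x ^ 5 + 2) * hx
    apply mul_left_cancel₀ (pow_ne_zero 4 h2)
    linear_combination (4 * x ^ 2 - 3) * h4 + h3

include D in
lemma LD.pid : IsPrincipalIdealRing (𝓞 L) := by
  apply RingOfIntegers.isPrincipalIdealRing_of_isPrincipal_of_norm_le_of_isPrime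
  rintro ⟨P, hP0⟩ hP hN
  have hle := D.minkowski hN
  simp only at hP hle ⊢
  have hne : P ≠ ⊥ := nonZeroDivisors.ne_zero hP0
  have hmax := hP.isMaximal hne
  letI : Field (𝓞 L ⧸ P) := Ideal.Quotient.field P
  haveI : Finite (𝓞 L ⧸ P) := Ideal.finiteQuotientOfFreeOfNeBot P hne
  have hx : (Ideal.Quotient.mk P D.p) ^ 5 = 2 := by
    rw [← map_pow, D.p_pow, map_ofNat]
  have hcard : Nat.card (𝓞 L ⧸ P) = Ideal.absNorm P := by
    rw [Ideal.absNorm_apply, Submodule.cardQuot_apply]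
  have := field_cases (Ideal.Quotient.mk P D.p) hx hcard hle
  simp only [← map_pow, ← map_add, ← map_sub, ← map_one (Ideal.Quotient.mk P), Ideal.Quotient.eq_zero_iff_mem] at this
  rcases this with h | h | h | h | h
  · exact principal_of_mem hP (by norm_num) D.abs2 h
  · exact principal_of_mem hP (by norm_num) D.abs3 h
  · exact principal_of_mem hP (by norm_num) D.abs5 h
  · exact principal_of_mem hP (by norm_num) D.abs7 h
  · exact principal_of_mem hP (by norm_num) D.abs13 h
end
end FQ

namespace FQ
open Polynomial NumberField

/-- In a commutative group generated modulo squares by three elements, three independent elements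
generate modulo squares. -/
lemma grp_gen {G : Type*} [CommGroup G] (f c : Fin 3 → G)
    (hgen : ∀ u : G, ∃ e : Fin 3 → Fin 2, ∃ s : G, u = (∏ i, f i ^ (e i : ℕ)) * s ^ 2)
    (hind : ∀ (e : Fin 3 → Fin 2) (s : G), ∏ i, c i ^ (e i : ℕ) = s ^ 2 → e = 0) (u : G) :
    ∃ e : Fin 3 → Fin 2, ∃ s : G, u = (∏ i, c i ^ (e i : ℕ)) * s ^ 2 := by
  choose E S hES using hgen
  let φ : (Fin 3 → Fin 2) → (Fin 3 → Fin 2) := fun e => E (∏ i, c i ^ (e i : ℕ))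
  have key : ∀ a b : Fin 2, ∀ x : G, ∃ t : G, x ^ ((a + b : Fin 2) : ℕ) = x ^ (a : ℕ) * (x ^ (b : ℕ))⁻¹ * t ^ 2 := by
    intro a b x
    fin_cases a <;> fin_cases b
    · exact ⟨1, by simp⟩
    · refine ⟨x, ?_⟩
      have : ((1 : Fin 2) : ℕ) = 1 := rfl
      simp [pow_two]
    · exact ⟨1, by simp⟩
    · exact ⟨1, by simp⟩
  have hinj : Function.Injective φ := by
    intro e e' hee
    have h1 := hES (∏ i, c i ^ (e i : ℕ))
    have h2 := hES (∏ i, c i ^ (e' i : ℕ))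
    change E (∏ i, c i ^ (e i : ℕ)) = E (∏ i, c i ^ (e' i : ℕ)) at hee
    rw [hee] at h1
    set F := ∏ i, f i ^ (E (∏ i, c i ^ (e' i : ℕ)) i : ℕ)
    choose T hT using key
    have h3 := hind (e + e') (S (∏ i, c i ^ (e i : ℕ)) * (S (∏ i, c i ^ (e' i : ℕ)))⁻¹ * ∏ i, T (e i) (e' i) (c i)) ?_
    · funext i
      have := congrFun h3 i
      simp only [Pi.add_apply, Pi.zero_apply] at this
      revert this
      generalize e i = a
      generalize e' i = b
      revert a b
      decide
    · simp only [Pi.add_apply]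
      rw [Finset.prod_congr rfl (fun i _ => hT (e i) (e' i) (c i)), Finset.prod_mul_distrib,
        Finset.prod_mul_distrib, Finset.prod_inv_distrib, Finset.prod_pow]
      rw [mul_pow]
      congr 1
      generalize (∏ i, c i ^ (e i : ℕ)) = x at *
      generalize (∏ i, c i ^ (e' i : ℕ)) = y at *
      rw [mul_pow, inv_pow]
      have h1' : S x ^ 2 = x * F⁻¹ := eq_mul_inv_of_mul_eq (by rw [mul_comm]; exact h1.symm)
      have h2' : S y ^ 2 = y * F⁻¹ := eq_mul_inv_of_mul_eq (by rw [mul_comm]; exact h2.symm)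
      rw [h1', h2']
      simp
  have hsur : Function.Surjective φ := Finite.surjective_of_injective hinj
  obtain ⟨e, he⟩ := hsur (E u)
  refine ⟨e, (S (∏ i, c i ^ (e i : ℕ)))⁻¹ * S u, ?_⟩
  have h1 := hES (∏ i, c i ^ (e i : ℕ))
  change E (∏ i, c i ^ (e i : ℕ)) = E u at he
  rw [he] at h1
  have h2 := hES u
  conv_lhs => rw [h2]
  generalize (∏ i, c i ^ (e i : ℕ)) = x at *
  rw [mul_pow, inv_pow]
  generalize ∏ i, f i ^ (E u i : ℕ) = F at *
  have : S x ^ 2 = x * F⁻¹ := eq_mul_inv_of_mul_eq (by rw [mul_comm]; exact h1.symm)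
  rw [this]
  simp
  rw [mul_comm F x⁻¹, ← mul_assoc, ← mul_assoc, mul_inv_cancel, one_mul]

lemma prod_two {G : Type*} [CommGroup G] {r : ℕ} (hr : r = 2) (f : Fin r → G) : ∃ g1 g2 : G,
    ∀ e : Fin r → ℤ, ∃ j k : ℤ, ∏ i, f i ^ e i = g1 ^ j * g2 ^ k := by
  subst hr
  exact ⟨f 0, f 1, fun e => ⟨e 0, e 1, Fin.prod_univ_two _⟩⟩

lemma zpow_red {G : Type*} [CommGroup G] (x : G) (j : ℤ) : ∃ e : Fin 2, ∃ s : G, x ^ j = x ^ (e : ℕ) * s ^ 2 := by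
  rcases Int.even_or_odd' j with ⟨k, hk | hk⟩
  · refine ⟨0, x ^ k, ?_⟩
    rw [hk, mul_comm 2 k, zpow_mul]; simp
  · refine ⟨1, x ^ k, ?_⟩
    rw [hk, zpow_add, mul_comm 2 k, zpow_mul]
    simp [mul_comm]

section
variable {L : Type*} [Field L] [NumberField L] {π : L} (D : LD L π)
include D
lemma LD.torsion (x : Units.torsion L) : (x : (𝓞 L)ˣ) = 1 ∨ (x : (𝓞 L)ˣ) = -1 :=
  Units.torsion_eq_one_or_neg_one_of_odd_finrank (by rw [D.fin]; decide) x
lemma LD.rank_eq : Units.rank L = 2 := by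
  rw [Units.rank, InfinitePlace.card_eq_nrRealPlaces_add_nrComplexPlaces, D.sig.1, D.sig.2]

lemma LD.units_gen : ∃ f : Fin 3 → (𝓞 L)ˣ, ∀ u : (𝓞 L)ˣ, ∃ e : Fin 3 → Fin 2, ∃ s, u = (∏ i, f i ^ (e i : ℕ)) * s ^ 2 := by
  obtain ⟨g1, g2, hg⟩ := prod_two D.rank_eq (Units.fundSystem L)
  refine ⟨![-1, g1, g2], fun u => ?_⟩
  obtain ⟨⟨ζ, e⟩, hu, -⟩ := Units.exist_unique_eq_mul_prod L u
  obtain ⟨j, k, hjk⟩ := hg e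
  obtain ⟨e1, s1, h1⟩ := zpow_red g1 j
  obtain ⟨e2, s2, h2⟩ := zpow_red g2 k
  simp only at hu
  rw [hjk, h1, h2] at hu
  rcases D.torsion ζ with h | h
  · refine ⟨![0, e1, e2], s1 * s2, ?_⟩
    rw [hu, h, Fin.prod_univ_three]
    simp [mul_pow]
    exact mul_mul_mul_comm _ _ _ _
  · refine ⟨![1, e1, e2], s1 * s2, ?_⟩
    rw [hu, h, Fin.prod_univ_three]
    simp [mul_pow]
    exact mul_mul_mul_comm _ _ _ _

lemma LD.digit (x : 𝓞 L) : D.p ∣ x ∨ D.p ∣ x - 1 := by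
  classical
  have h2 := D.abs2
  rw [Ideal.absNorm_apply, Submodule.cardQuot_apply] at h2
  have : Fintype (𝓞 L ⧸ Ideal.span {D.p}) := @Fintype.ofFinite _ (Nat.finite_of_card_ne_zero (by omega))
  have hne : (0 : 𝓞 L ⧸ Ideal.span {D.p}) ≠ 1 := by
    have hnt : Nontrivial (𝓞 L ⧸ Ideal.span {D.p}) := by
      rw [← Finite.one_lt_card_iff_nontrivial, h2]; norm_num
    exact zero_ne_one
  have h3 : ∀ y : 𝓞 L ⧸ Ideal.span {D.p}, y = 0 ∨ y = 1 := by
    intro y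
    by_contra h
    push Not at h
    have : ({0, 1, y} : Finset (𝓞 L ⧸ Ideal.span {D.p})).card ≤ Fintype.card (𝓞 L ⧸ Ideal.span {D.p}) :=
      Finset.card_le_univ _
    rw [← Nat.card_eq_fintype_card, h2, Finset.card_eq_three.2 ⟨0, 1, y, hne, h.1.symm, h.2.symm, rfl⟩] at this
    omega
  rcases h3 (Ideal.Quotient.mk _ x) with h | h
  · left
    rw [Ideal.Quotient.eq_zero_iff_mem, Ideal.mem_span_singleton] at h
    exact h
  · right
    rw [← map_one (Ideal.Quotient.mk _), Ideal.Quotient.eq, Ideal.mem_span_singleton] at h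
    exact h

lemma LD.not_dvd_one : ¬ D.p ∣ 1 := by
  intro h
  have h2 := D.abs2
  rw [Ideal.span_singleton_eq_top.2 (isUnit_of_dvd_one h)] at h2
  simp at h2

lemma LD.p_ne : D.p ≠ 0 := by
  intro h
  have := D.p_pow
  rw [h] at this
  norm_num at this

lemma LD.not_dvd {x : 𝓞 L} (h : D.p ∣ x - 1) : ¬ D.p ∣ x := by
  intro h2
  apply D.not_dvd_one
  have := dvd_sub h2 h
  simpa using this

/-- squares modulo two -/
lemma LD.sq_mod (s : 𝓞 L) : ∃ a b c : 𝓞 L, (a = 0 ∨ a = 1) ∧ (b = 0 ∨ b = 1) ∧ (c = 0 ∨ c = 1) ∧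
    D.p ^ 5 ∣ s ^ 2 - (a + b * D.p ^ 2 + c * D.p ^ 4) := by
  have hd : ∀ x : 𝓞 L, ∃ a y : 𝓞 L, (a = 0 ∨ a = 1) ∧ x = a + D.p * y := by
    intro x
    rcases D.digit x with ⟨y, h⟩ | ⟨y, h⟩
    · exact ⟨0, y, Or.inl rfl, by rw [h]; ring⟩
    · exact ⟨1, y, Or.inr rfl, by rw [← h]; ring⟩
  obtain ⟨a, y, ha, h1⟩ := hd s
  obtain ⟨b, z, hb, h2⟩ := hd y
  obtain ⟨c, w, hc, h3⟩ := hd z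
  refine ⟨a, b, c, ha, hb, hc, ?_⟩
  have ha2 : a ^ 2 = a := by rcases ha with h | h <;> simp [h]
  have hb2 : b ^ 2 = b := by rcases hb with h | h <;> simp [h]
  have hc2 : c ^ 2 = c := by rcases hc with h | h <;> simp [h]
  subst h1 h2 h3
  refine ⟨D.p * w ^ 2 + (a * b * D.p + a * D.p ^ 2 * c + a * D.p ^ 3 * w + b * D.p ^ 3 * c + b * D.p ^ 4 * w + c * D.p ^ 5 * w), ?_⟩
  linear_combination ha2 + hb2 * D.p ^ 2 + hc2 * D.p ^ 4
    - (a * b * D.p + a * D.p ^ 2 * c + a * D.p ^ 3 * w + b * D.p ^ 3 * c + b * D.p ^ 4 * w + c * D.p ^ 5 * w) * D.p_pow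

lemma LD.c1_not {s : 𝓞 L} (h : D.p ^ 5 ∣ (D.p - 1) - s ^ 2) : False := by
  obtain ⟨a, b, c, ha, hb, hc, h1⟩ := D.sq_mod s
  have h2 := dvd_add h h1
  obtain ⟨k, hk⟩ := h2
  rcases ha with rfl | rfl
  · apply D.not_dvd_one
    exact ⟨1 - b * D.p - c * D.p ^ 3 - D.p ^ 4 * k, by linear_combination -hk⟩
  · apply D.not_dvd_one
    refine ⟨D.p ^ 3 * k + D.p ^ 3 + b + c * D.p ^ 2, mul_left_cancel₀ D.p_ne ?_⟩
    linear_combination hk - D.p_pow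

lemma LD.c2_not {s : 𝓞 L} (h : D.p ^ 5 ∣ (D.p ^ 3 + D.p ^ 2 - 1) - s ^ 2) : False := by
  obtain ⟨a, b, c, ha, hb, hc, h1⟩ := D.sq_mod s
  have h2 := dvd_add h h1
  obtain ⟨k, hk⟩ := h2
  rcases ha with rfl | rfl
  · apply D.not_dvd_one
    exact ⟨D.p ^ 2 + D.p - b * D.p - c * D.p ^ 3 - D.p ^ 4 * k, by linear_combination -hk⟩
  · rcases hb with rfl | rfl
    · apply D.not_dvd_one
      refine ⟨D.p ^ 2 * k + D.p ^ 2 - 1 + c * D.p, mul_left_cancel₀ (pow_ne_zero 2 D.p_ne) ?_⟩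
      linear_combination hk - D.p_pow
    · apply D.not_dvd_one
      refine ⟨D.p * k + D.p + c, mul_left_cancel₀ (pow_ne_zero 3 D.p_ne) ?_⟩
      linear_combination hk - D.p_pow

lemma LD.c12_not {s : 𝓞 L} (h : D.p ^ 5 ∣ (D.p - 1) * (D.p ^ 3 + D.p ^ 2 - 1) - s ^ 2) : False := by
  obtain ⟨a, b, c, ha, hb, hc, h1⟩ := D.sq_mod s
  have h2 := dvd_add h h1
  obtain ⟨k, hk⟩ := h2
  rcases ha with rfl | rfl
  · apply D.not_dvd_one
    exact ⟨D.p ^ 4 * k - D.p ^ 3 + D.p + 1 + b * D.p + c * D.p ^ 3, by linear_combination hk⟩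
  · apply D.not_dvd_one
    refine ⟨- D.p ^ 3 * k + D.p ^ 2 - 1 - b - c * D.p ^ 2, mul_left_cancel₀ D.p_ne ?_⟩
    linear_combination -hk
end

noncomputable def LD.u1 {L : Type*} [Field L] [NumberField L] {π : L} (D : LD L π) : (𝓞 L)ˣ :=
  Units.mkOfMulEqOne (D.p - 1) (D.p ^ 4 + D.p ^ 3 + D.p ^ 2 + D.p + 1) (by linear_combination D.p_pow)
noncomputable def LD.u2 {L : Type*} [Field L] [NumberField L] {π : L} (D : LD L π) : (𝓞 L)ˣ :=
  Units.mkOfMulEqOne (D.p ^ 3 + D.p ^ 2 - 1) (D.p ^ 4 - D.p ^ 3 + D.p ^ 2 - 1)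
    (by linear_combination D.p ^ 2 * D.p_pow)

section
variable {L : Type*} [Field L] [NumberField L] {π : L} (D : LD L π)
include D
/-- If a product of the three units is a square modulo 2, it is `±1`. -/
lemma LD.ind_mod2 (e : Fin 3 → Fin 2) (s : 𝓞 L)
    (h : (2 : 𝓞 L) ∣ ((∏ i, (![-1, D.u1, D.u2] : Fin 3 → (𝓞 L)ˣ) i ^ (e i : ℕ) : (𝓞 L)ˣ) : 𝓞 L) - s ^ 2) :
    e 1 = 0 ∧ e 2 = 0 := by
  rw [← D.p_pow, Fin.prod_univ_three] at h
  have hu1 : (D.u1 : 𝓞 L) = D.p - 1 := rfl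
  have hu2 : (D.u2 : 𝓞 L) = D.p ^ 3 + D.p ^ 2 - 1 := rfl
  have h' : D.p ^ 5 ∣ ((D.u1 ^ (e 1 : ℕ) * D.u2 ^ (e 2 : ℕ) : (𝓞 L)ˣ) : 𝓞 L) - s ^ 2 := by
    generalize e 0 = e0 at h
    fin_cases e0
    · simpa using h
    · have h3 : D.p ^ 5 ∣ 2 * ((D.u1 ^ (e 1 : ℕ) * D.u2 ^ (e 2 : ℕ) : (𝓞 L)ˣ) : 𝓞 L) := by
        rw [← D.p_pow]; exact dvd_mul_right _ _
      have := dvd_add h h3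
      convert this using 1
      simp
      ring
  generalize e 1 = e1 at *
  generalize e 2 = e2 at *
  fin_cases e1 <;> fin_cases e2
  · simp
  · exact (D.c2_not (s := s) (by simpa [hu1, hu2] using h')).elim
  · exact (D.c1_not (s := s) (by simpa [hu1, hu2] using h')).elim
  · exact (D.c12_not (s := s) (by simpa [hu1, hu2] using h')).elim

lemma LD.unit_gen2 (u : (𝓞 L)ˣ) : ∃ e : Fin 3 → Fin 2, ∃ s : (𝓞 L)ˣ,
    u = (∏ i, (![-1, D.u1, D.u2] : Fin 3 → (𝓞 L)ˣ) i ^ (e i : ℕ)) * s ^ 2 := by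
  obtain ⟨f, hf⟩ := D.units_gen
  refine grp_gen f _ hf ?_ u
  intro e s hs
  obtain ⟨h1, h2⟩ := D.ind_mod2 e s (by rw [hs]; simp)
  have h0 : e 0 = 0 := by
    rw [Fin.prod_univ_three, h1, h2] at hs
    generalize e 0 = e0 at *
    fin_cases e0
    · rfl
    · exfalso
      simp at hs
      have h3 : (-1 : L) = (algebraMap (𝓞 L) L s) ^ 2 := by
        have := congrArg (fun x : (𝓞 L)ˣ => algebraMap (𝓞 L) L (x : 𝓞 L)) hs
        simpa using this
      have h4 := congrArg (Algebra.norm ℚ) h3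
      rw [D.norm_neg, map_one, map_pow] at h4
      nlinarith [sq_nonneg (Algebra.norm ℚ (algebraMap (𝓞 L) L s))]
  funext i
  fin_cases i
  · exact h0
  · exact h1
  · exact h2

lemma LD.unit_square (u : (𝓞 L)ˣ) (hN : 0 < Algebra.norm ℚ (algebraMap (𝓞 L) L u)) (s : 𝓞 L)
    (h : (2 : 𝓞 L) ∣ (u : 𝓞 L) - s ^ 2) : ∃ t : 𝓞 L, (u : 𝓞 L) = t ^ 2 := by
  obtain ⟨e, t, hu⟩ := D.unit_gen2 u
  have h1 := D.ind_mod2 e (s * (t⁻¹ : (𝓞 L)ˣ)) (by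
    have : ((∏ i, (![-1, D.u1, D.u2] : Fin 3 → (𝓞 L)ˣ) i ^ (e i : ℕ) : (𝓞 L)ˣ) : 𝓞 L) = u * (t⁻¹ : (𝓞 L)ˣ) ^ 2 := by
      rw [hu]; push_cast
      rw [mul_assoc, ← mul_pow]; simp
    rw [this, mul_pow, ← sub_mul]
    exact Dvd.dvd.mul_right h _)
  rw [Fin.prod_univ_three, h1.1, h1.2] at hu
  generalize e 0 = e0 at *
  fin_cases e0
  · exact ⟨t, by rw [hu]; simp⟩
  · exfalso
    rw [hu] at hN
    simp [D.norm_neg] at hN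
    nlinarith [sq_nonneg (Algebra.norm ℚ (algebraMap (𝓞 L) L t))]
end
end FQ

namespace FQ
open WithZero

/-- coefficientwise identity `κ q = B ^ 2 - X g` -/
structure PE {K : Type*} [Field K] (κ0 κ1 κ2 q0 q1 q2 q3 q4 B0 B1 B2 B3 g0 g1 g2 g3 g4 : K) : Prop where
  e0 : κ0*q0 = B0^2
  e1 : κ0*q1+κ1*q0 = 2*B0*B1 - g0
  e2 : κ0*q2+κ1*q1+κ2*q0 = 2*B0*B2+B1^2 - g1
  e3 : κ0*q3+κ1*q2+κ2*q1 = 2*B0*B3+2*B1*B2 - g2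
  e4 : κ0*q4+κ1*q3+κ2*q2 = 2*B1*B3+B2^2 - g3
  e5 : κ1*q4+κ2*q3 = 2*B2*B3 - g4
  e6 : κ2*q4 = B3^2

section
variable {K : Type*} [Field K] {κ0 κ1 κ2 q0 q1 q2 q3 q4 B0 B1 B2 B3 g0 g1 g2 g3 g4 : K}

lemma PE.rev (h : PE κ0 κ1 κ2 q0 q1 q2 q3 q4 B0 B1 B2 B3 g0 g1 g2 g3 g4) :
    PE κ2 κ1 κ0 q4 q3 q2 q1 q0 B3 B2 B1 B0 g4 g3 g2 g1 g0 :=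
  ⟨h.e6, by linear_combination h.e5, by linear_combination h.e4, by linear_combination h.e3,
    by linear_combination h.e2, by linear_combination h.e1, h.e0⟩

lemma PE.scale (h : PE κ0 κ1 κ2 q0 q1 q2 q3 q4 B0 B1 B2 B3 g0 g1 g2 g3 g4) {l : K} (hl : l ≠ 0) :
    PE (l*κ0) (l*κ1) (l*κ2) (q0/l) (q1/l) (q2/l) (q3/l) (q4/l) B0 B1 B2 B3 g0 g1 g2 g3 g4 := by
  obtain ⟨h0,h1,h2,h3,h4,h5,h6⟩ := h
  constructor <;> field_simp <;> first | assumption | linear_combination h3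

lemma PE.eval (h : PE κ0 κ1 κ2 q0 q1 q2 q3 q4 B0 B1 B2 B3 g0 g1 g2 g3 g4) (t : K) :
    (κ0+κ1*t+κ2*t^2)*(q0+q1*t+q2*t^2+q3*t^3+q4*t^4) =
      (B0+B1*t+B2*t^2+B3*t^3)^2 - t*(g0+g1*t+g2*t^2+g3*t^3+g4*t^4) := by
  linear_combination h.e0+t*h.e1+t^2*h.e2+t^3*h.e3+t^4*h.e4+t^5*h.e5+t^6*h.e6

/-- The norm identity. -/
lemma PE.norm (h : PE κ0 κ1 1 q0 q1 q2 q3 q4 B0 B1 B2 B3 g0 g1 g2 g3 g4) :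
    ∃ y e : K, e = (g0 - κ0*(g2 - κ1*g3 + (κ1^2-κ0)*g4)) ^ 2 
      - (g0 - κ0*(g2 - κ1*g3 + (κ1^2-κ0)*g4)) * (g1 - κ1*g2 + (κ1^2-κ0)*g3 + (2*κ0*κ1 - κ1^3)*g4) * κ1
      + (g1 - κ1*g2 + (κ1^2-κ0)*g3 + (2*κ0*κ1 - κ1^3)*g4)^2 * κ0 ∧ y ^ 2 = κ0 * e := by
  obtain ⟨h0,h1,h2,h3,h4,h5,h6⟩ := h
  set γ0 := g0 - κ0*(g2 - κ1*g3 + (κ1^2-κ0)*g4) with hγ0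
  set γ1 := g1 - κ1*g2 + (κ1^2-κ0)*g3 + (2*κ0*κ1 - κ1^3)*g4 with hγ1
  set β0 := B0 - κ0*(B2 - κ1*B3) with hβ0
  set β1 := B1 - κ1*B2 + (κ1^2-κ0)*B3 with hβ1
  have a1 : γ0 - γ1*κ1 = 2*β0*β1 - β1^2*κ1 := by
    rw [hγ0, hγ1, hβ0, hβ1]
    linear_combination (h1 - κ1*h2 + (κ1^2-κ0)*h3 + (2*κ0*κ1 - κ1^3)*h4 +
      (κ1^4-3*κ0*κ1^2+κ0^2)*h5 + (-κ1^5+4*κ0*κ1^3-3*κ0^2*κ1)*h6)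
  have a0 : -γ1*κ0 = β0^2 - β1^2*κ0 := by
    rw [hγ1, hβ0, hβ1]
    linear_combination (h0 + (-κ0)*h2 + κ0*κ1*h3 + (-κ0)*(κ1^2-κ0)*h4 + (-κ0)*(2*κ0*κ1 - κ1^3)*h5 +
      (-κ0)*(κ1^4-3*κ0*κ1^2+κ0^2)*h6)
  refine ⟨β0^2 - β0*β1*κ1+β1^2*κ0, _, rfl, ?_⟩
  have : κ0 * (γ0^2-γ0*γ1*κ1+γ1^2*κ0) = (-γ1*κ0)^2 - (-γ1*κ0)*(γ0-γ1*κ1)*κ1 + (γ0-γ1*κ1)^2*κ0 := by ring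
  rw [this, a1, a0]
  ring

lemma PE.parity0 (v : Valuation K ℤᵐ⁰) (h : PE κ0 κ1 κ2 q0 q1 q2 q3 q4 B0 B1 B2 B3 g0 g1 g2 g3 g4)
    (k0 : v κ0 ≤ 1) (k1 : v κ1 ≤ 1) (k2 : v κ2 ≤ 1) (hk : v κ0 = 1 ∨ v κ1 = 1 ∨ v κ2 = 1)
    (hg0 : v g0 = 1) (hg1 : v g1 ≤ 1) (hg2 : v g2 ≤ 1) (hg3 : v g3 ≤ 1) (hg4 : v g4 ≤ 1) :
    ∃ y : K, v κ0 = v y ^ 2 := by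
  by_cases c0 : v κ0 = 1
  · exact ⟨1, by simp [c0]⟩
  by_cases c00 : κ0 = 0
  · exact ⟨0, by simp [c00]⟩
  have hlt0 : v κ0 < 1 := lt_of_le_of_ne k0 c0
  have hm : ∀ x y : K, v x ≤ 1 → v y ≤ 1 → v (x * y) ≤ 1 := by
    intro x y hx hy; rw [map_mul]; exact mul_le_one' hx hy
  have hp : ∀ (x : K) (n : ℕ), v x ≤ 1 → v (x ^ n) ≤ 1 := by
    intro x n hx; rw [map_pow]; exact pow_le_one' hx n
  have ha : ∀ x y : K, v x ≤ 1 → v y ≤ 1 → v (x + y) ≤ 1 := fun x y hx hy => v.map_add_le hx hy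
  have hs : ∀ x y : K, v x ≤ 1 → v y ≤ 1 → v (x - y) ≤ 1 := fun x y hx hy => v.map_sub_le hx hy
  have h2 : v (2 : K) ≤ 1 := by
    rw [← one_add_one_eq_two]; exact ha _ _ (by simp) (by simp)
  have hml : ∀ x y : K, v x ≤ 1 → v y < 1 → v (x * y) < 1 := by
    intro x y hx hy
    rw [map_mul]
    exact lt_of_le_of_lt (mul_le_of_le_one_left' hx) hy
  by_cases c1 : v κ1 = 1
  · have k1ne : κ1 ≠ 0 := by intro h; simp [h] at c1
    -- approximate root
    have happ : ∀ n : ℕ, ∃ t : K, v t = v κ0 ∧ v (κ0 + κ1*t+κ2*t^2) ≤ v κ0 ^ (n+2) := by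
      intro n
      induction n with
      | zero =>
        refine ⟨-κ0/κ1, ?_, ?_⟩
        · rw [map_div₀, c1, Valuation.map_neg, div_one]
        · have : κ0 + κ1*(-κ0/κ1)+κ2*(-κ0/κ1)^2 = κ2 * (κ0/κ1)^2 := by field_simp; ring
          rw [this, map_mul, map_pow, map_div₀, c1, div_one]
          exact mul_le_of_le_one_left' k2
      | succ n ih =>
        obtain ⟨t, ht, hA⟩ := ih
        have hlt : v (κ2*t^2) < v κ0 := by
          rw [map_mul, map_pow, ht, pow_two]
          have h1 : v κ0 * v κ0 < v κ0 := by
            have hpos : 0 < v κ0 := by rw [Valuation.pos_iff]; exact c00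
            exact mul_lt_of_lt_one_left hpos hlt0
          exact lt_of_le_of_lt (mul_le_of_le_one_left' k2) h1
        have hvt : v (-(κ0+κ2*t^2)/κ1) = v κ0 := by
          rw [map_div₀, c1, Valuation.map_neg, div_one, Valuation.map_add_eq_of_lt_left v hlt]
        refine ⟨-(κ0+κ2*t^2)/κ1, hvt, ?_⟩
        have h3 : κ0 + κ1*(-(κ0+κ2*t^2)/κ1)+κ2*(-(κ0+κ2*t^2)/κ1)^2 =
            κ2 * ((-(κ0+κ2*t^2)/κ1) + t) * (-(κ0+κ1*t+κ2*t^2)/κ1) := by field_simp; ring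
        rw [h3, map_mul, map_mul, map_div₀ v (-(κ0+κ1*t+κ2*t^2)), c1, div_one, Valuation.map_neg]
        have h4 : v (-(κ0+κ2*t^2)/κ1 + t) ≤ v κ0 := v.map_add_le hvt.le ht.le
        calc v κ2 * v (-(κ0+κ2*t^2)/κ1 + t) * v (κ0+κ1*t+κ2*t^2) ≤ 1 * v κ0 * v κ0 ^ (n+2) := by gcongr
          _ = v κ0 ^ (n+1+2) := by rw [one_mul, ← pow_succ']
    -- bound for q
    obtain ⟨M, hM0, hM⟩ : ∃ M : ℤᵐ⁰, 0 < M ∧ ∀ t : K, v t ≤ 1 → v (q0+q1*t+q2*t^2+q3*t^3+q4*t^4) * M ≤ 1 := by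
      obtain ⟨N, hN1, a0, a1, a2, a3, a4⟩ : ∃ N : ℤᵐ⁰, 1 ≤ N ∧ v q0 ≤ N ∧ v q1 ≤ N ∧ v q2 ≤ N ∧ v q3 ≤ N ∧ v q4 ≤ N :=
        ⟨max 1 (max (v q0) (max (v q1) (max (v q2) (max (v q3) (v q4))))), by simp, by simp, by simp, by simp, by simp, by simp⟩
      have hN0 : 0 < N := lt_of_lt_of_le zero_lt_one hN1
      refine ⟨N⁻¹, by simpa using hN0, fun t ht => ?_⟩
      have hb : ∀ (q : K) (n : ℕ), v q ≤ N → v (q * t^n) ≤ N := by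
        intro q n hq
        rw [map_mul, map_pow]
        exact (mul_le_of_le_one_right' (pow_le_one' ht n)).trans hq
      have : v (q0+q1*t+q2*t^2+q3*t^3+q4*t^4) ≤ N := by
        refine v.map_add_le (v.map_add_le (v.map_add_le (v.map_add_le a0 ?_) (hb _ _ a2)) (hb _ _ a3)) (hb _ _ a4)
        simpa using hb q1 1 a1
      calc _ ≤ N * N⁻¹ := by gcongr
        _ = 1 := mul_inv_cancel₀ hN0.ne'
    obtain ⟨n, hn⟩ : ∃ n : ℕ, v κ0 ^ n < v κ0 * M := by
      apply exists_pow_lt₀ hlt0 (Units.mk0 (v κ0 * M) _)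
      exact mul_ne_zero ((Valuation.ne_zero_iff _).2 c00) hM0.ne'
    obtain ⟨t, ht, hA⟩ := happ n
    have htlt : v t < 1 := by rw [ht]; exact hlt0
    have hgt : v (g0+g1*t+g2*t^2+g3*t^3+g4*t^4) = 1 := by
      have : g0+g1*t+g2*t^2+g3*t^3+g4*t^4 = g0 + (g1+g2*t+g3*t^2+g4*t^3)*t := by ring
      rw [this, Valuation.map_add_eq_of_lt_left v, hg0]
      rw [hg0]
      refine hml _ _ ?_ htlt
      refine ha _ _ (ha _ _ (ha _ _ hg1 (hm _ _ hg2 htlt.le)) (hm _ _ hg3 (hp _ _ htlt.le))) (hm _ _ hg4 (hp _ _ htlt.le))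
    refine ⟨B0+B1*t+B2*t^2+B3*t^3, ?_⟩
    have hev := h.eval t
    have hB : (B0+B1*t+B2*t^2+B3*t^3)^2 = t*(g0+g1*t+g2*t^2+g3*t^3+g4*t^4) +
      (κ0+κ1*t+κ2*t^2)*(q0+q1*t+q2*t^2+q3*t^3+q4*t^4) := by linear_combination -hev
    rw [← map_pow, hB, Valuation.map_add_eq_of_lt_left v, map_mul, hgt, mul_one, ht]
    rw [map_mul, map_mul, hgt, mul_one, ht]
    have hA' : v (κ0+κ1*t+κ2*t^2) < v κ0 * M := lt_of_le_of_lt (hA.trans (pow_le_pow_right_of_le_one' k0 (by omega))) hn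
    by_cases hq : v (q0+q1*t+q2*t^2+q3*t^3+q4*t^4) = 0
    · rw [hq, mul_zero, Valuation.pos_iff]; exact c00
    calc v (κ0+κ1*t+κ2*t^2) * v (q0+q1*t+q2*t^2+q3*t^3+q4*t^4) 
        < v κ0 * M * v (q0+q1*t+q2*t^2+q3*t^3+q4*t^4) := by
          exact mul_lt_mul_of_pos_right hA' (zero_lt_iff.2 hq)
      _ = v κ0 * (v (q0+q1*t+q2*t^2+q3*t^3+q4*t^4) * M) := by rw [mul_assoc, mul_comm M]
      _ ≤ v κ0 * 1 := by gcongr; exact hM t htlt.le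
      _ = v κ0 := mul_one _
  · have c2 : v κ2 = 1 := by tauto
    have k2ne : κ2 ≠ 0 := by intro h; simp [h] at c2
    have hsc := h.scale (inv_ne_zero k2ne)
    rw [inv_mul_cancel₀ k2ne] at hsc
    obtain ⟨y, e, he, hy⟩ := hsc.norm
    have hk0 : v (κ2⁻¹ * κ0) = v κ0 := by simp [c2]
    have hk1 : v (κ2⁻¹ * κ1) = v κ1 := by simp [c2]
    have hlt1 : v κ1 < 1 := lt_of_le_of_ne k1 c1
    generalize κ2⁻¹ * κ0 = x0 at *
    generalize κ2⁻¹ * κ1 = x1 at *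
    rw [← hk0] at hlt0 
    rw [← hk1] at hlt1
    have hx0 := hlt0.le
    have hx1 := hlt1.le
    have i0 : v (x1^2-x0) ≤ 1 := hs _ _ (hp _ _ hx1) hx0
    have hG1 : v (g1 - x1*g2 + (x1^2-x0)*g3 + (2*x0*x1 - x1^3)*g4) ≤ 1 := by
      refine ha _ _ (ha _ _ (hs _ _ hg1 (hm _ _ hx1 hg2)) (hm _ _ i0 hg3)) (hm _ _ (hs _ _ (hm _ _ (hm _ _ h2 hx0) hx1) (hp _ _ hx1)) hg4)
    have hG0 : v (g0 - x0*(g2 - x1*g3 + (x1^2-x0)*g4)) = 1 := by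
      rw [sub_eq_add_neg, Valuation.map_add_eq_of_lt_left v, hg0]
      rw [hg0, Valuation.map_neg, mul_comm]
      exact hml _ _ (ha _ _ (hs _ _ hg2 (hm _ _ hx1 hg3)) (hm _ _ i0 hg4)) hlt0
    generalize g1 - x1*g2 + (x1^2-x0)*g3 + (2*x0*x1 - x1^3)*g4 = G1 at *
    generalize g0 - x0*(g2 - x1*g3 + (x1^2-x0)*g4) = G0 at *
    have hev : v e = 1 := by
      have : e = G0^2 + ((-(G0*G1))*x1 + G1^2*x0) := by rw [he]; ring
      rw [this, Valuation.map_add_eq_of_lt_left v, map_pow, hG0, one_pow]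
      rw [map_pow, hG0, one_pow]
      refine v.map_add_lt (hml _ _ ?_ hlt1) (hml _ _ (hp _ _ hG1) hlt0)
      rw [Valuation.map_neg]; exact hm _ _ hG0.le hG1
    refine ⟨y, ?_⟩
    rw [← map_pow, hy, map_mul, hev, mul_one, hk0]

/-- parity of the valuation of the constant term. -/
lemma PE.parity (v : Valuation K ℤᵐ⁰) (h : PE κ0 κ1 1 q0 q1 q2 q3 q4 B0 B1 B2 B3 g0 g1 g2 g3 g4)
    (hg0 : v g0 = 1) (hg1 : v g1 ≤ 1) (hg2 : v g2 ≤ 1) (hg3 : v g3 ≤ 1) (hg4 : v g4 = 1) :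
    ∃ y : K, v κ0 = v y ^ 2 := by
  obtain ⟨l, hl, a0, a1, a2, hor⟩ : ∃ l : K, l ≠ 0 ∧ v (l * κ0) ≤ 1 ∧ v (l * κ1) ≤ 1 ∧ v (l * 1) ≤ 1 ∧
      (v (l * κ0) = 1 ∨ v (l * κ1) = 1 ∨ v (l * 1) = 1) := by
    have key : ∀ m : K, m ≠ 0 → ∀ x, v x ≤ v m → v (m⁻¹ * x) ≤ 1 := by
      intro m hm x hx
      have : v m ≠ 0 := (Valuation.ne_zero_iff _).2 hm
      rw [map_mul, map_inv₀]
      calc (v m)⁻¹ * v x ≤ (v m)⁻¹ * v m := by gcongr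
        _ = 1 := inv_mul_cancel₀ this
    have key2 : ∀ m : K, v 1 ≤ v m → m ≠ 0 := by
      intro m hm h0; rw [h0] at hm; simp at hm
    by_cases h1 : v κ0 ≤ v κ1
    · by_cases h2 : v 1 ≤ v κ1
      · have := key2 _ h2
        exact ⟨κ1⁻¹, inv_ne_zero this, key _ this _ h1, key _ this _ le_rfl, key _ this _ h2, by
          right; left; rw [inv_mul_cancel₀ this, map_one]⟩
      · push Not at h2
        exact ⟨1, one_ne_zero, by simpa using (h1.trans h2.le), by simpa using h2.le, by simp, by simp⟩
    · push Not at h1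
      by_cases h2 : v 1 ≤ v κ0
      · have := key2 _ h2
        exact ⟨κ0⁻¹, inv_ne_zero this, key _ this _ le_rfl, key _ this _ h1.le, key _ this _ h2, by
          left; rw [inv_mul_cancel₀ this, map_one]⟩
      · push Not at h2
        exact ⟨1, one_ne_zero, by simpa using h2.le, by simpa using (h1.trans h2).le, by simp, by simp⟩
  have hsc := h.scale hl
  obtain ⟨y, hy⟩ := hsc.parity0 v a0 a1 a2 hor hg0 hg1 hg2 hg3 hg4.le
  obtain ⟨z, hz⟩ := hsc.rev.parity0 v a2 a1 a0 (by tauto) hg4 hg3 hg2 hg1 hg0.le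
  refine ⟨y / z, ?_⟩
  have : v l ≠ 0 := (Valuation.ne_zero_iff _).2 hl
  rw [mul_one] at hz
  rw [map_div₀, div_pow, ← hy, ← hz, map_mul, mul_div_cancel_left₀ _ this]
end
end FQ

namespace FQ
open WithZero NumberField IsDedekindDomain

section
variable {L : Type*} [Field L] [NumberField L] {π : L} (D : LD L π)
include D

lemma LD.decomp (ρ : 𝓞 L) (hρ : Prime ρ) (Y : 𝓞 L) (hY : Y ≠ 0)
    (H : ∀ v : HeightOneSpectrum (𝓞 L), ρ ∉ v.asIdeal → ∃ y : L, v.valuation L (algebraMap (𝓞 L) L Y) = (v.valuation L y) ^ 2) :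
    ∃ (ε : (𝓞 L)ˣ) (e : ℕ) (z : 𝓞 L), Y = ε * ρ ^ e * z ^ 2 := by
  have := D.pid
  induction Y using (wellFounded_dvdNotUnit (α := 𝓞 L)).induction with
  | _ Y ih =>
  by_cases hu : IsUnit Y
  · obtain ⟨ε, hε⟩ := hu
    exact ⟨ε, 0, 1, by simp [hε]⟩
  obtain ⟨p, hp, Y', rfl⟩ := WfDvdMonoid.exists_irreducible_factor hu hY
  have hpp : Prime p := hp.prime
  have hY' : Y' ≠ 0 := right_ne_zero_of_mul hY
  by_cases hass : Associated p ρ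
  · obtain ⟨η, rfl⟩ := hass
    obtain ⟨ε, e, z, hz⟩ := ih Y' ⟨hY', p, hp.not_isUnit, mul_comm _ _⟩ hY' (by
      intro v hv
      obtain ⟨y, hy⟩ := H v hv
      refine ⟨y, ?_⟩
      rw [← hy, map_mul, map_mul]
      have : p ∉ v.asIdeal := fun h => hv (Ideal.mul_mem_right _ _ h)
      rw [(v.valuation_eq_one_iff_notMem (K := L)).2 this, one_mul])
    refine ⟨ε * η⁻¹, e+1, z, ?_⟩
    rw [hz, pow_succ]
    have : (η : 𝓞 L) * (η⁻¹ : (𝓞 L)ˣ) = 1 := by simp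
    push_cast
    linear_combination (- ε * (p * η)^e * p * z^2 : 𝓞 L) * this
  · let v : HeightOneSpectrum (𝓞 L) := ⟨Ideal.span {p}, (Ideal.span_singleton_prime hpp.ne_zero).2 hpp, by
      simpa using hpp.ne_zero⟩
    have hv : ρ ∉ v.asIdeal := by
      intro h
      apply hass
      have h1 : p ∣ ρ := Ideal.mem_span_singleton.1 h
      exact (hp.associated_of_dvd hρ.irreducible h1)
    obtain ⟨y, hy⟩ := H v hv
    have hlt : v.valuation L (algebraMap (𝓞 L) L (p * Y')) < 1 := by
      rw [HeightOneSpectrum.valuation_lt_one_iff_mem]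
      exact Ideal.mem_span_singleton.2 (Dvd.intro _ rfl)
    have hylt : v.valuation L y < 1 := by
      by_contra hc
      push Not at hc
      rw [hy] at hlt
      exact absurd hlt (not_lt.2 (one_le_pow_of_one_le' hc 2))
    have hle : v.valuation L y ≤ exp (-1 : ℤ) := by
      rcases eq_or_ne (v.valuation L y) 0 with h0 | h0
      · rw [h0]; exact zero_le
      · rw [← WithZero.exp_log h0] at hylt ⊢
        rw [← WithZero.exp_zero, WithZero.exp_lt_exp] at hylt
        rw [WithZero.exp_le_exp]; omega
    have hle2 : v.intValuation (p * Y') ≤ exp (-((2:ℕ) : ℤ)) := by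
      rw [← HeightOneSpectrum.valuation_of_algebraMap (K := L), hy]
      calc _ ≤ (exp (-1 : ℤ))^2 := by gcongr
        _ = _ := by rw [← WithZero.exp_nsmul]; norm_num
    rw [HeightOneSpectrum.intValuation_le_pow_iff_mem] at hle2
    have hd : p ^ 2 ∣ p * Y' := by
      rw [← Ideal.mem_span_singleton, ← Ideal.span_singleton_pow]; exact hle2
    rw [pow_two, mul_dvd_mul_iff_left hpp.ne_zero] at hd
    obtain ⟨Z, rfl⟩ := hd
    have hZ : Z ≠ 0 := right_ne_zero_of_mul hY'
    obtain ⟨ε, e, z, hz⟩ := ih Z ⟨hZ, p * p, fun h => hp.not_isUnit (isUnit_of_mul_isUnit_left h), by ring⟩ hZ (by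
      intro v hv
      obtain ⟨y, hy⟩ := H v hv
      refine ⟨y / algebraMap (𝓞 L) L p, ?_⟩
      have h0 : v.valuation L (algebraMap (𝓞 L) L p) ≠ 0 := by
        rw [Valuation.ne_zero_iff]
        simpa using hpp.ne_zero
      rw [map_div₀, div_pow, ← hy, map_mul, map_mul, map_mul, map_mul, eq_div_iff (pow_ne_zero _ h0)]
      rw [pow_two, mul_comm, mul_assoc])
    exact ⟨ε, e, p * z, by rw [hz]; ring⟩

lemma LD.square_core (Y i : 𝓞 L) (hY : Y ≠ 0)
    (H : ∀ v : HeightOneSpectrum (𝓞 L), (10 : 𝓞 L) ∉ v.asIdeal →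
      ∃ y : L, v.valuation L (algebraMap (𝓞 L) L Y) = (v.valuation L y) ^ 2)
    (hN : ∃ r : ℚ, Algebra.norm ℚ (algebraMap (𝓞 L) L Y) = r ^ 2) (hi : (2 : 𝓞 L) ∣ Y * i ^ 2 - 1) :
    ∃ t : 𝓞 L, Y = t ^ 2 := by
  have hpow := D.p_pow
  have habs := D.abs5
  have hρ : Prime (D.p ^ 2 + 1) := by
    have h0 : D.p ^ 2 + 1 ≠ 0 := by
      intro h; rw [h] at habs; simp at habs
    rw [← Ideal.span_singleton_prime h0]
    exact Ideal.isPrime_of_irreducible_absNorm (by rw [habs]; exact (by norm_num : Nat.Prime 5))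
  obtain ⟨ε, e, z, hz⟩ := D.decomp (D.p ^ 2 + 1) hρ Y hY (by
    intro v hv
    by_cases h10 : (10 : 𝓞 L) ∈ v.asIdeal
    · refine ⟨1, ?_⟩
      have hvp := v.isPrime
      rw [map_one, one_pow, HeightOneSpectrum.valuation_eq_one_iff_notMem]
      intro hYv
      rw [show (10 : 𝓞 L) = 2 * 5 by norm_num] at h10
      rcases hvp.mem_or_mem h10 with h | h
      · apply hvp.ne_top
        rw [Ideal.eq_top_iff_one]
        obtain ⟨r, hr⟩ := hi
        have : (1 : 𝓞 L) = Y * i^2 - 2 * r := by rw [← hr]; ring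
        rw [this]
        exact Ideal.sub_mem _ (Ideal.mul_mem_right _ _ hYv) (Ideal.mul_mem_right _ _ h)
      · apply hv
        apply hvp.mem_of_pow_mem 5
        have : (D.p^2+1)^5 = 5 * (1 + D.p^8+2*D.p^6+2*D.p^4+D.p^2) := by
          linear_combination (D.p^5+2) * hpow
        rw [this]; exact Ideal.mul_mem_right _ _ h
    · exact H v h10)
  obtain ⟨r, hr⟩ := hN
  have hYL : algebraMap (𝓞 L) L Y ≠ 0 := by simpa using hY
  have hr0 : r ≠ 0 := by
    rintro rfl
    rw [zero_pow two_ne_zero, Algebra.norm_eq_zero_iff] at hr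
    exact hYL hr
  have hnρ : Algebra.norm ℚ (algebraMap (𝓞 L) L (D.p^2+1)) ^ 2 = 25 := by
    have h1 : |Algebra.norm ℤ (D.p^2+1)| = 5 := by
      rw [Ideal.absNorm_span_singleton] at habs
      rw [Int.abs_eq_natAbs, habs]; rfl
    have h2 : Algebra.norm ℚ (algebraMap (𝓞 L) L (D.p^2+1)) = ((Algebra.norm ℤ (D.p^2+1) : ℤ) : ℚ) :=
      (Algebra.coe_norm_int (K := L) _).symm
    rw [h2, ← sq_abs, ← Int.cast_abs, h1]; norm_num
  have hnε : Algebra.norm ℚ (algebraMap (𝓞 L) L ε) ^ 2 = 1 := by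
    have h1 : IsUnit (Algebra.norm ℤ (ε : 𝓞 L)) := ε.isUnit.map _
    have h2 : Algebra.norm ℚ (algebraMap (𝓞 L) L ε) = ((Algebra.norm ℤ (ε : 𝓞 L) : ℤ) : ℚ) :=
      (Algebra.coe_norm_int (K := L) _).symm
    rw [h2]
    rcases Int.isUnit_iff.1 h1 with h | h <;> rw [h] <;> norm_num
  have hnz : Algebra.norm ℚ (algebraMap (𝓞 L) L z) ≠ 0 := by
    rw [Ne, Algebra.norm_eq_zero_iff]
    intro h
    apply hYL
    rw [hz]; simp [h]
  have hnY : r ^ 2 = Algebra.norm ℚ (algebraMap (𝓞 L) L ε) * Algebra.norm ℚ (algebraMap (𝓞 L) L (D.p^2+1)) ^ e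
      * Algebra.norm ℚ (algebraMap (𝓞 L) L z) ^ 2 := by
    rw [← hr]; conv_lhs => rw [hz]
    simp only [map_mul, map_pow]
  generalize Algebra.norm ℚ (algebraMap (𝓞 L) L (D.p^2+1)) = nρ at *
  generalize hne : Algebra.norm ℚ (algebraMap (𝓞 L) L ε) = nε at *
  generalize Algebra.norm ℚ (algebraMap (𝓞 L) L z) = nz at *
  have he : Even e := by
    by_contra hodd
    obtain ⟨k, rfl⟩ := Nat.not_even_iff_odd.1 hodd
    have h1 : nε * nρ = (r / (nz * 5^k))^2 := by
      have : nρ ^ (2*k) = 5^(2*k) := by rw [pow_mul, hnρ, pow_mul]; norm_num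
      rw [pow_succ nρ, this] at hnY
      field_simp
      rw [hnY]; ring
    have h2 : (nε * nρ)^2 = 5^2 := by rw [mul_pow, hnρ, hnε]; norm_num
    have h3 : nε * nρ = 5 := by
      rcases sq_eq_sq_iff_eq_or_eq_neg.1 h2 with h | h
      · exact h
      · rw [h] at h1; nlinarith [sq_nonneg (r / (nz * 5^k))]
    rw [h3] at h1
    have hirr := (show Nat.Prime 5 by norm_num).irrational_sqrt
    apply hirr
    refine ⟨|r / (nz * 5^k)|, ?_⟩
    rw [eq_comm, Real.sqrt_eq_iff_mul_self_eq (by norm_num) (by positivity)]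
    rw [← Rat.cast_mul, abs_mul_abs_self, ← pow_two, ← h1]; norm_num
  obtain ⟨k, rfl⟩ := he
  have hpos : 0 < nε := by
    have h1 : 0 < r^2 := by positivity
    rw [hnY, ← two_mul, pow_mul, hnρ] at h1
    by_contra hc
    push Not at hc
    have h2 : (0:ℚ) ≤ 25^k * nz^2 := by positivity
    nlinarith [mul_nonneg (neg_nonneg.2 hc) h2]
  obtain ⟨t, ht⟩ := D.unit_square ε (by rw [hne]; exact hpos) (ε * ((D.p^2+1)^k * z) * i) (by
    obtain ⟨s, hs⟩ := hi
    refine ⟨-ε * s, ?_⟩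
    rw [hz] at hs
    linear_combination (-ε : 𝓞 L) * hs)
  exact ⟨t * ((D.p^2+1)^k * z), by rw [hz, ht]; ring⟩
end
end FQ

namespace FQ
open WithZero NumberField IsDedekindDomain

lemma Z2.den (x : Z2) : ∃ M m : ℤ, Odd M ∧ (M : ℚ) * x = m := by
  refine ⟨(x : ℚ).den, (x : ℚ).num, ?_, ?_⟩
  · by_contra hc
    rw [Int.not_odd_iff_even] at hc
    have h1 : (((x : ℚ).den : ℤ) : Z2) * x = (((x : ℚ).num : ℤ) : Z2) := by
      apply Z2.ext_rat
      push_cast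
      exact Rat.den_mul_eq_num _
    have h2 := congrArg res h1
    have h4 : ((((x : ℚ).den : ℤ) : ℤ) : ZMod 2) = 0 := (ZMod.intCast_zmod_eq_zero_iff_dvd _ _).2 hc.two_dvd
    rw [map_mul, map_intCast, map_intCast, h4, zero_mul, eq_comm] at h2
    have h3 : (2:ℤ) ∣ (x:ℚ).num := by
      exact_mod_cast (ZMod.intCast_zmod_eq_zero_iff_dvd _ _).1 h2
    have hcop := (x : ℚ).reduced
    have : 2 ∣ Nat.gcd (x:ℚ).num.natAbs (x:ℚ).den := Nat.dvd_gcd (Int.natCast_dvd.1 h3) (by exact_mod_cast hc.two_dvd)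
    rw [hcop.gcd_eq_one] at this
    omega
  · push_cast; exact Rat.den_mul_eq_num _

lemma norm_sq_aux {c δ Q0 Q1 Q2 u w b0 b1 : ℚ} (hc : c ≠ 0)
    (F0 : Q0^2 = c*(1+4*δ^5)) (F1 : 2*Q0*Q1 = -20*c*δ^4) (F2 : Q1^2+2*Q0*Q2 = 40*c*δ^3)
    (F3 : 2*Q1*Q2 = -40*c*δ^2) (F4 : Q2^2 = 20*c*δ) (h : MP Q0 Q1 Q2 c u w b0 b1) :
    ∃ r : ℚ, (δ^2+u*δ+w)^5 + 1/4*((2*δ+u)^5-5*(2*δ+u)^3*(δ^2+u*δ+w)+5*(2*δ+u)*(δ^2+u*δ+w)^2)+1/16 = r^2 := by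
  obtain ⟨q0, q1, q2, m0, m1, m2, m3, m4⟩ := h
  set β0 := 2*b0+Q0-Q2*w with hβ0
  set β1 := 2*b1+Q1-Q2*u with hβ1
  set f0 := c*((1+4*δ^5) - w*40*δ^3 + u*w*(-40*δ^2) - w*(u^2-w)*20*δ - 4*w*(u^3-2*u*w)) with hf0
  set f1 := c*(-20*δ^4 - u*40*δ^3 + (u^2-w)*(-40*δ^2) + (-u^3+2*u*w)*20*δ - 4*(u^4-3*u^2*w+w^2)) with hf1
  have a0 : β0^2 - β1^2*w = f0 := by
    rw [hβ0, hβ1, hf0]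
    linear_combination 4*(m0 - w*m2 + u*w*m3 - w*(u^2-w)*m4) + F0 - w*F2 + u*w*F3 - w*(u^2-w)*F4
  have a1 : 2*β0*β1 - β1^2*u = f1 := by
    rw [hβ0, hβ1, hf1]
    linear_combination 4*(m1 - u*m2 + (u^2-w)*m3 + (-u^3+2*u*w)*m4) + F1 - u*F2 + (u^2-w)*F3 + (-u^3+2*u*w)*F4
  refine ⟨(β0^2-β0*β1*u+β1^2*w)/(4*c), ?_⟩
  have h1 : (β0^2-β0*β1*u+β1^2*w)^2 = f0^2-f0*f1*u+f1^2*w := by rw [← a0, ← a1]; ring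
  rw [div_pow, h1, hf0, hf1]
  field_simp
  ring

lemma PE_of_MP {L : Type*} [Field L] {c δ Q0 Q1 Q2 u w b0 b1 θ0 : L} (h4 : 4*θ0^5 = 1)
    (F0 : Q0^2 = c*(1+4*δ^5)) (F1 : 2*Q0*Q1 = -20*c*δ^4) (F2 : Q1^2+2*Q0*Q2 = 40*c*δ^3)
    (F3 : 2*Q1*Q2 = -40*c*δ^2) (F4 : Q2^2 = 20*c*δ) (h : MP Q0 Q1 Q2 c u w b0 b1) :
    ∃ q0 q1 q2 q3 q4 B0 B1 B2 B3, PE ((δ+θ0)^2+u*(δ+θ0)+w) (2*(δ+θ0)+u) 1 q0 q1 q2 q3 q4 B0 B1 B2 B3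
      (-20*c*θ0^4) (-40*c*θ0^3) (-40*c*θ0^2) (-20*c*θ0) (-4*c) := by
  obtain ⟨q0, q1, q2, m0, m1, m2, m3, m4⟩ := h
  set θ := δ+θ0 with hθ
  refine ⟨4*(c*θ^3+q2*θ^2+q1*θ+q0), 4*(3*c*θ^2+2*q2*θ+q1), 4*(3*c*θ+q2), 4*c, 0,
    2*(b0+b1*θ)+Q0+Q1*θ+Q2*θ^2, 2*b1+Q1+2*Q2*θ, Q2, 0, ?_⟩
  have hδ : δ = θ - θ0 := by rw [hθ]; ring
  clear_value θ
  subst hδ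
  constructor
  · linear_combination (-4)*(m0+θ*m1+θ^2*m2+θ^3*m3+θ^4*m4) - (F0+θ*F1+θ^2*F2+θ^3*F3+θ^4*F4) + c*h4
  · linear_combination (-4)*(m1+2*θ*m2+3*θ^2*m3+4*θ^3*m4) - (F1+2*θ*F2+3*θ^2*F3+4*θ^3*F4)
  · linear_combination (-4)*(m2+3*θ*m3+6*θ^2*m4) - (F2+3*θ*F3+6*θ^2*F4)
  · linear_combination (-4)*(m3+4*θ*m4) - (F3+4*θ*F4)
  · linear_combination (-4)*(m4) - (F4)
  · ring
  · ring

section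
variable {L : Type*} [Field L] [NumberField L] {π : L} (D : LD L π)
include D

lemma LD.sq (δ : ℤ) (hδ : δ = 0 ∨ δ = 1) {Q0 Q1 Q2 c u w b0 b1 : Z2} (hc : c = 1 ∨ c = 5)
    (F0 : Q0^2 = c*(1+4*δ^5)) (F1 : 2*Q0*Q1 = -20*c*δ^4) (F2 : Q1^2+2*Q0*Q2 = 40*c*δ^3)
    (F3 : 2*Q1*Q2 = -40*c*δ^2) (F4 : Q2^2 = 20*c*δ) (hu : res u = 0) (hw : res w = 0)
    (h : MP Q0 Q1 Q2 c u w b0 b1) :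
    ∃ σ : L, σ^2 = ((δ:L) + π⁻¹^2)^2 + algebraMap ℚ L u * ((δ:L) + π⁻¹^2) + algebraMap ℚ L w := by
  obtain ⟨u, rfl⟩ := even_of_res hu
  obtain ⟨w, rfl⟩ := even_of_res hw
  have hπ := D.ne_zero
  have hθ4 : 4*(π⁻¹^2)^5 = 1 := by
    have h := D.pow
    field_simp
    linear_combination (-π^5-2)*h
  set φ : Z2 →+* L := (algebraMap ℚ L).comp Z2.subtype with hφ
  have hφa : ∀ x : Z2, algebraMap ℚ L x = φ x := fun x => rfl
  obtain ⟨r, hr⟩ : ∃ r : ℚ, Algebra.norm ℚ (((δ:L) + π⁻¹^2)^2 + φ (2*u) * ((δ:L) + π⁻¹^2) + φ (2*w)) = r^2 := by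
    obtain ⟨r, hr⟩ := norm_sq_aux (c := c) (δ := δ) (by rcases hc with rfl | rfl <;> norm_num)
      (by exact_mod_cast congrArg Z2.subtype F0)
      (by exact_mod_cast congrArg Z2.subtype F1) (by exact_mod_cast congrArg Z2.subtype F2)
      (by exact_mod_cast congrArg Z2.subtype F3) (by exact_mod_cast congrArg Z2.subtype F4) (h.map Z2.subtype)
    refine ⟨r, ?_⟩
    rw [← hr, ← D.normm2]
    congr 1
    simp only [map_add, map_mul, map_pow, map_intCast, map_ofNat]
    simp only [Subring.subtype_apply, hφa]
    ring
  obtain ⟨q0, q1, q2, q3, q4, B0, B1, B2, B3, hPE⟩ := PE_of_MP (c := φ c) (δ := (δ : L)) hθ4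
    (by have := congrArg φ F0; simp only [map_mul, map_pow, map_add, map_neg, map_intCast, map_ofNat, map_one] at this; exact this) (by have := congrArg φ F1; simp only [map_mul, map_pow, map_add, map_neg, map_intCast, map_ofNat, map_one] at this; exact this) (by have := congrArg φ F2; simp only [map_mul, map_pow, map_add, map_neg, map_intCast, map_ofNat, map_one] at this; exact this)
    (by have := congrArg φ F3; simp only [map_mul, map_pow, map_add, map_neg, map_intCast, map_ofNat, map_one] at this; exact this) (by have := congrArg φ F4; simp only [map_mul, map_pow, map_add, map_neg, map_intCast, map_ofNat, map_one] at this; exact this) (h.map φ)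
  obtain ⟨M1, m1, hM1, hm1⟩ := Z2.den u
  obtain ⟨M2, m2, hM2, hm2⟩ := Z2.den w
  rw [hφa, hφa]
  set A := ((δ:L) + π⁻¹^2)^2 + φ (2*u) * ((δ:L) + π⁻¹^2) + φ (2*w) with hA
  have hφ1 : (M1 : L) * φ u = m1 := by
    have := congrArg (algebraMap ℚ L) hm1
    rwa [map_mul, map_intCast, map_intCast] at this
  have hφ2 : (M2 : L) * φ w = m2 := by
    have := congrArg (algebraMap ℚ L) hm2
    rwa [map_mul, map_intCast, map_intCast] at this
  set M := M1 * M2 with hM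
  have hMo : Odd M := hM1.mul hM2
  have hM0 : M ≠ 0 := by rintro h0; rw [h0] at hMo; simp at hMo
  have hML : (M : L) ≠ 0 := by exact_mod_cast hM0
  set Y : 𝓞 L := (M*(1+δ*D.p^2))^2 + 2*(M*M2*m1*D.p^2*(1+δ*D.p^2)+M*M1*m2*D.p^4) with hY
  have hYA : algebraMap (𝓞 L) L Y = (M*π^2)^2*A := by
    rw [hY, hA]
    simp only [map_add, map_mul, map_pow, map_intCast, map_ofNat, D.coe_p, map_one]
    rw [← hφ1, ← hφ2, hM]
    push_cast
    field_simp
    ring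
  have hMπ : (M:L)*π^2 ≠ 0 := mul_ne_zero hML (pow_ne_zero _ hπ)
  by_cases hY0 : Y = 0
  · refine ⟨0, ?_⟩
    rw [hY0, map_zero, eq_comm, mul_eq_zero] at hYA
    rcases hYA with h | h
    · exact absurd h (pow_ne_zero _ hMπ)
    · rw [h]; norm_num
  have hp5 := D.p_pow
  obtain ⟨t, ht⟩ := D.square_core Y (1 - δ*D.p^2+δ*D.p^4) hY0 (by
    intro v hv
    set V := v.valuation L with hV
    have hvp := v.isPrime
    have hmem : ∀ a b : 𝓞 L, a * b = 10 → V (algebraMap (𝓞 L) L a) = 1 := by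
      intro a b hab
      rw [hV, v.valuation_eq_one_iff_notMem]
      intro ha
      apply hv
      rw [← hab]
      exact Ideal.mul_mem_right _ _ ha
    have v2 : V 2 = 1 := by have := hmem 2 5 (by norm_num); rwa [map_ofNat] at this
    have v5 : V 5 = 1 := by have := hmem 5 2 (by norm_num); rwa [map_ofNat] at this
    have v4 : V 4 = 1 := by rw [show (4:L) = 2*2 by norm_num, map_mul, v2, one_mul]
    have v20 : V 20 = 1 := by rw [show (20:L) = 4*5 by norm_num, map_mul, v4, v5, one_mul]
    have v40 : V 40 = 1 := by rw [show (40:L) = 20*2 by norm_num, map_mul, v20, v2, one_mul]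
    have vπ : V π = 1 := by
      have := hmem D.p (5*D.p^4) (by linear_combination 5*hp5)
      rwa [D.coe_p] at this
    have vc : V (φ c) = 1 := by
      rcases hc with rfl | rfl
      · simp
      · rw [map_ofNat]; exact v5
    obtain ⟨y, hy⟩ := hPE.parity V (by simp [v20, vc, vπ]) (by simp [v40, vc, vπ]) (by simp [v40, vc, vπ])
      (by simp [v20, vc, vπ]) (by simp [v4, vc])
    refine ⟨M*π^2*y, ?_⟩
    rw [hYA, map_mul, map_pow, map_mul, hy, ← mul_pow, map_mul, map_mul]) ⟨Algebra.norm ℚ (M*π^2)*r, by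
      rw [hYA, map_mul, map_pow, hr, mul_pow]⟩ (by
    obtain ⟨m, hm⟩ := hMo
    have hm' : (M : 𝓞 L) = 2*m+1 := by exact_mod_cast congrArg (Int.cast : ℤ → 𝓞 L) hm
    set Z : 𝓞 L := M*M2*m1*D.p^2*(1+δ*D.p^2)+M*M1*m2*D.p^4 with hZ
    clear_value Z
    rw [hY, hm']
    rcases hδ with rfl | rfl
    · refine ⟨2*m^2+2*m+Z, ?_⟩
      push_cast
      ring
    · refine ⟨(2*m^2+2*m)*(1+2*D.p)^2 + 2*D.p^2+2*D.p+Z*(1-D.p^2+D.p^4)^2, ?_⟩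
      push_cast
      have e1 : (1+D.p^2)*(1-D.p^2+D.p^4) = 1+2*D.p := by linear_combination D.p*hp5
      linear_combination (2*m+1)^2*((1+D.p^2)*(1-D.p^2+D.p^4)+1+2*D.p)*e1)
  refine ⟨algebraMap (𝓞 L) L t / (M*π^2), ?_⟩
  rw [ht, map_pow] at hYA
  rw [div_pow, hYA]
  field_simp
end
end FQ

namespace FQ
open NumberField Polynomial

lemma LD.SC {L : Type*} [Field L] [NumberField L] {π : L} (D : LD L π) (P : Par) (δ : ℤ)
    (hδ : δ = 0 ∨ δ = 1) (hc : P.c = 1 ∨ P.c = 5)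
    (F0 : P.Q0^2 = P.c*(1+4*δ^5)) (F1 : 2*P.Q0*P.Q1 = -20*P.c*δ^4) (F2 : P.Q1^2+2*P.Q0*P.Q2 = 40*P.c*δ^3)
    (F3 : 2*P.Q1*P.Q2 = -40*P.c*δ^2) (F4 : P.Q2^2 = 20*P.c*δ) : SC P := by
  have hπ := D.ne_zero
  have hθ4 : (π⁻¹^2)^5 = algebraMap ℚ L (1/4) := by
    have h := D.pow
    rw [← pow_mul, mul_comm, pow_mul, inv_pow, h]; norm_num
  set φ : Z2 →+* L := (algebraMap ℚ L).comp Z2.subtype with hφ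
  have hφa : ∀ x : Z2, algebraMap ℚ L x = φ x := fun x => rfl
  have hmin0 := minpoly_fifth D.fin hθ4 nfq
  have hmin : (minpoly ℚ ((δ:L)+π⁻¹^2)).natDegree = 5 := by
    have h1 := minpoly.add_algebraMap (A := ℚ) (π⁻¹^2) (δ:ℚ)
    rw [add_comm, ← map_intCast (algebraMap ℚ L), h1, hmin0, natDegree_comp]
    rw [natDegree_X_pow_sub_C, natDegree_X_sub_C]
  have hθ0 : (δ:L)+π⁻¹^2 ≠ 0 := by
    intro h
    rw [h] at hmin
    simp at hmin
  have hf : (algebraMap ℚ L P.Q0 + algebraMap ℚ L P.Q1 * ((δ:L)+π⁻¹^2) + algebraMap ℚ L P.Q2 * ((δ:L)+π⁻¹^2)^2)^2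
      = 4 * algebraMap ℚ L P.c * ((δ:L)+π⁻¹^2)^5 := by
    have f0 := congrArg φ F0
    have f1 := congrArg φ F1
    have f2 := congrArg φ F2
    have f3 := congrArg φ F3
    have f4 := congrArg φ F4
    simp only [map_mul, map_pow, map_add, map_neg, map_intCast, map_ofNat, map_one] at f0 f1 f2 f3 f4
    rw [hφa, hφa, hφa, hφa]
    have h4 : 4*(π⁻¹^2)^5 = 1 := by rw [hθ4]; norm_num
    set θ := (δ:L)+π⁻¹^2 with hθ
    have hδ' : (δ:L) = θ - π⁻¹^2 := by rw [hθ]; ring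
    rw [hδ'] at f0 f1 f2 f3 f4
    linear_combination f0+θ*f1+θ^2*f2+θ^3*f3+θ^4*f4 - φ P.c*h4
  apply lemmaS
  refine halvHyp_of_square P D.fin ((δ:L)+π⁻¹^2) ((algebraMap ℚ L P.Q0 + algebraMap ℚ L P.Q1 * ((δ:L)+π⁻¹^2) + algebraMap ℚ L P.Q2 * ((δ:L)+π⁻¹^2)^2)/(2*((δ:L)+π⁻¹^2)^2)) hmin ?_ hf ?_
  · rw [div_pow, hf]; field_simp; ring
  · intro u w b0 b1 hu hw _ _ h
    exact D.sq δ hδ hc F0 F1 F2 F3 F4 hu hw h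

lemma irr : Irreducible (X^5 - C (2:ℚ)) :=
  X_pow_sub_C_irreducible_of_prime (by norm_num) (fun b h => nf2 b h)

instance : Fact (Irreducible (X^5 - C (2:ℚ))) := ⟨irr⟩

lemma LDinst : ∃ (L : Type) (_ : Field L) (_ : NumberField L) (π : L), LD L π := by
  have h0 : (X^5 - C (2:ℚ)) ≠ 0 := irr.ne_zero
  have pb := AdjoinRoot.powerBasis h0
  have : FiniteDimensional ℚ (AdjoinRoot (X^5 - C (2:ℚ))) := (AdjoinRoot.powerBasis h0).finite
  have : CharZero (AdjoinRoot (X^5 - C (2:ℚ))) := algebraRat.charZero _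
  refine ⟨AdjoinRoot (X^5 - C (2:ℚ)), inferInstance, ⟨⟩, AdjoinRoot.root _, ⟨?_, ?_⟩⟩
  · have h1 := (AdjoinRoot.powerBasis h0).finrank
    rw [AdjoinRoot.powerBasis_dim, natDegree_X_pow_sub_C] at h1
    convert h1
  · have := AdjoinRoot.eval₂_root (X^5 - C (2:ℚ))
    simp [sub_eq_zero] at this
    exact this

lemma res_odd (n : ℤ) (h : Odd n) : res (n : Z2) = 1 := by
  rw [map_intCast]
  obtain ⟨k, rfl⟩ := h
  push_cast
  rw [show (2 : ZMod 2) = 0 from rfl]; ring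
lemma res_even (n : ℤ) (h : Even n) : res (n : Z2) = 0 := by
  rw [map_intCast]
  exact (ZMod.intCast_zmod_eq_zero_iff_dvd _ _).2 h.two_dvd

noncomputable def PC : Par := ⟨((-1:ℤ):Z2), ((0:ℤ):Z2), ((0:ℤ):Z2), ((1:ℤ):Z2), res_odd _ (by decide), res_even _ (by decide), res_even _ (by decide), res_odd _ (by decide)⟩
noncomputable def PEE : Par := ⟨((5:ℤ):Z2), ((-10:ℤ):Z2), ((10:ℤ):Z2), ((5:ℤ):Z2), res_odd _ (by decide), res_even _ (by decide), res_even _ (by decide), res_odd _ (by decide)⟩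

lemma SC_C : SC PC := by
  obtain ⟨L, _, _, π, D⟩ := LDinst
  apply D.SC PC 0 (by simp) (by left; simp [PC]) <;> simp [PC]
lemma SC_E : SC PEE := by
  obtain ⟨L, _, _, π, D⟩ := LDinst
  apply D.SC PEE 1 (by simp) (by right; simp [PEE]) <;> simp [PEE] <;> norm_num

lemma c5 : ((5:Z2):ℚ) = 5 := rfl
lemma c10 : ((10:Z2):ℚ) = 10 := rfl

lemma root_C (x : ℚ) : ((PC.Q0:ℚ) + PC.Q1*x + PC.Q2*x^2)^2 - 4*PC.c*x^5 ≠ 0 := by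
  intro h
  simp [PC] at h
  exact nfq x (by linarith)
lemma root_E (x : ℚ) : ((PEE.Q0:ℚ) + PEE.Q1*x + PEE.Q2*x^2)^2 - 4*PEE.c*x^5 ≠ 0 := by
  intro h
  simp [PEE, c5, c10] at h
  exact nfq (x-1) (by linear_combination (-1/20)*h)

theorem J1C {x e : ℚ} (h : e^2 - e + x^5 = 0) : x = 0 := by
  by_contra hx
  exact J1 SC_C root_C hx (e := e) (by simp [PC]; linear_combination h)
theorem J1E {x e : ℚ} (h : e^2 + (5-10*x+10*x^2)*e + 5*x^5 = 0) : x = 0 := by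
  by_contra hx
  exact J1 SC_E root_E hx (e := e) (by simp [PEE, c5, c10]; linear_combination h)
theorem J2C {u w b0 b1 : ℚ} (h : X^2 + C u * X + C w ∣ (C b0 + C b1 * X)^2 - (C b0 + C b1*X) + X^5) : u = 0 ∧ w = 0 := by
  apply J2 SC_C root_C (b0 := b0) (b1 := b1)
  convert h using 1
  simp [PC, curveP]; ring
theorem J2E {u w b0 b1 : ℚ} (h : X^2 + C u * X + C w ∣
    (C b0 + C b1 * X)^2 + (5 - 10*X+10*X^2)*(C b0 + C b1*X) + 5*X^5) : u = 0 ∧ w = 0 := by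
  apply J2 SC_E root_E (b0 := b0) (b1 := b1)
  convert h using 1
  have t10 : (C 10 : ℚ[X]) = 10 := rfl
  have t5 : (C 5 : ℚ[X]) = 5 := rfl
  simp [PEE, curveP, kap_apply, c5, c10]
  rw [t5, t10]; ring
end FQ

namespace FQ
open NumberField Polynomial

section
variable {K : Type*} [Field K] [NumberField K]

/-- real version of an embedding -/
noncomputable def toReal (htr : ∀ φ : K →+* ℂ, ∀ x : K, (φ x).im = 0) (φ : K →+* ℂ) : K →+* ℝ where
  toFun x := (φ x).re
  map_one' := by simp
  map_zero' := by simp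
  map_add' := by intro x y; simp
  map_mul' := by intro x y; simp [htr φ]

lemma toReal_coe (htr : ∀ φ : K →+* ℂ, ∀ x : K, (φ x).im = 0) (φ : K →+* ℂ) (x : K) :
    ((toReal htr φ x : ℝ) : ℂ) = φ x := by
  apply Complex.ext
  · simp [toReal]
  · simp [htr φ]

lemma real_homs (htr : ∀ φ : K →+* ℂ, ∀ x : K, (φ x).im = 0) {n : ℕ} (hn : Module.finrank ℚ K = n) :
    ∃ e : Fin n → (K →+* ℝ), Function.Injective e ∧ ∀ x, ∏ i, e i x = (Algebra.norm ℚ x : ℝ) := by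
  have hc : Fintype.card (K →+* ℂ) = n := by rw [Embeddings.card, hn]
  let q := (Fintype.equivFinOfCardEq hc).symm
  refine ⟨fun i => toReal htr (q i), ?_, ?_⟩
  · intro i j hij
    apply q.injective
    ext x
    rw [← toReal_coe htr, ← toReal_coe htr (q j)]
    simp only at hij
    rw [hij]
  · intro x
    have h1 := Algebra.norm_eq_prod_embeddings ℚ ℂ x
    have h2 : ∏ σ : K →ₐ[ℚ] ℂ, σ x = ∏ i, q i x := by
      rw [← Equiv.prod_comp (q.trans (RingHom.equivRatAlgHom K ℂ))]
      rfl
    rw [h2] at h1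
    apply Complex.ofReal_injective
    push_cast
    rw [Finset.prod_congr rfl (fun i _ => toReal_coe htr (q i) x), ← h1]
    simp

lemma rat_of_const (htr : ∀ φ : K →+* ℂ, ∀ x : K, (φ x).im = 0) (y : K)
    (h : ∀ φ ψ : K →+* ℝ, φ y = ψ y) : ∃ r : ℚ, algebraMap ℚ K r = y := by
  obtain ⟨φ0⟩ : Nonempty (K →+* ℂ) := inferInstance
  have hint : IsIntegral ℚ y := IsIntegral.of_finite ℚ y
  have hroots : ∀ z : ℂ, z ∈ (minpoly ℚ y).rootSet ℂ → z = φ0 y := by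
    intro z hz
    rw [← Algebra.IsAlgebraic.range_eval_eq_rootSet_minpoly (K := K) ℂ y] at hz
    obtain ⟨ψ, hψ⟩ := hz
    have := h (toReal htr ψ) (toReal htr φ0)
    have h2 := congrArg (fun t : ℝ => (t:ℂ)) this
    simp only [toReal_coe] at h2
    rw [← hψ, ← h2]; rfl
  have hcard : Fintype.card ((minpoly ℚ y).rootSet ℂ) = (minpoly ℚ y).natDegree :=
    card_rootSet_eq_natDegree (minpoly.irreducible hint).separable (IsAlgClosed.splits _)
  have hle : Fintype.card ((minpoly ℚ y).rootSet ℂ) ≤ 1 := by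
    rw [Fintype.card_le_one_iff]
    intro a b
    apply Subtype.ext
    rw [hroots _ a.2, hroots _ b.2]
  rw [hcard] at hle
  have hd : (minpoly ℚ y).degree = 1 := by
    have := minpoly.natDegree_pos hint
    rw [degree_eq_natDegree (minpoly.ne_zero hint)]
    have : (minpoly ℚ y).natDegree = 1 := by omega
    rw [this]; rfl
  exact minpoly.mem_range_of_degree_eq_one ℚ y hd

lemma rat_of_odd_pow (htr : ∀ φ : K →+* ℂ, ∀ x : K, (φ x).im = 0) (y : K) {k : ℕ} (hk : Odd k) (r : ℚ)
    (h : y ^ k = algebraMap ℚ K r) : ∃ r : ℚ, algebraMap ℚ K r = y := by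
  apply rat_of_const htr
  intro φ ψ
  apply hk.strictMono_pow.injective
  simp only
  rw [← map_pow, ← map_pow, h]
  simp

lemma mem_of_pos (htr : ∀ φ : K →+* ℂ, ∀ x : K, (φ x).im = 0) (F : IntermediateField ℚ K) (Y : K)
    (hY : Y ^ 2 ∈ F) (hpos : ∀ φ : K →+* ℝ, 0 < φ Y) : Y ∈ F := by
  by_contra hc
  obtain ⟨φ0⟩ : Nonempty (K →+* ℂ) := inferInstance
  letI : Algebra F ℂ := (φ0.comp F.val.toRingHom).toAlgebra
  have halg : ∀ x : F, algebraMap F ℂ x = φ0 x := fun x => rfl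
  have hmin : minpoly F Y = X ^ 2 - C ⟨Y^2, hY⟩ := by
    symm
    apply minpoly.eq_of_irreducible_of_monic
    · apply (X_pow_sub_C_irreducible_of_prime Nat.prime_two)
      intro b hb
      have h1 : (b : K)^2 = Y^2 := congrArg Subtype.val hb
      rcases sq_eq_sq_iff_eq_or_eq_neg.1 h1 with h | h
      · exact hc (h ▸ b.2)
      · exact hc (by have := F.neg_mem b.2; rw [h] at this; simpa using this)
    · simp [aeval_def]

    · exact monic_X_pow_sub_C _ (by norm_num)
  have hmem : -(φ0 Y) ∈ (minpoly F Y).rootSet ℂ := by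
    rw [mem_rootSet]
    refine ⟨minpoly.ne_zero (IsIntegral.of_finite F Y), ?_⟩
    rw [hmin]
    simp [halg]
  rw [← Algebra.IsAlgebraic.range_eval_eq_rootSet_minpoly (K := K) ℂ Y] at hmem
  obtain ⟨ψ, hψ⟩ := hmem
  have h1 := hpos (toReal htr φ0)
  have h2 := hpos (toReal htr ψ.toRingHom)
  have h3 : (toReal htr ψ.toRingHom) Y = - (toReal htr φ0) Y := by
    have : ((toReal htr ψ.toRingHom Y : ℝ) : ℂ) = ((-(toReal htr φ0 Y) : ℝ) : ℂ) := by
      rw [toReal_coe, Complex.ofReal_neg, toReal_coe]; exact hψ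
    exact Complex.ofReal_injective this
  linarith

lemma hom_ext_gen {T : K} (hT : IntermediateField.adjoin ℚ {T} = ⊤) {φ ψ : K →+* ℝ} (h : φ T = ψ T) : φ = ψ := by
  have : (RingHom.equivRatAlgHom K ℝ φ) = (RingHom.equivRatAlgHom K ℝ ψ) := by
    have hT' : Algebra.adjoin ℚ {T} = ⊤ := by
      rw [← IntermediateField.adjoin_simple_toSubalgebra_of_isAlgebraic (Algebra.IsAlgebraic.isAlgebraic T), hT]; rfl
    apply AlgHom.ext_of_adjoin_eq_top hT'
    intro x hx
    rw [Set.mem_singleton_iff.1 hx]; exact h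
  exact (RingHom.equivRatAlgHom K ℝ).injective this
end
end FQ

namespace FQ
open NumberField Polynomial

section
variable {K : Type*} [Field K] [NumberField K]

/-- data attached to one coordinate of a point -/
structure Crd (W g k : K) : Prop where
  hW : W ≠ 0
  hgk : 5 * g * k = 1
  hP : g + k * W = W^3 - 2*W^2 + 2*W
  hg : ∀ φ : K →+* ℝ, 0 < φ g
  hY : ∀ φ : K →+* ℝ, 0 < φ W * φ (k * W - g)

/-- a point on the scaled Fermat quintic -/
structure Pt (U V W : K) : Prop where
  hs : U + V + W = 2
  hk : 5 * (U*V*W) * (2 - U*V - U*W - V*W) = 1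

lemma Pt.rot {U V W : K} (h : Pt U V W) : Pt V W U := by
  constructor
  · linear_combination h.hs
  · linear_combination h.hk

lemma Pt.swap {U V W : K} (h : Pt U V W) : Pt V U W := by
  constructor
  · linear_combination h.hs
  · linear_combination h.hk

lemma Pt.crd {U V W : K} (h : Pt U V W) : Crd W (U*V*W) (2 - U*V - U*W - V*W) := by
  obtain ⟨hs, hk⟩ := h
  have hW : W ≠ 0 := by rintro rfl; simp at hk
  have hkey : ∀ φ : K →+* ℝ, 0 < φ (2 - U*V - U*W - V*W) ∧ 0 < φ (U*V*W) := by
    intro φ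
    have e1 : φ U + φ V + φ W = 2 := by
      have := congrArg φ hs
      simpa only [map_add, map_ofNat] using this
    have e2 : φ (2 - U*V - U*W - V*W) = (φ U^2 + φ V^2 + φ W^2)/2 := by
      simp only [map_sub, map_mul, map_ofNat]
      linear_combination (1/2*(-φ U - φ V - φ W) - 1) * e1
    have hW' : φ W ≠ 0 := by simpa using hW
    have e3 : 0 < φ (2 - U*V - U*W - V*W) := by rw [e2]; positivity
    refine ⟨e3, ?_⟩
    have e4 : 5 * φ (U*V*W) * φ (2 - U*V - U*W - V*W) = 1 := by
      have := congrArg φ hk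
      rw [map_mul φ (5 * (U*V*W)), map_mul φ 5 _, map_ofNat, map_one] at this
      exact this
    by_contra hc
    nlinarith
  refine ⟨hW, hk, ?_, fun φ => (hkey φ).2, ?_⟩
  · linear_combination (-W^2) * hs
  · intro φ
    have e1 : φ U + φ V + φ W = 2 := by
      have := congrArg φ hs
      simpa only [map_add, map_ofNat] using this
    have hW' : φ W ≠ 0 := by simpa using hW
    have : φ W * φ ((2 - U*V - U*W - V*W) * W - U*V*W) = (φ W)^2 * (((φ U - φ V)^2 + φ W^2)/2) := by
      simp only [map_sub, map_mul, map_ofNat]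
      linear_combination φ W^2 * (1/2*(-φ U - φ V - φ W) - 1) * e1
    rw [this]; positivity

lemma pt_of_sol (htr : ∀ φ : K →+* ℂ, ∀ x : K, (φ x).im = 0) (x y : K) (h : x^5+y^5+1 = 0) (hxy : x * y ≠ 0) :
    Pt ((y+1)/(x+y+1)) ((x+1)/(x+y+1)) ((x+y)/(x+y+1)) := by
  have he : x + y + 1 ≠ 0 := by
    intro he
    obtain ⟨φ0⟩ : Nonempty (K →+* ℂ) := inferInstance
    set φ := toReal htr φ0
    have h1 : φ x + φ y + 1 = 0 := by simpa using congrArg φ he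
    have h2 : φ x^5 + φ y^5 + 1 = 0 := by simpa using congrArg φ h
    have hx : φ x ≠ 0 := by intro h0; exact hxy (by simp [(map_eq_zero φ).1 h0])
    have hy : φ y ≠ 0 := by intro h0; exact hxy (by simp [(map_eq_zero φ).1 h0])
    have hyy : φ y = -1 - φ x := by linarith
    have h3 : φ x * φ y * (φ x^2 + φ x + 1) = 0 := by
      rw [hyy] at h2 ⊢
      linear_combination (1/5) * h2
    have h4 : φ x^2 + φ x + 1 ≠ 0 := by nlinarith [sq_nonneg (φ x + 1/2)]
    exact (mul_ne_zero (mul_ne_zero hx hy) h4) h3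
  constructor
  · field_simp; ring
  · field_simp
    linear_combination (-1:K) * h

lemma Crd.ratl {W g k : K} (h : Crd W g k) : 5*g^2 - 5*g*(W^3-2*W^2+2*W) + W = 0 := by
  linear_combination (5*g) * h.hP - (W) * h.hgk

lemma Crd.g_ne {W g k : K} (h : Crd W g k) : g ≠ 0 := by
  intro hg; have := h.hgk; simp [hg] at this

/-- The equation of the curve E -/
lemma Crd.eta {W g k : K} (h : Crd W g k) : (-5*g*W⁻¹^3)^2 + (5 - 10*W⁻¹+10*W⁻¹^2)*(-5*g*W⁻¹^3) + 5*W⁻¹^5 = 0 := by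
  have := h.ratl
  have hW := h.hW
  field_simp
  linear_combination 5 * this

lemma Crd.etaQ {W g k : K} (h : Crd W g k) : (-5*g*W⁻¹^3) + (5 - 10*W⁻¹+10*W⁻¹^2) = 5*k*W⁻¹^2 := by
  have := h.hP
  have hW := h.hW
  field_simp
  linear_combination (-5) * this

lemma Crd.mem (htr : ∀ φ : K →+* ℂ, ∀ x : K, (φ x).im = 0) {W g k : K} (h : Crd W g k) :
    -5*g*W⁻¹^3 ∈ IntermediateField.adjoin ℚ {W⁻¹} := by
  set F := IntermediateField.adjoin ℚ {W⁻¹} with hF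
  have hT : W⁻¹ ∈ F := IntermediateField.mem_adjoin_simple_self ℚ _
  have hn : ∀ n : ℕ, (n:K) ∈ F := fun n => natCast_mem F n
  have hn5 : (5:K) ∈ F := by exact_mod_cast hn 5
  have hn10 : (10:K) ∈ F := by exact_mod_cast hn 10
  have hn2 : (2:K) ∈ F := by exact_mod_cast hn 2
  have hn20 : (20:K) ∈ F := by exact_mod_cast hn 20
  have hQ : (5 - 10*W⁻¹+10*W⁻¹^2) ∈ F :=
    add_mem (sub_mem hn5 (mul_mem hn10 hT)) (mul_mem hn10 (pow_mem hT 2))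
  have hY : 2*(-5*g*W⁻¹^3) + (5 - 10*W⁻¹+10*W⁻¹^2) ∈ F := by
    apply mem_of_pos htr
    · have : (2*(-5*g*W⁻¹^3) + (5 - 10*W⁻¹+10*W⁻¹^2))^2 = (5 - 10*W⁻¹+10*W⁻¹^2)^2 - 20 * W⁻¹^5 := by
        linear_combination 4 * h.eta
      rw [this]
      exact sub_mem (pow_mem hQ 2) (mul_mem hn20 (pow_mem hT 5))
    · intro φ
      have h1 : 2*(-5*g*W⁻¹^3) + (5 - 10*W⁻¹+10*W⁻¹^2) = 5 * (W * (k*W-g)) * W⁻¹^4 := by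
        have := h.etaQ
        have hW := h.hW
        rw [two_mul, add_assoc, this]; field_simp; ring
      rw [h1]
      have hW' : φ W ≠ 0 := by simpa using h.hW
      have := h.hY φ
      rw [← map_mul] at this
      rw [map_mul, map_mul, map_pow, map_ofNat, map_inv₀]
      positivity
  have : -5*g*W⁻¹^3 = (2*(-5*g*W⁻¹^3) + (5 - 10*W⁻¹+10*W⁻¹^2) - (5 - 10*W⁻¹+10*W⁻¹^2)) / 2 := by ring
  rw [this]
  exact div_mem (sub_mem hY hQ) hn2

lemma exists_poly {T η : K} (h : η ∈ IntermediateField.adjoin ℚ {T}) :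
    ∃ p : ℚ[X], aeval T p = η ∧ p.degree < (minpoly ℚ T).degree := by
  have h1 : η ∈ (IntermediateField.adjoin ℚ {T}).toSubalgebra := h
  rw [IntermediateField.adjoin_simple_toSubalgebra_of_isAlgebraic (Algebra.IsAlgebraic.isAlgebraic T),
    Algebra.adjoin_singleton_eq_range_aeval] at h1
  obtain ⟨p, hp⟩ := h1
  have hm := minpoly.monic (IsIntegral.of_finite ℚ T)
  refine ⟨p %ₘ minpoly ℚ T, ?_, degree_modByMonic_lt p hm⟩
  rw [← hp, modByMonic_eq_sub_mul_div]
  simp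

lemma natDegree_lt_of_deg {p : ℚ[X]} {n : ℕ} (hn : 0 < n) (h : p.degree < (n:ℕ)) : p.natDegree < n := by
  by_cases hp0 : p = 0
  · simpa [hp0] using hn
  · exact (natDegree_lt_iff_degree_lt hp0).2 h

lemma Crd.deg_ne (htr : ∀ φ : K →+* ℂ, ∀ x : K, (φ x).im = 0) {W g k : K} (h : Crd W g k) :
    (minpoly ℚ W⁻¹).natDegree ≠ 1 ∧ (minpoly ℚ W⁻¹).natDegree ≠ 2 := by
  obtain ⟨p, hp, hd⟩ := exists_poly (h.mem htr)
  have hm := minpoly.monic (IsIntegral.of_finite ℚ W⁻¹)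
  have hT : W⁻¹ ≠ 0 := inv_ne_zero h.hW
  have heq := h.eta
  rw [← hp] at heq
  have hdvd : minpoly ℚ W⁻¹ ∣ p^2 + (5-10*X+10*X^2)*p + 5*X^5 := by
    apply minpoly.dvd
    simp only [map_add, map_mul, map_pow, map_sub, aeval_X, map_ofNat]
    exact heq
  constructor
  · intro h1
    have hd' : p.degree < 1 := by
      rw [degree_eq_natDegree hm.ne_zero, h1] at hd; exact_mod_cast hd
    have hpc : p = C (p.coeff 0) := eq_C_of_degree_le_zero (Nat.WithBot.lt_one_iff_le_zero.1 hd')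
    obtain ⟨r, hr⟩ := minpoly.mem_range_of_degree_eq_one ℚ W⁻¹ (by rw [degree_eq_natDegree hm.ne_zero, h1]; rfl)
    have : (p.coeff 0)^2 + (5 - 10*r+10*r^2)*(p.coeff 0) + 5*r^5 = 0 := by
      rw [← hr, hpc, aeval_C] at heq
      apply (algebraMap ℚ K).injective
      simp only [map_add, map_mul, map_pow, map_sub, map_ofNat, map_zero]
      exact heq
    have h0 := J1E this
    rw [h0, map_zero] at hr
    exact hT hr.symm
  · intro h2
    have hmf : minpoly ℚ W⁻¹ = X^2 + C ((minpoly ℚ W⁻¹).coeff 1) * X + C ((minpoly ℚ W⁻¹).coeff 0) := by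
      have := hm.as_sum
      rw [h2] at this
      rw [this]
      simp [Finset.sum_range_succ]
      ring
    have hpf : p = C (p.coeff 0) + C (p.coeff 1) * X := by
      have hd2 : p.degree < (2:ℕ) := by rw [degree_eq_natDegree hm.ne_zero, h2] at hd; exact hd
      have := as_sum_range' p 2 (natDegree_lt_of_deg (by norm_num) hd2)
      conv_lhs => rw [this]
      simp [Finset.sum_range_succ, ← C_mul_X_pow_eq_monomial]
    rw [hmf, hpf] at hdvd
    obtain ⟨hu, hw⟩ := J2E hdvd
    rw [hu, hw] at hmf
    have := minpoly.aeval ℚ W⁻¹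
    rw [hmf] at this
    simp at this
    exact h.hW this
end
end FQ

namespace FQ
open NumberField Polynomial

section
variable {K : Type*} [Field K] [NumberField K]

lemma rat_of_quad (hn : Module.finrank ℚ K = 3) {u : K} (p : ℚ[X]) (hp : p ≠ 0) (hd : p.natDegree ≤ 2) (h : aeval u p = 0) :
    ∃ r : ℚ, algebraMap ℚ K r = u := by
  have hi := IsIntegral.of_finite ℚ u
  have h1 : (minpoly ℚ u).natDegree ≤ 2 := (natDegree_le_of_dvd (minpoly.dvd ℚ u h) hp).trans hd
  have h2 : (minpoly ℚ u).natDegree ∣ 3 := hn ▸ minpoly.degree_dvd hi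
  have h3 : (minpoly ℚ u).natDegree = 1 := by
    rcases (Nat.dvd_prime Nat.prime_three).1 h2 with h | h <;> omega
  exact minpoly.mem_range_of_degree_eq_one ℚ u (by rw [degree_eq_natDegree (minpoly.ne_zero hi), h3]; rfl)

lemma adjoin_top_of_deg {T : K} (h : (minpoly ℚ T).natDegree = Module.finrank ℚ K) : IntermediateField.adjoin ℚ {T} = ⊤ := by
  rw [← IntermediateField.finrank_eq_one_iff_eq_top]
  have h1 := IntermediateField.adjoin.finrank (IsIntegral.of_finite ℚ T)
  rw [h] at h1
  have h2 := Module.finrank_mul_finrank ℚ (IntermediateField.adjoin ℚ {T}) K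
  rw [h1] at h2
  have h3 : 0 < Module.finrank ℚ K := Module.finrank_pos
  exact Nat.eq_of_mul_eq_mul_left h3 (by omega)

lemma quad_form {a : ℚ[X]} (ha : a.Monic) (hd : a.natDegree = 2) : a = X^2 + C (a.coeff 1) * X + C (a.coeff 0) := by
  have := ha.as_sum
  rw [hd] at this
  conv_lhs => rw [this]
  simp [Finset.sum_range_succ]
  ring

lemma lin_form {p : ℚ[X]} (hd : p.degree < 2) : p = C (p.coeff 0) + C (p.coeff 1) * X := by
  have := as_sum_range' p 2 (natDegree_lt_of_deg (by norm_num) hd)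
  conv_lhs => rw [this]
  simp [Finset.sum_range_succ, ← C_mul_X_pow_eq_monomial]

lemma stepC (hn : Module.finrank ℚ K = 3) (x y : K) (h : x^5+y^5+1 = 0) (hxy : x * y ≠ 0) :
    (∃ k : ℚ, x^3 = algebraMap ℚ K k * y^2) ∨ (∃ k : ℚ, y^3 = algebraMap ℚ K k * x^2) := by
  have hx : x ≠ 0 := left_ne_zero_of_mul hxy
  have hy : y ≠ 0 := right_ne_zero_of_mul hxy
  have hi := IsIntegral.of_finite ℚ (x*y)
  have hm := minpoly.monic hi
  have hE : (-x^5)^2 - (-x^5) + (x*y)^5 = 0 := by linear_combination x^5 * h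
  have h2 : (minpoly ℚ (x*y)).natDegree ∣ 3 := hn ▸ minpoly.degree_dvd hi
  rcases (Nat.dvd_prime Nat.prime_three).1 h2 with h1 | h3
  · exfalso
    obtain ⟨v, hv⟩ := minpoly.mem_range_of_degree_eq_one ℚ (x*y) (by rw [degree_eq_natDegree hm.ne_zero, h1]; rfl)
    have hmon : (X^2 - X + C (v^5) : ℚ[X]).natDegree = 2 := by compute_degree!
    obtain ⟨u, hu⟩ := rat_of_quad hn (u := -x^5) (X^2 - X + C (v^5)) (by intro h0; rw [h0] at hmon; simp at hmon)
      hmon.le (by simp only [map_add, map_sub, map_pow, aeval_X, aeval_C]; rw [hv]; exact hE)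
    have : u^2 - u + v^5 = 0 := by
      apply (algebraMap ℚ K).injective
      simp only [map_add, map_sub, map_pow, map_zero]
      rw [hu, hv]; exact hE
    have := J1C this
    rw [this, map_zero] at hv
    exact hxy hv.symm
  · have htop := adjoin_top_of_deg (h3.trans hn.symm)
    obtain ⟨p, hp, hd⟩ := exists_poly (T := x*y) (η := -x^5) (by rw [htop]; trivial)
    have hd3 : p.natDegree < 3 := natDegree_lt_of_deg (by norm_num) (by rw [degree_eq_natDegree hm.ne_zero, h3] at hd; exact hd)
    have hpf : p = C (p.coeff 0) + C (p.coeff 1) * X + C (p.coeff 2) * X^2 := by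
      have := as_sum_range' p 3 hd3
      conv_lhs => rw [this]
      simp [Finset.sum_range_succ, ← C_mul_X_pow_eq_monomial]
    set b0 := p.coeff 0
    set b1 := p.coeff 1
    set b2 := p.coeff 2
    set N : ℚ[X] := p^2 - p + X^5 with hN
    have hNd : N.natDegree = 5 := by rw [hN, hpf]; compute_degree!
    have hNm : N.Monic := by rw [hN, hpf]; monicity!
    have hdvd : minpoly ℚ (x*y) ∣ N := by
      apply minpoly.dvd
      simp only [hN, map_add, map_sub, map_pow, aeval_X]
      rw [hp]; exact hE
    obtain ⟨a, ha⟩ := hdvd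
    have ham : a.Monic := hm.of_mul_monic_left (ha ▸ hNm)
    have had : a.natDegree = 2 := by
      have := hm.natDegree_mul ham
      rw [← ha, hNd, h3] at this; omega
    have haf := quad_form ham had
    have hb := lin_form (p := p %ₘ a) (by
      have := degree_modByMonic_lt p ham
      rwa [degree_eq_natDegree ham.ne_zero, had] at this)
    have hdv : a ∣ (p %ₘ a)^2 - (p %ₘ a) + X^5 := by
      have h1 : a ∣ N := ⟨_, by rw [ha, mul_comm]⟩
      have h2 : (p %ₘ a)^2 - (p %ₘ a) + X^5 = N - a * ((p /ₘ a) * (2 * p - 1 - a * (p /ₘ a))) := by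
        rw [modByMonic_eq_sub_mul_div]; ring
      rw [h2]; exact dvd_sub h1 (dvd_mul_right _ _)
    rw [hb] at hdv
    nth_rewrite 1 [haf] at hdv
    obtain ⟨hu, hw⟩ := J2C hdv
    rw [hu, hw] at haf
    have haX : a = X^2 := by rw [haf]; simp
    have hc0 : N.coeff 0 = 0 := by rw [ha, haX]; simp
    have hc1 : N.coeff 1 = 0 := by rw [ha, haX, coeff_mul_X_pow']; simp
    have hNf : N = C (b0^2 - b0) + C (2*b0*b1 - b1) * X + X^2 * (C (b1^2+2*b0*b2 - b2) + C (2*b1*b2) * X + C (b2^2)*X^2 + X^3) := by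
      rw [hN, hpf]; simp only [map_add, map_mul, map_sub, map_pow, map_ofNat]; ring
    have e0 : b0^2 - b0 = 0 := by 
      rw [hNf] at hc0
      generalize b0^2 - b0 = c at hc0 ⊢
      simpa using hc0
    have e1 : 2*b0*b1 - b1 = 0 := by
      rw [hNf] at hc1
      generalize b0^2 - b0 = c at hc1 ⊢
      simpa [coeff_X_pow_mul', coeff_C] using hc1
    have hev : -x^5 = algebraMap ℚ K b0 + algebraMap ℚ K b1 * (x*y) + algebraMap ℚ K b2 * (x*y)^2 := by
      rw [← hp, hpf]; simp
    have e01 : b0 = 0 ∨ b0 = 1 := by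
      have : b0 * (b0 - 1) = 0 := by linear_combination e0
      rcases mul_eq_zero.1 this with h | h
      · left; exact h
      · right; linarith
    rcases e01 with h0 | h0
    · left
      rw [h0] at e1 hev
      have hb1 : b1 = 0 := by linarith
      rw [hb1] at hev
      refine ⟨-b2, mul_left_cancel₀ (pow_ne_zero 2 hx) ?_⟩
      simp only [map_zero, map_neg] at hev ⊢
      linear_combination -hev
    · right
      rw [h0] at e1 hev
      have hb1 : b1 = 0 := by linarith
      rw [hb1] at hev
      refine ⟨b2, mul_left_cancel₀ (pow_ne_zero 2 hy) ?_⟩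
      simp only [map_zero, map_one] at hev ⊢
      linear_combination h + hev

lemma case3 (htr : ∀ φ : K →+* ℂ, ∀ x : K, (φ x).im = 0) (hn : Module.finrank ℚ K = 3) (x y : K)
    (h : x^5+y^5+1 = 0) (hxy : x * y ≠ 0) : False := by
  have hx : x ≠ 0 := left_ne_zero_of_mul hxy
  have hy : y ≠ 0 := right_ne_zero_of_mul hxy
  have both : (∃ r : ℚ, algebraMap ℚ K r = x) → (∃ r : ℚ, algebraMap ℚ K r = y) → False := by
    rintro ⟨r, hr⟩ ⟨s, hs⟩
    have : (-r^5)^2 - (-r^5) + (r*s)^5 = 0 := by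
      apply (algebraMap ℚ K).injective
      simp only [map_add, map_sub, map_pow, map_neg, map_mul, map_zero]
      rw [hr, hs]; linear_combination x^5 * h
    have h0 := J1C this
    apply hxy
    rw [← hr, ← hs, ← map_mul, h0, map_zero]
  have hxr : (∃ r : ℚ, algebraMap ℚ K r = x) → False := by
    rintro ⟨r, hr⟩
    refine both ⟨r, hr⟩ (rat_of_odd_pow htr y (k := 5) (by decide) (-r^5-1) ?_)
    simp only [map_sub, map_pow, map_neg, map_one]
    rw [hr]; linear_combination h
  have hyr : (∃ r : ℚ, algebraMap ℚ K r = y) → False := by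
    rintro ⟨r, hr⟩
    refine both (rat_of_odd_pow htr x (k := 5) (by decide) (-r^5-1) ?_) ⟨r, hr⟩
    simp only [map_sub, map_pow, map_neg, map_one]
    rw [hr]; linear_combination h
  have h1 := stepC hn x y h hxy
  have h2 := stepC hn (y/x) (1/x) (by field_simp; linear_combination h) (mul_ne_zero (div_ne_zero hy hx) (div_ne_zero one_ne_zero hx))
  rcases h1 with ⟨k, hk⟩ | ⟨k, hk⟩ <;> rcases h2 with ⟨l, hl⟩ | ⟨l, hl⟩
  · have hl' : y^3 = algebraMap ℚ K l * x := by field_simp at hl; linear_combination hl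
    apply hyr
    refine rat_of_odd_pow htr y (k := 7) (by decide) (l^3*k) ?_
    apply mul_left_cancel₀ (pow_ne_zero 2 hy)
    simp only [map_mul, map_pow]
    linear_combination (y^6 + y^3 * (algebraMap ℚ K l * x) + (algebraMap ℚ K l * x)^2) * hl' + (algebraMap ℚ K l)^3 * hk
  · have hl' : 1 = algebraMap ℚ K l * (y^2 * x) := by field_simp at hl; linear_combination hl
    have hl0 : l ≠ 0 := by rintro rfl; simp at hl'
    have hl0' : algebraMap ℚ K l ≠ 0 := by simpa using hl0
    apply hxr
    have h4 : x^4 = algebraMap ℚ K (k/l) := by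
      rw [map_div₀, eq_div_iff hl0']
      linear_combination algebraMap ℚ K l * x * hk - algebraMap ℚ K k * hl'
    obtain ⟨r, hr⟩ := rat_of_const htr (x^2) (by
      intro φ ψ
      have e1 : (φ (x^2))^2 = (ψ (x^2))^2 := by
        rw [← map_pow, ← map_pow, ← pow_mul, h4]; simp
      have p1 : 0 ≤ φ (x^2) := by rw [map_pow]; positivity
      have p2 : 0 ≤ ψ (x^2) := by rw [map_pow]; positivity
      exact (pow_left_inj₀ p1 p2 (by norm_num)).1 e1)
    refine rat_of_quad hn (X^2 - C r) (X_pow_sub_C_ne_zero (by norm_num) r) (by rw [natDegree_X_pow_sub_C]) ?_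
    simp [hr]
  · have hl' : y^3 = algebraMap ℚ K l * x := by field_simp at hl; linear_combination hl
    have hk0 : k ≠ 0 := by rintro rfl; simp [hy] at hk
    have hk0' : algebraMap ℚ K k ≠ 0 := by simpa using hk0
    apply hxr
    refine ⟨l/k, ?_⟩
    rw [map_div₀, div_eq_iff hk0']
    apply mul_left_cancel₀ hx
    linear_combination hk - hl'
  · have hl' : 1 = algebraMap ℚ K l * (y^2 * x) := by field_simp at hl; linear_combination hl
    have hl0 : l ≠ 0 := by rintro rfl; simp at hl'
    have hl0' : algebraMap ℚ K l ≠ 0 := by simpa using hl0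
    apply hyr
    refine rat_of_odd_pow htr y (k := 7) (by decide) (k/l^2) ?_
    rw [map_div₀, map_pow, eq_div_iff (pow_ne_zero 2 hl0')]
    linear_combination (algebraMap ℚ K l)^2*y^4 * hk - algebraMap ℚ K k * (1 + algebraMap ℚ K l * (y^2 * x)) * hl'

lemma case12 (htr : ∀ φ : K →+* ℂ, ∀ x : K, (φ x).im = 0) {W g k : K} (h : Crd W g k) :
    Module.finrank ℚ K ≠ 1 ∧ Module.finrank ℚ K ≠ 2 := by
  have h1 := h.deg_ne htr
  have hd : (minpoly ℚ W⁻¹).natDegree ∣ Module.finrank ℚ K := minpoly.degree_dvd (IsIntegral.of_finite ℚ _)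
  constructor
  · intro h0
    rw [h0] at hd
    exact h1.1 (Nat.dvd_one.1 hd)
  · intro h0
    rw [h0] at hd
    rcases (Nat.dvd_prime Nat.prime_two).1 hd with h | h
    · exact h1.1 h
    · exact h1.2 h
end
end FQ

namespace FQ
open NumberField Polynomial

lemma J2E_red {a p : ℚ[X]} (ham : a.Monic) (had : a.natDegree = 2) (h : a ∣ p^2 + (5-10*X+10*X^2)*p + 5*X^5) : a = X^2 := by
  have haf := quad_form ham had
  have hb := lin_form (p := p %ₘ a) (by
    have := degree_modByMonic_lt p ham
    rwa [degree_eq_natDegree ham.ne_zero, had] at this)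
  have hdv : a ∣ (p %ₘ a)^2 + (5-10*X+10*X^2)*(p %ₘ a) + 5*X^5 := by
    have h2 : (p %ₘ a)^2 + (5-10*X+10*X^2)*(p %ₘ a) + 5*X^5 =
      p^2 + (5-10*X+10*X^2)*p + 5*X^5 - a * ((p /ₘ a) * (2 * p + (5-10*X+10*X^2) - a * (p /ₘ a))) := by
      rw [modByMonic_eq_sub_mul_div]; ring
    rw [h2]; exact dvd_sub h (dvd_mul_right _ _)
  rw [hb] at hdv
  nth_rewrite 1 [haf] at hdv
  obtain ⟨hu, hw⟩ := J2E hdv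
  rw [hu, hw] at haf
  rw [haf]; simp

lemma J2E_redB {a A B : ℚ[X]} (ham : a.Monic) (had : a.natDegree = 2) (hc : IsCoprime B a)
    (h : a ∣ A^2 + (5-10*X+10*X^2)*A*B + 5*X^5*B^2) : a = X^2 := by
  obtain ⟨u, v, huv⟩ := hc
  apply J2E_red ham had (p := A * u)
  have : (A*u)^2 + (5-10*X+10*X^2)*(A*u) + 5*X^5 = u^2 * (A^2 + (5-10*X+10*X^2)*A*B + 5*X^5*B^2)
     + a * ((5-10*X+10*X^2)*A*u*v + 5*X^5*v*(1 + u*B)) := by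
    linear_combination (-(5-10*X+10*X^2)*A*u - 5*X^5*(1+u*B)) * huv
  rw [this]
  exact dvd_add (Dvd.dvd.mul_left h _) (dvd_mul_right _ _)

section
variable {K : Type*} [Field K] [NumberField K]

lemma cub_form {p : ℚ[X]} (hd : p.natDegree < 4) :
    p = C (p.coeff 0) + C (p.coeff 1) * X + C (p.coeff 2) * X^2 + C (p.coeff 3) * X^3 := by
  have := as_sum_range' p 4 hd
  conv_lhs => rw [this]
  simp [Finset.sum_range_succ, ← C_mul_X_pow_eq_monomial]

lemma quo_form {p : ℚ[X]} (hd : p.natDegree < 3) :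
    p = C (p.coeff 0) + C (p.coeff 1) * X + C (p.coeff 2) * X^2 := by
  have := as_sum_range' p 3 hd
  conv_lhs => rw [this]
  simp [Finset.sum_range_succ, ← C_mul_X_pow_eq_monomial]

lemma coeffs_Xsq {N m : ℚ[X]} {c c0 c1 : ℚ} {R : ℚ[X]} (h : N = m * (C c * X^2)) (hN : N = C c0 + C c1 * X + X^2 * R) :
    c0 = 0 ∧ c1 = 0 := by
  have h0 : N.coeff 0 = 0 := by rw [h]; simp
  have h1 : N.coeff 1 = 0 := by rw [h, ← mul_assoc, coeff_mul_X_pow']; simp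
  rw [hN] at h0 h1
  constructor
  · simpa using h0
  · simpa [coeff_X_pow_mul', coeff_C] using h1

lemma lead6 (d0 d1 d2 d3 d4 d5 d6 : ℚ) :
    (C d0 + C d1 * X + X^2 * (C d2 + C d3 * X + C d4 * X^2 + C d5 * X^3 + C d6 * X^4) : ℚ[X]).coeff 6 = d6 := by
  simp [coeff_X_pow_mul', coeff_C, coeff_X]

lemma lead7 (d0 d1 d2 d3 d4 d5 d6 d7 : ℚ) :
    (C d0 + C d1 * X + X^2 * (C d2 + C d3 * X + C d4 * X^2 + C d5 * X^3 + C d6 * X^4 + C d7 * X^5) : ℚ[X]).coeff 7 = d7 := by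
  simp [coeff_X_pow_mul', coeff_C, coeff_X]

lemma Crd.types4 (htr : ∀ φ : K →+* ℂ, ∀ x : K, (φ x).im = 0) {W g k : K} (h : Crd W g k)
   (hn : (minpoly ℚ W⁻¹).natDegree = 4) :
    (∃ a0 a1 a2 : ℚ, -5*g*W⁻¹^3 = a0 + a1 * W⁻¹ + a2 * W⁻¹^2) ∨
    (∃ l0 l1 : ℚ, l1 ≠ 0 ∧ -5*g = l0 * W + l1) ∨ (∃ l0 l1 : ℚ, l1 ≠ 0 ∧ 5*k*W = l0 * W + l1) := by
  have hW := h.hW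
  obtain ⟨p, hp, hd⟩ := exists_poly (h.mem htr)
  have hi := IsIntegral.of_finite ℚ W⁻¹
  have hm := minpoly.monic hi
  have hd4 : p.natDegree < 4 := natDegree_lt_of_deg (by norm_num) (by rw [degree_eq_natDegree hm.ne_zero, hn] at hd; exact hd)
  have hpf := cub_form hd4
  generalize p.coeff 0 = a0 at hpf
  generalize p.coeff 1 = a1 at hpf
  generalize p.coeff 2 = a2 at hpf
  generalize p.coeff 3 = a3 at hpf
  have hev : -5*g*W⁻¹^3 = a0 + a1 * W⁻¹ + a2 * W⁻¹^2 + a3 * W⁻¹^3 := by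
    rw [← hp, hpf]; simp
  by_cases h3 : a3 = 0
  · left
    exact ⟨a0, a1, a2, by rw [hev, h3]; simp⟩
  right
  set N : ℚ[X] := p^2 + (5-10*X+10*X^2)*p + 5*X^5 with hN
  have hdvd : minpoly ℚ W⁻¹ ∣ N := by
    apply minpoly.dvd
    simp only [hN, map_add, map_sub, map_pow, map_mul, map_ofNat, aeval_X]
    rw [hp]; exact h.eta
  have hNf : N = C (a0^2 + 5*a0) + C (2*a0*a1+5*a1-10*a0) * X + X^2 * (C (a1^2+2*a0*a2+5*a2-10*a1+10*a0)
     + C (2*a0*a3+2*a1*a2+5*a3-10*a2+10*a1) * X + C (a2^2+2*a1*a3-10*a3+10*a2) * X^2 + C (2*a2*a3+10*a3+5) * X^3 + C (a3^2) * X^4) := by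
    rw [hN, hpf]; simp only [map_add, map_mul, map_sub, map_pow, map_ofNat]; ring
  have h32 : a3^2 ≠ 0 := pow_ne_zero 2 h3
  have hNd : N.natDegree = 6 := by
    rw [hNf]; compute_degree!
  have hNl : N.leadingCoeff = a3^2 := by
    rw [leadingCoeff, hNd, hNf]
    exact lead6 _ _ _ _ _ _ _
  obtain ⟨a, ha⟩ := hdvd
  have hN0 : N ≠ 0 := by intro h0; rw [h0] at hNd; simp at hNd
  have ha0 : a ≠ 0 := by rintro rfl; exact hN0 (by rw [ha, mul_zero])
  have hal : a.leadingCoeff = a3^2 := by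
    rw [← hNl, ha, leadingCoeff_mul, hm.leadingCoeff, one_mul]
  have had : a.natDegree = 2 := by
    have := natDegree_mul hm.ne_zero ha0
    rw [← ha, hNd, hn] at this; omega
  have ha' : C (a3^2)⁻¹ * a = X^2 := by
    apply J2E_red (p := p)
    · rw [Monic, leadingCoeff_mul, leadingCoeff_C, hal]; exact inv_mul_cancel₀ h32
    · rw [natDegree_C_mul (inv_ne_zero h32), had]
    · refine ⟨C (a3^2) * minpoly ℚ W⁻¹, ?_⟩
      change N = _
      rw [ha]
      have : C (a3^2)⁻¹ * C (a3^2) = (1 : ℚ[X]) := by rw [← C_mul, inv_mul_cancel₀ h32, C_1]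
      linear_combination (-a * minpoly ℚ W⁻¹) * this
  have ha2 : a = C (a3^2) * X^2 := by
    rw [← ha', ← mul_assoc, ← C_mul, mul_inv_cancel₀ h32, C_1, one_mul]
  obtain ⟨e0, e1⟩ := coeffs_Xsq (by rw [ha, ha2]) hNf
  have e01 : a0 = 0 ∨ a0 = -5 := by
    have : a0 * (a0 + 5) = 0 := by linear_combination e0
    rcases mul_eq_zero.1 this with h | h
    · left; exact h
    · right; linarith
  rcases e01 with h0 | h0
  · left
    have hb1 : a1 = 0 := by rw [h0] at e1; linarith
    rw [h0, hb1] at hev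
    refine ⟨a2, a3, h3, ?_⟩
    field_simp at hev
    push_cast at hev
    linear_combination hev
  · right
    have hb1 : a1 = 10 := by rw [h0] at e1; linarith
    have := h.etaQ
    rw [hev, h0, hb1] at this
    refine ⟨a2+10, a3, h3, ?_⟩
    push_cast at this ⊢
    field_simp at this
    linear_combination -this

/-- type 0 or type -1, +1 -/
lemma Crd.types5a {W g k : K} (h : Crd W g k)
   (hn : (minpoly ℚ W⁻¹).natDegree = 5) {a0 a1 a2 a3 : ℚ}
   (hev : -5*g*W⁻¹^3 = a0 + a1 * W⁻¹ + a2 * W⁻¹^2 + a3 * W⁻¹^3) (h3 : a3 ≠ 0) :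
    (∃ l0 l1 l2 : ℚ, l2 ≠ 0 ∧ -5*g = l0 * W^2 + l1 * W + l2) ∨ (∃ l0 l1 l2 : ℚ, l2 ≠ 0 ∧ 5*k*W = l0 * W^2 + l1 * W + l2) := by
  have hW := h.hW
  have hi := IsIntegral.of_finite ℚ W⁻¹
  have hm := minpoly.monic hi
  set p : ℚ[X] := C a0 + C a1 * X + C a2 * X^2 + C a3 * X^3 with hpf
  have hp : aeval W⁻¹ p = -5*g*W⁻¹^3 := by rw [hev, hpf]; simp
  set N : ℚ[X] := p^2 + (5-10*X+10*X^2)*p + 5*X^5 with hN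
  have hdvd : minpoly ℚ W⁻¹ ∣ N := by
    apply minpoly.dvd
    simp only [hN, map_add, map_sub, map_pow, map_mul, map_ofNat, aeval_X]
    rw [hp]; exact h.eta
  have hNf : N = C (a0^2 + 5*a0) + C (2*a0*a1+5*a1-10*a0) * X + X^2 * (C (a1^2+2*a0*a2+5*a2-10*a1+10*a0)
     + C (2*a0*a3+2*a1*a2+5*a3-10*a2+10*a1) * X + C (a2^2+2*a1*a3-10*a3+10*a2) * X^2 + C (2*a2*a3+10*a3+5) * X^3 + C (a3^2) * X^4) := by
    rw [hN, hpf]; simp only [map_add, map_mul, map_sub, map_pow, map_ofNat]; ring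
  have h32 : a3^2 ≠ 0 := pow_ne_zero 2 h3
  have hNd : N.natDegree = 6 := by
    rw [hNf]; compute_degree!
  obtain ⟨a, ha⟩ := hdvd
  have hN0 : N ≠ 0 := by intro h0; rw [h0] at hNd; simp at hNd
  have ha0 : a ≠ 0 := by rintro rfl; exact hN0 (by rw [ha, mul_zero])
  have had : a.natDegree = 1 := by
    have := natDegree_mul hm.ne_zero ha0
    rw [← ha, hNd, hn] at this; omega
  have had' : a.degree = 1 := by rw [degree_eq_natDegree ha0, had]; rfl
  obtain ⟨r, hr⟩ := exists_root_of_degree_eq_one had'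
  have hNr : N.eval r = 0 := by rw [ha, eval_mul, hr.eq_zero, mul_zero]
  have hr0 : r = 0 := by
    apply J1E (e := p.eval r)
    rw [hN] at hNr
    simpa using hNr
  rw [hr0, hNf] at hNr
  have e0 : a0^2 + 5*a0 = 0 := by simpa using hNr
  have e01 : a0 = 0 ∨ a0 = -5 := by
    have : a0 * (a0 + 5) = 0 := by linear_combination e0
    rcases mul_eq_zero.1 this with h | h
    · left; exact h
    · right; linarith
  rcases e01 with h0 | h0
  · left
    rw [h0] at hev
    refine ⟨a1, a2, a3, h3, ?_⟩
    field_simp at hev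
    push_cast at hev
    linear_combination hev
  · right
    have := h.etaQ
    rw [hev, h0] at this
    refine ⟨a1-10, a2+10, a3, h3, ?_⟩
    push_cast at this ⊢
    field_simp at this
    linear_combination -this

lemma Crd.types5 (htr : ∀ φ : K →+* ℂ, ∀ x : K, (φ x).im = 0) {W g k : K} (h : Crd W g k)
   (hn : (minpoly ℚ W⁻¹).natDegree = 5) (hf : Module.finrank ℚ K = 5) :
    (∃ a0 a1 a2 : ℚ, -5*g*W⁻¹^3 = a0 + a1 * W⁻¹ + a2 * W⁻¹^2) ∨
    (∃ l0 l1 l2 : ℚ, l2 ≠ 0 ∧ -5*g = l0 * W^2 + l1 * W + l2) ∨ (∃ l0 l1 l2 : ℚ, l2 ≠ 0 ∧ 5*k*W = l0 * W^2 + l1 * W + l2) ∨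
    (∃ a b c d : ℚ, a ≠ 0 ∧ b ≠ 0 ∧ -5*g*(a*W+b) = W*(c*W+d)) ∨ (∃ a b c d : ℚ, a ≠ 0 ∧ b ≠ 0 ∧ 5*k*(a*W+b) = c*W+d) := by
  have hW := h.hW
  have hi := IsIntegral.of_finite ℚ W⁻¹
  have hm := minpoly.monic hi
  set T := W⁻¹ with hT
  set η := -5*g*T^3 with hη
  have hnli : ¬ LinearIndependent ℚ ![1, T, T^2, T^3, -η, -T*η] := by
    intro hl
    have := hl.fintype_card_le_finrank
    simp [hf] at this
  rw [Fintype.not_linearIndependent_iff] at hnli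
  obtain ⟨v, hv, i, hvi⟩ := hnli
  simp only [Fin.sum_univ_succ, Fin.isValue, Matrix.cons_val_zero, Matrix.cons_val_succ, Fin.sum_univ_zero, Rat.smul_def, Finset.univ_eq_empty, Finset.sum_empty] at hv
  have hvi' : ¬ (v 0 = 0 ∧ v 1 = 0 ∧ v 2 = 0 ∧ v 3 = 0 ∧ v 4 = 0 ∧ v 5 = 0) := by
    rintro ⟨h0, h1, h2, h3, h4, h5⟩
    fin_cases i <;> simp_all
  change _ + ((v 1 : K) * _ + ((v 2 : K) * _ + ((v 3 : K) * _ + ((v 4 : K) * _ + ((v 5 : K) * _ + 0))))) = 0 at hv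
  generalize v 0 = a0 at hv hvi'
  generalize v 1 = a1 at hv hvi'
  generalize v 2 = a2 at hv hvi'
  generalize v 3 = a3 at hv hvi'
  generalize v 4 = α at hv hvi'
  generalize v 5 = β at hv hvi'
  have hrel : (a0 + a1 * T + a2 * T^2 + a3 * T^3 : K) = (α + β * T) * η := by linear_combination hv
  set A : ℚ[X] := C a0 + C a1 * X + C a2 * X^2 + C a3 * X^3 with hA
  set B : ℚ[X] := C α + C β * X with hB
  have hAe : aeval T A = (a0 + a1 * T + a2 * T^2 + a3 * T^3 : K) := by rw [hA]; simp
  have hBe : aeval T B = (α + β * T : K) := by rw [hB]; simp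
  have small : ∀ q : ℚ[X], q.natDegree < 5 → aeval T q = 0 → q = 0 := by
    intro q hq h0
    by_contra hq0
    have := natDegree_le_of_dvd (minpoly.dvd ℚ T h0) hq0
    omega
  have hAd : A.natDegree ≤ 3 := by rw [hA]; compute_degree!
  have hBd : B.natDegree ≤ 1 := by rw [hB]; compute_degree!
  have hB0 : B ≠ 0 := by
    intro hB0
    rw [hB0, map_zero] at hBe
    rw [← hBe, zero_mul, ← hAe] at hrel
    have hA0 := small A (by omega) hrel
    apply hvi'
    have c0 := congrArg (fun q => coeff q 0) hA0
    have c1 := congrArg (fun q => coeff q 1) hA0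
    have c2 := congrArg (fun q => coeff q 2) hA0
    have c3 := congrArg (fun q => coeff q 3) hA0
    have c4 := congrArg (fun q => coeff q 0) hB0
    have c5 := congrArg (fun q => coeff q 1) hB0
    simp [hA, hB, coeff_X, coeff_C] at c0 c1 c2 c3 c4 c5
    exact ⟨c0, c1, c2, c3, c4, c5⟩
  have hBT : (α + β * T : K) ≠ 0 := by
    intro h0
    rw [← hBe] at h0
    exact hB0 (small B (by omega) h0)
  by_cases hβ : β = 0
  · have hα : α ≠ 0 := by rintro rfl; apply hB0; rw [hB, hβ]; simp
    have hα' : (α : K) ≠ 0 := by exact_mod_cast hα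
    have hev : -5*g*W⁻¹^3 = ((a0/α : ℚ):K) + ((a1/α : ℚ):K) * W⁻¹ + ((a2/α : ℚ):K) * W⁻¹^2 + ((a3/α : ℚ):K) * W⁻¹^3 := by
      rw [hβ] at hrel
      change η = ((a0/α : ℚ):K) + ((a1/α : ℚ):K) * T + ((a2/α : ℚ):K) * T^2 + ((a3/α : ℚ):K) * T^3
      push_cast at hrel ⊢
      apply mul_left_cancel₀ hα'
      field_simp
      linear_combination -hrel
    by_cases h3 : a3 = 0
    · left
      rw [h3, zero_div] at hev
      rw [Rat.cast_zero, zero_mul, add_zero] at hev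
      exact ⟨_, _, _, hev⟩
    · right
      rcases h.types5a hn hev (div_ne_zero h3 hα) with h1 | h1
      · left; exact h1
      · right; left; exact h1
  by_cases hBA : B ∣ A
  · left
    obtain ⟨A', hA'⟩ := hBA
    have hBd1 : B.natDegree = 1 := by rw [hB]; compute_degree!
    have hA'd : A'.natDegree < 3 := by
      by_cases h0 : A' = 0
      · rw [h0]; simp
      have := natDegree_mul hB0 h0
      rw [← hA'] at this
      omega
    have hq := quo_form hA'd
    refine ⟨A'.coeff 0, A'.coeff 1, A'.coeff 2, ?_⟩
    rw [← hAe, ← hBe, hA', map_mul, hBe] at hrel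
    have := mul_left_cancel₀ hBT hrel
    rw [← this]
    conv_lhs => rw [hq]
    simp
  right; right; right
  set N : ℚ[X] := A^2 + (5-10*X+10*X^2)*A*B + 5*X^5*B^2 with hN
  have hdvd : minpoly ℚ T ∣ N := by
    apply minpoly.dvd
    simp only [hN, map_add, map_sub, map_pow, map_mul, map_ofNat, aeval_X]
    rw [hBe, hAe, hrel]
    linear_combination (α + β * T : K)^2 * h.eta
  have hNf : N = C (a0^2 + 5*(a0*α)) + C (2*a0*a1+5*(a0*β+a1*α)-10*(a0*α)) * X + X^2 * (C (a1^2+2*a0*a2+5*(a1*β+a2*α)-10*(a0*β+a1*α)+10*(a0*α))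
     + C (2*a0*a3+2*a1*a2+5*(a2*β+a3*α)-10*(a1*β+a2*α)+10*(a0*β+a1*α)) * X + C (a2^2+2*a1*a3+5*(a3*β)-10*(a2*β+a3*α)+10*(a1*β+a2*α)) * X^2
     + C (2*a2*a3-10*(a3*β)+10*(a2*β+a3*α)+5*α^2) * X^3 + C (a3^2+10*(a3*β)+10*α*β) * X^4 + C (5*β^2) * X^5) := by
    rw [hN, hA, hB]; simp only [map_add, map_mul, map_sub, map_pow, map_ofNat]; ring
  have hcc : 5*β^2 ≠ 0 := by positivity
  generalize hcdef : 5*β^2 = c at hNf hcc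
  have hNd : N.natDegree = 7 := by
    rw [hNf]; compute_degree!
  have hNl : N.leadingCoeff = c := by
    rw [leadingCoeff, hNd, hNf]
    exact lead7 _ _ _ _ _ _ _ _
  obtain ⟨a, ha⟩ := hdvd
  have hN0 : N ≠ 0 := by intro h0; rw [h0] at hNd; simp at hNd
  have ha0 : a ≠ 0 := by rintro rfl; exact hN0 (by rw [ha, mul_zero])
  have hal : a.leadingCoeff = c := by
    rw [← hNl, ha, leadingCoeff_mul, hm.leadingCoeff, one_mul]
  have had : a.natDegree = 2 := by
    have := natDegree_mul hm.ne_zero ha0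
    rw [← ha, hNd, hn] at this; omega
  have hBirr : Irreducible B := irreducible_of_degree_eq_one (by rw [hB, add_comm]; exact degree_linear hβ)
  have hnd : ¬ B ∣ a := by
    intro hBa
    have h1 : B ∣ N := ha ▸ Dvd.dvd.mul_left hBa _
    have h2 : B ∣ A^2 := by
      have : A^2 = N - B * ((5-10*X+10*X^2)*A + 5*X^5*B) := by rw [hN]; ring
      rw [this]; exact dvd_sub h1 (dvd_mul_right _ _)
    exact hBA (hBirr.prime.dvd_of_dvd_pow h2)
  have hcop : IsCoprime B (C c⁻¹ * a) := by
    rw [hBirr.coprime_iff_not_dvd]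
    intro h1
    apply hnd
    have : a = C c * (C c⁻¹ * a) := by rw [← mul_assoc, ← C_mul, mul_inv_cancel₀ hcc, C_1, one_mul]
    rw [this]; exact Dvd.dvd.mul_left h1 _
  have ha' : C c⁻¹ * a = X^2 := by
    apply J2E_redB (A := A) (B := B) _ _ hcop
    · refine ⟨C c * minpoly ℚ T, ?_⟩
      change N = _
      rw [ha]
      have : C c⁻¹ * C c = (1 : ℚ[X]) := by rw [← C_mul, inv_mul_cancel₀ hcc, C_1]
      linear_combination (-a * minpoly ℚ T) * this
    · rw [Monic, leadingCoeff_mul, leadingCoeff_C, hal]; exact inv_mul_cancel₀ hcc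
    · rw [natDegree_C_mul (inv_ne_zero hcc), had]
  have ha2 : a = C c * X^2 := by
    rw [← ha', ← mul_assoc, ← C_mul, mul_inv_cancel₀ hcc, C_1, one_mul]
  have hα : α ≠ 0 := by
    intro h0
    apply hnd
    rw [ha2, hB, h0]
    refine ⟨C (c/β) * X, ?_⟩
    have : C c = C β * C (c/β) := by rw [← C_mul]; congr 1; field_simp
    rw [this, C_0]; ring
  obtain ⟨e0, e1⟩ := coeffs_Xsq (by rw [ha, ha2]) hNf
  have e01 : a0 = 0 ∨ a0 = -5*α := by
    have : a0 * (a0 + 5*α) = 0 := by linear_combination e0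
    rcases mul_eq_zero.1 this with h | h
    · left; exact h
    · right; linarith
  have hTW : T * W = 1 := inv_mul_cancel₀ hW
  rcases e01 with h0 | h0
  · left
    have hb1 : a1 = 0 := by
      rw [h0] at e1
      have : α * a1 = 0 := by linear_combination e1/5
      exact (mul_eq_zero.1 this).resolve_left hα
    rw [h0, hb1] at hrel
    refine ⟨α, β, a2, a3, hα, hβ, ?_⟩
    rw [hη, hT] at hrel
    push_cast at hrel
    field_simp at hrel
    linear_combination -hrel
  · right
    have hb1 : a1 = 10*α - 5*β := by
      rw [h0] at e1
      have : α * (a1 - 10*α + 5*β) = 0 := by linear_combination -e1/5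
      linarith [(mul_eq_zero.1 this).resolve_left hα]
    have h2 := h.etaQ
    change η + _ = _ at h2
    refine ⟨α, β, a2 + 10*α - 10*β, a3 + 10*β, hα, hβ, ?_⟩
    have h4 : (5*k*T^2)*(α + β*T) = (a2 + 10*α - 10*β) * T^2 + (a3 + 10*β) * T^3 := by
      rw [h0, hb1] at hrel
      push_cast at hrel
      rw [← h2]
      linear_combination -hrel
    rw [hT] at h4
    push_cast
    field_simp at h4
    linear_combination h4
end
end FQ

namespace FQ

lemma four_of_card {s : Finset ℝ} (h : 4 ≤ s.card) : ∃ a ∈ s, ∃ b ∈ s, ∃ c ∈ s, ∃ d ∈ s, a < b ∧ b < c ∧ c < d := by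
  obtain ⟨t, hts, ht⟩ := Finset.exists_subset_card_eq h
  have f := t.orderEmbOfFin ht
  have hm := fun i => hts (t.orderEmbOfFin_mem ht i)
  exact ⟨_, hm 0, _, hm 1, _, hm 2, _, hm 3, (t.orderEmbOfFin ht).strictMono (by decide),
    (t.orderEmbOfFin ht).strictMono (by decide), (t.orderEmbOfFin ht).strictMono (by decide)⟩

lemma two_of_card {s : Finset ℝ} (h : 2 ≤ s.card) : ∃ a ∈ s, ∃ b ∈ s, a < b := by
  obtain ⟨t, hts, ht⟩ := Finset.exists_subset_card_eq h
  have hm := fun i => hts (t.orderEmbOfFin_mem ht i)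
  exact ⟨_, hm 0, _, hm 1, (t.orderEmbOfFin ht).strictMono (by decide)⟩

/-- Rolle with explicit derivative on an order connected set -/
lemma rolle1 {S : Set ℝ} (hS : S.OrdConnected) {f f1 : ℝ → ℝ} (hf : ∀ x ∈ S, HasDerivAt f (f1 x) x)
    {a b : ℝ} (ha : a ∈ S) (hb : b ∈ S) (hab : a < b) (fa : f a = 0) (fb : f b = 0) : ∃ z, a < z ∧ z < b ∧ z ∈ S ∧ f1 z = 0 := by
  have hI : Set.Icc a b ⊆ S := hS.out ha hb
  obtain ⟨z, hz, hz0⟩ := exists_hasDerivAt_eq_zero (f := f) (f' := f1) hab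
    (fun x hx => (hf x (hI hx)).continuousAt.continuousWithinAt) (by rw [fa, fb])
    (fun x hx => hf x (hI (Set.Ioo_subset_Icc_self hx)))
  exact ⟨z, hz.1, hz.2, hI (Set.Ioo_subset_Icc_self hz), hz0⟩

lemma rolle2 {S : Set ℝ} (hS : S.OrdConnected) {f f1 f2 : ℝ → ℝ} (hf : ∀ x ∈ S, HasDerivAt f (f1 x) x)
    (hf1 : ∀ x ∈ S, HasDerivAt f1 (f2 x) x)
    {a b c d : ℝ} (ha : a ∈ S) (hb : b ∈ S) (hc : c ∈ S) (hd : d ∈ S) (hab : a < b) (hbc : b < c) (hcd : c < d)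
    (fa : f a = 0) (fb : f b = 0) (fc : f c = 0) (fd : f d = 0) : ∃ z ∈ S, ∃ w ∈ S, z < w ∧ f2 z = 0 ∧ f2 w = 0 := by
  obtain ⟨x, hx1, hx2, hxS, hx⟩ := rolle1 hS hf ha hb hab fa fb
  obtain ⟨y, hy1, hy2, hyS, hy⟩ := rolle1 hS hf hb hc hbc fb fc
  obtain ⟨t, ht1, ht2, htS, ht⟩ := rolle1 hS hf hc hd hcd fc fd
  obtain ⟨z, hz1, hz2, hzS, hz⟩ := rolle1 hS hf1 hxS hyS (by linarith) hx hy
  obtain ⟨w, hw1, hw2, hwS, hw⟩ := rolle1 hS hf1 hyS htS (by linarith) hy ht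
  exact ⟨z, hzS, w, hwS, by linarith, hz, hw⟩

section
variable {E E1 E2 E3 : ℝ → ℝ}

lemma sqrt_d1 {x : ℝ} (h : HasDerivAt E (E1 x) x) (hp : 0 < E x) : HasDerivAt (fun x => √(E x)) (E1 x / (2*√(E x))) x :=
  h.sqrt hp.ne'

lemma sqrt_d2 {x : ℝ} (h : HasDerivAt E (E1 x) x) (h1 : HasDerivAt E1 (E2 x) x) (hp : 0 < E x) :
    HasDerivAt (fun x => E1 x / (2*√(E x))) ((2 * E x * E2 x - E1 x^2) / (4*(√(E x))^3)) x := by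
  have hs : 0 < √(E x) := Real.sqrt_pos.2 hp
  have hsq : √(E x)^2 = E x := Real.sq_sqrt hp.le
  have := h1.div ((sqrt_d1 h hp).const_mul 2) (by positivity)
  refine this.congr_deriv ?_
  generalize √(E x) = s at *
  rw [← hsq]
  field_simp
  ring

lemma sqrt_d3 {x : ℝ} (h : HasDerivAt E (E1 x) x) (h1 : HasDerivAt E1 (E2 x) x) (h2 : HasDerivAt E2 (E3 x) x) (hp : 0 < E x) :
    HasDerivAt (fun x => (2 * E x * E2 x - E1 x^2) / (4*(√(E x))^3))
      ((4 * E x^2 * E3 x - 6 * E x * E1 x * E2 x + 3 * E1 x^3) / (8*(√(E x))^5)) x := by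
  have hs : 0 < √(E x) := Real.sqrt_pos.2 hp
  have hsq : √(E x)^2 = E x := Real.sq_sqrt hp.le
  have hne : 4 * √(E x)^3 ≠ 0 := by positivity
  have := (((h.const_mul 2).mul h2).sub (h1.pow 2)).div (((sqrt_d1 h hp).pow 3).const_mul 4) hne
  refine this.congr_deriv ?_
  simp only [Pi.pow_apply, Pi.sub_apply, Pi.mul_apply]
  generalize √(E x) = s at *
  rw [← hsq]
  field_simp
  ring

lemma sqrt_quad {S : Set ℝ} (hS : S.OrdConnected) (h : ∀ x, HasDerivAt E (E1 x) x) (h1 : ∀ x, HasDerivAt E1 (E2 x) x)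
    (hp : ∀ x ∈ S, 0 < E x) {a b c d : ℝ} (ha : a ∈ S) (hb : b ∈ S) (hc : c ∈ S) (hd : d ∈ S) (hab : a < b) (hbc : b < c) (hcd : c < d)
    (q0 q1 q2 q3 : ℝ) (fa : √(E a) = q0 + q1*a + q2*a^2 + q3*a^3) (fb : √(E b) = q0 + q1*b + q2*b^2 + q3*b^3)
    (fc : √(E c) = q0 + q1*c + q2*c^2 + q3*c^3) (fd : √(E d) = q0 + q1*d + q2*d^2 + q3*d^3) :
    ∃ z ∈ S, ∃ w ∈ S, z < w ∧ (2 * E z * E2 z - E1 z^2) / (4*(√(E z))^3) - (2*q2 + 6*q3*z) = 0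
      ∧ (2 * E w * E2 w - E1 w^2) / (4*(√(E w))^3) - (2*q2 + 6*q3*w) = 0 := by
  apply rolle2 hS (f := fun x => √(E x) - (q0 + q1*x + q2*x^2 + q3*x^3)) (f1 := fun x => E1 x / (2*√(E x)) - (q1 + 2*q2*x + 3*q3*x^2))
    (f2 := fun x => (2 * E x * E2 x - E1 x^2) / (4*(√(E x))^3) - (2*q2 + 6*q3*x)) _ _ ha hb hc hd hab hbc hcd
  · rw [fa, sub_self]
  · rw [fb, sub_self]
  · rw [fc, sub_self]
  · rw [fd, sub_self]
  · intro x hx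
    apply (sqrt_d1 (h x) (hp x hx)).sub
    have := (((hasDerivAt_const x q0).add ((hasDerivAt_id x).const_mul q1)).add (((hasDerivAt_id x).pow 2).const_mul q2)).add (((hasDerivAt_id x).pow 3).const_mul q3)
    refine this.congr_deriv ?_
    simp; try ring
  · intro x hx
    apply (sqrt_d2 (h x) (h1 x) (hp x hx)).sub
    have := ((hasDerivAt_const x q1).add ((hasDerivAt_id x).const_mul (2*q2))).add (((hasDerivAt_id x).pow 2).const_mul (3*q3))
    refine this.congr_deriv ?_
    simp; try ring

lemma sqrt_cub {S : Set ℝ} (hS : S.OrdConnected) (h : ∀ x, HasDerivAt E (E1 x) x) (h1 : ∀ x, HasDerivAt E1 (E2 x) x)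
    (h2 : ∀ x, HasDerivAt E2 (E3 x) x)
    (hp : ∀ x ∈ S, 0 < E x) {a b c d : ℝ} (ha : a ∈ S) (hb : b ∈ S) (hc : c ∈ S) (hd : d ∈ S) (hab : a < b) (hbc : b < c) (hcd : c < d)
    (q0 q1 q2 q3 : ℝ) (fa : √(E a) = q0 + q1*a + q2*a^2 + q3*a^3) (fb : √(E b) = q0 + q1*b + q2*b^2 + q3*b^3)
    (fc : √(E c) = q0 + q1*c + q2*c^2 + q3*c^3) (fd : √(E d) = q0 + q1*d + q2*d^2 + q3*d^3) :
    ∃ z ∈ S, (4 * E z^2 * E3 z - 6 * E z * E1 z * E2 z + 3 * E1 z^3) / (8*(√(E z))^5) - 6*q3 = 0 := by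
  obtain ⟨z, hz, w, hw, hzw, e1, e2⟩ := sqrt_quad hS h h1 hp ha hb hc hd hab hbc hcd q0 q1 q2 q3 fa fb fc fd
  obtain ⟨t, _, _, htS, ht⟩ := rolle1 hS (f := fun x => (2 * E x * E2 x - E1 x^2) / (4*(√(E x))^3) - (2*q2 + 6*q3*x))
    (f1 := fun x => (4 * E x^2 * E3 x - 6 * E x * E1 x * E2 x + 3 * E1 x^3) / (8*(√(E x))^5) - 6*q3) (by
      intro x hx
      apply (sqrt_d3 (h x) (h1 x) (h2 x) (hp x hx)).sub
      have := ((hasDerivAt_const x (2*q2)).add ((hasDerivAt_id x).const_mul (6*q3)))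
      refine this.congr_deriv ?_
      simp) hz hw hzw e1 e2
  exact ⟨t, htS, ht⟩
end
end FQ

namespace FQ

/-- real sextic polynomial function -/
def p6 (c0 c1 c2 c3 c4 c5 c6 x : ℝ) : ℝ := c0 + c1*x + c2*x^2 + c3*x^3 + c4*x^4 + c5*x^5 + c6*x^6

lemma p6_deriv (c0 c1 c2 c3 c4 c5 c6 x : ℝ) :
    HasDerivAt (p6 c0 c1 c2 c3 c4 c5 c6) (p6 c1 (2*c2) (3*c3) (4*c4) (5*c5) (6*c6) 0 x) x := by
  have := ((((((hasDerivAt_const x c0).add ((hasDerivAt_id x).const_mul c1)).add (((hasDerivAt_id x).pow 2).const_mul c2)).add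
    (((hasDerivAt_id x).pow 3).const_mul c3)).add (((hasDerivAt_id x).pow 4).const_mul c4)).add
    (((hasDerivAt_id x).pow 5).const_mul c5)).add (((hasDerivAt_id x).pow 6).const_mul c6)
  refine this.congr_deriv ?_
  simp [p6]; ring

lemma real0 {a b c d : ℝ} (ha : 0 < 5+20*a^5) (hd : 0 < 5+20*d^5) (hab : a < b) (hbc : b < c) (hcd : c < d)
    (q0 q1 q2 : ℝ) (fa : √(5+20*a^5) = q0 + q1*a + q2*a^2) (fb : √(5+20*b^5) = q0 + q1*b + q2*b^2)
    (fc : √(5+20*c^5) = q0 + q1*c + q2*c^2) (fd : √(5+20*d^5) = q0 + q1*d + q2*d^2) : False := by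
  set E := p6 5 0 0 0 0 20 0 with hE
  set E1 := p6 0 (2*0) (3*0) (4*0) (5*20) (6*0) 0 with hE1
  set E2 := p6 (2*0) (2*(3*0)) (3*(4*0)) (4*(5*20)) (5*(6*0)) (6*0) 0 with hE2
  set E3 := p6 (2*(3*0)) (2*(3*(4*0))) (3*(4*(5*20))) (4*(5*(6*0))) (5*(6*0)) (6*0) 0 with hE3
  have d1 : ∀ x, HasDerivAt E (E1 x) x := fun x => p6_deriv _ _ _ _ _ _ _ x
  have d2 : ∀ x, HasDerivAt E1 (E2 x) x := fun x => p6_deriv _ _ _ _ _ _ _ x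
  have d3 : ∀ x, HasDerivAt E2 (E3 x) x := fun x => p6_deriv _ _ _ _ _ _ _ x
  have hEx : ∀ x, E x = 5 + 20*x^5 := by intro x; simp [hE, p6]
  have hmono : ∀ x y : ℝ, x ≤ y → x^5 ≤ y^5 := fun x y h => (Odd.strictMono_pow (by decide : Odd 5)).monotone h
  let S : Set ℝ := {x | 0 < E x}
  have hS : S.OrdConnected := by
    constructor
    intro x hx y hy z hz
    simp only [S, Set.mem_setOf_eq, hEx] at hx ⊢
    linarith [hmono x z hz.1]
  have haS : a ∈ S := by simp only [S, Set.mem_setOf_eq, hEx]; exact ha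
  have hdS : d ∈ S := by simp only [S, Set.mem_setOf_eq, hEx]; exact hd
  obtain ⟨z, hz, w, hw, hzw, e1, e2⟩ := sqrt_quad hS d1 d2 (fun x hx => hx) haS
    (hS.out haS hdS ⟨hab.le, by linarith⟩) (hS.out haS hdS ⟨by linarith, by linarith⟩) hdS hab hbc hcd q0 q1 q2 0
    (by rw [hEx]; linarith) (by rw [hEx]; linarith) (by rw [hEx]; linarith) (by rw [hEx]; linarith)
  set F : ℝ → ℝ := fun x => (2 * E x * E2 x - E1 x^2) / (4*(√(E x))^3) with hF
  have hFd : ∀ x ∈ S, HasDerivAt F (15000*x^2*(1-x^5)^2/(√(E x))^5) x := by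
    intro x hx
    refine (sqrt_d3 (d1 x) (d2 x) (d3 x) hx).congr_deriv ?_
    have hs : 0 < √(E x) := Real.sqrt_pos.2 hx
    rw [div_eq_div_iff (by positivity) (by positivity)]
    generalize √(E x)^5 = s
    simp only [hE, hE1, hE2, hE3, p6]
    ring
  have hI : Set.Icc z w ⊆ S := hS.out hz hw
  have hFm : MonotoneOn F (Set.Icc z w) := by
    apply monotoneOn_of_deriv_nonneg (convex_Icc z w)
    · exact fun x hx => (hFd x (hI hx)).continuousAt.continuousWithinAt
    · exact fun x hx => (hFd x (hI (interior_subset hx))).differentiableAt.differentiableWithinAt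
    · intro x hx
      have hxS := hI (interior_subset hx)
      rw [(hFd x hxS).deriv]
      have hs : 0 < √(E x) := Real.sqrt_pos.2 hxS
      positivity
  have hzw' : F z = F w := by
    have e1' : F z - (2*q2 + 6*0*z) = 0 := e1
    have e2' : F w - (2*q2 + 6*0*w) = 0 := e2
    linarith
  obtain ⟨p, hp, hp'⟩ := ((Set.Ioo_infinite hzw).sdiff (Set.toFinite ({0, 1} : Set ℝ))).nonempty
  have hpS := hI (Set.Ioo_subset_Icc_self hp)
  have hconst : F =ᶠ[nhds p] fun _ => F z := by
    filter_upwards [Ioo_mem_nhds hp.1 hp.2] with x hx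
    have hx' := Set.Ioo_subset_Icc_self hx
    apply le_antisymm
    · rw [hzw']; exact hFm hx' ⟨hzw.le, le_refl _⟩ hx'.2
    · exact hFm ⟨le_refl _, hzw.le⟩ hx' hx'.1
  have h0 := hconst.deriv_eq
  rw [(hFd p hpS).deriv, deriv_const] at h0
  have hs : 0 < √(E p) := Real.sqrt_pos.2 hpS
  simp only [Set.mem_insert_iff, Set.mem_singleton_iff, not_or] at hp'
  have h5 : 1 - p^5 ≠ 0 := by
    intro h
    apply hp'.2
    apply (Odd.strictMono_pow (by decide : Odd 5)).injective
    simp only; linarith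
  have : 15000*p^2*(1-p^5)^2/(√(E p))^5 ≠ 0 := by
    have := hp'.1
    positivity
  exact this h0

/-- the discriminant of the quadratic equation for g, as a function of W -/
noncomputable def dE (x : ℝ) : ℝ := 25*(x^3-2*x^2+2*x)^2 - 20*x

lemma dE_sextic : dE = p6 0 (-20) 100 (-200) 200 (-100) 25 := by
  ext x; simp only [dE, p6]; ring

lemma dE_cub {S : Set ℝ} (hS : S.OrdConnected) (hp : ∀ x ∈ S, 0 < dE x)
    {a b c d : ℝ} (ha : a ∈ S) (hb : b ∈ S) (hc : c ∈ S) (hd : d ∈ S) (hab : a < b) (hbc : b < c) (hcd : c < d)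
    (q0 q1 q2 q3 : ℝ) (fa : √(dE a) = q0 + q1*a + q2*a^2 + q3*a^3) (fb : √(dE b) = q0 + q1*b + q2*b^2 + q3*b^3)
    (fc : √(dE c) = q0 + q1*c + q2*c^2 + q3*c^3) (fd : √(dE d) = q0 + q1*d + q2*d^2 + q3*d^3) :
    ∃ z ∈ S, ((-24000)*z^0 + 240000*z^1 + (-1200000)*z^2 + 4800000*z^3 + (-18600000)*z^4 + 63540000*z^5 + (-169200000)*z^6 + 336000000*z^7 + (-495000000)*z^8 + 543000000*z^9 + (-444300000)*z^10 + 270000000*z^11 + (-120000000)*z^12 + 37500000*z^13 + (-7500000)*z^14 + 750000*z^15) / (8*(√(dE z))^5) - 6*q3 = 0 := by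
  set E := p6 0 (-20) 100 (-200) 200 (-100) 25 with hE
  set E1 := p6 (-20) (2*100) (3*(-200)) (4*200) (5*(-100)) (6*25) 0 with hE1
  set E2 := p6 (2*100) (2*(3*(-200))) (3*(4*200)) (4*(5*(-100))) (5*(6*25)) (6*0) 0 with hE2
  set E3 := p6 (2*(3*(-200))) (2*(3*(4*200))) (3*(4*(5*(-100)))) (4*(5*(6*25))) (5*(6*0)) (6*0) 0 with hE3
  have d1 : ∀ x, HasDerivAt E (E1 x) x := fun x => p6_deriv _ _ _ _ _ _ _ x
  have d2 : ∀ x, HasDerivAt E1 (E2 x) x := fun x => p6_deriv _ _ _ _ _ _ _ x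
  have d3 : ∀ x, HasDerivAt E2 (E3 x) x := fun x => p6_deriv _ _ _ _ _ _ _ x
  have hEd : dE = E := dE_sextic
  rw [hEd] at hp fa fb fc fd
  obtain ⟨z, hz, hz2⟩ := sqrt_cub hS d1 d2 d3 hp ha hb hc hd hab hbc hcd q0 q1 q2 q3 fa fb fc fd
  refine ⟨z, hz, ?_⟩
  rw [← hz2, hEd]
  congr 2
  simp only [hE, hE1, hE2, hE3, p6]
  ring

lemma neg4 {a b c d : ℝ} (hd : d < 0) (hab : a < b) (hbc : b < c) (hcd : c < d)
    (q0 q1 q2 : ℝ) (fa : √(dE a) = q0 + q1*a + q2*a^2 + 5*a^3) (fb : √(dE b) = q0 + q1*b + q2*b^2 + 5*b^3)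
    (fc : √(dE c) = q0 + q1*c + q2*c^2 + 5*c^3) (fd : √(dE d) = q0 + q1*d + q2*d^2 + 5*d^3) : False := by
  have hp : ∀ x ∈ Set.Iio (0:ℝ), 0 < dE x := by
    intro x hx
    have hx : x < 0 := hx
    have := sq_nonneg (x^3-2*x^2+2*x)
    unfold dE; linarith
  obtain ⟨z, hz, h⟩ := dE_cub Set.ordConnected_Iio hp (a := a) (b := b) (c := c) (d := d) (by simp only [Set.mem_Iio]; linarith) (by simp only [Set.mem_Iio]; linarith)
    (by simp only [Set.mem_Iio]; linarith) hd hab hbc hcd q0 q1 q2 5 fa fb fc fd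
  have hs : 0 < √(dE z) := Real.sqrt_pos.2 (hp z hz)
  have hz : z < 0 := hz
  obtain ⟨t, rfl⟩ : ∃ t, z = -t := ⟨-z, by ring⟩
  have ht : 0 < t := by linarith
  have : 0 < (24000*t^0 + 240000*t^1 + 1200000*t^2 + 4800000*t^3 + 18600000*t^4 + 63540000*t^5 + 169200000*t^6 + 336000000*t^7 + 495000000*t^8 + 543000000*t^9 + 444300000*t^10 + 270000000*t^11 + 120000000*t^12 + 37500000*t^13 + 7500000*t^14 + 750000*t^15) / (8*(√(dE (-t)))^5) := by positivity
  have h2 : ∀ u v : ℝ, (-u)/v - 6*5 = 0 → 0 < u/v → False := by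
    intro u v h1 h2
    rw [neg_div] at h1; linarith
  refine h2 _ _ ?_ this
  rw [← h]
  congr 2
  ring

lemma pos4 {a b c d : ℝ} (ha : 2 < a) (hab : a < b) (hbc : b < c) (hcd : c < d)
    (q0 q1 q2 : ℝ) (fa : √(dE a) = q0 + q1*a + q2*a^2 + (-5)*a^3) (fb : √(dE b) = q0 + q1*b + q2*b^2 + (-5)*b^3)
    (fc : √(dE c) = q0 + q1*c + q2*c^2 + (-5)*c^3) (fd : √(dE d) = q0 + q1*d + q2*d^2 + (-5)*d^3) : False := by
  have hp : ∀ x ∈ Set.Ioi (2:ℝ), 0 < dE x := by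
    intro x hx
    have hx : 2 < x := hx
    obtain ⟨t, rfl⟩ : ∃ t, x = 2+t := ⟨x-2, by ring⟩
    have ht : 0 < t := by linarith
    have : dE (2+t) = 25*(2+t)^2*(t^4+4*t^3+8*t^2+8*t) + (2+t)*(80*t + 180 + 20*t) := by unfold dE; ring
    rw [this]; positivity
  obtain ⟨z, hz, h⟩ := dE_cub Set.ordConnected_Ioi hp (a := a) (b := b) (c := c) (d := d) ha (by simp only [Set.mem_Ioi]; linarith)
    (by simp only [Set.mem_Ioi]; linarith) (by simp only [Set.mem_Ioi]; linarith) hab hbc hcd q0 q1 q2 (-5) fa fb fc fd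
  have hs : 0 < √(dE z) := Real.sqrt_pos.2 (hp z hz)
  have hz : 2 < z := hz
  obtain ⟨t, rfl⟩ : ∃ t, z = 2+t := ⟨z-2, by ring⟩
  have ht : 0 < t := by linarith
  have : 0 < (617736000*t^0 + 5078640000*t^1 + 19736400000*t^2 + 48285600000*t^3 + 83488800000*t^4 + 108413940000*t^5 + 109462800000*t^6 + 87600000000*t^7 + 56025000000*t^8 + 28617000000*t^9 + 11567700000*t^10 + 3630000000*t^11 + 855000000*t^12 + 142500000*t^13 + 15000000*t^14 + 750000*t^15) / (8*(√(dE (2+t)))^5) := by positivity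
  have h2 : ∀ u v : ℝ, u/v - 6*(-5) = 0 → 0 < u/v → False := by
    intro u v h1 h2
    linarith
  refine h2 _ _ ?_ this
  rw [← h]
  congr 2
  ring
end FQ

namespace FQ

lemma slope_left {a b x y : ℝ} (hab : a < b) (hb : b < 0) (hx : 0 < x) (hy : 0 < y)
    (ex : 5*x^2 - 5*x*(a^3-2*a^2+2*a) + a = 0) (ey : 5*y^2 - 5*y*(b^3-2*b^2+2*b) + b = 0) :
    y ≤ x + (b - a) ∧ x < 1/10 := by
  obtain ⟨s, rfl⟩ : ∃ s, b = -s := ⟨-b, by ring⟩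
  obtain ⟨t, rfl⟩ : ∃ t, a = -t := ⟨-a, by ring⟩
  have hs : 0 < s := by linarith
  have hst : s < t := by linarith
  have ht : 0 < t := by linarith
  have h1 : 5*x*(t^2+2*t+2) < 1 := by
    have h2 : t * (5*x*(t^2+2*t+2) - 1) < 0 := by
      have : t * (5*x*(t^2+2*t+2) - 1) = -5*x^2 := by linear_combination ex
      rw [this]
      have := pow_pos hx 2
      linarith
    by_contra hc
    push Not at hc
    have := mul_nonneg ht.le (by linarith : 0 ≤ 5*x*(t^2+2*t+2) - 1)
    linarith
  have h10 : 10*x*(t+1) < 1 := by nlinarith [mul_pos hx (pow_pos ht 2)]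
  refine ⟨?_, by nlinarith [mul_pos hx ht]⟩
  by_contra hc
  push Not at hc
  have key : (y - x) * (5*(x+y) + 5*s*(s^2+2*s+2)) = (t - s) * (5*x*(t^2+t*s+s^2+2*t+2*s+2) - 1) := by
    linear_combination ey - ex
  have hD : 0 < 5*(x+y) + 5*s*(s^2+2*s+2) := by positivity
  have h3 : (t-s) * (5*(x+y) + 5*s*(s^2+2*s+2)) < (t - s) * (5*x*(t^2+t*s+s^2+2*t+2*s+2) - 1) := by
    rw [← key]
    exact mul_lt_mul_of_pos_right (by linarith) hD
  have h4 := lt_of_mul_lt_mul_left h3 (by linarith)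
  have h5 : 5*x*(s*(t+s+2)) ≤ s := by
    have : s * (10*x*(t+1)) ≤ s * 1 := mul_le_mul_of_nonneg_left h10.le hs.le
    have : 5*x*s*(t+s+2) ≤ 5*x*s*(2*t+2) := mul_le_mul_of_nonneg_left (by linarith) (by positivity)
    nlinarith
  have h6 : 0 < s^3 := by positivity
  have h7 : 0 < s^2 := by positivity
  nlinarith

lemma slope_right {a b x y : ℝ} (hab : a < b) (ha : 2 < a) (hx : 0 < x) (hy : 0 < y)
    (ex : 5*x^2 - 5*x*(a^3-2*a^2+2*a) + a = 0) (ey : 5*y^2 - 5*y*(b^3-2*b^2+2*b) + b = 0)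
    (lx : 2*x < a^3-2*a^2+2*a) (ly : 2*y < b^3-2*b^2+2*b) :
    y ≤ x := by
  by_contra hc
  push Not at hc
  have key : (y - x) * (5*(b^3-2*b^2+2*b - y) - 5*x) = -((b - a) * (5*x*(a^2+a*b+b^2-2*a-2*b+2) - 1)) := by
    linear_combination ex - ey
  have hP : ∀ c : ℝ, 2 < c → 2*c ≤ c^3-2*c^2+2*c := by
    intro c hc
    have : c^3-2*c^2+2*c - 2*c = c^2*(c-2) := by ring
    have : 0 ≤ c^2*(c-2) := mul_nonneg (sq_nonneg _) (by linarith)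
    linarith
  have hPa := hP a ha
  have hPb := hP b (by linarith)
  have hx5 : 5*x ≤ 1 := by
    have h1 : 5*x*((a^3-2*a^2+2*a) - x) = a := by linear_combination -ex
    have h2 : a ≤ (a^3-2*a^2+2*a) - x := by linarith
    by_contra h3
    push Not at h3
    have : 1 * a < 5*x*((a^3-2*a^2+2*a) - x) := by
      apply mul_lt_mul h3 h2 (by linarith) (by linarith)
    linarith
  have hD : 0 < 5*(b^3-2*b^2+2*b - y) - 5*x := by nlinarith
  have hn : 0 < 5*x*(a^2+a*b+b^2-2*a-2*b+2) - 1 := by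
    have h1 : a * (5*x*(a^2-2*a+2) - 1) = 5*x^2 := by linear_combination -ex
    have h2 : 0 < 5*x*(a^2-2*a+2) - 1 := by
      by_contra h3
      push Not at h3
      have h4 := mul_nonneg (by linarith : 0 ≤ a) (by linarith : 0 ≤ -(5*x*(a^2-2*a+2) - 1))
      have h5 := pow_pos hx 2
      linarith
    have h3 : 0 < 5*x*(b*(a+b-2)) := by
      have : 0 < a + b - 2 := by linarith
      have : 0 < b := by linarith
      positivity
    nlinarith
  have := mul_pos (by linarith : 0 < y - x) hD
  have := mul_pos (by linarith : 0 < b - a) hn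
  linarith

lemma h422 (g : ℝ) {u v p : ℝ} (hu : 0 < u) (hv : 0 < v) (hp : 0 < p) :
    g/(p*(p+v)) - g/((p+u)*(p+v+u)) = g * u * ((p+v+p+u)/((p+u)*(p+v)) / (p*(p+v+u))) := by
  have h1 : p + u ≠ 0 := by positivity
  have h2 : p + v ≠ 0 := by positivity
  have h3 : p + v + u ≠ 0 := by positivity
  have h4 : p ≠ 0 := by positivity
  rw [div_sub_div _ _ (by positivity) (by positivity), div_div, ← mul_div_assoc, div_eq_div_iff (by positivity) (by positivity)]
  ring

lemma key22 (q0 q1 q2 a : ℝ) {u v p : ℝ} (hu : 0 < u) (hv : 0 < v) (hp : 0 < p) :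
    (((a+u)^3+q2*(a+u)^2+q1*(a+u)+q0)/(p*(p+v)) - (a^3+q2*a^2+q1*a+q0)/((p+u)*(p+v+u)))/u
     + (((a+u+p+v)^3+q2*(a+u+p+v)^2+q1*(a+u+p+v)+q0)/((p+v+u)*(p+v)) - ((a+u+p)^3+q2*(a+u+p)^2+q1*(a+u+p)+q0)/((p+u)*p))/v = 1 := by
  have hu' : u ≠ 0 := hu.ne'
  have hv' : v ≠ 0 := hv.ne'
  have h1 : p + u ≠ 0 := by positivity
  have h2 : p + v ≠ 0 := by positivity
  have h3 : p + v + u ≠ 0 := by positivity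
  have h4 : p ≠ 0 := by positivity
  field_simp
  ring

lemma t122 {ga gb u v p : ℝ} (hu : 0 < u) (hv : 0 < v) (hp : 2 < p) (pa : 0 < ga) (s1 : gb ≤ ga + u) (s2 : ga < 1/10) :
    (gb/(p*(p+v)) - ga/((p+u)*(p+v+u)))/u ≤ 1/4 + 1/10 := by
  have hp0 : 0 < p := by linarith
  rw [div_le_iff₀ hu]
  have h1 : gb/(p*(p+v)) ≤ ga/(p*(p+v)) + u/4 := by
    have h2 : gb/(p*(p+v)) ≤ (ga + u)/(p*(p+v)) := by
      apply div_le_div_of_nonneg_right (by linarith) (by positivity)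
    have h3 : u/(p*(p+v)) ≤ u/4 := by
      apply div_le_div_of_nonneg_left hu.le (by norm_num)
      nlinarith
    rw [add_div] at h2
    linarith
  have h4 : ga/(p*(p+v)) - ga/((p+u)*(p+v+u)) = ga * u * ((p+v+p+u)/((p+u)*(p+v)) / (p*(p+v+u))) :=
    h422 ga hu hv hp0
  have h5 : (p+v+p+u)/((p+u)*(p+v)) ≤ 1 := by
    rw [div_le_one (by positivity)]
    nlinarith [mul_pos hu hv, mul_pos hp0 hu, mul_pos hp0 hv]
  have h6 : (p+v+p+u)/((p+u)*(p+v)) / (p*(p+v+u)) ≤ 1 := by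
    apply div_le_one_of_le₀ _ (by positivity)
    have : 1 ≤ p*(p+v+u) := by nlinarith [mul_pos hp0 hu, mul_pos hp0 hv]
    linarith
  have h7 : ga * u * ((p+v+p+u)/((p+u)*(p+v)) / (p*(p+v+u))) ≤ ga * u * 1 :=
    mul_le_mul_of_nonneg_left h6 (by positivity)
  have h8 : ga * u ≤ 1/10 * u := mul_le_mul_of_nonneg_right s2.le hu.le
  linarith

lemma mixed22 {a b c d ga gb gc gd : ℝ} (hab : a < b) (hb : b < 0) (hc : 2 < c) (hcd : c < d)
    (pa : 0 < ga) (pb : 0 < gb) (pc : 0 < gc) (pd : 0 < gd)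
    (ea : 5*ga^2 - 5*ga*(a^3-2*a^2+2*a) + a = 0) (eb : 5*gb^2 - 5*gb*(b^3-2*b^2+2*b) + b = 0)
    (ec : 5*gc^2 - 5*gc*(c^3-2*c^2+2*c) + c = 0) (ed : 5*gd^2 - 5*gd*(d^3-2*d^2+2*d) + d = 0)
    (lc : 2*gc < c^3-2*c^2+2*c) (ld : 2*gd < d^3-2*d^2+2*d) (q0 q1 q2 : ℝ)
    (fa : ga = a^3 + q2*a^2 + q1*a + q0) (fb : gb = b^3 + q2*b^2 + q1*b + q0)
    (fc : gc = c^3 + q2*c^2 + q1*c + q0) (fd : gd = d^3 + q2*d^2 + q1*d + q0) : False := by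
  obtain ⟨s1, s2⟩ := slope_left hab hb pa pb ea eb
  have s3 := slope_right hcd hc pc pd ec ed lc ld
  obtain ⟨u, rfl⟩ : ∃ u, b = a + u := ⟨b - a, by ring⟩
  obtain ⟨p, rfl⟩ : ∃ p, c = a + u + p := ⟨c - (a+u), by ring⟩
  obtain ⟨v, rfl⟩ : ∃ v, d = a + u + p + v := ⟨d - (a + u + p), by ring⟩
  have hu : 0 < u := by linarith
  have hv : 0 < v := by linarith
  have hp : 2 < p := by linarith
  have hp0 : 0 < p := by linarith
  have key : (gb/(p*(p+v)) - ga/((p+u)*(p+v+u)))/u + (gd/((p+v+u)*(p+v)) - gc/((p+u)*p))/v = 1 := by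
    rw [fa, fb, fc, fd]
    exact key22 q0 q1 q2 a hu hv hp0
  have t2 : (gd/((p+v+u)*(p+v)) - gc/((p+u)*p))/v ≤ 0 := by
    apply div_nonpos_of_nonpos_of_nonneg _ hv.le
    have : gd/((p+v+u)*(p+v)) ≤ gc/((p+u)*p) := by
      apply div_le_div₀ pc.le s3 (by positivity)
      apply mul_le_mul <;> linarith
    linarith
  have t1 := t122 (gb := gb) hu hv hp pa (by linarith) s2
  linarith

/-- A non-vertical line meets the real Fermat quintic in at most three points. -/
lemma line3 {a b : ℝ} (hline : ¬ (b = 0 ∧ a = -1)) {x1 x2 x3 x4 : ℝ} (h12 : x1 < x2) (h23 : x2 < x3) (h34 : x3 < x4)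
    (e1 : x1^5 + (a*x1+b)^5 + 1 = 0) (e2 : x2^5 + (a*x2+b)^5 + 1 = 0)
    (e3 : x3^5 + (a*x3+b)^5 + 1 = 0) (e4 : x4^5 + (a*x4+b)^5 + 1 = 0) : False := by
  have hd : ∀ x ∈ (Set.univ : Set ℝ), HasDerivAt (fun x : ℝ => x^5 + (a*x+b)^5 + 1) (5*(x^4 + a*(a*x+b)^4)) x := by
    intro x _
    have := (((hasDerivAt_id x).pow 5).add ((((hasDerivAt_id x).const_mul a).add (hasDerivAt_const x b)).pow 5)).add (hasDerivAt_const x 1)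
    refine this.congr_deriv ?_
    simp; ring
  obtain ⟨y1, l1, m1, -, z1⟩ := rolle1 Set.ordConnected_univ hd (Set.mem_univ x1) (Set.mem_univ x2) h12 e1 e2
  obtain ⟨y2, l2, m2, -, z2⟩ := rolle1 Set.ordConnected_univ hd (Set.mem_univ x2) (Set.mem_univ x3) h23 e2 e3
  obtain ⟨y3, l3, m3, -, z3⟩ := rolle1 Set.ordConnected_univ hd (Set.mem_univ x3) (Set.mem_univ x4) h34 e3 e4
  have ha : a < 0 := by
    by_contra hc
    push Not at hc
    have hz : ∀ y : ℝ, 5*(y^4 + a*(a*y+b)^4) = 0 → y = 0 := by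
      intro y hy
      have h1 : 0 ≤ a*(a*y+b)^4 := mul_nonneg hc (by positivity)
      have h2 : 0 ≤ y^4 := by positivity
      have h3 : y^4 = 0 := by linarith
      exact pow_eq_zero_iff (by norm_num) |>.mp h3
    have := hz y1 z1
    have := hz y2 z2
    linarith
  obtain ⟨c, hc, hca⟩ : ∃ c : ℝ, 0 < c ∧ c^4 = -a := by
    refine ⟨√(√(-a)), Real.sqrt_pos.mpr (Real.sqrt_pos.mpr (by linarith)), ?_⟩
    have h1 := Real.sq_sqrt (Real.sqrt_nonneg (-a))
    have h2 := Real.sq_sqrt (by linarith : 0 ≤ -a)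
    calc √(√(-a))^4 = (√(√(-a))^2)^2 := by ring
      _ = -a := by rw [h1, h2]
  have hlin : ∀ y : ℝ, 5*(y^4 + a*(a*y+b)^4) = 0 → y = c*(a*y+b) ∨ y = -c*(a*y+b) := by
    intro y hy
    have h1 : (y^2 - (c*(a*y+b))^2) * (y^2 + (c*(a*y+b))^2) = 0 := by
      have : (y^2 - (c*(a*y+b))^2) * (y^2 + (c*(a*y+b))^2) = y^4 - c^4*(a*y+b)^4 := by ring
      rw [this, hca]; linarith
    have h2 : y^2 = (c*(a*y+b))^2 := by
      rcases mul_eq_zero.mp h1 with h | h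
      · linarith
      · have e1 := sq_nonneg y
        have e2 := sq_nonneg (c*(a*y+b))
        linarith
    rcases sq_eq_sq_iff_eq_or_eq_neg.mp h2 with h | h
    · exact Or.inl h
    · right; linarith
  have hA : ∀ y z : ℝ, y < z → y = c*(a*y+b) → z = c*(a*z+b) → False := by
    intro y z hyz hy hz
    have h1 : (z - y) * (1 - c*a) = 0 := by linear_combination hz - hy
    have h2 : 0 < 1 - c*a := by nlinarith
    rcases mul_eq_zero.mp h1 with h | h <;> linarith
  have hB : ∀ y z : ℝ, y < z → y = -c*(a*y+b) → z = -c*(a*z+b) → False := by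
    intro y z hyz hy hz
    have h1 : (z - y) * (1 + c*a) = 0 := by linear_combination hz - hy
    have h2 : 1 + c*a = 0 := by
      rcases mul_eq_zero.mp h1 with h | h
      · linarith
      · exact h
    have h3 : c^5 = 1 := by
      have : c^5 = c^4*c := by ring
      rw [this, hca]; linarith
    have h4 : c = 1 := (pow_eq_one_iff_of_nonneg hc.le (by norm_num)).mp h3
    subst h4
    exact hline ⟨by linear_combination hy - y*h2, by linarith⟩
  have l12 : y1 < y2 := by linarith
  have l23 : y2 < y3 := by linarith
  rcases hlin y1 z1 with k1 | k1 <;> rcases hlin y2 z2 with k2 | k2 <;> rcases hlin y3 z3 with k3 | k3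
  · exact hA _ _ l12 k1 k2
  · exact hA _ _ l12 k1 k2
  · exact hA _ _ (l12.trans l23) k1 k3
  · exact hB _ _ l23 k2 k3
  · exact hA _ _ l23 k2 k3
  · exact hB _ _ (l12.trans l23) k1 k3
  · exact hB _ _ l12 k1 k2
  · exact hB _ _ l12 k1 k2
end FQ

namespace FQ
open NumberField Polynomial

section
variable {K : Type*} [Field K] [NumberField K]

lemma Pt.real {U V W : K} (h : Pt U V W) (φ : K →+* ℝ) : φ W < 0 ∨ 2 < φ W := by
  have hg := h.crd.hg φ
  have e1 : φ U + φ V + φ W = 2 := by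
    have := congrArg φ h.hs
    simpa only [map_add, map_ofNat] using this
  have e4 : 5 * (φ U * φ V * φ W) * (2 - φ U*φ V - φ U*φ W-φ V*φ W) = 1 := by
    have := congrArg φ h.hk
    simpa only [map_sub, map_mul, map_ofNat, map_one] using this
  have hg' : 0 < φ U * φ V * φ W := by simpa only [map_mul] using hg
  generalize φ U = u at *
  generalize φ V = v at *
  generalize φ W = w at *
  by_contra hc
  push Not at hc
  obtain ⟨h0, h2⟩ := hc
  have hw : 0 < w := by
    rcases h0.lt_or_eq with h | h
    · exact h
    · subst h; simp at hg'
  have huv : 0 < u * v := by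
    by_contra h
    push Not at h
    have := mul_nonneg (by linarith : 0 ≤ -(u*v)) hw.le
    linarith
  have hu : 0 < u ∧ 0 < v := by
    rcases pos_and_pos_or_neg_and_neg_of_mul_pos huv with h | h
    · exact h
    · linarith
  obtain ⟨hu, hv⟩ := hu
  have hs : 0 < u*v+u*w+v*w := by positivity
  have hsg : 6*(u*v*w) ≤ (u*v+u*w+v*w)^2 := by
    have : (u*v+u*w+v*w)^2 - 3*(u*v*w)*(u+v+w) = ((u*v-u*w)^2+(u*v-v*w)^2+(u*w-v*w)^2)/2 := by ring
    rw [e1] at this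
    nlinarith [sq_nonneg (u*v-u*w), sq_nonneg (u*v-v*w), sq_nonneg (u*w-v*w)]
  have e5 : 5 * (u*v*w) * (2 - (u*v+u*w+v*w)) = 1 := by linear_combination e4
  have h2s : 0 < 2 - (u*v+u*w+v*w) := by
    by_contra h
    push Not at h
    have := mul_nonneg (by linarith : 0 ≤ 5*(u*v*w)) (by linarith : 0 ≤ -(2 - (u*v+u*w+v*w)))
    linarith
  generalize u*v+u*w+v*w = s at *
  generalize u*v*w = g at *
  have h3 : 6 ≤ 5 * s^2 * (2-s) := by
    have := mul_le_mul_of_nonneg_right hsg h2s.le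
    linarith
  nlinarith [mul_nonneg (by linarith : 0 ≤ s + 2/3) (sq_nonneg (s-4/3))]

lemma real_set (htr : ∀ φ : K →+* ℂ, ∀ x : K, (φ x).im = 0) {n : ℕ} (hn : Module.finrank ℚ K = n) {T : K}
    (hT : ∀ φ ψ : K →+* ℝ, φ T = ψ T → φ = ψ) :
    ∃ s : Finset ℝ, s.card = n ∧ ∀ a ∈ s, ∃ φ : K →+* ℝ, φ T = a := by
  obtain ⟨e, he, -⟩ := real_homs htr hn
  classical
  refine ⟨Finset.univ.image (fun i => e i T), ?_, ?_⟩
  · rw [Finset.card_image_of_injective]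
    · simp
    · intro i j hij
      exact he (hT _ _ hij)
  · intro a ha
    simp only [Finset.mem_image, Finset.mem_univ, true_and] at ha
    obtain ⟨i, hi⟩ := ha
    exact ⟨e i, hi⟩

lemma Crd.kill0 (htr : ∀ φ : K →+* ℂ, ∀ x : K, (φ x).im = 0) {W g k : K} (h : Crd W g k)
    (hT : ∀ φ ψ : K →+* ℝ, φ W = ψ W → φ = ψ) (hf : 4 ≤ Module.finrank ℚ K) (a0 a1 a2 : ℚ)
    (ha : -5*g*W⁻¹^3 = a0 + a1 * W⁻¹ + a2 * W⁻¹^2) : False := by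
  have hT' : ∀ φ ψ : K →+* ℝ, φ (1 - W⁻¹) = ψ (1 - W⁻¹) → φ = ψ := by
    intro φ ψ hh
    apply hT
    rw [map_sub, map_sub, map_one, map_one, map_inv₀, map_inv₀] at hh
    exact inv_injective (by linarith)
  obtain ⟨s, hs, hs'⟩ := real_set htr rfl hT'
  have key : ∀ r ∈ s, 0 < 5+20*r^5 ∧ √(5+20*r^5) = (2*(a0+a1+a2)+5 : ℝ) + (-2*a1-4*a2-10 : ℝ)*r + (2*a2+10 : ℝ) * r^2 := by
    intro r hr
    obtain ⟨φ, hφ⟩ := hs' r hr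
    have e1 := congrArg φ h.eta
    have hY := h.hY φ
    have e2 := congrArg φ h.etaQ
    have e3 := congrArg φ ha
    have hw : φ W ≠ 0 := by simpa using h.hW
    simp only [map_add, map_mul, map_pow, map_sub, map_ofNat, map_neg, map_inv₀, map_zero, map_ratCast, map_one] at e1 e2 e3 hφ hY
    have ht : (φ W)⁻¹ = 1 - r := by linarith
    have hY3 : -5 * φ g * (φ W)⁻¹^3 + 5 * φ k * (φ W)⁻¹^2 = 5 * (φ W * (φ k * φ W - φ g)) * ((φ W)⁻¹^2)^2 := by
      field_simp; ring
    have hpos : 0 < -5 * φ g * (φ W)⁻¹^3 + 5 * φ k * (φ W)⁻¹^2 := by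
      rw [hY3]
      have : (φ W)⁻¹ ≠ 0 := inv_ne_zero hw
      positivity
    rw [← e2] at hpos
    have hsq : (-5 * φ g * (φ W)⁻¹^3 + (-5 * φ g * (φ W)⁻¹^3 + (5 - 10*(φ W)⁻¹ + 10*(φ W)⁻¹^2)))^2 = 5 + 20*r^5 := by
      have hr : r = 1 - (φ W)⁻¹ := by linarith
      rw [hr]
      linear_combination 4*e1
    refine ⟨by rw [← hsq]; positivity, ?_⟩
    rw [← hsq, Real.sqrt_sq hpos.le, e3, ht]
    ring
  obtain ⟨a, as, b, bs, c, cs, d, ds, hab, hbc, hcd⟩ := four_of_card (s := s) (by omega)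
  exact real0 (key a as).1 (key d ds).1 hab hbc hcd _ _ _ (key a as).2 (key b bs).2 (key c cs).2 (key d ds).2

lemma Crd.kill1 (htr : ∀ φ : K →+* ℂ, ∀ x : K, (φ x).im = 0) {W g k : K} (h : Crd W g k)
    (hr : ∀ φ : K →+* ℝ, φ W < 0 ∨ 2 < φ W)
    (hT : ∀ φ ψ : K →+* ℝ, φ W = ψ W → φ = ψ) (hf : Module.finrank ℚ K = 5) (l0 l1 l2 : ℚ)
    (ha : 5*k*W = l0 * W^2 + l1 * W + l2) : False := by
  obtain ⟨s, hs, hs'⟩ := real_set htr hf hT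
  have key : ∀ w ∈ s, ∃ γ κ : ℝ, 0 < γ ∧ 5*γ*κ = w ∧ γ + κ = w^3-2*w^2+2*w ∧ 0 < w*(κ-γ) ∧ 5*κ = l0*w^2+l1*w+l2 := by
    intro w hw
    obtain ⟨φ, hφ⟩ := hs' w hw
    have e1 := congrArg φ h.hP
    have hY := h.hY φ
    have e2 := congrArg φ h.hgk
    have e3 := congrArg φ ha
    simp only [map_add, map_mul, map_pow, map_sub, map_ofNat, map_ratCast, map_one, hφ] at e1 e2 e3 hY
    exact ⟨φ g, φ k * w, h.hg φ, by linear_combination w * e2, e1, hY, by linear_combination e3⟩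
  have hdE : ∀ w γ κ : ℝ, 5*γ*κ = w → γ + κ = w^3-2*w^2+2*w → dE w = (5*(κ-γ))^2 := by
    intro w γ κ h1 h2
    unfold dE
    rw [← h2]
    linear_combination 20*h1
  have hneg : ∀ w ∈ s, w < 0 → √(dE w) = (-2*l2 : ℝ) + (10-2*l1 : ℝ)*w + (-10-2*l0 : ℝ)*w^2 + 5*w^3 := by
    intro w hw h0
    obtain ⟨γ, κ, h1, h2, h3, h4, h5⟩ := key w hw
    have : κ - γ < 0 := by
      by_contra hc
      push Not at hc
      have := mul_nonneg (by linarith : 0 ≤ -w) hc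
      linarith
    rw [hdE w γ κ h2 h3, ← neg_sq, Real.sqrt_sq (by linarith)]
    linear_combination 5*h3 - 2*h5
  have hpos : ∀ w ∈ s, 2 < w → √(dE w) = (2*l2 : ℝ) + (-10+2*l1 : ℝ)*w + (10+2*l0 : ℝ)*w^2 + (-5)*w^3 ∧
      ∃ γ, 0 < γ ∧ 5*γ^2 - 5*γ*(w^3-2*w^2+2*w) + w = 0 ∧ 2*γ < w^3-2*w^2+2*w ∧ γ = w^3 + (-2-l0/5 : ℝ)*w^2+(2-l1/5 : ℝ)*w+(-l2/5 : ℝ) := by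
    intro w hw h0
    obtain ⟨γ, κ, h1, h2, h3, h4, h5⟩ := key w hw
    have : 0 < κ - γ := by
      by_contra hc
      push Not at hc
      have := mul_nonneg (by linarith : 0 ≤ w) (by linarith : 0 ≤ -(κ - γ))
      linarith
    refine ⟨?_, γ, h1, ?_, by linarith, ?_⟩
    · rw [hdE w γ κ h2 h3, Real.sqrt_sq (by linarith)]
      linear_combination -5*h3 + 2*h5
    · rw [← h3, ← h2]; ring
    · linear_combination h3 - h5/5
  have hneg2 : ∀ w ∈ s, ∃ γ, 0 < γ ∧ 5*γ^2 - 5*γ*(w^3-2*w^2+2*w) + w = 0 ∧ γ = w^3 + (-2-l0/5 : ℝ)*w^2+(2-l1/5 : ℝ)*w+(-l2/5 : ℝ) := by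
    intro w hw
    obtain ⟨γ, κ, h1, h2, h3, h4, h5⟩ := key w hw
    refine ⟨γ, h1, ?_, ?_⟩
    · rw [← h3, ← h2]; ring
    · linear_combination h3 - h5/5
  have hdich : ∀ w ∈ s, w < 0 ∨ 2 < w := by
    intro w hw
    obtain ⟨φ, hφ⟩ := hs' w hw
    rw [← hφ]; exact hr φ
  have hcard := Finset.card_filter_add_card_filter_not (s := s) (fun w => w < 0)
  rw [hs] at hcard
  have mN : ∀ w, w ∈ s.filter (fun w => w < 0) → w ∈ s ∧ w < 0 := by
    intro w hw; exact Finset.mem_filter.mp hw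
  have mP : ∀ w, w ∈ s.filter (fun w => ¬ w < 0) → w ∈ s ∧ 2 < w := by
    intro w hw
    have := Finset.mem_filter.mp hw
    exact ⟨this.1, (hdich w this.1).resolve_left this.2⟩
  by_cases c1 : 4 ≤ (s.filter (fun w => w < 0)).card
  · obtain ⟨a, as, b, bs, c, cs, d, ds, hab, hbc, hcd⟩ := four_of_card c1
    have h1 := mN a as
    have h2 := mN b bs
    have h3 := mN c cs
    have h4 := mN d ds
    exact neg4 h4.2 hab hbc hcd _ _ _ (hneg a h1.1 h1.2) (hneg b h2.1 h2.2) (hneg c h3.1 h3.2) (hneg d h4.1 h4.2)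
  by_cases c2 : 4 ≤ (s.filter (fun w => ¬ w < 0)).card
  · obtain ⟨a, as, b, bs, c, cs, d, ds, hab, hbc, hcd⟩ := four_of_card c2
    have h1 := mP a as
    have h2 := mP b bs
    have h3 := mP c cs
    have h4 := mP d ds
    exact pos4 h1.2 hab hbc hcd _ _ _ (hpos a h1.1 h1.2).1 (hpos b h2.1 h2.2).1 (hpos c h3.1 h3.2).1 (hpos d h4.1 h4.2).1
  obtain ⟨a, as, b, bs, hab⟩ := two_of_card (s := s.filter (fun w => w < 0)) (by omega)
  obtain ⟨c, cs, d, ds, hcd⟩ := two_of_card (s := s.filter (fun w => ¬ w < 0)) (by omega)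
  obtain ⟨as, a0⟩ := mN a as
  obtain ⟨bs, b0⟩ := mN b bs
  obtain ⟨cs, c0⟩ := mP c cs
  obtain ⟨ds, d0⟩ := mP d ds
  obtain ⟨ga, pa, ea, fa⟩ := hneg2 a as
  obtain ⟨gb, pb, eb, fb⟩ := hneg2 b bs
  obtain ⟨-, gc, pc, ec, lc, fc⟩ := hpos c cs c0
  obtain ⟨-, gd, pd, ed, ld, fd⟩ := hpos d ds d0
  exact mixed22 hab b0 c0 hcd pa pb pc pd ea eb ec ed lc ld _ _ _ fa fb fc fd
end
end FQ

namespace FQ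
open NumberField Polynomial

section
variable {K : Type*} [Field K] [NumberField K]

lemma prod_form {F : Type*} [Field F] {n : ℕ} (M : F[X]) (hd : M.natDegree ≤ n) (w : Fin n → F) (hw : Function.Injective w)
    (hM : ∀ i, M.eval (w i) = 0) (x : F) : M.eval x = M.coeff n * ∏ i, (x - w i) := by
  have : M = C (M.coeff n) * ∏ i, (X - C (w i)) := by
    have hmon : (∏ i, (X - C (w i))).Monic := monic_prod_of_monic _ _ (fun i _ => monic_X_sub_C _)
    have hdeg : (∏ i, (X - C (w i))).natDegree = n := by
      rw [natDegree_prod_of_monic _ _ (fun i _ => monic_X_sub_C _)]; simp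
    have hlt : (M - C (M.coeff n) * ∏ i, (X - C (w i))).degree < (n : ℕ) := by
      rw [degree_lt_iff_coeff_zero]
      intro m hm
      rcases hm.eq_or_lt with h | h
      · subst h
        rw [coeff_sub, coeff_C_mul]
        have : (∏ i, (X - C (w i))).coeff n = 1 := by
          have := hmon.coeff_natDegree
          rwa [hdeg] at this
        rw [this]; ring
      · rw [coeff_sub, coeff_C_mul, coeff_eq_zero_of_natDegree_lt (p := M) (by omega), coeff_eq_zero_of_natDegree_lt (p := ∏ i, (X - C (w i))) (by rw [hdeg]; exact h)]
        ring
    refine eq_of_degree_sub_lt_of_eval_index_eq (s := Finset.univ) (v := w) hw.injOn (by simpa using hlt) ?_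
    intro i _
    rw [hM i, eval_mul, eval_prod, Finset.prod_eq_zero (Finset.mem_univ i) (by simp)]
    simp
  conv_lhs => rw [this]
  rw [eval_mul, eval_C, eval_prod]
  simp

lemma gen_inj {W : K} (hT : (minpoly ℚ W⁻¹).natDegree = Module.finrank ℚ K) (φ ψ : K →+* ℝ) (h : φ W = ψ W) : φ = ψ := by
  apply hom_ext_gen (adjoin_top_of_deg hT)
  rw [map_inv₀, map_inv₀, h]

lemma gen_deg {W : K} (hT : (minpoly ℚ W⁻¹).natDegree = Module.finrank ℚ K) : (minpoly ℚ W).natDegree = Module.finrank ℚ K := by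
  have h1 := adjoin_top_of_deg hT
  have h2 : IntermediateField.adjoin ℚ {W} = ⊤ := by
    rw [eq_top_iff, ← h1, IntermediateField.adjoin_simple_le_iff]
    exact inv_mem (IntermediateField.mem_adjoin_simple_self ℚ W)
  rw [← IntermediateField.adjoin.finrank (IsIntegral.of_finite ℚ W), h2]
  exact IntermediateField.finrank_top'

/-- the coordinate generates -/
def Gen (n : ℕ) (W : K) : Prop := (minpoly ℚ W).natDegree = n

lemma Gen.zero {n : ℕ} {W : K} (h : Gen n W) (p : ℚ[X]) (hd : p.natDegree < n) (hp : aeval W p = 0) : p = 0 := by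
  by_contra hc
  have := natDegree_le_of_dvd (minpoly.dvd ℚ W hp) hc
  rw [h] at this
  omega

lemma Gen.zero5 {W : K} (h : Gen 5 W) (m0 m1 m2 m3 m4 : ℚ) (hm : (m4:K)*W^4+m3*W^3+m2*W^2+m1*W+m0 = 0) :
    m4 = 0 ∧ m3 = 0 ∧ m2 = 0 ∧ m1 = 0 ∧ m0 = 0 := by
  have hp := h.zero (C m4 * X^4 + C m3 * X^3 + C m2 * X^2 + C m1 * X + C m0) (by compute_degree!) (by simpa using hm)
  have c := fun i => congrArg (fun q => coeff q i) hp
  refine ⟨?_, ?_, ?_, ?_, ?_⟩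
  · simpa [coeff_X, coeff_C] using c 4
  · simpa [coeff_X, coeff_C] using c 3
  · simpa [coeff_X, coeff_C] using c 2
  · simpa [coeff_X, coeff_C] using c 1
  · simpa [coeff_X, coeff_C] using c 0

lemma Gen.zero4 {W : K} (h : Gen 4 W) (m0 m1 m2 m3 : ℚ) (hm : (m3:K)*W^3+m2*W^2+m1*W+m0 = 0) :
    m3 = 0 ∧ m2 = 0 ∧ m1 = 0 ∧ m0 = 0 := by
  have hp := h.zero (C m3 * X^3 + C m2 * X^2 + C m1 * X + C m0) (by compute_degree!) (by simpa using hm)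
  have c := fun i => congrArg (fun q => coeff q i) hp
  refine ⟨?_, ?_, ?_, ?_⟩
  · simpa [coeff_X, coeff_C] using c 3
  · simpa [coeff_X, coeff_C] using c 2
  · simpa [coeff_X, coeff_C] using c 1
  · simpa [coeff_X, coeff_C] using c 0

lemma norm_lin5 (htr : ∀ φ : K →+* ℂ, ∀ x : K, (φ x).im = 0) (hn : Module.finrank ℚ K = 5) {W : K}
    (hT : ∀ φ ψ : K →+* ℝ, φ W = ψ W → φ = ψ) (m0 m1 m2 m3 m4 m5 : ℚ)
    (hm : (m5:K)*W^5+m4*W^4+m3*W^3+m2*W^2+m1*W+m0 = 0) (α β : ℚ) :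
    m5 * Algebra.norm ℚ ((α:K)*W+β) = m5*β^5-m4*β^4*α+m3*β^3*α^2-m2*β^2*α^3+m1*β*α^4-m0*α^5 := by
  obtain ⟨e, he, hprod⟩ := real_homs htr hn
  have hpf := prod_form (C (m5:ℝ) * X^5 + C (m4:ℝ) * X^4 + C (m3:ℝ) * X^3 + C (m2:ℝ) * X^2 + C (m1:ℝ) * X + C (m0:ℝ)) (n := 5)
    (by compute_degree!) (fun i => e i W) (fun i j hij => he (hT _ _ hij)) (by
      intro i
      have := congrArg (e i) hm
      simpa using this)
  have hc : (C (m5:ℝ) * X^5 + C (m4:ℝ) * X^4 + C (m3:ℝ) * X^3 + C (m2:ℝ) * X^2 + C (m1:ℝ) * X + C (m0:ℝ)).coeff 5 = (m5:ℝ) := by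
    simp [coeff_X, coeff_C]
  rw [hc] at hpf
  have h1 := hprod ((α:K)*W+β)
  have : (m5:ℝ) * (Algebra.norm ℚ ((α:K)*W+β) : ℝ) = m5*β^5-m4*β^4*α+m3*β^3*α^2-m2*β^2*α^3+m1*β*α^4-m0*α^5 := by
    rw [← h1]
    simp only [map_add, map_mul, map_ratCast]
    by_cases hα : α = 0
    · subst hα
      simp
    · have hα' : (α:ℝ) ≠ 0 := by exact_mod_cast hα
      have h2 := hpf (-β/α)
      simp only [eval_add, eval_mul, eval_C, eval_pow, eval_X] at h2
      have h3 : ∏ i, ((α:ℝ) * e i W + β) = (-α)^5 * ∏ i, (-(β:ℝ)/α - e i W) := by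
        rw [show ((-α:ℝ))^5 = ∏ i : Fin 5, (-α:ℝ) by simp, ← Finset.prod_mul_distrib]
        apply Finset.prod_congr rfl
        intro i _
        field_simp
        ring
      rw [h3, mul_left_comm, ← h2]
      field_simp
      ring
  exact_mod_cast this

lemma norm_lin4 (htr : ∀ φ : K →+* ℂ, ∀ x : K, (φ x).im = 0) (hn : Module.finrank ℚ K = 4) {W : K}
    (hT : ∀ φ ψ : K →+* ℝ, φ W = ψ W → φ = ψ) (m0 m1 m2 m3 m4 : ℚ)
    (hm : (m4:K)*W^4+m3*W^3+m2*W^2+m1*W+m0 = 0) (α β : ℚ) :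
    m4 * Algebra.norm ℚ ((α:K)*W+β) = m4*β^4-m3*β^3*α+m2*β^2*α^2-m1*β*α^3+m0*α^4 := by
  obtain ⟨e, he, hprod⟩ := real_homs htr hn
  have hpf := prod_form (C (m4:ℝ) * X^4 + C (m3:ℝ) * X^3 + C (m2:ℝ) * X^2 + C (m1:ℝ) * X + C (m0:ℝ)) (n := 4)
    (by compute_degree!) (fun i => e i W) (fun i j hij => he (hT _ _ hij)) (by
      intro i
      have := congrArg (e i) hm
      simpa using this)
  have hc : (C (m4:ℝ) * X^4 + C (m3:ℝ) * X^3 + C (m2:ℝ) * X^2 + C (m1:ℝ) * X + C (m0:ℝ)).coeff 4 = (m4:ℝ) := by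
    simp [coeff_X, coeff_C]
  rw [hc] at hpf
  have h1 := hprod ((α:K)*W+β)
  have : (m4:ℝ) * (Algebra.norm ℚ ((α:K)*W+β) : ℝ) = m4*β^4-m3*β^3*α+m2*β^2*α^2-m1*β*α^3+m0*α^4 := by
    rw [← h1]
    simp only [map_add, map_mul, map_ratCast]
    by_cases hα : α = 0
    · subst hα
      simp
    · have hα' : (α:ℝ) ≠ 0 := by exact_mod_cast hα
      have h2 := hpf (-β/α)
      simp only [eval_add, eval_mul, eval_C, eval_pow, eval_X] at h2
      have h3 : ∏ i, ((α:ℝ) * e i W + β) = (-α)^4 * ∏ i, (-(β:ℝ)/α - e i W) := by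
        rw [show ((-α:ℝ))^4 = ∏ i : Fin 4, (-α:ℝ) by simp, ← Finset.prod_mul_distrib]
        apply Finset.prod_congr rfl
        intro i _
        field_simp
        ring
      rw [h3, mul_left_comm, ← h2]
      field_simp
      ring
  exact_mod_cast this
end
end FQ

namespace FQ
open NumberField Polynomial

section
variable {K : Type*} [Field K] [NumberField K]

def Kum (a : ℕ) (W g : K) : Prop := ∃ r : ℚ, Algebra.norm ℚ (5*g) = 5^a * r^5 * (Algebra.norm ℚ W)^3

lemma norm_rat (q : ℚ) : Algebra.norm ℚ (q : K) = q ^ (Module.finrank ℚ K) := by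
  have := Algebra.norm_algebraMap (R := ℚ) (S := K) q
  rwa [eq_ratCast] at this

lemma Crd.quad {W g k : K} (h : Crd W g k) : (5*g)^2 - 5*(5*g)*(W^3-2*W^2+2*W) + 5*W = 0 := by
  linear_combination 5 * h.ratl

lemma kumA4 (htr : ∀ φ : K →+* ℂ, ∀ x : K, (φ x).im = 0) (hn : Module.finrank ℚ K = 4) {W g k : K} (h : Crd W g k)
    (hT : ∀ φ ψ : K →+* ℝ, φ W = ψ W → φ = ψ) (hG : Gen 4 W) (l0 l1 : ℚ) (hl : l1 ≠ 0) (he : -5*g = l0*W+l1) :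
    Kum 3 W g ∧ l0 ≠ 0 := by
  have he' : 5*g = -((l0:K)*W+l1) := by linear_combination -he
  have hq := h.quad
  rw [he'] at hq
  have hm : ((5*l0 : ℚ):K)*W^4 + ((5*l1-10*l0 : ℚ) : K)*W^3 + ((l0^2+10*l0-10*l1 : ℚ):K)*W^2+((2*l0*l1+10*l1+5 : ℚ):K)*W + ((l1^2:ℚ):K) = 0 := by
    push_cast
    linear_combination hq
  have h0 : l0 ≠ 0 := by
    rintro rfl
    have := hG.zero4 (l1^2) (2*0*l1+10*l1+5) (0^2+10*0-10*l1) (5*l1-10*0) (by push_cast at hm ⊢; linear_combination hm)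
    exact hl (by linarith [this.1])
  refine ⟨?_, h0⟩
  have n1 := norm_lin4 htr hn hT _ _ _ _ _ hm 1 0
  have n2 := norm_lin4 htr hn hT _ _ _ _ _ hm l0 l1
  simp only [Rat.cast_one, one_mul, Rat.cast_zero, add_zero] at n1
  have n3 : Algebra.norm ℚ (5*g) = Algebra.norm ℚ ((l0:K)*W+l1) := by
    rw [he', show -((l0:K)*W+l1) = ((-1:ℚ):K)*((l0:K)*W+l1) by push_cast; ring, map_mul, norm_rat, hn]
    norm_num
  refine ⟨-l0/l1, ?_⟩
  rw [n3]
  generalize Algebra.norm ℚ ((l0:K)*W+l1) = y at *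
  generalize Algebra.norm ℚ W = x at *
  have hx : x = l1^2/(5*l0) := by field_simp; linear_combination n1
  have hy : y = -l0^2*l1 := by
    apply mul_left_cancel₀ (mul_ne_zero (by norm_num : (5:ℚ) ≠ 0) h0)
    linear_combination n2
  rw [hx, hy]
  field_simp

lemma kumB4 (htr : ∀ φ : K →+* ℂ, ∀ x : K, (φ x).im = 0) (hn : Module.finrank ℚ K = 4) {W g k : K} (h : Crd W g k)
    (hT : ∀ φ ψ : K →+* ℝ, φ W = ψ W → φ = ψ) (hG : Gen 4 W) (l0 l1 : ℚ) (hl : l1 ≠ 0) (he : 5*k*W = l0*W+l1) :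
    Kum 1 W g := by
  have hq : 5*g*((l0:K)*W+l1) = ((5:ℚ):K)*W := by
    rw [← he]; push_cast; linear_combination 5*W*h.hgk
  have hP : 5*g + ((l0:K)*W+l1) = 5*(W^3-2*W^2+2*W) := by
    rw [← he]; linear_combination 5*h.hP
  have hm : ((-5*l0 : ℚ):K)*W^4 + ((-5*l1+10*l0 : ℚ) : K)*W^3 + ((l0^2-10*l0+10*l1 : ℚ):K)*W^2+((2*l0*l1-10*l1+5 : ℚ):K)*W + ((l1^2:ℚ):K) = 0 := by
    push_cast at hq ⊢
    linear_combination ((l0:K)*W+l1)*hP - hq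
  have h0 : l0 ≠ 0 := by
    rintro rfl
    have := hG.zero4 (l1^2) (2*0*l1-10*l1+5) (0^2-10*0+10*l1) (-5*l1+10*0) (by push_cast at hm ⊢; linear_combination hm)
    exact hl (by linarith [this.1])
  have n1 := norm_lin4 htr hn hT _ _ _ _ _ hm 1 0
  have n2 := norm_lin4 htr hn hT _ _ _ _ _ hm l0 l1
  simp only [Rat.cast_one, one_mul, Rat.cast_zero, add_zero] at n1
  have n3 := congrArg (Algebra.norm ℚ) hq
  rw [map_mul (Algebra.norm ℚ) (5*g), map_mul (Algebra.norm ℚ) _ W, norm_rat, hn] at n3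
  refine ⟨5/l1, ?_⟩
  generalize Algebra.norm ℚ ((l0:K)*W+l1) = y at *
  generalize Algebra.norm ℚ W = x at *
  generalize Algebra.norm ℚ (5*g) = G at *
  have hx : x = -l1^2/(5*l0) := by field_simp; linear_combination -n1
  have hy : y = l0^2*l1 := by
    apply mul_left_cancel₀ (mul_ne_zero (by norm_num : (5:ℚ) ≠ 0) h0)
    linear_combination -n2
  rw [hy, hx] at n3
  rw [hx]
  field_simp at n3 ⊢
  linear_combination n3

lemma kumC5 (htr : ∀ φ : K →+* ℂ, ∀ x : K, (φ x).im = 0) (hn : Module.finrank ℚ K = 5) {W g k : K} (h : Crd W g k)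
    (hT : ∀ φ ψ : K →+* ℝ, φ W = ψ W → φ = ψ) (hG : Gen 5 W) (a b c d : ℚ) (ha : a ≠ 0) (hb : b ≠ 0) (he : -5*g*(a*W+b) = W*(c*W+d)) :
    Kum 1 W g ∧ c ≠ 0 ∧ a*d-b*c ≠ 0 := by
  have hq := h.quad
  have hW := h.hW
  have hm' : W*((c:K)*W+d)^2 + 5*(c*W+d)*(a*W+b)*(W^3-2*W^2+2*W)+5*(a*W+b)^2 = 0 := by
    apply mul_left_cancel₀ hW
    linear_combination (a*W+b)^2*hq - (W*(c*W+d) + (-5)*g*(a*W+b) + 5*(a*W+b)*(W^3-2*W^2+2*W)) * he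
  have hm : ((5*a*c : ℚ):K)*W^5 + ((5*(a*d+b*c)-10*a*c : ℚ):K)*W^4 + ((c^2+5*b*d-10*(a*d+b*c)+10*a*c : ℚ) : K)*W^3
     + ((2*c*d-10*b*d+10*(a*d+b*c)+5*a^2 : ℚ):K)*W^2+((d^2+10*b*d+10*a*b : ℚ):K)*W + ((5*b^2:ℚ):K) = 0 := by
    push_cast
    linear_combination hm'
  have h0 : c ≠ 0 := by
    rintro rfl
    have := hG.zero5 _ _ _ _ _ (by
      rw [show (5*a*0:ℚ) = 0 by ring, Rat.cast_zero, zero_mul, zero_add] at hm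
      exact hm)
    have h1 := this.2.2.2.2
    exact hb (by simpa using h1)
  have n1 := norm_lin5 htr hn hT _ _ _ _ _ _ hm 1 0
  have n2 := norm_lin5 htr hn hT _ _ _ _ _ _ hm a b
  have n3 := norm_lin5 htr hn hT _ _ _ _ _ _ hm c d
  simp only [Rat.cast_one, one_mul, Rat.cast_zero, add_zero] at n1
  have n4 : -Algebra.norm ℚ (5*g) * Algebra.norm ℚ ((a:K)*W+b) = Algebra.norm ℚ W * Algebra.norm ℚ ((c:K)*W+d) := by
    have := congrArg (Algebra.norm ℚ) he
    rw [show (-5*g*((a:K)*W+b)) = ((-1:ℚ):K)*(5*g)*((a:K)*W+b) by push_cast; ring] at this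
    rw [map_mul _ W, map_mul (Algebra.norm ℚ) (((-1:ℚ):K)*(5*g)), map_mul (Algebra.norm ℚ) ((-1:ℚ):K), norm_rat, hn] at this
    rw [← this]; ring
  have hne : Algebra.norm ℚ ((a:K)*W+b) ≠ 0 := by
    rw [Algebra.norm_ne_zero_iff]
    intro hz
    have := hG.zero5 b a 0 0 0 (by push_cast; linear_combination hz)
    exact hb this.2.2.2.2
  generalize Algebra.norm ℚ ((a:K)*W+b) = y at *
  generalize Algebra.norm ℚ ((c:K)*W+d) = z at *
  have n2' : 5*c*y = a*b*(a*d-b*c)^2 := by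
    apply mul_left_cancel₀ ha
    linear_combination n2
  have n3' : a*z = -c^2*(a*d-b*c)^2 := by
    apply mul_left_cancel₀ (mul_ne_zero (by norm_num : (5:ℚ) ≠ 0) h0)
    linear_combination n3
  have hD : a*d-b*c ≠ 0 := by
    intro h
    rw [h] at n2'
    exact hne (by simpa [h0] using n2')
  refine ⟨⟨c/b, ?_⟩, h0, hD⟩
  generalize Algebra.norm ℚ W = x at *
  generalize Algebra.norm ℚ (5*g) = G at *
  have hx : x = -b^2/(a*c) := by field_simp; linear_combination n1/5
  have hy : y = a*b*(a*d-b*c)^2/(5*c) := by field_simp; linear_combination n2'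
  have hz : z = -c^2*(a*d-b*c)^2/a := by field_simp; linear_combination n3'
  rw [hy, hx, hz] at n4
  rw [hx]
  generalize a*d-b*c = D at *
  field_simp at n4 ⊢
  linear_combination -n4

lemma kumD5 (htr : ∀ φ : K →+* ℂ, ∀ x : K, (φ x).im = 0) (hn : Module.finrank ℚ K = 5) {W g k : K} (h : Crd W g k)
    (hT : ∀ φ ψ : K →+* ℝ, φ W = ψ W → φ = ψ) (hG : Gen 5 W) (a b c d : ℚ) (ha : a ≠ 0) (hb : b ≠ 0) (he : 5*k*(a*W+b) = c*W+d) :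
    Kum 4 W g ∧ c ≠ 0 ∧ a*d-b*c ≠ 0 := by
  have hq := h.ratl
  have he : g*(c*W+d) = a*W+b := by
    rw [← he]; linear_combination (a*W+b)*h.hgk
  have hm' : W*((c:K)*W+d)^2 - 5*(c*W+d)*(a*W+b)*(W^3-2*W^2+2*W)+5*(a*W+b)^2 = 0 := by
    linear_combination (c*W+d)^2*hq - (5*(a*W+b)+5*g*(c*W+d) - 5*(c*W+d)*(W^3-2*W^2+2*W)) * he
  have hm : ((-5*a*c : ℚ):K)*W^5 + ((-5*(a*d+b*c)+10*a*c : ℚ):K)*W^4 + ((c^2-5*b*d+10*(a*d+b*c)-10*a*c : ℚ) : K)*W^3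
     + ((2*c*d+10*b*d-10*(a*d+b*c)+5*a^2 : ℚ):K)*W^2+((d^2-10*b*d+10*a*b : ℚ):K)*W + ((5*b^2:ℚ):K) = 0 := by
    push_cast
    linear_combination hm'
  have h0 : c ≠ 0 := by
    rintro rfl
    have := hG.zero5 _ _ _ _ _ (by
      rw [show (-5*a*0:ℚ) = 0 by ring, Rat.cast_zero, zero_mul, zero_add] at hm
      exact hm)
    have h1 := this.2.2.2.2
    exact hb (by simpa using h1)
  have n1 := norm_lin5 htr hn hT _ _ _ _ _ _ hm 1 0
  have n2 := norm_lin5 htr hn hT _ _ _ _ _ _ hm a b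
  have n3 := norm_lin5 htr hn hT _ _ _ _ _ _ hm c d
  simp only [Rat.cast_one, one_mul, Rat.cast_zero, add_zero] at n1
  have n4 : Algebra.norm ℚ (5*g) * Algebra.norm ℚ ((c:K)*W+d) = 5^5 * Algebra.norm ℚ ((a:K)*W+b) := by
    have := congrArg (Algebra.norm ℚ) he
    rw [← this, show (5:K) = ((5:ℚ):K) by push_cast; rfl, map_mul (Algebra.norm ℚ) ((5:ℚ):K), map_mul, norm_rat, hn]
    ring
  have hne : Algebra.norm ℚ ((a:K)*W+b) ≠ 0 := by
    rw [Algebra.norm_ne_zero_iff]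
    intro hz
    have := hG.zero5 b a 0 0 0 (by push_cast; linear_combination hz)
    exact hb this.2.2.2.2
  generalize Algebra.norm ℚ ((a:K)*W+b) = y at *
  generalize Algebra.norm ℚ ((c:K)*W+d) = z at *
  have n2' : -5*c*y = a*b*(a*d-b*c)^2 := by
    apply mul_left_cancel₀ ha
    linear_combination n2
  have n3' : a*z = c^2*(a*d-b*c)^2 := by
    apply mul_left_cancel₀ (mul_ne_zero (by norm_num : (5:ℚ) ≠ 0) h0)
    linear_combination -n3
  have hD : a*d-b*c ≠ 0 := by
    intro h
    rw [h] at n2'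
    exact hne (by simpa [h0] using n2')
  refine ⟨⟨-a/b, ?_⟩, h0, hD⟩
  generalize Algebra.norm ℚ W = x at *
  generalize Algebra.norm ℚ (5*g) = G at *
  have hx : x = b^2/(a*c) := by field_simp; linear_combination -n1/5
  have hy : y = -a*b*(a*d-b*c)^2/(5*c) := by field_simp; linear_combination -n2'
  have hz : z = c^2*(a*d-b*c)^2/a := by field_simp; linear_combination n3'
  rw [hy, hz] at n4
  rw [hx]
  generalize a*d-b*c = D at *
  field_simp at n4 ⊢
  linear_combination n4

lemma kumE5 (htr : ∀ φ : K →+* ℂ, ∀ x : K, (φ x).im = 0) (hn : Module.finrank ℚ K = 5) {W g k : K} (h : Crd W g k)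
    (hT : ∀ φ ψ : K →+* ℝ, φ W = ψ W → φ = ψ) (hG : Gen 5 W) (l0 l1 l2 : ℚ) (hl : l2 ≠ 0) (he : -5*g = l0*W^2+l1*W+l2) :
    Kum 3 W g ∧ l0 ≠ 0 := by
  have he' : 5*g = -((l0:K)*W^2+l1*W+l2) := by linear_combination -he
  have hq := h.quad
  rw [he'] at hq
  have hm : ((5*l0 : ℚ):K)*W^5 + ((l0^2 + 5*l1-10*l0 : ℚ) : K)*W^4 + ((2*l0*l1+5*l2-10*l1+10*l0 : ℚ):K)*W^3
      + ((l1^2+2*l0*l2-10*l2+10*l1 : ℚ):K)*W^2 +((2*l1*l2+10*l2+5 : ℚ):K)*W + ((l2^2:ℚ):K) = 0 := by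
    push_cast
    linear_combination hq
  have h0 : l0 ≠ 0 := by
    rintro rfl
    have := hG.zero5 _ _ _ _ _ (by
      rw [show (5*0:ℚ) = 0 by ring, Rat.cast_zero, zero_mul, zero_add] at hm
      exact hm)
    exact hl (by simpa using this.2.2.2.2)
  refine ⟨?_, h0⟩
  have n1 := norm_lin5 htr hn hT _ _ _ _ _ _ hm 1 0
  simp only [Rat.cast_one, one_mul, Rat.cast_zero, add_zero] at n1
  obtain ⟨e, hei, hprod⟩ := real_homs htr hn
  have hl0 : (l0:ℂ) ≠ 0 := by exact_mod_cast h0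
  obtain ⟨ρ, hρ⟩ := IsAlgClosed.exists_root (C (l0:ℂ) * X^2 + C (l1:ℂ)*X + C (l2:ℂ)) (by
    rw [degree_quadratic hl0]; norm_num)
  have hρ : (l0:ℂ)*ρ^2+l1*ρ+l2 = 0 := by simpa [IsRoot] using hρ
  obtain ⟨σ, hσ⟩ : ∃ σ : ℂ, σ = -(l1:ℂ)/l0 - ρ := ⟨_, rfl⟩
  have hs : (l1:ℂ) = -l0*(ρ+σ) := by rw [hσ]; field_simp; ring
  have hp : (l2:ℂ) = l0*(ρ*σ) := by rw [hs] at hρ; linear_combination hρ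
  have hpf := prod_form (C (5*l0:ℂ) * X^5 + C (l0^2 + 5*l1-10*l0:ℂ) * X^4 + C (2*l0*l1+5*l2-10*l1+10*l0:ℂ) * X^3
    + C (l1^2+2*l0*l2-10*l2+10*l1:ℂ) * X^2 + C (2*l1*l2+10*l2+5:ℂ) * X + C (l2^2:ℂ)) (n := 5)
    (by compute_degree!) (fun i => ((e i W : ℝ) : ℂ)) (fun i j hij => hei (hT _ _ (by simpa using hij))) (by
      intro i
      have := congrArg (fun x => ((e i x : ℝ) : ℂ)) hm
      simpa [map_ofNat] using this)
  have hc : (C (5*l0:ℂ) * X^5 + C (l0^2 + 5*l1-10*l0:ℂ) * X^4 + C (2*l0*l1+5*l2-10*l1+10*l0:ℂ) * X^3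
    + C (l1^2+2*l0*l2-10*l2+10*l1:ℂ) * X^2 + C (2*l1*l2+10*l2+5:ℂ) * X + C (l2^2:ℂ)).coeff 5 = 5*(l0:ℂ) := by
    simp [coeff_X, coeff_C, -map_add, -map_mul, -map_sub, -map_pow]
  rw [hc] at hpf
  simp only [eval_add, eval_mul, eval_C, eval_pow, eval_X] at hpf
  have r1 : 5*(l0:ℂ) * ∏ i, (ρ - (e i W : ℂ)) = 5*ρ := by
    rw [← hpf ρ, hs, hp]; ring
  have r2 : 5*(l0:ℂ) * ∏ i, (σ - (e i W : ℂ)) = 5*σ := by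
    rw [← hpf σ, hs, hp]; ring
  have r3 : ((Algebra.norm ℚ ((l0:K)*W^2+l1*W+l2) : ℚ) : ℂ) = l0^5 * (∏ i, (ρ - (e i W : ℂ))) * ∏ i, (σ - (e i W : ℂ)) := by
    have h1 := hprod ((l0:K)*W^2+l1*W+l2)
    have h2 := congrArg (fun x : ℝ => (x : ℂ)) h1
    simp only [Complex.ofReal_ratCast] at h2
    rw [← h2, Complex.ofReal_prod, show (l0:ℂ)^5 = ∏ i : Fin 5, (l0:ℂ) by simp, ← Finset.prod_mul_distrib, ← Finset.prod_mul_distrib]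
    apply Finset.prod_congr rfl
    intro i _
    simp only [map_add, map_mul, map_pow, map_ratCast]
    push_cast
    rw [hs, hp]; ring
  have r4 : (Algebra.norm ℚ ((l0:K)*W^2+l1*W+l2) : ℚ) = l0^2*l2 := by
    have : ((Algebra.norm ℚ ((l0:K)*W^2+l1*W+l2) : ℚ) : ℂ) = ((l0^2*l2 : ℚ) : ℂ) := by
      rw [r3]
      push_cast
      rw [hp]
      have r1' : (l0:ℂ) * ∏ i, (ρ - (e i W : ℂ)) = ρ := by linear_combination r1/5
      have r2' : (l0:ℂ) * ∏ i, (σ - (e i W : ℂ)) = σ := by linear_combination r2/5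
      linear_combination (l0:ℂ)^4 * (∏ i, (σ - (e i W : ℂ))) * r1' + (l0:ℂ)^3*ρ*r2'
    exact_mod_cast this
  have n3 : Algebra.norm ℚ (5*g) = -(l0^2*l2) := by
    rw [he', show -((l0:K)*W^2+l1*W+l2) = ((-1:ℚ):K)*((l0:K)*W^2+l1*W+l2) by push_cast; ring, map_mul, norm_rat, hn, r4]
    norm_num
  refine ⟨l0/l2, ?_⟩
  rw [n3]
  generalize Algebra.norm ℚ W = x at *
  have hx : x = -l2^2/(5*l0) := by field_simp; linear_combination n1
  rw [hx]
  field_simp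
end
end FQ

namespace FQ
open NumberField Polynomial

section
variable {K : Type*} [Field K] [NumberField K]

lemma five_pow (a b : ℕ) (r : ℚ) (h : (5:ℚ)^b = 5^a * r^5) : a % 5 = b % 5 := by
  have : Fact (Nat.Prime 5) := ⟨by norm_num⟩
  have hr : r ≠ 0 := by
    rintro rfl
    simp at h
  have h1 := congrArg (padicValRat 5) h
  have h5 : padicValRat 5 (5:ℚ) = 1 := by
    have := padicValRat.self (p := 5) (by norm_num)
    simpa using this
  rw [padicValRat.mul (by positivity) (pow_ne_zero _ hr), padicValRat.pow, padicValRat.pow, padicValRat.pow, h5] at h1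
  push_cast at h1
  omega

lemma kum_sum {U V W : K} (h : Pt U V W) {n : ℕ} (hn : Module.finrank ℚ K = n) {a b c : ℕ} (ha : Kum a U (U*V*W)) (hb : Kum b V (U*V*W)) (hc : Kum c W (U*V*W)) :
    (a+b+c) % 5 = (3*n) % 5 := by
  obtain ⟨r, hr⟩ := ha
  obtain ⟨s, hs⟩ := hb
  obtain ⟨t, ht⟩ := hc
  apply five_pow (r := r*s*t)
  have hg : Algebra.norm ℚ (U*V*W) ≠ 0 := Algebra.norm_ne_zero_iff.mpr h.crd.g_ne
  have h5 : Algebra.norm ℚ (5*(U*V*W)) = 5^n * Algebra.norm ℚ (U*V*W) := by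
    rw [show (5:K) = ((5:ℚ):K) by push_cast; rfl, map_mul (Algebra.norm ℚ) ((5:ℚ):K), norm_rat, hn]
  have hprod : Algebra.norm ℚ (U*V*W) = Algebra.norm ℚ U * Algebra.norm ℚ V * Algebra.norm ℚ W := by
    rw [map_mul, map_mul]
  rw [h5] at hr hs ht
  rw [hprod] at hr hs ht hg
  generalize Algebra.norm ℚ U = u at *
  generalize Algebra.norm ℚ V = v at *
  generalize Algebra.norm ℚ W = w at *
  apply mul_right_cancel₀ (pow_ne_zero 3 hg)
  calc (5:ℚ)^(3*n) * (u*v*w)^3 = (5^n*(u*v*w))*(5^n*(u*v*w))*(5^n*(u*v*w)) := by ring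
    _ = (5^a*r^5*u^3)*(5^b*s^5*v^3)*(5^c*t^5*w^3) := by
      conv_lhs => 
        congr
        · congr
          · rw [hr]
          · rw [hs]
        · rw [ht]
    _ = _ := by ring

/-- fermat equation in terms of a point -/
lemma Pt.fermat {U V W : K} (h : Pt U V W) : (1-U)^5+(1-V)^5+(1-W)^5 = 0 := by
  obtain ⟨hs, hk⟩ := h
  have hW : W = 2 - U - V := by linear_combination hs
  subst hW
  linear_combination (-1) * hk

/-- four distinct real places on a rational line is impossible -/
lemma no_line {U V W : K} (h : Pt U V W) (htr : ∀ φ : K →+* ℂ, ∀ x : K, (φ x).im = 0) (hf : 4 ≤ Module.finrank ℚ K)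
    (hT : ∀ φ ψ : K →+* ℝ, φ U = ψ U → φ = ψ) (l m : ℚ) (he : V = l*U+m) : False := by
  have hF := h.fermat
  have hV : ∀ φ : K →+* ℝ, φ V = l * φ U + m := by
    intro φ; rw [he]; simp
  have hsum : ∀ φ : K →+* ℝ, φ U + φ V + φ W = 2 := by
    intro φ
    have := congrArg φ h.hs
    simpa only [map_add, map_ofNat] using this
  have hFR : ∀ φ : K →+* ℝ, (1-φ U)^5+(1-φ V)^5+(1-φ W)^5 = 0 := by
    intro φ
    have := congrArg φ hF
    simpa only [map_add, map_pow, map_sub, map_zero, map_one] using this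
  have hinj5 : ∀ x y : ℝ, x^5 = y^5 → x = y := fun x y hxy => (Odd.strictMono_pow (by decide : Odd 5)).injective hxy
  have hZ : ∀ φ : K →+* ℝ, 1 - φ W ≠ 0 := by
    intro φ hz
    have h1 := hFR φ
    rw [hz] at h1
    have h2 := hinj5 (1-φ U) (-(1-φ V)) (by linear_combination h1)
    have h3 := hsum φ
    linarith
  obtain ⟨c, hc⟩ : ∃ c : ℝ, c = 1 - l - m := ⟨_, rfl⟩
  have hm : (m:ℝ) = 1 - l - c := by rw [hc]; ring
  simp only [hm] at hV
  by_cases hc1 : c = 1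
  · obtain ⟨s, hs, hs'⟩ := real_set htr rfl hT
    obtain ⟨a, as, b, bs, hab⟩ := two_of_card (s := s) (by omega)
    obtain ⟨φ, hφ⟩ := hs' a as
    obtain ⟨ψ, hψ⟩ := hs' b bs
    subst hc1
    have hW1 : ∀ φ : K →+* ℝ, φ W = 2 - φ U - φ V := fun φ => by linear_combination hsum φ
    have e1 := hFR φ
    have e2 := hFR ψ
    rw [hW1, hV, hφ] at e1
    rw [hW1, hV, hψ] at e2
    have h1 := hinj5 ((1-(l*a+(1-l-1)))*(1-b)) ((1-(l*b+(1-l-1)))*(1-a)) (by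
      linear_combination (1-b)^5*e1 - (1-a)^5*e2)
    have : a = b := by linear_combination h1
    linarith
  · have hc1' : 1 - c ≠ 0 := fun h => hc1 (by linarith)
    have hlin : ∀ φ : K →+* ℝ, (1-φ V)/(1-φ W) = (l+c)/(1-c) * ((1-φ U)/(1-φ W)) + c/(1-c) := by
      intro φ
      have hz := hZ φ
      have hU : φ W = 2 - φ U - φ V := by linear_combination hsum φ
      field_simp
      rw [hU, hV φ]
      ring
    have hT' : ∀ φ ψ : K →+* ℝ, φ ((1-U)/(1-W)) = ψ ((1-U)/(1-W)) → φ = ψ := by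
      intro φ ψ hh
      have l1 := hlin φ
      have l2 := hlin ψ
      simp only [map_div₀, map_sub, map_one] at hh
      rw [hh, ← l2] at l1
      have zφ := hZ φ
      have zψ := hZ ψ
      have hz : 1 - φ W = 1 - ψ W := by
        have s1 : (1-φ U)/(1-φ W) + (1-φ V)/(1-φ W) + 1 = 1/(1-φ W) := by
          field_simp; linear_combination -hsum φ
        have s2 : (1-ψ U)/(1-ψ W) + (1-ψ V)/(1-ψ W) + 1 = 1/(1-ψ W) := by
          field_simp; linear_combination -hsum ψ
        rw [hh, l1, s2] at s1
        field_simp at s1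
        exact s1
      apply hT
      rw [hz] at hh
      field_simp at hh
      linarith
    obtain ⟨s, hs, hs'⟩ := real_set htr rfl hT'
    have key : ∀ x ∈ s, x^5 + ((l+c)/(1-c)*x+c/(1-c))^5 + 1 = 0 := by
      intro x hx
      obtain ⟨φ, hφ⟩ := hs' x hx
      rw [map_div₀, map_sub, map_sub, map_one] at hφ
      have hz := hZ φ
      rw [← hφ, ← hlin φ]
      field_simp
      rw [hFR φ, mul_zero]
    obtain ⟨x1, s1, x2, s2, x3, s3, x4, s4, h12, h23, h34⟩ := four_of_card (s := s) (by omega)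
    refine line3 ?_ h12 h23 h34 (key _ s1) (key _ s2) (key _ s3) (key _ s4)
    rintro ⟨hb, ha⟩
    have := key _ s1
    rw [hb, ha] at this
    ring_nf at this
    norm_num at this

/-- two coordinates of the first kind cannot coexist -/
lemma no_two {U V W : K} (h : Pt U V W) (htr : ∀ φ : K →+* ℂ, ∀ x : K, (φ x).im = 0) (hf : 4 ≤ Module.finrank ℚ K)
    (hT : ∀ φ ψ : K →+* ℝ, φ U = ψ U → φ = ψ) (l0 l1 m0 m1 : ℚ) (hm : m0 ≠ 0) (g : K) (h1 : -5*g = l0*U+l1) (h2 : -5*g = m0*V+m1) : False := by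
  have hm' : (m0:K) ≠ 0 := by exact_mod_cast hm
  apply no_line h htr hf hT (l0/m0) ((l1-m1)/m0)
  push_cast
  field_simp
  linear_combination h1 - h2

lemma Crd.types4c (htr : ∀ φ : K →+* ℂ, ∀ x : K, (φ x).im = 0) (hn : Module.finrank ℚ K = 4) {W g k : K} (h : Crd W g k) :
    (∀ φ ψ : K →+* ℝ, φ W = ψ W → φ = ψ) ∧ 
    ((Kum 3 W g ∧ ∃ l0 l1 : ℚ, l0 ≠ 0 ∧ -5*g = l0*W+l1) ∨ Kum 1 W g) := by
  have hd : (minpoly ℚ W⁻¹).natDegree ∣ Module.finrank ℚ K := minpoly.degree_dvd (IsIntegral.of_finite ℚ _)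
  have hdeg : (minpoly ℚ W⁻¹).natDegree = 4 := by
    have := h.deg_ne htr
    rw [hn] at hd
    have h4 := Nat.le_of_dvd (by norm_num) hd
    interval_cases hh : (minpoly ℚ W⁻¹).natDegree <;> simp_all
  have hdeg' : (minpoly ℚ W⁻¹).natDegree = Module.finrank ℚ K := by rw [hdeg, hn]
  have hT := gen_inj hdeg'
  have hG : Gen 4 W := by unfold Gen; rw [gen_deg hdeg', hn]
  refine ⟨hT, ?_⟩
  rcases h.types4 htr hdeg with ⟨a0, a1, a2, ha⟩ | ⟨l0, l1, hl, he⟩ | ⟨l0, l1, hl, he⟩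
  · exact (h.kill0 htr hT (by omega) a0 a1 a2 ha).elim
  · obtain ⟨hk, h0⟩ := kumA4 htr hn h hT hG l0 l1 hl he
    exact Or.inl ⟨hk, l0, l1, h0, he⟩
  · exact Or.inr (kumB4 htr hn h hT hG l0 l1 hl he)

lemma case4 {U V W : K} (h : Pt U V W) (htr : ∀ φ : K →+* ℂ, ∀ x : K, (φ x).im = 0) (hn : Module.finrank ℚ K = 4) : False := by
  have hu := h.rot.crd
  have hv := h.rot.rot.crd
  have hw := h.crd
  rw [show V*W*U = U*V*W by ring] at hu
  rw [show W*U*V = U*V*W by ring] at hv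
  obtain ⟨tu, hu⟩ := hu.types4c htr hn
  obtain ⟨tv, hv⟩ := hv.types4c htr hn
  obtain ⟨tw, hw⟩ := hw.types4c htr hn
  have h4 : 4 ≤ Module.finrank ℚ K := by omega
  rcases hu with ⟨ku, l0, l1, hl, eu⟩ | ku <;> rcases hv with ⟨kv, m0, m1, hm, ev⟩ | kv <;> rcases hw with ⟨kw, n0, n1, hn', ew⟩ | kw
  · exact no_two h htr h4 tu _ _ _ _ hm _ eu ev
  · exact no_two h htr h4 tu _ _ _ _ hm _ eu ev
  · exact no_two h.rot.rot htr h4 tw _ _ _ _ hl _ ew eu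
  · have := kum_sum h hn ku kv kw
    omega
  · exact no_two h.rot htr h4 tv _ _ _ _ hn' _ ev ew
  · have := kum_sum h hn ku kv kw
    omega
  · have := kum_sum h hn ku kv kw
    omega
  · have := kum_sum h hn ku kv kw
    omega
end
end FQ

namespace FQ
open NumberField Polynomial

section
variable {K : Type*} [Field K] [NumberField K]

lemma caseA_core {U V W : K} (h : Pt U V W) (hG : Gen 5 W) (l0 l1 l2 : ℚ) (h0 : l0 ≠ 0) (h2 : l2 ≠ 0)
    (hW : -5*(U*V*W) = l0*W^2+l1*W+l2) (a b c d a2 d2 : ℚ) (hb : b ≠ 0) (hc : c ≠ 0)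
    (f2 : (a+a2)*l0 = -5*b) (f1 : (a+a2)*l1 = 10*b-c) (f0 : (a+a2)*l2 = 2*c+d+d2)
    (hV : V*(5*b*W-c) = a*(l0*W^2+l1*W+l2) - c*(2-W) - d) : False := by
  have hU : U*(5*b*W-c) = a2*(l0*W^2+l1*W+l2) - c*(2-W) - d2 := by
    have hs := h.hs
    have g2 : ((a:K)+a2)*l0 = -5*b := by exact_mod_cast f2
    have g1 : ((a:K)+a2)*l1 = 10*b-c := by exact_mod_cast f1
    have g0 : ((a:K)+a2)*l2 = 2*c+d+d2 := by exact_mod_cast f0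
    linear_combination (5*b*W-c)*hs - hV - W^2*g2 - W*g1 - g0
  have hq := h.crd.quad
  rw [show 5*(U*V*W) = -((l0:K)*W^2+l1*W+l2) by linear_combination -hW] at hq
  obtain ⟨n, hn⟩ : ∃ n : ℚ, n = -2*c-d := ⟨_, rfl⟩
  obtain ⟨n', hn'⟩ : ∃ n' : ℚ, n' = -2*c-d2 := ⟨_, rfl⟩
  have hd : d = -2*c-n := by rw [hn]; ring
  have hd2 : d2 = -2*c-n' := by rw [hn']; ring
  subst hd hd2
  obtain ⟨ν, hν⟩ : ∃ ν : ℚ, ν = a*a2*l0 := ⟨_, rfl⟩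
  have hT : 5*W*((a:K)*(l0*W^2+l1*W+l2)+c*W+n)*(a2*(l0*W^2+l1*W+l2)+c*W+n') + (l0*W^2+l1*W+l2)*(5*b*W-c)^2 = 0 := by
    have e1 : (a:K)*(l0*W^2+l1*W+l2)+c*W+n = V*(5*b*W-c) := by push_cast at hV; linear_combination -hV
    have e2 : (a2:K)*(l0*W^2+l1*W+l2)+c*W+n' = U*(5*b*W-c) := by push_cast at hU; linear_combination -hU
    rw [e1, e2]
    linear_combination -(5*b*W-c)^2*hW
  obtain ⟨s2, hs2⟩ : ∃ s : ℚ, s = 5*a*a2*l1+5*(a+a2)*c+25*b^2-ν*l0+10*ν := ⟨_, rfl⟩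
  obtain ⟨s1, hs1⟩ : ∃ s : ℚ, s = 5*a*a2*l2+5*(a*n'+a2*n)-10*b*c-ν*l1-10*ν := ⟨_, rfl⟩
  obtain ⟨s0, hs0⟩ : ∃ s : ℚ, s = c^2-ν*l2 := ⟨_, rfl⟩
  have hz := hG.zero5 (l2*s0) (5*(n*n'-ν)+l1*s0+l2*s1) (5*(c*(n+n'))+l0*s0+l1*s1+l2*s2) (5*c^2+l0*s1+l1*s2) (l0*s2) (by
    rw [hs0, hs1, hs2, hν]
    push_cast
    linear_combination hT - a*a2*l0*hq)
  obtain ⟨z4, z3, z2, z1, z0⟩ := hz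
  have y2 : s2 = 0 := by simpa [h0] using z4
  have y0 : s0 = 0 := by simpa [h2] using z0
  rw [y2] at z3 z2
  rw [y0] at z2
  -- R1 l0 = R2 l1
  have k1 : l0*(c*(n+n')) = l1*c^2 := by linear_combination (l0*z2 - l1*z3)/5
  have k2 : l0*(n+n') = l1*c := by
    apply mul_left_cancel₀ hc
    linear_combination k1
  have hδ : a + a2 ≠ 0 := by
    intro h
    rw [h] at f2
    exact hb (by linarith)
  have k3 : 5*b*(a+a2)*l2 = -c^2 := by
    have : (a+a2)*(l0*(n+n')) = (a+a2)*(l1*c) := by rw [k2]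
    have e : n + n' = -2*c-(a+a2)*l2 := by linear_combination f0
    rw [e] at this
    linear_combination this + (2*c+(a+a2)*l2)*f2 + c*f1
  rw [hs0, hν] at y0
  have k4 : a*a2 = (a+a2)^2 := by
    have : (a*a2 - (a+a2)^2) * (l2*(a+a2)*l0) = 0 := by
      linear_combination -(a+a2)*y0 + (a+a2)*k3 - l2*(a+a2)^2*f2
    rcases mul_eq_zero.mp this with h | h
    · linarith
    · simp [h2, hδ, h0] at h
  have : 0 < (a+a2)^2 := by positivity
  nlinarith [sq_nonneg (a-a2)]

lemma caseM122 {U V W : K} (h : Pt U V W) (htr : ∀ φ : K →+* ℂ, ∀ x : K, (φ x).im = 0) (hn : Module.finrank ℚ K = 5)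
    (hT : ∀ φ ψ : K →+* ℝ, φ W = ψ W → φ = ψ) (hG : Gen 5 W) (l0 l1 l2 : ℚ) (h0 : l0 ≠ 0) (h2 : l2 ≠ 0)
    (hW : -5*(U*V*W) = l0*W^2+l1*W+l2) (a b c d : ℚ) (hb : b ≠ 0) (hc : c ≠ 0)
    (hU : -5*(U*V*W)*(a*U+b) = U*(c*U+d))
    (a' b' c' d' : ℚ) (hb' : b' ≠ 0)
    (hV : -5*(U*V*W)*(a'*V+b') = V*(c'*V+d')) : False := by
  have hU0 : U ≠ 0 := h.rot.crd.hW
  have hV0 : V ≠ 0 := h.rot.rot.crd.hW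
  have hs := h.hs
  have e1 : V*(5*b*W-c) = a*(l0*W^2+l1*W+l2) - c*(2-W) - d := by
    apply mul_left_cancel₀ hU0
    linear_combination U*a*hW - hU - U*c*hs
  have e2 : V*(5*b'*W-c') = d'-a'*(l0*W^2+l1*W+l2)+5*b'*(2-W)*W := by
    apply mul_left_cancel₀ hV0
    linear_combination -V*a'*hW + hV + 5*b'*V*W*hs
  have hz := hG.zero5 (-c*(d'-a'*l2)+c'*(a*l2-2*c-d)) (5*b*(d'-a'*l2)-c*(-a'*l1+10*b')-5*b'*(a*l2-2*c-d)+c'*(a*l1+c))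
    (5*b*(-a'*l1+10*b')-c*(-a'*l0-5*b')-5*b'*(a*l1+c)+c'*(a*l0)) (5*b*(-a'*l0-5*b')-5*b'*(a*l0)) 0 (by
      push_cast
      linear_combination (5*b'*W-c')*e1 - (5*b*W-c)*e2)
  obtain ⟨-, z3, z2, z1, z0⟩ := hz
  by_cases hp : c*b' = c'*b
  · obtain ⟨μ, hμ⟩ : ∃ μ : ℚ, μ = b'/b := ⟨_, rfl⟩
    have hb1 : b' = μ*b := by rw [hμ]; field_simp
    have hμ0 : μ ≠ 0 := by rw [hμ]; exact div_ne_zero hb' hb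
    have hc1 : c' = μ*c := by
      apply mul_right_cancel₀ hb
      rw [← hp, hb1]; ring
    obtain ⟨a2, ha2⟩ : ∃ a2 : ℚ, a' = μ*a2 := ⟨a'/μ, by field_simp⟩
    obtain ⟨d2, hd2⟩ : ∃ d2 : ℚ, d' = μ*d2 := ⟨d'/μ, by field_simp⟩
    subst hb1 hc1 ha2 hd2
    have f2 : (a+a2)*l0 = -5*b := by
      apply mul_left_cancel₀ (mul_ne_zero hμ0 hb)
      linear_combination -z3/5
    have f1 : (a+a2)*l1 = 10*b-c := by
      apply mul_left_cancel₀ (mul_ne_zero hμ0 hb)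
      linear_combination -z2/5 + μ*c/5*f2
    have f0 : (a+a2)*l2 = 2*c+d+d2 := by
      apply mul_left_cancel₀ (mul_ne_zero hμ0 hc)
      linear_combination z0
    exact caseA_core h hG l0 l1 l2 h0 h2 hW a b c d a2 d2 hb hc f2 f1 f0 e1
  · have ht : (a*l0)*c^2+5*b*(a*l1+c)*c+25*b^2*(a*l2-2*c-d) = 0 := by
      have : (c*b'-c'*b) * ((a*l0)*c^2+5*b*(a*l1+c)*c+25*b^2*(a*l2-2*c-d)) = 0 := by
        linear_combination -(c^3/5)*z3 - b*c^2*z2 - 5*b^2*c*z1 - 25*b^3*z0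
      rcases mul_eq_zero.mp this with h | h
      · exact absurd (by linarith) hp
      · exact h
    have hD : (5*b*W-c : K) ≠ 0 := by
      intro hz
      have := hG.zero5 (-c) (5*b) 0 0 0 (by push_cast; linear_combination hz)
      exact hb (by linarith [this.2.2.2.1])
    have hbK : (b:K) ≠ 0 := by exact_mod_cast hb
    have htK : ((a:K)*l0)*c^2+5*b*(a*l1+c)*c+25*b^2*(a*l2-2*c-d) = 0 := by exact_mod_cast ht
    apply no_line h.rot.swap htr (by omega) hT (a*l0/(5*b)) ((a*l1+c+a*l0*c/(5*b))/(5*b))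
    apply mul_right_cancel₀ hD
    rw [e1]
    push_cast
    field_simp
    linear_combination htK
end
end FQ

namespace FQ

section FiveAdic

/-- `x` is divisible by `5^n` in the 5-adic sense. -/
def Vg (x : ℚ) (n : ℤ) : Prop := x = 0 ∨ n ≤ padicValRat 5 x

/-- `x` has 5-adic valuation exactly `n`. -/
def Ve (x : ℚ) (n : ℤ) : Prop := x ≠ 0 ∧ padicValRat 5 x = n

instance fact5 : Fact (Nat.Prime 5) := ⟨by norm_num⟩

lemma Ve.mul {x y : ℚ} {m n : ℤ} (hx : Ve x m) (hy : Ve y n) : Ve (x*y) (m+n) :=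
  ⟨mul_ne_zero hx.1 hy.1, by rw [padicValRat.mul hx.1 hy.1, hx.2, hy.2]⟩

lemma Ve.vg {x : ℚ} {n : ℤ} (hx : Ve x n) : Vg x n := Or.inr hx.2.ge

lemma Vg.mono {x : ℚ} {m n : ℤ} (hx : Vg x n) (h : m ≤ n) : Vg x m := by
  rcases hx with hx | hx
  · exact Or.inl hx
  · exact Or.inr (h.trans hx)

lemma Vg.mul {x y : ℚ} {m n : ℤ} (hx : Vg x m) (hy : Vg y n) : Vg (x*y) (m+n) := by
  by_cases hx0 : x = 0
  · exact Or.inl (by rw [hx0, zero_mul])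
  by_cases hy0 : y = 0
  · exact Or.inl (by rw [hy0, mul_zero])
  right
  rw [padicValRat.mul hx0 hy0]
  exact add_le_add (hx.resolve_left hx0) (hy.resolve_left hy0)

lemma Vg.add {x y : ℚ} {n : ℤ} (hx : Vg x n) (hy : Vg y n) : Vg (x+y) n := by
  by_cases hx0 : x = 0
  · rw [hx0, zero_add]; exact hy
  by_cases hy0 : y = 0
  · rw [hy0, add_zero]; exact hx
  by_cases hs : x + y = 0
  · exact Or.inl hs
  right
  exact (le_min (hx.resolve_left hx0) (hy.resolve_left hy0)).trans (padicValRat.min_le_padicValRat_add hs)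

lemma Vg.neg {x : ℚ} {n : ℤ} (hx : Vg x n) : Vg (-x) n := by
  rcases hx with hx | hx
  · exact Or.inl (by rw [hx, neg_zero])
  · exact Or.inr (by rwa [padicValRat.neg])

lemma Ve.not_vg {x : ℚ} {n : ℤ} (hx : Ve x n) (h : Vg x (n+1)) : False := by
  rcases h with h | h
  · exact hx.1 h
  · have := hx.2; omega

lemma Ve.add {x y : ℚ} {n m : ℤ} (hx : Ve x n) (hy : Vg y m) (h : n < m) : Ve (x+y) n := by
  have hy' : Vg y (n+1) := hy.mono h
  have h0 : x + y ≠ 0 := by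
    intro h
    apply hx.not_vg
    rw [show x = -y by linarith]
    exact hy'.neg
  refine ⟨h0, ?_⟩
  have h1 : Vg (x+y) n := hx.vg.add (hy'.mono (by omega))
  have h2 := h1.resolve_left h0
  by_contra hne
  apply hx.not_vg
  rw [show x = (x+y) + -y by ring]
  exact Vg.add (Or.inr (by omega)) hy'.neg

lemma Ve.sq {x : ℚ} {n : ℤ} (hx : Ve x n) : Ve (x^2) (2*n) := by
  rw [pow_two, two_mul]; exact hx.mul hx

lemma Vg.sq {x : ℚ} {n : ℤ} (hx : Vg x n) : Vg (x^2) (2*n) := by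
  rw [pow_two, two_mul]; exact hx.mul hx

lemma ve_nat (n : ℕ) (h : ¬ 5 ∣ n) : Ve (n : ℚ) 0 := by
  refine ⟨?_, ?_⟩
  · intro h0
    apply h
    have : n = 0 := by exact_mod_cast h0
    rw [this]; exact dvd_zero _
  · rw [padicValRat.of_nat, padicValNat.eq_zero_of_not_dvd h]; rfl

lemma ve_int (n : ℤ) (h : ¬ (5:ℤ) ∣ n) : Ve (n : ℚ) 0 := by
  refine ⟨?_, ?_⟩
  · intro h0
    apply h
    have : n = 0 := by exact_mod_cast h0
    rw [this]; exact dvd_zero _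
  · rw [padicValRat.of_int, padicValInt.eq_zero_of_not_dvd (by exact_mod_cast h)]; rfl

lemma ve_five : Ve (5:ℚ) 1 := by
  refine ⟨by norm_num, ?_⟩
  have := padicValRat.self (p := 5) (by norm_num)
  exact_mod_cast this

lemma ve_unit_form {z : ℚ} (hz : Vg z 0) : Ve (z^2-z+1) 0 := by
  have hden : ¬ 5 ∣ z.den := by
    intro h
    rcases hz with hz | hz
    · rw [hz] at h; norm_num at h
    · have hz0 : z ≠ 0 := by
        rintro rfl; norm_num at h
      have hnum : ¬ (5:ℤ) ∣ z.num := by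
        intro h2
        have hc := z.reduced
        have h3 : 5 ∣ z.num.natAbs := Int.natCast_dvd.mp (by exact_mod_cast h2)
        have := Nat.dvd_gcd h3 h
        rw [hc] at this
        norm_num at this
      unfold padicValRat at hz
      rw [padicValInt.eq_zero_of_not_dvd (by exact_mod_cast hnum)] at hz
      have := one_le_padicValNat_of_dvd (p := 5) z.den_ne_zero h
      omega
  have hd := ve_nat _ hden
  have key : ¬ (5:ℤ) ∣ (z.num^2 - z.num*z.den+(z.den:ℤ)^2) := by
    have hd2 : ¬ (5:ℤ) ∣ (z.den:ℤ) := by exact_mod_cast hden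
    generalize z.num = x at *
    generalize (z.den:ℤ) = y at *
    intro h
    have h1 := Int.emod_emod_of_dvd x (dvd_refl (5:ℤ))
    have hx : x % 5 = 0 ∨ x % 5 = 1 ∨ x % 5 = 2 ∨ x % 5 = 3 ∨ x % 5 = 4 := by omega
    have hy : y % 5 = 1 ∨ y % 5 = 2 ∨ y % 5 = 3 ∨ y % 5 = 4 := by omega
    have h2 := Int.emod_eq_zero_of_dvd h
    rcases hx with hx | hx | hx | hx | hx <;> rcases hy with hy | hy | hy | hy <;>
      simp [pow_two, Int.add_emod, Int.sub_emod, Int.mul_emod, hx, hy] at h2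
  have hk := ve_int _ key
  push_cast at hk
  have e : (z.num:ℚ)^2 - z.num*z.den+(z.den:ℚ)^2 = (z^2-z+1)*(z.den)^2 := by
    have : (z.num:ℚ) = z * z.den := (Rat.mul_den_eq_num z).symm
    rw [this]; ring
  rw [e] at hk
  have hne : z^2-z+1 ≠ 0 := left_ne_zero_of_mul hk.1
  refine ⟨hne, ?_⟩
  have h3 : Ve (z^2-z+1) (padicValRat 5 (z^2-z+1)) := ⟨hne, rfl⟩
  have := (h3.mul hd.sq).2
  rw [hk.2] at this
  omega

lemma five_core {z ω : ℚ} (hz : Vg z 0) (hω : ω ≠ 0) (hz1 : z + 1 ≠ 0)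
    (h : 2*(5+ω^2)*(ω*(10*z+ω^2*(z+1)^2))^2+5*(10+3*ω^2)*(z^2-1)*(ω*(10*z+ω^2*(z+1)^2))+125*(z^2-z+1)^2 = 0) : False := by
  have u := ve_unit_form hz
  have one : Ve (1:ℚ) 0 := by simpa using ve_nat 1 (by norm_num)
  have two : Ve (2:ℚ) 0 := by simpa using ve_nat 2 (by norm_num)
  have three : Ve (3:ℚ) 0 := by simpa using ve_nat 3 (by norm_num)
  have ten : Ve (10:ℚ) 1 := by
    have := two.mul ve_five
    norm_num at this; exact this
  have t3 : Ve (125*(z^2-z+1)^2) 3 := by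
    have := ((ve_five.mul (ve_five.mul ve_five)).mul u.sq)
    norm_num at this; exact this
  obtain ⟨m, hm⟩ : ∃ m, Ve ω m := ⟨_, hω, rfl⟩
  obtain ⟨r, hr⟩ : ∃ r, Ve (z+1) r := ⟨_, hz1, rfl⟩
  have zp : Vg (z+1) 0 := hz.add one.vg
  have zm : Vg (z-1) 0 := by rw [sub_eq_add_neg]; exact hz.add one.vg.neg
  have hr0 : 0 ≤ r := by
    have := zp.resolve_left hz1
    rw [hr.2] at this; exact this
  have zz : Vg (z^2-1) r := by
    have := hr.vg.mul zm
    rw [show z^2-1 = (z+1)*(z-1) by ring]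
    simpa using this
  rcases le_or_gt 1 m with h1 | h1
  · have H : Vg (ω*(10*z+ω^2*(z+1)^2)) 2 := by
      have e1 : Vg (10*z) 1 := by simpa using ten.vg.mul hz
      have e2 : Vg (ω^2*(z+1)^2) 1 := (hm.sq.vg.mul zp.sq).mono (by omega)
      exact (hm.vg.mul (e1.add e2)).mono (by omega)
    have w2 : Vg (ω^2) 1 := hm.sq.vg.mono (by omega)
    have T1 := (two.vg.mul (ve_five.vg.add w2)).mul H.sq
    have w3 : Vg (10+3*ω^2) 1 := ten.vg.add ((three.vg.mul w2).mono (by omega))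
    have T2 := ((ve_five.vg.mul w3).mul zz).mul H
    apply t3.not_vg
    have := (T1.mono (m := 4) (by omega)).add (T2.mono (m := 4) (by omega))
    rw [show 125*(z^2-z+1)^2 = -(2*(5+ω^2)*(ω*(10*z+ω^2*(z+1)^2))^2+5*(10+3*ω^2)*(z^2-1)*(ω*(10*z+ω^2*(z+1)^2))) by linarith]
    exact this.neg
  · have w5 : Ve (5+ω^2) (2*m) := by
      rw [add_comm]; exact hm.sq.add ve_five.vg (by omega)
    have w3 : Vg (10+3*ω^2) (2*m) := by
      have := three.vg.mul hm.sq.vg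
      exact (ten.vg.mono (by omega)).add (this.mono (by omega))
    rcases le_or_gt (m+r) 0 with h2 | h2
    · have H : Ve (ω*(10*z+ω^2*(z+1)^2)) (m+(2*m+2*r)) := by
        apply hm.mul
        rw [add_comm]
        exact (hm.sq.mul hr.sq).add (ten.vg.mul hz) (by omega)
      have T1 := (two.mul w5).mul H.sq
      have T2 := ((ve_five.vg.mul w3).mul zz).mul H.vg
      apply T1.not_vg
      have := (T2.mono (m := _ + 1) (n := _) ?_).add (t3.vg.mono (m := (0+2*m+2*(m+(2*m+2*r)))+1) (by omega))
      · rw [show 2*(5+ω^2)*(ω*(10*z+ω^2*(z+1)^2))^2 = -(5*(10+3*ω^2)*(z^2-1)*(ω*(10*z+ω^2*(z+1)^2)) + 125*(z^2-z+1)^2) by linarith]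
        exact this.neg
      · omega
    · have hz0 : Ve z 0 := by
        have : Ve (-1 + (z+1)) 0 := by
          refine Ve.add (m := r) ⟨by norm_num, ?_⟩ hr.vg (by omega)
          simp
        simpa using this
      have H : Ve (ω*(10*z+ω^2*(z+1)^2)) (m+(1+0)) := by
        apply hm.mul
        exact (ten.mul hz0).add (hm.sq.mul hr.sq).vg (by omega)
      have T1 := (two.mul w5).mul H.sq
      have T2 := ((ve_five.vg.mul w3).mul zz).mul H.vg
      apply T1.not_vg
      have := (T2.mono (m := _ + 1) (n := _) ?_).add (t3.vg.mono (m := (0+2*m+2*(m+(1+0)))+1) (by omega))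
      · rw [show 2*(5+ω^2)*(ω*(10*z+ω^2*(z+1)^2))^2 = -(5*(10+3*ω^2)*(z^2-1)*(ω*(10*z+ω^2*(z+1)^2)) + 125*(z^2-z+1)^2) by linarith]
        exact this.neg
      · omega

lemma five_main {z ω : ℚ} (hz : z ≠ 0) (hω : ω ≠ 0) (hz1 : z + 1 ≠ 0)
    (h : 2*(5+ω^2)*(ω*(10*z+ω^2*(z+1)^2))^2+5*(10+3*ω^2)*(z^2-1)*(ω*(10*z+ω^2*(z+1)^2))+125*(z^2-z+1)^2 = 0) : False := by
  rcases le_or_gt 0 (padicValRat 5 z) with h0 | h0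
  · exact five_core (Or.inr h0) hω hz1 h
  · apply five_core (z := z⁻¹) (ω := -ω) ?_ (neg_ne_zero.mpr hω)
    · intro h2
      apply hz1
      field_simp at h2
      linarith
    · field_simp
      linear_combination h
    · right
      rw [padicValRat.inv]; omega
end FiveAdic
end FQ

namespace FQ

lemma no_sqrt10 (x : ℚ) (h : x^2 = 10) : False := by
  have h1 : IsSquare (10:ℚ) := ⟨x, by rw [← h]; ring⟩
  rw [Rat.isSquare_iff] at h1
  obtain ⟨y, hy⟩ := h1.1
  norm_num at hy
  have : y.natAbs * y.natAbs = 10 := by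
    have := congrArg Int.natAbs hy
    rw [Int.natAbs_mul] at this
    simpa using this.symm
  have h3 : y.natAbs ≤ 3 ∨ 4 ≤ y.natAbs := by omega
  rcases h3 with h3 | h3
  · interval_cases y.natAbs <;> omega
  · nlinarith

lemma ratB {a b A be e p q d1 d2 : ℚ} (ha : a ≠ 0) (hb : b ≠ 0) (hA : A ≠ 0) (he : e + be ≠ 0)
    (q1 : A^2*a*b = -5*p*q*be) (q2 : 5*e = a+b) (q3 : d1+d2 = -be)
    (q4 : 5*(1+p)*(1+q) = A*a*b*(be+2))
    (q5 : (1+p)*b+(1+q)*a = A*e*a*b*(be+2))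
    (r1 : 5*(1+p)*d2 = 5*(p*e-be)-a) (r2 : 5*(1+q)*d1 = 5*(q*e-be)-b)
    (q6 : d1*d2+A-2 = -e*(be+2)) : False := by
  have k0 : (a+b)*(1+p)*(1+q) = (1+p)*b+(1+q)*a := by
    linear_combination -q5 + e*q4 - (1+p)*(1+q)*q2
  have k1 : p*q = 1 := by
    have : (p*q-1)*(e+be) = 0 := by
      linear_combination ((1+q)*r1 + (1+p)*r2 - 5*(1+p)*(1+q)*q3)*(-1/5) - k0/5 - (1+p)*(1+q)*q2/5
    rcases mul_eq_zero.mp this with h | h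
    · linarith
    · exact absurd h he
  have k2 : (a*p+b)*(p+1) = 0 := by
    linear_combination p*k0 + (-b-a*p-p*b)*k1
  have k3 : a*p+b = 0 := by
    rcases mul_eq_zero.mp k2 with h | h
    · exact h
    · have hp : p = -1 := by linarith
      subst hp
      have hq : q = -1 := by linarith
      subst hq
      linarith
  have k4 : b*q+a = 0 := by
    linear_combination q*k3 - a*k1
  have q1' : A^2*a*b = -5*be := by linear_combination q1 - 5*be*k1
  have hab : a - b ≠ 0 := by
    intro h
    have hba : b = a := by linarith
    subst hba
    have hp : p = -1 := by
      apply mul_left_cancel₀ ha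
      linarith
    subst hp
    have hq : q = -1 := by linarith
    subst hq
    have hbe : be + 2 = 0 := by
      have : A*b*b*(be+2) = 0 := by linarith
      simpa [hA, ha] using this
    have hbe' : be = -2 := by linarith
    subst hbe'
    have hb' : b = 10/3 := by linarith
    subst hb'
    apply no_sqrt10 (A*(10/3))
    linear_combination q1'
  have s2 : 5*(a-b)*d2 = -(a^2+a*b+b^2) - 5*be*a := by
    linear_combination a*r1 + (-5*d2+5*e)*k3 - b*q2
  have s1 : 5*(a-b)*d1 = (a^2+a*b+b^2) + 5*be*b := by
    linear_combination -b*r2 - (-5*d1+5*e)*k4 + a*q2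
  have s4 : -5*(a-b)^2 = A*a^2*b^2*(be+2) := by
    linear_combination a*b*q4 - 5*b*(1+q)*k3 - 5*(a+a*p)*k4*0 - 5*(b-b*1)*k3*0 - 5*(a-b)*k4
  have s5 : A*(a-b)^2 = be*(be+2)*(a*b) := by
    linear_combination -A*s4/5 - a*b*(be+2)*q1'/5
  have G : 50*(a-b)^2-50*be*a*b-10*(a+b)*(a-b)^2+15*be*a*b*(a+b)+(a^2+a*b+b^2)^2 = 0 := by
    linear_combination -25*(a-b)^2*q6 + 5*(a-b)*d2*s1 + ((a^2+a*b+b^2) + 5*be*b)*s2 + 25*s5 + 5*(a-b)^2*(be+2)*q2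
  have hz : p = -b/a := by field_simp; linarith
  have hp0 : p ≠ 0 := left_ne_zero_of_mul (by rw [k1]; norm_num)
  have hH : (A*a*b/(a-b))*(10*p+(A*a*b/(a-b))^2*(p+1)^2) = 25*(a-b)/a^2 := by
    rw [hz]
    field_simp

    linear_combination A*a^2*b^2*(a-b)^2*q1' + 5*(a-b)^2*s4
  apply five_main (z := p) (ω := A*a*b/(a-b)) hp0 (div_ne_zero (by simp [hA, ha, hb]) hab)
  · intro h
    apply hab
    rw [hz] at h
    field_simp at h
    linarith
  · rw [hH]
    have hw : (A*a*b/(a-b))^2*(a-b)^2 = -5*be*a*b := by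
      field_simp
      linear_combination q1'
    generalize (A*a*b/(a-b))^2 = w at hw
    rw [hz]
    field_simp
    linear_combination 125*G + (1250-375*(a+b))*hw
end FQ

namespace FQ

lemma ratB0 {a b A be e p q d1 d2 : ℚ} (ha : a ≠ 0) (hb : b ≠ 0) (hA : A ≠ 0) (hbe : be ≠ 0) (he : e + be ≠ 0)
    (n1 n2 n1' n2' : ℚ) (hn1 : n1 = a-5*be+5*p*e) (hn2 : n2 = -5*(1+p)) (hn1' : n1' = b-5*be+5*q*e) (hn2' : n2' = -5*(1+q))
    (I1 : -5*(a*b)*A*e*be*(d1*d2) - be*(a*n1'+b*n1) + a*b*(2*be+10*A*e*be+5*A^2*e^2) = 0)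
    (I2 : 5*(a*b)*A*((be-e)*(d1*d2)+e*be*(d1+d2)) - (be*(a*n2'+b*n2)+n1*n1') + a*b*(1-10*A*(be-e+e*be)-10*A^2*e) = 0)
    (I3 : 5*(a*b)*A*(d1*d2-(be-e)*(d1+d2)-e*be) - (n1*n2'+n2*n1') + a*b*(-5*A*(2-2*(be-e)-e*be)+5*A^2) = 0)
    (I4 : 5*(a*b)*A*(-(d1+d2)+be-e) - n2*n2' + a*b*(-5*A*(be-e-2)) = 0)
    (J0 : -(a*b)*be*(d1+d2) - a*b*be^2 = 0)
    (J1 : 5*(a*b)*A*(-2*e*(d1*d2)) - b*(n1*d2-a*be) - a*(n1'*d1-b*be) - a*b*(2*be+10*A*e*be+5*A^2*e^2) = 0)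
    (J2 : 5*(a*b)*A*((2+e)*(d1*d2)+2*e*(d1+d2)) - b*(n2*d2-n1) - a*(n2'*d1-n1') - a*b*(1-10*A*(be-e+e*be)-10*A^2*e) = 0)
    (J3 : 5*(a*b)*A*(-(d1*d2)-(2+e)*(d1+d2)-2*e) + b*n2 + a*n2' - a*b*(-5*A*(2-2*(be-e)-e*be)+5*A^2) = 0)
    (J4 : 5*(a*b)*A*(d1+d2+2+e) - a*b*(-5*A*(be-e-2)) = 0)
    (z1 : n2*d1^2+n1*d1+a*be ≠ 0) (z2 : n2'*d2^2+n1'*d2+b*be ≠ 0) : False := by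
  have q3 : d1 + d2 = -be := by
    have : a*b*be*(d1+d2+be) = 0 := by linear_combination -J0
    have : d1+d2+be = 0 := by simpa [ha, hb, hbe] using this
    linarith
  have q1 : A^2*a*b = -5*p*q*be := by
    have : (-5*be*(be+e)^2)*(A^2*a*b+5*p*q*be) = 0 := by
      subst hn1 hn2 hn1' hn2'
      linear_combination -be*I1+be^2*I2-be^3*I3+be^4*I4
    have h2 : be + e ≠ 0 := by rwa [add_comm]
    have : A^2*a*b+5*p*q*be = 0 := by simpa [hbe, h2] using this
    linarith
  have q2 : 5*e = a+b := by
    have h1 : e*((e+be)^2*(a+b-5*e)) = 0 := by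
      subst hn1 hn2 hn1' hn2'
      linear_combination (e*I1+e^2*I2+e^3*I3+e^4*I4)/5
    by_cases h0 : e = 0
    · subst hn1 hn1' h0
      have : be^2*(a+b) = 0 := by linear_combination I1/5
      have : a + b = 0 := by simpa [hbe] using this
      linarith
    · have : a+b-5*e = 0 := by simpa [h0, he] using h1
      linarith
  have hd2 : d2 = -be-d1 := by linarith
  have r2' : d1*(5*(1+q)*d1 - (5*(q*e-be)-b)) = 0 := by
    have : (n2*d1^2+n1*d1+a*be)*(d1*(5*(1+q)*d1 - (5*(q*e-be)-b))) = 0 := by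
      subst hn1 hn2 hn1' hn2' hd2
      linear_combination (J0+(I1+J1)*d1+(I2+J2)*d1^2+(I3+J3)*d1^3+(I4+J4)*d1^4)
    exact (mul_eq_zero.mp this).resolve_left z1
  have r1' : d2*(5*(1+p)*d2 - (5*(p*e-be)-a)) = 0 := by
    have : (n2'*d2^2+n1'*d2+b*be)*(d2*(5*(1+p)*d2 - (5*(p*e-be)-a))) = 0 := by
      have hd1 : d1 = -be-d2 := by linarith
      clear hd2
      subst hn1 hn2 hn1' hn2' hd1
      linear_combination (J0+(I1+J1)*d2+(I2+J2)*d2^2+(I3+J3)*d2^3+(I4+J4)*d2^4)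
    exact (mul_eq_zero.mp this).resolve_left z2
  have r2 : 5*(1+q)*d1 = 5*(q*e-be)-b := by
    by_cases h0 : d1 = 0
    · subst hn1 hn2 hn1' hn2' hd2 h0
      have : a*be*(b-5*(q*e-be)) = 0 := by linear_combination I1+J1
      have : b-5*(q*e-be) = 0 := by simpa [ha, hbe] using this
      linarith
    · have := (mul_eq_zero.mp r2').resolve_left h0
      linarith
  have r1 : 5*(1+p)*d2 = 5*(p*e-be)-a := by
    by_cases h0 : d2 = 0
    · have hd1 : d1 = -be-d2 := by linarith
      clear hd2
      subst hn1 hn2 hn1' hn2' hd1 h0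
      have : b*be*(a-5*(p*e-be)) = 0 := by linear_combination I1+J1
      have : a-5*(p*e-be) = 0 := by simpa [hb, hbe] using this
      linarith
    · have := (mul_eq_zero.mp r1').resolve_left h0
      linarith
  have q4 : 5*(1+p)*(1+q) = A*a*b*(be+2) := by
    subst hn1 hn2 hn1' hn2'
    linear_combination -(I4+J4)/5
  have q5 : (1+p)*b+(1+q)*a = A*e*a*b*(be+2) := by
    subst hn1 hn2 hn1' hn2' hd2
    linear_combination (I3+J3)/5 + (1+p)*r2 + (1+q)*r1 + be*q4
  have q6 : d1*d2+A-2 = -e*(be+2) := by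
    have : (A*a*b)*(d1*d2+A-2+e*(be+2)) = 0 := by
      subst hn1 hn2 hn1' hn2' hd2
      linear_combination I3/5 + (1+p)*r2 + (1+q)*r1 + be*q4 - 2*q5
    have : d1*d2+A-2+e*(be+2) = 0 := by simpa [ha, hb, hA] using this
    linarith
  exact ratB ha hb hA he q1 q2 q3 q4 q5 r1 r2 q6
end FQ

namespace FQ

section
variable {K : Type*} [Field K] [NumberField K]

lemma Gen.no_root {W : K} (hG : Gen 5 W) (m0 m1 m2 m3 m4 m5 d : ℚ) (h5 : m5 ≠ 0)
    (hm : (m5:K)*W^5+m4*W^4+m3*W^3+m2*W^2+m1*W+m0 = 0) : m5*d^5+m4*d^4+m3*d^3+m2*d^2+m1*d+m0 ≠ 0 := by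
  intro h
  have hK : (m5:K)*d^5+m4*d^4+m3*d^3+m2*d^2+m1*d+m0 = 0 := by exact_mod_cast h
  have hWd : W - d ≠ 0 := by
    intro hz
    have := hG.zero5 (-d) 1 0 0 0 (by push_cast; linear_combination hz)
    exact one_ne_zero this.2.2.2.1
  have := hG.zero5 (m1+d*(m2+d*(m3+d*(m4+d*m5)))) (m2+d*(m3+d*(m4+d*m5))) (m3+d*(m4+d*m5)) (m4+d*m5) m5 (by
    push_cast
    apply mul_left_cancel₀ hWd
    linear_combination hm - hK)
  exact h5 this.1

lemma caseM113_core {U V W : K} (h : Pt U V W) (hG : Gen 5 W) {a b A be e p q d1 d2 : ℚ} (ha : a ≠ 0) (hb : b ≠ 0) (hA : A ≠ 0)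
    (hbe : be ≠ 0) (he : e + be ≠ 0)
    (hU : -5*(U*V*W) = a*U^2+a*(d1-2)*U+p/A) (hV : -5*(U*V*W) = b*V^2+b*(d2-2)*V+q/A)
    (hW : (2-U*V-U*W-V*W)*(W+be) = A*(W-e)) : False := by
  have hs := h.hs
  have hAK : (A:K) ≠ 0 := by exact_mod_cast hA
  have hgE : 5*(U*V*W)*(A*(W-e)) = W+be := by
    linear_combination (W+be)*h.hk - 5*(U*V*W)*hW
  obtain ⟨N1, hN1⟩ : ∃ N : K, N = (W+be)*(a-5*W)-5*p*W*(W-e) := ⟨_, rfl⟩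
  obtain ⟨N2, hN2⟩ : ∃ N : K, N = (W+be)*(b-5*W)-5*q*W*(W-e) := ⟨_, rfl⟩
  have e1 : U*(5*W*(A*(W-e)))*(a*(d1-W)) = N1 := by
    have h1 : U*(a*(d1-W)) = -5*(U*V*W)-p/A+a*(U*V) := by
      linear_combination -hU - a*U*hs
    have h2 : (p/A:K)*(5*W*(A*(W-e))) = 5*p*W*(W-e) := by field_simp
    rw [hN1]
    linear_combination (5*W*(A*(W-e)))*h1 + (a-5*W)*hgE - h2
  have e2 : V*(5*W*(A*(W-e)))*(b*(d2-W)) = N2 := by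
    have h1 : V*(b*(d2-W)) = -5*(U*V*W)-q/A+b*(U*V) := by
      linear_combination -hV - b*V*hs
    have h2 : (q/A:K)*(5*W*(A*(W-e))) = 5*q*W*(W-e) := by field_simp
    rw [hN2]
    linear_combination (5*W*(A*(W-e)))*h1 + (b-5*W)*hgE - h2
  have hm : (W+be)^2 - 5*(W+be)*(A*(W-e))*(W^3-2*W^2+2*W)+5*W*(A*(W-e))^2 = 0 := by
    have := h.crd.quad
    rw [← hgE]
    linear_combination (A*(W-e))^2*this
  have F1 : 5*W*(A*(W-e))*(W+be)*(a*(d1-W))*(b*(d2-W)) = N1*N2 := by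
    rw [← e1, ← e2]
    linear_combination -5*W*(A*(W-e))*(a*(d1-W))*(b*(d2-W))*hgE
  have F2 : 5*W*(A*(W-e))*(2-W)*(a*(d1-W))*(b*(d2-W)) = N1*(b*(d2-W))+N2*(a*(d1-W)) := by
    rw [← e1, ← e2]
    linear_combination -5*W*(A*(W-e))*(a*(d1-W))*(b*(d2-W))*hs
  rw [hN1, hN2] at F1 F2
  obtain ⟨n1, hn1⟩ : ∃ n : ℚ, n = a-5*be+5*p*e := ⟨_, rfl⟩
  obtain ⟨n2, hn2⟩ : ∃ n : ℚ, n = -5*(1+p) := ⟨_, rfl⟩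
  obtain ⟨n1', hn1'⟩ : ∃ n : ℚ, n = b-5*be+5*q*e := ⟨_, rfl⟩
  obtain ⟨n2', hn2'⟩ : ∃ n : ℚ, n = -5*(1+q) := ⟨_, rfl⟩
  obtain ⟨I4, I3, I2, I1, -⟩ := hG.zero5 0
    (-5*(a*b)*A*e*be*(d1*d2) - be*(a*n1'+b*n1) + a*b*(2*be+10*A*e*be+5*A^2*e^2))
    (5*(a*b)*A*((be-e)*(d1*d2)+e*be*(d1+d2)) - (be*(a*n2'+b*n2)+n1*n1') + a*b*(1-10*A*(be-e+e*be)-10*A^2*e))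
    (5*(a*b)*A*(d1*d2-(be-e)*(d1+d2)-e*be) - (n1*n2'+n2*n1') + a*b*(-5*A*(2-2*(be-e)-e*be)+5*A^2))
    (5*(a*b)*A*(-(d1+d2)+be-e) - n2*n2' + a*b*(-5*A*(be-e-2))) (by
      rw [hn1, hn2, hn1', hn2']
      push_cast
      linear_combination F1 + a*b*hm)
  obtain ⟨J4, J3, J2, J1, J0⟩ := hG.zero5
    (-(a*b)*be*(d1+d2) - a*b*be^2)
    (5*(a*b)*A*(-2*e*(d1*d2)) - b*(n1*d2-a*be) - a*(n1'*d1-b*be) - a*b*(2*be+10*A*e*be+5*A^2*e^2))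
    (5*(a*b)*A*((2+e)*(d1*d2)+2*e*(d1+d2)) - b*(n2*d2-n1) - a*(n2'*d1-n1') - a*b*(1-10*A*(be-e+e*be)-10*A^2*e))
    (5*(a*b)*A*(-(d1*d2)-(2+e)*(d1+d2)-2*e) + b*n2 + a*n2' - a*b*(-5*A*(2-2*(be-e)-e*be)+5*A^2))
    (5*(a*b)*A*(d1+d2+2+e) - a*b*(-5*A*(be-e-2))) (by
      rw [hn1, hn2, hn1', hn2']
      push_cast
      linear_combination F2 - a*b*hm)
  have hr := hG.no_root (be^2) (2*be+10*A*e*be+5*A^2*e^2) (1-10*A*(be-e+e*be)-10*A^2*e)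
    (-5*A*(2-2*(be-e)-e*be)+5*A^2) (-5*A*(be-e-2)) (-5*A)
  have hr2 := fun d => hr d (by simpa using hA) (by push_cast; linear_combination hm)
  refine ratB0 ha hb hA hbe he n1 n2 n1' n2' hn1 hn2 hn1' hn2' I1 I2 I3 I4 J0 J1 J2 J3 J4 ?_ ?_
  · intro hz
    apply hr2 d1
    apply mul_left_cancel₀ (mul_ne_zero ha hb)
    linear_combination I1*d1+I2*d1^2+I3*d1^3+I4*d1^4 + (n2'*d1^2+n1'*d1+b*be)*hz
  · intro hz
    apply hr2 d2
    apply mul_left_cancel₀ (mul_ne_zero ha hb)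
    linear_combination I1*d2+I2*d2^2+I3*d2^3+I4*d2^4 + (n2*d2^2+n1*d2+a*be)*hz

lemma caseM113 {U V W : K} (h : Pt U V W) (hG : Gen 5 W) {a p1 p0 b q1 q0 α β c d : ℚ} (ha : a ≠ 0) (hb : b ≠ 0)
    (hα : α ≠ 0) (hβ : β ≠ 0) (hc : c ≠ 0) (hdet : α*d-β*c ≠ 0)
    (hU : -5*(U*V*W) = a*U^2+p1*U+p0) (hV : -5*(U*V*W) = b*V^2+q1*V+q0)
    (hW : 5*(2-U*V-U*W-V*W)*(α*W+β) = c*W+d) : False := by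
  have haK : (a:K) ≠ 0 := by exact_mod_cast ha
  have hbK : (b:K) ≠ 0 := by exact_mod_cast hb
  have hαK : (α:K) ≠ 0 := by exact_mod_cast hα
  have hcK : (c:K) ≠ 0 := by exact_mod_cast hc
  apply caseM113_core h hG (a := a) (b := b) (A := c/(5*α)) (be := β/α) (e := -d/c) (p := p0*(c/(5*α))) (q := q0*(c/(5*α)))
    (d1 := 2+p1/a) (d2 := 2+q1/b) ha hb (by positivity) (div_ne_zero hβ hα)
  · intro h0
    apply hdet
    field_simp at h0
    linarith
  · rw [hU]; push_cast; field_simp; ring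
  · rw [hV]; push_cast; field_simp; ring
  · push_cast
    field_simp
    linear_combination hW
end
end FQ

namespace FQ

section
variable {K : Type*} [Field K] [NumberField K]

lemma Crd.types5c (htr : ∀ φ : K →+* ℂ, ∀ x : K, (φ x).im = 0) (hn : Module.finrank ℚ K = 5) {W g k : K} (h : Crd W g k)
    (hr : ∀ φ : K →+* ℝ, φ W < 0 ∨ 2 < φ W) :
    (∀ φ ψ : K →+* ℝ, φ W = ψ W → φ = ψ) ∧ Gen 5 W ∧
    ((Kum 3 W g ∧ ∃ l0 l1 l2 : ℚ, l0 ≠ 0 ∧ l2 ≠ 0 ∧ -5*g = l0*W^2+l1*W+l2) ∨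
     (Kum 1 W g ∧ ∃ a b c d : ℚ, b ≠ 0 ∧ c ≠ 0 ∧ -5*g*(a*W+b) = W*(c*W+d)) ∨
     (Kum 4 W g ∧ ∃ a b c d : ℚ, a ≠ 0 ∧ b ≠ 0 ∧ c ≠ 0 ∧ a*d-b*c ≠ 0 ∧ 5*k*(a*W+b) = c*W+d)) := by
  have hd : (minpoly ℚ W⁻¹).natDegree ∣ Module.finrank ℚ K := minpoly.degree_dvd (IsIntegral.of_finite ℚ _)
  have hdeg : (minpoly ℚ W⁻¹).natDegree = 5 := by
    have := h.deg_ne htr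
    rw [hn] at hd
    rcases (Nat.dvd_prime (by norm_num)).mp hd with h1 | h1
    · exact absurd h1 this.1
    · exact h1
  have hdeg' : (minpoly ℚ W⁻¹).natDegree = Module.finrank ℚ K := by rw [hdeg, hn]
  have hT := gen_inj hdeg'
  have hG : Gen 5 W := by unfold Gen; rw [gen_deg hdeg', hn]
  refine ⟨hT, hG, ?_⟩
  rcases h.types5 htr hdeg hn with ⟨a0, a1, a2, ha⟩ | ⟨l0, l1, l2, hl, he⟩ | ⟨l0, l1, l2, hl, he⟩ | ⟨a, b, c, d, ha, hb, he⟩ | ⟨a, b, c, d, ha, hb, he⟩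
  · exact (h.kill0 htr hT (by omega) a0 a1 a2 ha).elim
  · obtain ⟨hk, h0⟩ := kumE5 htr hn h hT hG l0 l1 l2 hl he
    exact Or.inl ⟨hk, l0, l1, l2, h0, hl, he⟩
  · exact (h.kill1 htr hr hT hn l0 l1 l2 he).elim
  · obtain ⟨hk, hc, -⟩ := kumC5 htr hn h hT hG a b c d ha hb he
    exact Or.inr (Or.inl ⟨hk, a, b, c, d, hb, hc, he⟩)
  · obtain ⟨hk, hc, h2⟩ := kumD5 htr hn h hT hG a b c d ha hb he
    exact Or.inr (Or.inr ⟨hk, a, b, c, d, ha, hb, hc, h2, he⟩)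

lemma case5 {U V W : K} (h : Pt U V W) (htr : ∀ φ : K →+* ℂ, ∀ x : K, (φ x).im = 0) (hn : Module.finrank ℚ K = 5) : False := by
  have hu := h.rot.crd
  have hv := h.rot.rot.crd
  have hw := h.crd
  rw [show V*W*U = U*V*W by ring] at hu
  rw [show W*U*V = U*V*W by ring] at hv
  obtain ⟨tu, gu, hu⟩ := hu.types5c htr hn (fun φ => h.rot.real φ)
  obtain ⟨tv, gv, hv⟩ := hv.types5c htr hn (fun φ => h.rot.rot.real φ)
  obtain ⟨tw, gw, hw⟩ := hw.types5c htr hn (fun φ => h.real φ)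
  have e1 : V*W*U = U*V*W := by ring
  have e2 : W*U*V = U*V*W := by ring
  rcases hu with ⟨ku, u⟩ | ⟨ku, u⟩ | ⟨ku, u⟩ <;> rcases hv with ⟨kv, v⟩ | ⟨kv, v⟩ | ⟨kv, v⟩ <;>
    rcases hw with ⟨kw, w⟩ | ⟨kw, w⟩ | ⟨kw, w⟩ <;>
    first
    | (exfalso
       have := kum_sum h hn ku kv kw
       omega)
    | skip
  · obtain ⟨a, p1, p0, ha, -, u⟩ := u
    obtain ⟨b, q1, q0, hb, -, v⟩ := v
    obtain ⟨α, β, c, d, hα, hβ, hc, hdet, w⟩ := w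
    exact caseM113 h gw ha hb hα hβ hc hdet u v w
  · obtain ⟨l0, l1, l2, h0, h2, u⟩ := u
    obtain ⟨a, b, c, d, hb, hc, v⟩ := v
    obtain ⟨a', b', c', d', hb', hc', w⟩ := w
    exact caseM122 h.rot htr hn tu gu l0 l1 l2 h0 h2 (by rw [e1]; exact u) a b c d hb hc (by rw [e1]; exact v)
      a' b' c' d' hb' (by rw [e1]; exact w)
  · obtain ⟨a, p1, p0, ha, -, u⟩ := u
    obtain ⟨b, q1, q0, hb, -, w⟩ := w
    obtain ⟨α, β, c, d, hα, hβ, hc, hdet, v⟩ := v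
    exact caseM113 h.rot.rot gv hb ha hα hβ hc hdet (by rw [e2]; exact w) (by rw [e2]; exact u) v
  · obtain ⟨l0, l1, l2, h0, h2, v⟩ := v
    obtain ⟨a, b, c, d, hb, hc, w⟩ := w
    obtain ⟨a', b', c', d', hb', hc', u⟩ := u
    exact caseM122 h.rot.rot htr hn tv gv l0 l1 l2 h0 h2 (by rw [e2]; exact v) a b c d hb hc (by rw [e2]; exact w)
      a' b' c' d' hb' (by rw [e2]; exact u)
  · obtain ⟨l0, l1, l2, h0, h2, w⟩ := w
    obtain ⟨a, b, c, d, hb, hc, u⟩ := u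
    obtain ⟨a', b', c', d', hb', hc', v⟩ := v
    exact caseM122 h htr hn tw gw l0 l1 l2 h0 h2 w a b c d hb hc u a' b' c' d' hb' v
  · obtain ⟨a, p1, p0, ha, -, v⟩ := v
    obtain ⟨b, q1, q0, hb, -, w⟩ := w
    obtain ⟨α, β, c, d, hα, hβ, hc, hdet, u⟩ := u
    exact caseM113 h.rot gu ha hb hα hβ hc hdet (by rw [e1]; exact v) (by rw [e1]; exact w) u
end

end FQ

/-- Let `K` be a totally real number field (every embedding of `K` into `ℂ` has image in
`ℝ`, expressed by saying every embedding takes values with imaginary part zero) of degree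
at most `5` over `ℚ`. Then every pair `x, y ∈ K` with `x⁵ + y⁵ + 1 = 0` satisfies
`xy = 0`: the Fermat quintic has no non-trivial point over `K`. -/
theorem no_nontrivial_point_low_degree_totally_real
    (K : Type*) [Field K] [NumberField K]
    (htr : ∀ φ : K →+* ℂ, ∀ x : K, (φ x).im = 0)
    (hdeg : Module.finrank ℚ K ≤ 5) :
    ∀ x y : K, x^5 + y^5 + 1 = 0 → x * y = 0 := by
  intro x y h
  by_contra hxy
  have P := FQ.pt_of_sol htr x y h hxy
  have h12 := FQ.case12 htr P.crd
  have hpos : 0 < Module.finrank ℚ K := Module.finrank_pos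
  obtain ⟨n, hn⟩ : ∃ n, Module.finrank ℚ K = n := ⟨_, rfl⟩
  have hc : n = 3 ∨ n = 4 ∨ n = 5 := by omega
  rcases hc with hc | hc | hc
  · exact FQ.case3 htr (hn.trans hc) x y h hxy
  · exact FQ.case4 P htr (hn.trans hc)
  · exact FQ.case5 P htr (hn.trans hc)
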